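/- Let M be a symmetric n\times n integer matrix and let f(x) = x^T M x be the associated positive definite classically integral quadratic form, with discriminant df = det M. Assume: (a) f represents some odd integer (there exists x \in \mathbb{Z}^n with f(x) odd); (b) for every prime p, p^{n-2} does not divide det M; and (c) either n \ge 5, or n = 4 and det M is even. Then f is almost primitively universal: there exists N such that every integer a \ge N equals f(x) for some x \in \mathbb{Z}^n with gcd(x_1,...,x_n) = 1. -/

import Mathlib

set_option maxHeartbeats 400000

namespace APU

/-! ## Divisor bound -/

lemma tau_bound (ε : ℝ) (hε : 0 < ε) :
    ∃ C : ℝ, 1 ≤ C ∧ ∀ n : ℕ, 1 ≤ n → (n.divisors.card : ℝ) ≤ C * (n : ℝ) ^ ε := by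
  obtain ⟨P0, hP0⟩ : ∃ P0 : ℕ, (2 : ℝ) ^ (1 / ε) ≤ P0 := exists_nat_ge _
  have hc : 0 < ε * Real.log 2 := mul_pos hε (Real.log_pos (by norm_num))
  set c := ε * Real.log 2 with hcdef
  set C0 := 1 + 1 / c with hC0
  have hC01 : 1 ≤ C0 := by rw [hC0]; have : 0 < 1 / c := by positivity
                           linarith
  refine ⟨C0 ^ P0, one_le_pow₀ hC01, fun n hn => ?_⟩
  have hn0 : n ≠ 0 := by omega
  have hsmall : ∀ p : ℕ, p.Prime → ∀ v : ℕ, ((v : ℝ) + 1) ≤ C0 * (((p : ℝ) ^ v) ^ ε) := by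
    intro p hp v
    have h1 : (2 : ℝ) ^ v ≤ (p : ℝ) ^ v := by
      have : (2 : ℝ) ≤ p := by exact_mod_cast hp.two_le
      gcongr
    have h2 : 1 + v * c ≤ ((2 : ℝ) ^ v) ^ ε := by
      have : ((2 : ℝ) ^ v) ^ ε = Real.exp (v * c) := by
        rw [← Real.rpow_natCast, ← Real.rpow_mul (by norm_num), Real.rpow_def_of_pos (by norm_num)]
        congr 1; rw [hcdef]; ring
      rw [this]
      have := Real.add_one_le_exp (v * c); linarith
    have h3 : ((2 : ℝ) ^ v) ^ ε ≤ ((p : ℝ) ^ v) ^ ε := by gcongr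
    have h4 : (v : ℝ) + 1 ≤ C0 * (1 + v * c) := by
      rw [hC0]
      have hv : (0 : ℝ) ≤ v := by positivity
      have : (1 + 1 / c) * (1 + v * c) = 1 + v * c + 1 / c + v := by field_simp; ring
      rw [this]
      have : 0 < 1 / c := by positivity
      nlinarith
    calc (v : ℝ) + 1 ≤ C0 * (1 + v * c) := h4
      _ ≤ _ := by gcongr; linarith
  have hlarge : ∀ p : ℕ, p.Prime → P0 ≤ p → ∀ v : ℕ, ((v : ℝ) + 1) ≤ (((p : ℝ) ^ v) ^ ε) := by
    intro p hp hle v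
    have h1 : (2 : ℝ) ≤ (p : ℝ) ^ ε := by
      have : ((2 : ℝ) ^ (1 / ε)) ^ ε ≤ (p : ℝ) ^ ε := by
        gcongr
        exact hP0.trans (by exact_mod_cast hle)
      rwa [← Real.rpow_mul (by norm_num), one_div_mul_cancel hε.ne', Real.rpow_one] at this
    have h2 : ((p : ℝ) ^ v) ^ ε = ((p : ℝ) ^ ε) ^ v := by
      rw [← Real.rpow_natCast, ← Real.rpow_mul (by positivity), mul_comm, Real.rpow_mul (by positivity),
        Real.rpow_natCast]
    rw [h2]
    have h3 : (v : ℝ) + 1 ≤ 2 ^ v := by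
      have := Nat.lt_two_pow_self (n := v)
      exact_mod_cast this
    exact h3.trans (by gcongr)
  rw [Nat.card_divisors hn0]
  have hprod : (n : ℝ) ^ ε = ∏ p ∈ n.primeFactors, (((p : ℝ) ^ (n.factorization p)) ^ ε) := by
    conv_lhs => rw [← Nat.prod_factorization_pow_eq_self hn0]
    rw [Finsupp.prod, Nat.support_factorization]
    push_cast
    rw [← Real.finsetProd_rpow]
    intro i _; positivity
  rw [hprod]
  push_cast
  have key : ∀ s : Finset ℕ, (∀ p ∈ s, p.Prime) →
      ∏ p ∈ s, ((n.factorization p : ℝ) + 1) ≤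
        C0 ^ (s.filter (· < P0)).card * ∏ p ∈ s, (((p : ℝ) ^ (n.factorization p)) ^ ε) := by
    intro s
    induction s using Finset.induction_on with
    | empty => intro _; simp
    | insert p s hps ih =>
      intro h
      rw [Finset.prod_insert hps, Finset.prod_insert hps]
      have ih' := ih (fun q hq => h q (Finset.mem_insert_of_mem hq))
      have hp := h p (Finset.mem_insert_self _ _)
      have hpos : 0 ≤ ∏ p ∈ s, ((n.factorization p : ℝ) + 1) := by positivity
      by_cases hlt : p < P0
      · rw [Finset.filter_insert, if_pos hlt, Finset.card_insert_of_notMem (by simp [hps]), pow_succ]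
        calc _ ≤ (C0 * (((p : ℝ) ^ (n.factorization p)) ^ ε)) *
              (C0 ^ (s.filter (· < P0)).card * ∏ p ∈ s, (((p : ℝ) ^ (n.factorization p)) ^ ε)) := by
              gcongr
              exact hsmall p hp _
          _ = _ := by ring
      · rw [Finset.filter_insert, if_neg hlt]
        calc _ ≤ ((((p : ℝ) ^ (n.factorization p)) ^ ε)) *
              (C0 ^ (s.filter (· < P0)).card * ∏ p ∈ s, (((p : ℝ) ^ (n.factorization p)) ^ ε)) := by
              gcongr
              exact hlarge p hp (by omega) _
          _ = _ := by ring
  refine (key n.primeFactors (fun p hp => Nat.prime_of_mem_primeFactors hp)).trans ?_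
  have hcard : (n.primeFactors.filter (· < P0)).card ≤ P0 := by
    calc _ ≤ (Finset.range P0).card := Finset.card_le_card (by
          intro x hx; simp at hx ⊢; exact hx.2)
      _ = P0 := by simp
  have : C0 ^ (n.primeFactors.filter (· < P0)).card ≤ C0 ^ P0 := pow_le_pow_right₀ hC01 hcard
  gcongr

/-! ## The character -/

/-- the quadratic character attached to `-D`, made zero at non-coprime arguments -/
def chi (s0 D n : ℕ) : ℤ := if n.Coprime s0 then jacobiSym (-(D : ℤ)) n else 0

/-- number-of-representations type divisor sum -/
def rho (s0 D k : ℕ) : ℤ := ∑ δ ∈ k.divisors, chi s0 D δ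

lemma coprime_odd {s0 n : ℕ} (h2 : 2 ∣ s0) (h : n.Coprime s0) : Odd n := by
  rw [← Nat.not_even_iff_odd]
  intro he
  have : 2 ∣ Nat.gcd n s0 := Nat.dvd_gcd he.two_dvd h2
  rw [h] at this
  omega

lemma chi_mul {s0 : ℕ} (h2 : 2 ∣ s0) (D a b : ℕ) :
    chi s0 D (a * b) = chi s0 D a * chi s0 D b := by
  unfold chi
  by_cases ha : a.Coprime s0
  · by_cases hb : b.Coprime s0
    · have hab : (a * b).Coprime s0 := Nat.Coprime.mul_left ha hb
      rw [if_pos ha, if_pos hb, if_pos hab]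
      have ha0 : a ≠ 0 := by rintro rfl; simpa using coprime_odd h2 ha
      have hb0 : b ≠ 0 := by rintro rfl; simpa using coprime_odd h2 hb
      exact jacobiSym.mul_right' _ ha0 hb0
    · have : ¬ (a * b).Coprime s0 := fun h => hb (Nat.Coprime.coprime_mul_left h)
      simp [hb, this]
  · have : ¬ (a * b).Coprime s0 := fun h => ha (Nat.Coprime.coprime_mul_right h)
    simp [ha, this]

lemma chi_one (s0 D : ℕ) : chi s0 D 1 = 1 := by simp [chi]

lemma chi_tri (s0 D n : ℕ) : chi s0 D n = 0 ∨ chi s0 D n = 1 ∨ chi s0 D n = -1 := by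
  unfold chi
  split_ifs
  · exact jacobiSym.trichotomy _ _
  · left; rfl

lemma chi_abs_le (s0 D n : ℕ) : |chi s0 D n| ≤ 1 := by
  rcases chi_tri s0 D n with h | h | h <;> simp [h]

lemma chi_eq_zero {s0 D n : ℕ} (h : ¬ n.Coprime s0) : chi s0 D n = 0 := by simp [chi, h]

lemma chi_sq {s0 D n : ℕ} (hD : D ∣ s0) (h : n.Coprime s0) : chi s0 D n = 1 ∨ chi s0 D n = -1 := by
  unfold chi
  rw [if_pos h]
  apply jacobiSym.eq_one_or_neg_one
  have := (Nat.Coprime.coprime_dvd_right hD h).symm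
  simpa [Int.gcd] using this

lemma chi_periodic {s0 D : ℕ} (h2 : 2 * D ∣ s0) {n n' : ℕ} (h : n ≡ n' [MOD 4 * s0]) :
    chi s0 D n = chi s0 D n' := by
  have hcop : n.Coprime s0 ↔ n'.Coprime s0 := by
    have := (h.of_dvd (Dvd.intro_left 4 rfl)).gcd_eq
    unfold Nat.Coprime
    rw [this]
  unfold chi
  by_cases hc : n.Coprime s0
  · have hc' := hcop.1 hc
    rw [if_pos hc, if_pos hc']
    have e2 : 2 ∣ s0 := (Dvd.intro _ rfl).trans h2
    rw [jacobiSym.mod_right _ (coprime_odd e2 hc), jacobiSym.mod_right _ (coprime_odd e2 hc')]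
    congr 1
    have hd : 4 * (-(D : ℤ)).natAbs ∣ 4 * s0 := by
      simp only [Int.natAbs_neg, Int.natAbs_natCast]
      exact Nat.mul_dvd_mul_left 4 ((Dvd.intro_left 2 rfl).trans h2)
    exact h.of_dvd hd
  · simp [hc, mt hcop.2 hc]

lemma chi_neg_one {s0 D : ℕ} (hs : 0 < s0) (h2 : 2 * D ∣ s0) : chi s0 D (4 * s0 - 1) = -1 := by
  have hD0 : 0 < D := by
    rcases Nat.eq_zero_or_pos D with h | h
    · subst h; simp at h2; omega
    · exact h
  have e2 : 2 ∣ s0 := (Dvd.intro _ rfl).trans h2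
  have hc : (4 * s0 - 1).Coprime s0 := by
    have : (4 * s0 - 1).Coprime (4 * s0) := by
      have h := Nat.coprime_self_sub_left (m := 1) (n := 4 * s0) (by omega)
      exact h.2 (by simp)
    exact Nat.Coprime.coprime_mul_left_right this
  have hodd := coprime_odd e2 hc
  unfold chi
  rw [if_pos hc]
  rw [jacobiSym.neg _ hodd, ZMod.χ₄_nat_three_mod_four (by omega)]
  have hmod : (4 * s0 - 1) % (4 * D) = 4 * D - 1 := by
    obtain ⟨k, hk⟩ := (Dvd.intro_left 2 rfl : D ∣ 2 * D).trans h2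
    have hk0 : 0 < k := by rcases Nat.eq_zero_or_pos k with h | h; (subst h; omega); exact h
    obtain ⟨j, rfl⟩ : ∃ j, k = j + 1 := ⟨k - 1, by omega⟩
    have : 4 * s0 - 1 = (4 * D - 1) + (4 * D) * j := by
      rw [hk]; have : 4 * (D * (j + 1)) = 4 * D + 4 * D * j := by ring
      omega
    rw [this, Nat.add_mul_mod_self_left, Nat.mod_eq_of_lt (by omega)]
  have h1 : jacobiSym (D : ℤ) (4 * s0 - 1) = jacobiSym (D : ℤ) (4 * D - 1) := by
    rw [jacobiSym.mod_right' D hodd, hmod]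
  have ho : Odd (4 * D - 1) := by rw [Nat.odd_iff]; omega
  have h3 : jacobiSym (4 * D : ℤ) (4 * D - 1) = 1 := by
    rw [jacobiSym.mod_left' (a₂ := 1), jacobiSym.one_left]
    have : ((4 * D - 1 : ℕ) : ℤ) = 4 * D - 1 := by push_cast [show 1 ≤ 4 * D by omega]; ring
    rw [this]
    have h : (1 : ℤ) ≡ 4 * D [ZMOD (4 * D - 1)] := (Int.modEq_iff_dvd).2 ⟨1, by ring⟩
    exact h.symm
  rw [jacobiSym.mul_left, jacobiSym.at_four ho, one_mul] at h3
  rw [h1, h3]; norm_num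

/-- `chi` as a Dirichlet character -/
noncomputable def chiD {s0 D : ℕ} (hs : 0 < s0) (h2 : 2 * D ∣ s0) : DirichletCharacter ℂ (4 * s0) where
  toFun z := ((chi s0 D z.val : ℤ) : ℂ)
  map_one' := by
    have : NeZero (4 * s0) := ⟨by omega⟩
    have : Fact (1 < 4 * s0) := ⟨by omega⟩
    rw [ZMod.val_one, chi_one]; norm_num
  map_mul' x y := by
    have : NeZero (4 * s0) := ⟨by omega⟩
    rw [ZMod.val_mul, chi_periodic h2 (Nat.mod_modEq _ _), chi_mul ((Dvd.intro _ rfl).trans h2)]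
    push_cast; rfl
  map_nonunit' x hx := by
    have : NeZero (4 * s0) := ⟨by omega⟩
    have : ¬ x.val.Coprime s0 := by
      intro h
      apply hx
      have e2 : 2 ∣ s0 := (Dvd.intro _ rfl).trans h2
      have : x.val.Coprime (4 * s0) := by
        apply Nat.Coprime.mul_right _ h
        have := (coprime_odd e2 h)
        exact Nat.Coprime.pow_right 2 (Nat.coprime_two_right.2 this)
      have := (ZMod.isUnit_iff_coprime x.val (4 * s0)).2 this
      rwa [ZMod.natCast_zmod_val] at this
    simp [chi_eq_zero this]

lemma chiD_apply {s0 D : ℕ} (hs : 0 < s0) (h2 : 2 * D ∣ s0) (n : ℕ) :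
    chiD hs h2 (n : ZMod (4 * s0)) = (chi s0 D n : ℂ) := by
  have : NeZero (4 * s0) := ⟨by omega⟩
  change ((chi s0 D (n : ZMod (4 * s0)).val : ℤ) : ℂ) = _
  rw [ZMod.val_natCast, chi_periodic h2 (Nat.mod_modEq _ _)]

lemma chiD_ne_one {s0 D : ℕ} (hs : 0 < s0) (h2 : 2 * D ∣ s0) : chiD hs h2 ≠ 1 := by
  intro h
  have h1 := chiD_apply hs h2 (4 * s0 - 1)
  rw [chi_neg_one hs h2, h] at h1
  have hu : IsUnit (((4 * s0 - 1 : ℕ)) : ZMod (4 * s0)) := by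
    rw [ZMod.isUnit_iff_coprime]
    exact (Nat.coprime_self_sub_left (m := 1) (n := 4 * s0) (by omega)).2 (by simp)
  rw [MulChar.one_apply hu] at h1
  norm_num at h1

lemma abel_bound (z : ℕ → ℂ) (c : ℕ → ℝ) (B : ℝ) (hB : ∀ k, ‖∑ i ∈ Finset.range k, z i‖ ≤ B)
    (hc : Antitone c) (hc0 : ∀ i, 0 ≤ c i) (k : ℕ) :
    ‖∑ i ∈ Finset.range k, (c i : ℂ) * z i‖ ≤ B * c 0 := by
  have hB0 : 0 ≤ B := (norm_nonneg _).trans (hB 0)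
  have key : ∀ k, ∑ i ∈ Finset.range k, (c i : ℂ) * z i =
      (c k : ℂ) * ∑ i ∈ Finset.range k, z i +
        ∑ i ∈ Finset.range k, ((c i - c (i + 1) : ℝ) : ℂ) * ∑ j ∈ Finset.range (i + 1), z j := by
    intro k
    induction k with
    | zero => simp
    | succ k ih =>
      rw [Finset.sum_range_succ, ih, Finset.sum_range_succ (fun i => ((c i - c (i + 1) : ℝ) : ℂ) * _),
        Finset.sum_range_succ z]
      push_cast; ring
  rw [key]
  have h1 : ‖(c k : ℂ) * ∑ i ∈ Finset.range k, z i‖ ≤ c k * B := by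
    rw [norm_mul, Complex.norm_real, Real.norm_of_nonneg (hc0 k)]
    exact mul_le_mul_of_nonneg_left (hB k) (hc0 k)
  have h2 : ‖∑ i ∈ Finset.range k, ((c i - c (i + 1) : ℝ) : ℂ) * ∑ j ∈ Finset.range (i + 1), z j‖
      ≤ ∑ i ∈ Finset.range k, (c i - c (i + 1)) * B := by
    refine (norm_sum_le _ _).trans (Finset.sum_le_sum fun i _ => ?_)
    have : 0 ≤ c i - c (i + 1) := sub_nonneg.2 (hc (Nat.le_succ i))
    rw [norm_mul, Complex.norm_real, Real.norm_of_nonneg this]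
    exact mul_le_mul_of_nonneg_left (hB _) this
  rw [← Finset.sum_mul, Finset.sum_range_sub'] at h2
  refine (norm_add_le _ _).trans ((add_le_add h1 h2).trans (le_of_eq ?_))
  ring

/-- partial sums of a nontrivial character over any window are bounded -/
lemma char_window {q : ℕ} [NeZero q] (χ : DirichletCharacter ℂ q) (hχ : χ ≠ 1) (M k : ℕ) :
    ‖∑ i ∈ Finset.range k, χ ((M + i : ℕ) : ZMod q)‖ ≤ q := by
  have hper : ∀ M, ∑ i ∈ Finset.range q, χ ((M + i : ℕ) : ZMod q) = 0 := by
    intro M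
    have h0 := MulChar.sum_eq_zero_of_ne_one hχ
    rw [← h0]
    refine Finset.sum_bij (fun i _ => ((M + i : ℕ) : ZMod q)) (by simp) ?_ ?_ (by simp)
    · intro i hi j hj hij
      simp only [Finset.mem_range] at hi hj
      rw [ZMod.natCast_eq_natCast_iff] at hij
      have := Nat.ModEq.add_left_cancel' M hij
      exact Nat.ModEq.eq_of_lt_of_lt this hi hj
    · intro b _
      refine ⟨(b - (M : ZMod q)).val, by simpa using ZMod.val_lt _, by simp⟩
  have hred : ∀ (t M r : ℕ), ∑ i ∈ Finset.range (q * t + r), χ ((M + i : ℕ) : ZMod q) =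
      ∑ i ∈ Finset.range r, χ ((M + i : ℕ) : ZMod q) := by
    intro t
    induction t with
    | zero => intro M r; simp
    | succ t ih =>
      intro M r
      rw [show q * (t + 1) + r = q + (q * t + r) by ring, Finset.sum_range_add, hper, zero_add]
      rw [← ih M r]
      refine Finset.sum_congr rfl fun i _ => ?_
      congr 1
      push_cast
      simp
  rw [← Nat.div_add_mod k q, hred]
  refine (norm_sum_le _ _).trans ?_
  calc _ ≤ ∑ i ∈ Finset.range (k % q), (1 : ℝ) := Finset.sum_le_sum fun i _ => χ.norm_le_one _
    _ = (k % q : ℕ) := by simp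
    _ ≤ q := by exact_mod_cast (Nat.mod_lt _ (NeZero.pos q)).le

open Filter Topology in
lemma char_partial {q : ℕ} [NeZero q] (χ : DirichletCharacter ℂ q) (hχ : χ ≠ 1) (N : ℕ) :
    ‖∑ n ∈ Finset.Icc 1 N, χ (n : ZMod q) / n - DirichletCharacter.LFunction χ 1‖ ≤ q / (N + 1) := by
  -- finite window bound at real s ≥ 1
  have hwin : ∀ s : ℝ, 1 < s → ∀ k : ℕ,
      ‖∑ i ∈ Finset.range k, LSeries.term (fun n => χ (n : ZMod q)) s (i + (N + 1))‖ ≤ q / (N + 1) := by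
    intro s hs k
    have h := abel_bound (fun i => χ ((N + 1 + i : ℕ) : ZMod q))
      (fun i => ((N + 1 + i : ℕ) : ℝ) ^ (-s)) q (fun k => char_window χ hχ (N + 1) k) ?_ ?_ k
    · have e : ∀ i, LSeries.term (fun n => χ (n : ZMod q)) s (i + (N + 1)) =
        ((((N + 1 + i : ℕ) : ℝ) ^ (-s) : ℝ) : ℂ) * χ ((N + 1 + i : ℕ) : ZMod q) := by
        intro i
        rw [LSeries.term_of_ne_zero (by omega)]
        rw [Complex.ofReal_cpow (by positivity)]
        rw [show i + (N + 1) = N + 1 + i by ring]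
        push_cast
        rw [Complex.cpow_neg]
        field_simp
      simp_rw [e]
      refine h.trans ?_
      rw [div_eq_mul_inv]
      gcongr
      simp only [add_zero]
      push_cast
      rw [← Real.rpow_neg_one]
      apply Real.rpow_le_rpow_of_exponent_le
      · have : (0:ℝ) ≤ N := by positivity
        linarith
      · linarith
    · intro i j hij
      apply Real.rpow_le_rpow_of_nonpos
      · positivity
      · exact_mod_cast (by omega)
      · linarith
    · intro i; positivity
  have hbd : ∀ s : ℝ, 1 < s →
      ‖∑ n ∈ Finset.range (N + 1), LSeries.term (fun n => χ (n : ZMod q)) s n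
        - DirichletCharacter.LFunction χ s‖ ≤ q / (N + 1) := by
    intro s hs
    have hs' : 1 < (s : ℂ).re := by simpa using hs
    rw [DirichletCharacter.LFunction_eq_LSeries χ hs', LSeries]
    have hsum : Summable (LSeries.term (fun n => χ (n : ZMod q)) s) :=
      DirichletCharacter.LSeriesSummable_of_one_lt_re χ hs'
    rw [← hsum.sum_add_tsum_nat_add (N + 1), sub_add_cancel_left, norm_neg]
    have ht := ((summable_nat_add_iff (N + 1)).2 hsum).hasSum.tendsto_sum_nat
    exact le_of_tendsto ht.norm (Eventually.of_forall fun k => hwin s hs k)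
  have hcast : Tendsto (fun s : ℝ => (s : ℂ)) (𝓝[>] 1) (𝓝 (1 : ℂ)) := by
    have : Tendsto (fun s : ℝ => (s : ℂ)) (𝓝 1) (𝓝 ((1 : ℝ) : ℂ)) := Complex.continuous_ofReal.tendsto 1
    simpa using this.mono_left nhdsWithin_le_nhds
  have hL : Tendsto (fun s : ℝ => DirichletCharacter.LFunction χ s) (𝓝[>] 1)
      (𝓝 (DirichletCharacter.LFunction χ 1)) :=
    ((DirichletCharacter.differentiable_LFunction hχ).continuous.tendsto 1).comp hcast
  have hP : Tendsto (fun s : ℝ => ∑ n ∈ Finset.range (N + 1), LSeries.term (fun n => χ (n : ZMod q)) s n)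
      (𝓝[>] 1) (𝓝 (∑ n ∈ Finset.Icc 1 N, χ (n : ZMod q) / n)) := by
    have e : ∑ n ∈ Finset.Icc 1 N, χ (n : ZMod q) / n =
        ∑ n ∈ Finset.range (N + 1), LSeries.term (fun n => χ (n : ZMod q)) 1 n := by
      rw [Finset.range_eq_Ico, Finset.sum_eq_sum_Ico_succ_bot (by omega)]
      simp only [LSeries.term_zero, zero_add]
      refine Finset.sum_congr (by ext; simp) fun n hn => ?_
      simp at hn
      rw [LSeries.term_of_ne_zero (by omega)]
      simp
    rw [e]
    apply tendsto_finsetSum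
    intro n _
    by_cases hn : n = 0
    · subst hn; simp
    · simp_rw [LSeries.term_of_ne_zero hn]
      apply Tendsto.div tendsto_const_nhds _ (by simp [hn])
      exact (Tendsto.const_cpow hcast (Or.inl (by exact_mod_cast hn)))
  refine le_of_tendsto ((hP.sub hL).norm) ?_
  filter_upwards [self_mem_nhdsWithin] with s hs
  exact hbd s hs

/-- The value `L(1,χ)` as a real number, with convergence rate. -/
theorem chi_partial {s0 D : ℕ} (hs : 0 < s0) (h2 : 2 * D ∣ s0) :
    ∃ L C : ℝ, L ≠ 0 ∧ 0 < C ∧ ∀ N : ℕ,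
      |∑ n ∈ Finset.Icc 1 N, (chi s0 D n : ℝ) / n - L| ≤ C / (N + 1) := by
  have : NeZero (4 * s0) := ⟨by omega⟩
  have hχ := chiD_ne_one hs h2
  set Λ := DirichletCharacter.LFunction (chiD hs h2) 1 with hΛ
  have hne : Λ ≠ 0 := DirichletCharacter.LFunction_apply_one_ne_zero hχ
  have hb : ∀ N : ℕ, ‖((∑ n ∈ Finset.Icc 1 N, (chi s0 D n : ℝ) / n : ℝ) : ℂ) - Λ‖ ≤
      (4 * s0 : ℕ) / (N + 1) := by
    intro N
    have := char_partial (chiD hs h2) hχ N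
    simp_rw [chiD_apply] at this
    push_cast at this ⊢
    exact this
  have him : Λ.im = 0 := by
    have : ∀ N : ℕ, |Λ.im| ≤ ((4 * s0 : ℕ) : ℝ) / (N + 1) := by
      intro N
      have h := (Complex.abs_im_le_norm _).trans (hb N)
      simpa only [Complex.sub_im, Complex.ofReal_im, zero_sub, abs_neg] using h
    have ht : Filter.Tendsto (fun N : ℕ => ((4 * s0 : ℕ) : ℝ) / (N + 1)) Filter.atTop (nhds 0) := by
      have := (tendsto_one_div_add_atTop_nhds_zero_nat (𝕜 := ℝ)).const_mul ((4 * s0 : ℕ) : ℝ)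
      simpa [div_eq_mul_inv] using this
    have := ge_of_tendsto' ht this
    exact abs_eq_zero.1 (le_antisymm this (abs_nonneg _))
  refine ⟨Λ.re, (4 * s0 : ℕ), ?_, by exact_mod_cast (by omega), fun N => ?_⟩
  · intro h; exact hne (Complex.ext h him)
  · have h := (Complex.abs_re_le_norm _).trans (hb N)
    simpa only [Complex.sub_re, Complex.ofReal_re] using h

end APU

set_option maxHeartbeats 400000

namespace APU

open Finset

/-! ## Conics over finite rings -/

/-- points of `a x² + b y² = m` -/
def conic {R : Type*} [CommRing R] [Fintype R] [DecidableEq R] (a b m : R) : Finset (R × R) :=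
  univ.filter fun z => a * z.1 ^ 2 + b * z.2 ^ 2 = m

/-- the exponential sum over the conic -/
noncomputable def expS {R : Type*} [CommRing R] [Fintype R] [DecidableEq R] (a b m : R)
    (ψ : AddChar R ℂ) (u : R × R) : ℂ :=
  ∑ z ∈ conic a b m, ψ (u.1 * z.1 + u.2 * z.2)

section field
variable {F : Type*} [Field F] [Fintype F] [DecidableEq F]

lemma conic_card_field (hF : ringChar F ≠ 2) {a b m : F} (ha : a ≠ 0) (hb : b ≠ 0) (hm : m ≠ 0) :
    |((conic a b m).card : ℤ) - Fintype.card F| ≤ 1 := by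
  classical
  set η := quadraticChar F with hη
  have hsq : ∀ u : F, ((univ.filter fun x : F => x ^ 2 = u).card : ℤ) = η u + 1 := by
    intro u
    rw [← quadraticChar_card_sqrts hF u]
    congr 2
    ext; simp
  have h0 : ∑ x : F, η x = 0 := quadraticChar_sum_zero hF
  have hinv : η⁻¹ = η := (quadraticChar_isQuadratic F).inv
  have hcount : ((conic a b m).card : ℤ) = ∑ u : F, (η u + 1) * (η ((m - a * u) / b) + 1) := by
    have : (conic a b m) = univ.biUnion fun u : F =>
        (univ.filter fun x : F => x ^ 2 = u) ×ˢ (univ.filter fun x : F => x ^ 2 = (m - a * u) / b) := by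
      ext ⟨x, y⟩
      simp only [conic, mem_filter, mem_univ, true_and, mem_biUnion, mem_product]
      constructor
      · intro h
        exact ⟨x ^ 2, rfl, by rw [← h]; field_simp; ring⟩
      · rintro ⟨u, rfl, h⟩
        rw [h]; field_simp; ring
    rw [this, card_biUnion]
    · push_cast
      refine sum_congr rfl fun u _ => ?_
      rw [card_product]
      push_cast
      rw [hsq, hsq]
    · intro u _ v _ huv
      rw [Function.onFun, disjoint_left]
      rintro ⟨x, y⟩ h1 h2
      simp only [mem_product, mem_filter, mem_univ, true_and] at h1 h2
      exact huv (h1.1.symm.trans h2.1)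
  have hJ : jacobiSum η η = -η (-1) := by
    have := jacobiSum_nontrivial_inv (quadraticChar_ne_one hF)
    rwa [← hη, hinv] at this
  have h2 : ∑ u : F, η ((m - a * u) / b) = 0 := by
    rw [← h0]
    apply Fintype.sum_bijective (fun u : F => (m - a * u) / b)
    · constructor
      · intro u v huv
        simp only at huv
        field_simp at huv
        simpa [ha] using huv
      · intro v
        exact ⟨(m - b * v) / a, by field_simp; ring⟩
    · intro u; rfl
  have h3 : ∑ u : F, η u * η ((m - a * u) / b) = η (a * b) * jacobiSum η η := by
    rw [jacobiSum, mul_sum]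
    symm
    apply Fintype.sum_bijective (fun t : F => m * t / a)
    · constructor
      · intro u v huv
        simp only at huv
        field_simp at huv
        exact huv
      · intro v
        exact ⟨a * v / m, by field_simp⟩
    · intro t
      have e1 : (m - a * (m * t / a)) / b = (m * (a * b) ^ 2) * (1 - t) * (a ^ 2 * b ^ 2 * b)⁻¹ := by
        field_simp
      have hmm : η m * η m = 1 := by
        rw [← map_mul, ← sq]; exact quadraticChar_sq_one' hm
      have hbb : η b * η b⁻¹ = 1 := by rw [← map_mul, mul_inv_cancel₀ hb]; simp
      have hab : η a * η a = 1 := by rw [← map_mul, ← sq]; exact quadraticChar_sq_one' ha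
      have haa : η a * η a⁻¹ = 1 := by rw [← map_mul, mul_inv_cancel₀ ha]; simp
      have hbb' : η b * η b = 1 := by rw [← map_mul, ← sq]; exact quadraticChar_sq_one' hb
      have hi : ∀ x : F, η x⁻¹ = η x := by
        intro x
        have := MulChar.inv_apply' η x
        rw [hinv] at this; exact this.symm
      have e2 : (m - a * (m * t / a)) / b = m * (1 - t) * b⁻¹ := by field_simp
      rw [e2, div_eq_mul_inv]
      simp only [map_mul, hi]
      linear_combination (-(η a * η b * η t * η (1 - t))) * hmm
  have hfin : ((conic a b m).card : ℤ) = Fintype.card F - η (a * b) * η (-1) := by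
    rw [hcount]
    have : ∀ u : F, (η u + 1) * (η ((m - a * u) / b) + 1) =
      η u * η ((m - a * u) / b) + η u + η ((m - a * u) / b) + 1 := fun u => by ring
    simp_rw [this, sum_add_distrib]
    rw [h3, h0, h2, hJ]
    simp
    ring
  rw [hfin, ← map_mul]
  rcases quadraticChar_isQuadratic F (a * b * -1) with h | h | h <;> rw [hη, h] <;> simp

/-- a line meets the conic in at most two points -/
lemma line_conic {a b m : F} (h2 : (2 : F) ≠ 0) (ha : a ≠ 0) (hb : b ≠ 0) (hm : m ≠ 0) (l1 l2 k : F) (hl : l1 ≠ 0 ∨ l2 ≠ 0) :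
    ((conic a b m).filter fun z => l1 * z.1 + l2 * z.2 = k).card ≤ 2 := by
  classical
  by_contra hcon
  push Not at hcon
  obtain ⟨x, hx, y, hy, z, hz, hxy, hxz, hyz⟩ := Finset.two_lt_card.1 hcon
  simp only [conic, mem_filter, mem_univ, true_and] at hx hy hz
  -- parametrise by the line direction
  have key : ∀ (a b l1 l2 : F) (x1 x2 y1 y2 z1 z2 : F), a ≠ 0 → b ≠ 0 → l1 ≠ 0 →
      a * x1 ^ 2 + b * x2 ^ 2 = m → a * y1 ^ 2 + b * y2 ^ 2 = m → a * z1 ^ 2 + b * z2 ^ 2 = m →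
      l1 * x1 + l2 * x2 = k → l1 * y1 + l2 * y2 = k → l1 * z1 + l2 * z2 = k →
      x2 ≠ y2 → x2 ≠ z2 → y2 ≠ z2 → False := by
    intro a b l1 l2 x1 x2 y1 y2 z1 z2 ha hb hl1 hx hy hz lx ly lz h1 h2' h3
    have ex : a * (k - l2 * x2) ^ 2 + b * l1 ^ 2 * x2 ^ 2 = m * l1 ^ 2 := by
      rw [← hx, ← lx]; ring
    have ey : a * (k - l2 * y2) ^ 2 + b * l1 ^ 2 * y2 ^ 2 = m * l1 ^ 2 := by
      rw [← hy, ← ly]; ring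
    have ez : a * (k - l2 * z2) ^ 2 + b * l1 ^ 2 * z2 ^ 2 = m * l1 ^ 2 := by
      rw [← hz, ← lz]; ring
    have d1 : (a * l2 ^ 2 + b * l1 ^ 2) * (x2 + y2) = 2 * a * k * l2 := by
      apply mul_left_cancel₀ (sub_ne_zero.2 h1)
      linear_combination ex - ey
    have d2 : (a * l2 ^ 2 + b * l1 ^ 2) * (x2 + z2) = 2 * a * k * l2 := by
      apply mul_left_cancel₀ (sub_ne_zero.2 h2')
      linear_combination ex - ez
    have d3 : a * l2 ^ 2 + b * l1 ^ 2 = 0 := by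
      apply mul_right_cancel₀ (sub_ne_zero.2 h3)
      linear_combination d1 - d2
    rw [d3, zero_mul] at d1
    have hl2 : l2 ≠ 0 := by
      rintro rfl
      apply mul_ne_zero hb (pow_ne_zero 2 hl1)
      linear_combination d3
    have hk : k = 0 := by
      have := d1.symm
      simpa [h2, ha, hl2] using this
    rw [hk] at ex
    apply mul_ne_zero hm (pow_ne_zero 2 hl1)
    linear_combination -ex + x2 ^ 2 * d3
  have ne2 : ∀ {x y : F × F}, x ≠ y → l1 ≠ 0 → l1 * x.1 + l2 * x.2 = k → l1 * y.1 + l2 * y.2 = k →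
      x.2 ≠ y.2 := by
    intro x y hne h hx hy he
    apply hne
    refine Prod.ext (mul_left_cancel₀ h ?_) he
    rw [he] at hx
    linear_combination hx - hy
  have ne1 : ∀ {x y : F × F}, x ≠ y → l2 ≠ 0 → l1 * x.1 + l2 * x.2 = k → l1 * y.1 + l2 * y.2 = k →
      x.1 ≠ y.1 := by
    intro x y hne h hx hy he
    apply hne
    refine Prod.ext he (mul_left_cancel₀ h ?_)
    rw [he] at hx
    linear_combination hx - hy
  rcases hl with h | h
  · exact key a b l1 l2 x.1 x.2 y.1 y.2 z.1 z.2 ha hb h hx.1 hy.1 hz.1 hx.2 hy.2 hz.2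
      (ne2 hxy h hx.2 hy.2) (ne2 hxz h hx.2 hz.2) (ne2 hyz h hy.2 hz.2)
  · exact key b a l2 l1 x.2 x.1 y.2 y.1 z.2 z.1 hb ha h
      (by rw [add_comm]; exact hx.1) (by rw [add_comm]; exact hy.1) (by rw [add_comm]; exact hz.1)
      (by rw [add_comm]; exact hx.2) (by rw [add_comm]; exact hy.2) (by rw [add_comm]; exact hz.2)
      (ne1 hxy h hx.2 hy.2) (ne1 hxz h hx.2 hz.2) (ne1 hyz h hy.2 hz.2)

lemma parseval {ψ : AddChar F ℂ} (hψ : ψ.IsPrimitive) (r : F × F → ℝ) :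
    ∑ v : F × F, ‖∑ d : F × F, (r d : ℂ) * ψ (v.1 * d.1 + v.2 * d.2)‖ ^ 2 =
      (Fintype.card F : ℝ) ^ 2 * ∑ d : F × F, r d ^ 2 := by
  classical
  have horth : ∀ d e : F × F, ∑ v : F × F, ψ (v.1 * d.1 + v.2 * d.2) * ψ (-(v.1 * e.1 + v.2 * e.2)) =
      if d = e then (Fintype.card F : ℂ) ^ 2 else 0 := by
    intro d e
    have : ∀ v : F × F, ψ (v.1 * d.1 + v.2 * d.2) * ψ (-(v.1 * e.1 + v.2 * e.2)) =
        ψ (v.1 * (d.1 - e.1)) * ψ (v.2 * (d.2 - e.2)) := by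
      intro v
      rw [← AddChar.map_add_eq_mul, ← AddChar.map_add_eq_mul]
      congr 1; ring
    simp_rw [this]
    rw [Fintype.sum_prod_type]
    simp_rw [← mul_sum]
    rw [← sum_mul, AddChar.sum_mulShift _ hψ, AddChar.sum_mulShift _ hψ]
    by_cases h1 : d.1 = e.1 <;> by_cases h2 : d.2 = e.2
    · have : d = e := Prod.ext h1 h2
      simp [this, sq]
    · have : d ≠ e := fun h => h2 (by rw [h])
      simp [this, sub_eq_zero, h2]
    · have : d ≠ e := fun h => h1 (by rw [h])
      simp [this, sub_eq_zero, h1]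
    · have : d ≠ e := fun h => h1 (by rw [h])
      simp [this, sub_eq_zero, h1]
  have hC : ((∑ v : F × F, ‖∑ d : F × F, (r d : ℂ) * ψ (v.1 * d.1 + v.2 * d.2)‖ ^ 2 : ℝ) : ℂ) =
      (((Fintype.card F : ℝ) ^ 2 * ∑ d : F × F, r d ^ 2 : ℝ) : ℂ) := by
    push_cast
    have e1 : ∀ v : F × F, ((‖∑ d : F × F, (r d : ℂ) * ψ (v.1 * d.1 + v.2 * d.2)‖ : ℂ)) ^ 2 =
        ∑ d : F × F, ∑ e : F × F, (r d : ℂ) * (r e : ℂ) *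
          (ψ (v.1 * d.1 + v.2 * d.2) * ψ (-(v.1 * e.1 + v.2 * e.2))) := by
      intro v
      rw [← Complex.mul_conj', map_sum, sum_mul_sum]
      refine sum_congr rfl fun d _ => sum_congr rfl fun e _ => ?_
      rw [map_mul, Complex.conj_ofReal, ← AddChar.map_neg_eq_conj]
      ring
    simp_rw [e1]
    rw [sum_comm]
    rw [mul_sum]
    refine sum_congr rfl fun d _ => ?_
    rw [sum_comm]
    simp_rw [← mul_sum, horth]
    simp
    ring
  exact_mod_cast hC

/-- difference representation function -/
def rep (C : Finset (F × F)) (d : F × F) : ℕ := ((C ×ˢ C).filter fun p => p.1 - p.2 = d).card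

lemma sum_rep (C : Finset (F × F)) (g : F × F → ℂ) :
    ∑ p ∈ C ×ˢ C, g (p.1 - p.2) = ∑ d : F × F, (rep C d : ℂ) * g d := by
  classical
  rw [← sum_fiberwise_of_maps_to (t := univ) (g := fun p : (F × F) × (F × F) => p.1 - p.2)
    (fun _ _ => mem_univ _)]
  refine sum_congr rfl fun d _ => ?_
  rw [rep, ← nsmul_eq_mul, ← sum_const]
  refine sum_congr rfl fun p hp => ?_
  rw [(mem_filter.1 hp).2]

lemma rep_le {a b m : F} (h2 : (2 : F) ≠ 0) (ha : a ≠ 0) (hb : b ≠ 0) (hm : m ≠ 0) {d : F × F}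
    (hd : d ≠ 0) : rep (conic a b m) d ≤ 2 := by
  classical
  refine le_trans ?_ (line_conic h2 ha hb hm (2 * a * d.1) (2 * b * d.2) (a * d.1 ^ 2 + b * d.2 ^ 2) ?_)
  · apply card_le_card_of_injOn (fun p => p.1)
    · rintro ⟨z, w⟩ hp
      simp only [conic, coe_filter, mem_product, mem_filter, mem_univ, true_and, Set.mem_setOf_eq] at hp ⊢
      obtain ⟨⟨hz, hw⟩, rfl⟩ := hp
      refine ⟨hz, ?_⟩
      simp only [Prod.fst_sub, Prod.snd_sub]
      linear_combination hz - hw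
    · rintro ⟨z, w⟩ hp ⟨z', w'⟩ hp' h
      simp only [coe_filter, Set.mem_setOf_eq] at hp hp' h
      subst h
      have := hp.2.trans hp'.2.symm
      simpa using this
  · by_contra hcon
    push Not at hcon
    apply hd
    ext
    · simpa [h2, ha] using hcon.1
    · simpa [h2, hb] using hcon.2

lemma rep_zero (C : Finset (F × F)) : rep C 0 = C.card := by
  classical
  rw [rep]
  symm
  apply card_bij (fun z _ => (z, z))
  · intro z hz; simp [hz]
  · intro z _ w _ h; simpa using h
  · rintro ⟨z, w⟩ h
    simp only [mem_filter, mem_product, sub_eq_zero] at h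
    exact ⟨z, h.1.1, by rw [h.2]⟩

lemma energy_le {a b m : F} (h2 : (2 : F) ≠ 0) (ha : a ≠ 0) (hb : b ≠ 0) (hm : m ≠ 0) :
    ∑ d : F × F, (rep (conic a b m) d : ℝ) ^ 2 ≤ 3 * ((conic a b m).card : ℝ) ^ 2 := by
  classical
  set C := conic a b m
  have htot : ∑ d : F × F, (rep C d : ℝ) = (C.card : ℝ) ^ 2 := by
    have : ∑ d : F × F, rep C d = (C ×ˢ C).card :=
      (card_eq_sum_card_fiberwise (fun _ _ => mem_univ _)).symm
    rw [card_product] at this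
    rw [sq]; exact_mod_cast this
  have hle : ∀ d : F × F, (rep C d : ℝ) ^ 2 ≤ 2 * rep C d + if d = 0 then (C.card : ℝ) ^ 2 else 0 := by
    intro d
    by_cases hd : d = 0
    · subst hd; rw [rep_zero]; simp
    · rw [if_neg hd, add_zero, sq]
      have : (rep C d : ℝ) ≤ 2 := by exact_mod_cast rep_le h2 ha hb hm hd
      gcongr
  refine (sum_le_sum fun d _ => hle d).trans ?_
  rw [sum_add_distrib, ← mul_sum, htot, sum_ite_eq' univ (0 : F × F)]
  simp
  linarith

lemma expS_fourth {a b m : F} (h2 : (2 : F) ≠ 0) (ha : a ≠ 0) (hb : b ≠ 0) (hm : m ≠ 0)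
    {ψ : AddChar F ℂ} (hψ : ψ.IsPrimitive) :
    ∑ v : F × F, ‖expS a b m ψ v‖ ^ 4 ≤
      (Fintype.card F : ℝ) ^ 2 * (3 * ((conic a b m).card : ℝ) ^ 2) := by
  classical
  have key : ∀ v : F × F, ‖expS a b m ψ v‖ ^ 4 =
      ‖∑ d : F × F, ((rep (conic a b m) d : ℝ) : ℂ) * ψ (v.1 * d.1 + v.2 * d.2)‖ ^ 2 := by
    intro v
    have h := sum_rep (conic a b m) (fun d => ψ (v.1 * d.1 + v.2 * d.2))
    have h' : ∑ p ∈ conic a b m ×ˢ conic a b m, ψ (v.1 * (p.1 - p.2).1 + v.2 * (p.1 - p.2).2) =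
        expS a b m ψ v * (starRingEnd ℂ) (expS a b m ψ v) := by
      rw [expS, map_sum, sum_mul_sum, sum_product]
      refine sum_congr rfl fun z _ => sum_congr rfl fun w _ => ?_
      rw [← AddChar.map_neg_eq_conj, ← AddChar.map_add_eq_mul]
      congr 1
      simp; ring
    rw [h', Complex.mul_conj'] at h
    push_cast
    rw [← h]
    rw [norm_pow, Complex.norm_real, norm_norm]
    ring
  simp_rw [key]
  rw [parseval hψ]
  gcongr
  exact energy_le h2 ha hb hm

lemma expS_orbit {a b m : F} (ψ : AddChar F ℂ) (c s : F) (h : c ^ 2 + a * b * s ^ 2 = 1) (u : F × F) :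
    expS a b m ψ (c * u.1 + a * s * u.2, c * u.2 - b * s * u.1) = expS a b m ψ u := by
  classical
  unfold expS
  apply sum_bij' (fun z _ => (c * z.1 - b * s * z.2, a * s * z.1 + c * z.2))
    (fun z _ => (c * z.1 + b * s * z.2, -(a * s * z.1) + c * z.2))
  · intro z hz
    simp only [conic, mem_filter, mem_univ, true_and] at hz ⊢
    linear_combination hz + (a * z.1 ^ 2 + b * z.2 ^ 2) * h
  · intro z hz
    simp only [conic, mem_filter, mem_univ, true_and] at hz ⊢
    linear_combination hz + (a * z.1 ^ 2 + b * z.2 ^ 2) * h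
  · intro z _
    ext
    · simp only; linear_combination z.1 * h
    · simp only; linear_combination z.2 * h
  · intro z _
    ext
    · simp only; linear_combination z.1 * h
    · simp only; linear_combination z.2 * h
  · intro z _
    congr 1
    ring

lemma expS_prime_bound {a b m : F} (hF : ringChar F ≠ 2) (ha : a ≠ 0) (hb : b ≠ 0) (hm : m ≠ 0)
    {ψ : AddChar F ℂ} (hψ : ψ.IsPrimitive) {u : F × F} (hu : u ≠ 0) :
    ‖expS a b m ψ u‖ ≤ 2 * (Fintype.card F : ℝ) ^ (3 / 4 : ℝ) := by
  classical
  have h2 : (2 : F) ≠ 0 := Ring.two_ne_zero hF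
  set q : ℝ := (Fintype.card F : ℝ) with hq
  have hq3 : 3 ≤ q := by
    have h1 : 1 < Fintype.card F := Fintype.one_lt_card
    have h3 : Fintype.card F % 2 = 1 := FiniteField.odd_card_of_char_ne_two hF
    have : 3 ≤ Fintype.card F := by omega
    rw [hq]; exact_mod_cast this
  have hcard : ∀ a b m : F, a ≠ 0 → b ≠ 0 → m ≠ 0 → |((conic a b m).card : ℝ) - q| ≤ 1 := by
    intro a b m ha hb hm
    have := conic_card_field hF ha hb hm
    rw [hq]
    exact_mod_cast this
  have hG := abs_le.1 (hcard 1 (a * b) 1 one_ne_zero (mul_ne_zero ha hb) one_ne_zero)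
  have hC := abs_le.1 (hcard a b m ha hb hm)
  set G := conic (1 : F) (a * b) 1 with hGdef
  -- orbit map
  let φ : F × F → F × F := fun g => (g.1 * u.1 + a * g.2 * u.2, g.1 * u.2 - b * g.2 * u.1)
  have hfib : ∀ v : F × F, (G.filter fun g => φ g = v).card ≤ 2 := by
    intro v
    by_cases h1 : u.1 = 0
    · have hu2 : u.2 ≠ 0 := fun h => hu (Prod.ext h1 h)
      refine le_trans (card_le_card ?_) (line_conic h2 one_ne_zero (mul_ne_zero ha hb) one_ne_zero
        u.2 (-(b * u.1)) v.2 (Or.inl hu2))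
      intro g hg
      rw [mem_filter] at hg ⊢
      refine ⟨hg.1, ?_⟩
      rw [← hg.2]; simp only [φ]; ring
    · refine le_trans (card_le_card ?_) (line_conic h2 one_ne_zero (mul_ne_zero ha hb) one_ne_zero
        u.1 (a * u.2) v.1 (Or.inl h1))
      intro g hg
      rw [mem_filter] at hg ⊢
      refine ⟨hg.1, ?_⟩
      rw [← hg.2]; simp only [φ]; ring
  have hsum : (G.card : ℝ) * ‖expS a b m ψ u‖ ^ 4 ≤ 2 * ∑ v : F × F, ‖expS a b m ψ v‖ ^ 4 := by
    have e1 : (G.card : ℝ) * ‖expS a b m ψ u‖ ^ 4 = ∑ g ∈ G, ‖expS a b m ψ (φ g)‖ ^ 4 := by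
      rw [← nsmul_eq_mul, ← sum_const]
      refine sum_congr rfl fun g hg => ?_
      have : g.1 ^ 2 + a * b * g.2 ^ 2 = 1 := by
        have := (mem_filter.1 hg).2
        rw [one_mul] at this; exact this
      rw [expS_orbit ψ g.1 g.2 this u]
    rw [e1, ← sum_fiberwise_of_maps_to (t := univ) (g := φ) (fun _ _ => mem_univ _), mul_sum]
    refine sum_le_sum fun v _ => ?_
    calc _ = ∑ g ∈ G.filter (fun g => φ g = v), ‖expS a b m ψ v‖ ^ 4 := by
          refine sum_congr rfl fun g hg => ?_
          rw [(mem_filter.1 hg).2]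
      _ = ((G.filter fun g => φ g = v).card : ℝ) * ‖expS a b m ψ v‖ ^ 4 := by
          rw [sum_const, nsmul_eq_mul]
      _ ≤ 2 * ‖expS a b m ψ v‖ ^ 4 := by
          gcongr
          exact_mod_cast hfib v
  have h4 := expS_fourth h2 ha hb hm hψ
  set X := ‖expS a b m ψ u‖ ^ 4 with hX
  have hX0 : 0 ≤ X := by positivity
  have hGl : 2 * q / 3 ≤ (G.card : ℝ) := by linarith
  have hCu : ((conic a b m).card : ℝ) ≤ 4 * q / 3 := by linarith
  have hC0 : (0 : ℝ) ≤ ((conic a b m).card : ℝ) := by positivity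
  have hfin : X ≤ 16 * q ^ 3 := by
    have h5 : (2 * q / 3) * X ≤ 2 * (q ^ 2 * (3 * (4 * q / 3) ^ 2)) := by
      calc (2 * q / 3) * X ≤ (G.card : ℝ) * X := by gcongr
        _ ≤ 2 * (q ^ 2 * (3 * ((conic a b m).card : ℝ) ^ 2)) := by
            refine hsum.trans ?_
            gcongr
        _ ≤ _ := by gcongr
    have : (2 * q / 3) * X ≤ (2 * q / 3) * (16 * q ^ 3) := by
      refine h5.trans (le_of_eq ?_); ring
    exact le_of_mul_le_mul_left this (by positivity)
  have hr : (2 * q ^ (3 / 4 : ℝ)) ^ 4 = 16 * q ^ 3 := by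
    rw [mul_pow, ← Real.rpow_natCast (q ^ (3/4 : ℝ)), ← Real.rpow_mul (by positivity)]
    norm_num
  rw [← hr] at hfin
  exact le_of_pow_le_pow_left₀ (by norm_num) (by positivity) hfin

end field
end APU

set_option maxHeartbeats 400000

namespace APU

open Finset

section ring
variable {R R' : Type*} [CommRing R] [Fintype R] [DecidableEq R] [CommRing R'] [Fintype R'] [DecidableEq R']

def kap (u : R × R) : ℕ := (univ.filter fun t : R => t * u.1 = 0 ∧ t * u.2 = 0).card

lemma kap_pos (u : R × R) : 1 ≤ kap u := by
  rw [kap, Nat.one_le_iff_ne_zero, ← Nat.pos_iff_ne_zero, card_pos]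
  exact ⟨0, by simp⟩

/-- exponential sum bound property -/
def SB (R : Type*) [CommRing R] [Fintype R] [DecidableEq R] (w : ℝ) : Prop :=
  ∀ (a b m : R), IsUnit a → IsUnit b → IsUnit m → ∀ ψ : AddChar R ℂ, ψ.IsPrimitive →
    ∀ u : R × R, ‖expS a b m ψ u‖ ≤ w * kap u

lemma conic_equiv (e : R ≃+* R') (a b m : R) :
    conic (e a) (e b) (e m) = (conic a b m).map (e.toEquiv.prodCongr e.toEquiv).toEmbedding := by
  ext ⟨x, y⟩
  simp only [conic, mem_filter, mem_univ, true_and, mem_map, Equiv.coe_toEmbedding]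
  constructor
  · intro h
    refine ⟨(e.symm x, e.symm y), ?_, by simp⟩
    apply e.injective
    simpa using h
  · rintro ⟨z, h, hz⟩
    have h1 : e z.1 = x := congrArg Prod.fst hz
    have h2 : e z.2 = y := congrArg Prod.snd hz
    rw [← h1, ← h2, ← h]; simp

lemma conic_card_equiv (e : R ≃+* R') (a b m : R) :
    (conic (e a) (e b) (e m)).card = (conic a b m).card := by
  rw [conic_equiv, card_map]

lemma conic_card_prod (a b m : R) (a' b' m' : R') :
    (conic (a, a') (b, b') (m, m')).card = (conic a b m).card * (conic a' b' m').card := by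
  rw [← card_product]
  apply card_bij (fun z _ => ((z.1.1, z.2.1), (z.1.2, z.2.2)))
  · intro z hz
    simp only [conic, mem_filter, mem_univ, true_and, mem_product] at hz ⊢
    exact ⟨congrArg Prod.fst hz, congrArg Prod.snd hz⟩
  · rintro ⟨⟨x, x'⟩, y, y'⟩ _ ⟨⟨z, z'⟩, w, w'⟩ _ h
    simp at h ⊢
    tauto
  · rintro ⟨⟨x, y⟩, x', y'⟩ h
    simp only [conic, mem_filter, mem_univ, true_and, mem_product] at h
    refine ⟨((x, x'), (y, y')), ?_, rfl⟩
    simp only [conic, mem_filter, mem_univ, true_and]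
    exact Prod.ext h.1 h.2

lemma SB_equiv (e : R ≃+* R') {w : ℝ} (h : SB R w) : SB R' w := by
  intro a b m ha hb hm ψ hψ u
  let ψ' : AddChar R ℂ := ψ.compAddMonoidHom (e : R →+ R')
  have hψ'v : ∀ x, ψ' x = ψ (e x) := fun x => rfl
  have hprim : ψ'.IsPrimitive := by
    intro t ht h1
    apply hψ (a := e t) (by simpa using ht)
    ext x
    have := DFunLike.congr_fun h1 (e.symm x)
    simpa [AddChar.mulShift_apply, hψ'v] using this
  have h1 := h (e.symm a) (e.symm b) (e.symm m) (ha.map e.symm) (hb.map e.symm) (hm.map e.symm) ψ' hprim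
    (e.symm u.1, e.symm u.2)
  have e1 : kap (e.symm u.1, e.symm u.2) = kap u := by
    unfold kap
    apply card_bij (fun t _ => e t)
    · intro t ht
      simp only [mem_filter, mem_univ, true_and] at ht ⊢
      constructor
      · have := congrArg e ht.1; simpa using this
      · have := congrArg e ht.2; simpa using this
    · intro t _ s _ h; exact e.injective h
    · intro t ht
      simp only [mem_filter, mem_univ, true_and] at ht
      refine ⟨e.symm t, ?_, by simp⟩
      simp only [mem_filter, mem_univ, true_and, ← map_mul, ht.1, ht.2, map_zero, and_self]
  have e2 : expS (e.symm a) (e.symm b) (e.symm m) ψ' (e.symm u.1, e.symm u.2) = expS a b m ψ u := by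
    unfold expS
    have := conic_equiv e.symm a b m
    rw [this, sum_map]
    refine sum_congr rfl fun z _ => ?_
    simp [hψ'v]
  rw [e1, e2] at h1
  exact h1

lemma SB_prod {w w' : ℝ} (hw : 0 ≤ w) (h : SB R w) (h' : SB R' w') : SB (R × R') (w * w') := by
  rintro ⟨a, a'⟩ ⟨b, b'⟩ ⟨m, m'⟩ ha hb hm ψ hψ ⟨⟨u, u'⟩, ⟨v, v'⟩⟩
  rw [Prod.isUnit_iff] at ha hb hm
  let ψ1 : AddChar R ℂ := ψ.compAddMonoidHom (AddMonoidHom.inl R R')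
  let ψ2 : AddChar R' ℂ := ψ.compAddMonoidHom (AddMonoidHom.inr R R')
  have v1 : ∀ x, ψ1 x = ψ (x, 0) := fun x => rfl
  have v2 : ∀ x, ψ2 x = ψ (0, x) := fun x => rfl
  have p1 : ψ1.IsPrimitive := by
    intro t ht h1
    apply hψ (a := (t, 0)) (by simpa using ht)
    ext x
    have := DFunLike.congr_fun h1 x.1
    simpa [AddChar.mulShift_apply, v1, Prod.mul_def] using this
  have p2 : ψ2.IsPrimitive := by
    intro t ht h1
    apply hψ (a := (0, t)) (by simpa using ht)
    ext x
    have := DFunLike.congr_fun h1 x.2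
    simpa [AddChar.mulShift_apply, v2, Prod.mul_def] using this
  have b1 := h a b m ha.1 hb.1 hm.1 ψ1 p1 (u, v)
  have b2 := h' a' b' m' ha.2 hb.2 hm.2 ψ2 p2 (u', v')
  have e1 : kap ((u, u'), (v, v')) = kap (u, v) * kap (u', v') := by
    unfold kap
    rw [← card_product]
    congr 1
    ext ⟨t, t'⟩
    simp only [mem_filter, mem_univ, true_and, mem_product, Prod.mk_mul_mk, Prod.mk_eq_zero]
    tauto
  have e2 : expS (a, a') (b, b') (m, m') ψ ((u, u'), (v, v')) =
      expS a b m ψ1 (u, v) * expS a' b' m' ψ2 (u', v') := by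
    unfold expS
    rw [sum_mul_sum, ← sum_product']
    apply sum_bij (fun z _ => ((z.1.1, z.2.1), (z.1.2, z.2.2)))
    · intro z hz
      simp only [conic, mem_filter, mem_univ, true_and, mem_product] at hz ⊢
      exact ⟨congrArg Prod.fst hz, congrArg Prod.snd hz⟩
    · rintro ⟨⟨x, x'⟩, y, y'⟩ _ ⟨⟨z, z'⟩, w, w'⟩ _ h
      simp at h ⊢
      tauto
    · rintro ⟨⟨x, y⟩, x', y'⟩ h
      simp only [conic, mem_filter, mem_univ, true_and, mem_product] at h
      refine ⟨((x, x'), (y, y')), ?_, rfl⟩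
      simp only [conic, mem_filter, mem_univ, true_and]
      exact Prod.ext h.1 h.2
    · rintro ⟨⟨x, x'⟩, y, y'⟩ _
      rw [v1, v2, ← AddChar.map_add_eq_mul]
      congr 1
      simp
  rw [e1, e2, norm_mul]
  push_cast
  calc _ ≤ (w * kap (u, v)) * (w' * kap (u', v')) := by gcongr
    _ = _ := by ring

lemma expS_norm_le (a b m : R) (ψ : AddChar R ℂ) (u : R × R) : ‖expS a b m ψ u‖ ≤ (conic a b m).card := by
  unfold expS
  refine (norm_sum_le _ _).trans ?_
  rw [← nsmul_one, ← sum_const]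
  exact sum_le_sum fun z _ => (AddChar.norm_apply ψ _).le

end ring

/-- linear equation count -/
lemma lin_count {F : Type*} [Field F] [Fintype F] [DecidableEq F] (k l1 l2 : F) (h : l1 ≠ 0 ∨ l2 ≠ 0) :
    (univ.filter fun w : F × F => k + l1 * w.1 + l2 * w.2 = 0).card = Fintype.card F := by
  rw [← card_univ]
  rcases h with h | h
  · symm
    apply card_bij (fun t _ => ((-k - l2 * t) / l1, t))
    · intro t _
      simp only [mem_filter, mem_univ, true_and]
      field_simp; ring
    · intro t _ s _ h; exact (Prod.ext_iff.1 h).2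
    · rintro ⟨x, y⟩ hxy
      simp only [mem_filter, mem_univ, true_and] at hxy
      refine ⟨y, mem_univ _, Prod.ext ?_ rfl⟩
      field_simp; linear_combination -hxy
  · symm
    apply card_bij (fun t _ => (t, (-k - l1 * t) / l2))
    · intro t _
      simp only [mem_filter, mem_univ, true_and]
      field_simp; ring
    · intro t _ s _ h; exact (Prod.ext_iff.1 h).1
    · rintro ⟨x, y⟩ hxy
      simp only [mem_filter, mem_univ, true_and] at hxy
      refine ⟨x, mem_univ _, Prod.ext rfl ?_⟩
      field_simp; linear_combination -hxy

/-- number of points of the conic mod `q` -/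
def NN (a b m : ℤ) (q : ℕ) [NeZero q] : ℕ := (conic (a : ZMod q) (b : ZMod q) (m : ZMod q)).card

lemma NN_mul (a b m : ℤ) {q r : ℕ} [NeZero q] [NeZero r] [NeZero (q * r)] (h : q.Coprime r) :
    NN a b m (q * r) = NN a b m q * NN a b m r := by
  unfold NN
  rw [← conic_card_prod, ← conic_card_equiv (ZMod.chineseRemainder h)]
  simp only [map_intCast]
  rfl

lemma NN_prime {a b m : ℤ} {p : ℕ} [NeZero p] (hp : p.Prime) (hp2 : p ≠ 2) (ha : ¬ (p : ℤ) ∣ a) (hb : ¬ (p : ℤ) ∣ b)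
    (hm : ¬ (p : ℤ) ∣ m) : |(NN a b m p : ℤ) - p| ≤ 1 := by
  have := Fact.mk hp
  have := conic_card_field (F := ZMod p) (a := a) (b := b) (m := m) (by rwa [ZMod.ringChar_zmod_n])
    (by rwa [Ne, ZMod.intCast_zmod_eq_zero_iff_dvd]) (by rwa [Ne, ZMod.intCast_zmod_eq_zero_iff_dvd])
    (by rwa [Ne, ZMod.intCast_zmod_eq_zero_iff_dvd])
  rw [ZMod.card] at this
  unfold NN
  convert this

lemma NN_pow_succ {a b m : ℤ} {p : ℕ} (hp : p.Prime) (hp2 : p ≠ 2) (ha : ¬ (p : ℤ) ∣ a) (hb : ¬ (p : ℤ) ∣ b)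
    (hm : ¬ (p : ℤ) ∣ m) (j : ℕ) (hj : 1 ≤ j) [NeZero (p ^ j)] [NeZero (p ^ (j + 1))] :
    NN a b m (p ^ (j + 1)) = p * NN a b m (p ^ j) := by
  have hfact := Fact.mk hp
  have hppos : 0 < p := hp.pos
  let Φ : ZMod (p ^ j) × ZMod p → ZMod (p ^ (j + 1)) := fun t => ((t.1.val + p ^ j * t.2.val : ℕ) : ZMod (p ^ (j + 1)))
  have hinj : Function.Injective Φ := by
    rintro ⟨t, w⟩ ⟨t', w'⟩ h
    simp only [Φ] at h
    rw [ZMod.natCast_eq_natCast_iff] at h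
    have hlt : ∀ (t : ZMod (p ^ j)) (w : ZMod p), t.val + p ^ j * w.val < p ^ (j + 1) := by
      intro t w
      have h1 := ZMod.val_lt t
      have h2 := ZMod.val_lt w
      calc t.val + p ^ j * w.val < p ^ j + p ^ j * w.val := by omega
        _ = p ^ j * (w.val + 1) := by ring
        _ ≤ p ^ j * p := Nat.mul_le_mul_left _ h2
        _ = _ := by ring
    have h := Nat.ModEq.eq_of_lt_of_lt h (hlt _ _) (hlt _ _)
    have h1 : t.val = t'.val := by
      have := congrArg (· % p ^ j) h
      simpa [Nat.add_mul_mod_self_left, Nat.mod_eq_of_lt (ZMod.val_lt _)] using this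
    have h2 : w.val = w'.val := by
      rw [h1] at h
      have : p ^ j * w.val = p ^ j * w'.val := by omega
      exact Nat.eq_of_mul_eq_mul_left (by positivity) this
    rw [ZMod.val_injective _ h1, ZMod.val_injective _ h2]
  have hbij : Function.Bijective Φ := by
    rw [Fintype.bijective_iff_injective_and_card]
    refine ⟨hinj, ?_⟩
    rw [Fintype.card_prod, ZMod.card, ZMod.card, ZMod.card, pow_succ]
  have hzero : ∀ (q : ℕ) (x y : ℤ), ((a : ZMod q) * (x : ZMod q) ^ 2 + b * (y : ZMod q) ^ 2 = m ↔ (q : ℤ) ∣ a * x ^ 2 + b * y ^ 2 - m) := by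
    intro q x y
    rw [← ZMod.intCast_zmod_eq_zero_iff_dvd]
    push_cast
    rw [sub_eq_zero]
  unfold NN
  -- count by fibres
  have hcount : (conic (a : ZMod (p ^ (j + 1))) b m).card =
      ∑ z ∈ conic (a : ZMod (p ^ j)) b m, p := by
    let f : ZMod (p ^ (j + 1)) × ZMod (p ^ (j + 1)) → ZMod (p ^ j) × ZMod (p ^ j) :=
      fun x => (ZMod.castHom (Nat.pow_dvd_pow p (Nat.le_succ j)) _ x.1, ZMod.castHom (Nat.pow_dvd_pow p (Nat.le_succ j)) _ x.2)
    have hmaps : ∀ x ∈ conic (a : ZMod (p ^ (j + 1))) b m, f x ∈ conic (a : ZMod (p ^ j)) b m := by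
      intro x hx
      simp only [conic, mem_filter, mem_univ, true_and] at hx ⊢
      have := congrArg (ZMod.castHom (Nat.pow_dvd_pow p (Nat.le_succ j)) (ZMod (p ^ j))) hx
      simpa only [map_add, map_mul, map_pow, map_intCast] using this
    rw [card_eq_sum_card_fiberwise hmaps]
    refine sum_congr rfl fun z hz => ?_
    simp only [conic, mem_filter, mem_univ, true_and] at hz
    have hz1 : ((z.1.val : ℤ) : ZMod (p ^ j)) = z.1 := by simp
    have hz2 : ((z.2.val : ℤ) : ZMod (p ^ j)) = z.2 := by simp
    set s : ℤ := (z.1.val : ℤ) with hs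
    set t : ℤ := (z.2.val : ℤ) with ht
    rw [← hz1, ← hz2, hzero] at hz
    obtain ⟨k, hk⟩ := hz
    push_cast at hk
    have hlin := lin_count (F := ZMod p) (k : ZMod p) ((2 * a * s : ℤ) : ZMod p) ((2 * b * t : ℤ) : ZMod p) ?_
    · rw [ZMod.card] at hlin
      refine Eq.trans ?_ hlin
      symm
      apply card_bij (fun w _ => (Φ (z.1, w.1), Φ (z.2, w.2)))
      · intro w hw
        simp only [mem_filter, mem_univ, true_and, conic] at hw ⊢
        have e1 : Φ (z.1, w.1) = ((s + p ^ j * (w.1.val : ℤ) : ℤ) : ZMod (p ^ (j + 1))) := by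
          simp [Φ, hs]
        have e2 : Φ (z.2, w.2) = ((t + p ^ j * (w.2.val : ℤ) : ℤ) : ZMod (p ^ (j + 1))) := by
          simp [Φ, ht]
        constructor
        · rw [e1, e2, hzero]
          have hw' : ((k + 2 * a * s * (w.1.val : ℤ) + 2 * b * t * (w.2.val : ℤ) : ℤ) : ZMod p) = 0 := by
            rw [← hw]; push_cast; simp
          rw [ZMod.intCast_zmod_eq_zero_iff_dvd] at hw'
          obtain ⟨l, hl⟩ := hw'
          obtain ⟨i, rfl⟩ : ∃ i, j = i + 1 := ⟨j - 1, by omega⟩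
          refine ⟨l + p ^ i * (a * (w.1.val : ℤ) ^ 2 + b * (w.2.val : ℤ) ^ 2), ?_⟩
          push_cast
          have hl' := congrArg (fun x : ℤ => (p : ℤ) ^ (i + 1) * x) hl
          linear_combination hk + hl'
        · ext
          · simp only [f, e1, map_intCast]
            rw [← hz1]; push_cast
            have : ((p : ZMod (p ^ j)) ^ j) = 0 := by exact_mod_cast ZMod.natCast_self (p ^ j)
            rw [this]; simp
          · simp only [f, e2, map_intCast]
            rw [← hz2]; push_cast
            have : ((p : ZMod (p ^ j)) ^ j) = 0 := by exact_mod_cast ZMod.natCast_self (p ^ j)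
            rw [this]; simp
      · intro w _ w' _ h
        have h1 := hinj (Prod.ext_iff.1 h).1
        have h2 := hinj (Prod.ext_iff.1 h).2
        exact Prod.ext (Prod.ext_iff.1 h1).2 (Prod.ext_iff.1 h2).2
      · rintro ⟨x, y⟩ hxy
        obtain ⟨⟨x0, w1⟩, rfl⟩ := hbij.2 x
        obtain ⟨⟨y0, w2⟩, rfl⟩ := hbij.2 y
        simp only [mem_filter, mem_univ, true_and, conic] at hxy
        have hfz : ∀ x0 w1, ZMod.castHom (Nat.pow_dvd_pow p (Nat.le_succ j)) (ZMod (p ^ j)) (Φ (x0, w1)) = x0 := by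
          intro x0 w1
          simp only [Φ, map_natCast]
          push_cast
          have : ((p : ZMod (p ^ j)) ^ j) = 0 := by exact_mod_cast ZMod.natCast_self (p ^ j)
          rw [this]; simp
        have hx0 : x0 = z.1 := by rw [← hxy.2]; exact (hfz _ _).symm
        have hy0 : y0 = z.2 := by rw [← hxy.2]; exact (hfz _ _).symm
        subst hx0 hy0
        refine ⟨(w1, w2), ?_, rfl⟩
        simp only [mem_filter, mem_univ, true_and]
        have e1 : Φ (z.1, w1) = ((s + p ^ j * (w1.val : ℤ) : ℤ) : ZMod (p ^ (j + 1))) := by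
          simp [Φ, hs]
        have e2 : Φ (z.2, w2) = ((t + p ^ j * (w2.val : ℤ) : ℤ) : ZMod (p ^ (j + 1))) := by
          simp [Φ, ht]
        have h1 := hxy.1
        rw [e1, e2, hzero] at h1
        obtain ⟨l, hl⟩ := h1
        have hw' : ((k + 2 * a * s * (w1.val : ℤ) + 2 * b * t * (w2.val : ℤ) : ℤ) : ZMod p) = 0 := by
          rw [ZMod.intCast_zmod_eq_zero_iff_dvd]
          obtain ⟨i, rfl⟩ : ∃ i, j = i + 1 := ⟨j - 1, by omega⟩
          refine ⟨l - p ^ i * (a * (w1.val : ℤ) ^ 2 + b * (w2.val : ℤ) ^ 2), ?_⟩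
          have hpp : ((p : ℤ) ^ (i + 1)) ≠ 0 := by positivity
          apply mul_left_cancel₀ hpp
          push_cast at hl
          linear_combination hl - hk
        rw [← hw']; push_cast; simp
    · by_contra hcon
      push Not at hcon
      have h2p : ¬ (p : ℤ) ∣ 2 := by
        intro h
        have : p ∣ 2 := by exact_mod_cast h
        exact hp2 ((Nat.prime_dvd_prime_iff_eq hp Nat.prime_two).1 this)
      have hpp : Prime (p : ℤ) := Nat.prime_iff_prime_int.1 hp
      rw [ZMod.intCast_zmod_eq_zero_iff_dvd, ZMod.intCast_zmod_eq_zero_iff_dvd] at hcon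
      have hs' : (p : ℤ) ∣ s := by
        rcases hpp.dvd_or_dvd hcon.1 with h | h
        · rcases hpp.dvd_or_dvd h with h | h
          · exact absurd h h2p
          · exact absurd h ha
        · exact h
      have ht' : (p : ℤ) ∣ t := by
        rcases hpp.dvd_or_dvd hcon.2 with h | h
        · rcases hpp.dvd_or_dvd h with h | h
          · exact absurd h h2p
          · exact absurd h hb
        · exact h
      apply hm
      have : m = a * s ^ 2 + b * t ^ 2 - p ^ j * k := by linear_combination -hk
      rw [this]
      apply dvd_sub
      · exact dvd_add (Dvd.dvd.mul_left (dvd_pow hs' two_ne_zero) _) (Dvd.dvd.mul_left (dvd_pow ht' two_ne_zero) _)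
      · exact Dvd.dvd.mul_right (dvd_pow_self _ (by omega)) _
  rw [hcount, sum_const, smul_eq_mul, mul_comm]

end APU

set_option maxHeartbeats 400000

namespace APU

open Finset

/-- local weights -/
noncomputable def wt (p k : ℕ) : ℝ := if k = 1 then 2 * (p : ℝ) ^ (3 / 4 : ℝ) else 2 * (p : ℝ) ^ k

/-- global weight -/
noncomputable def Wt (q : ℕ) : ℝ := q.factorization.prod wt

lemma wt_nonneg (p k : ℕ) : 0 ≤ wt p k := by unfold wt; split_ifs <;> positivity

lemma Wt_nonneg (q : ℕ) : 0 ≤ Wt q := by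
  unfold Wt Finsupp.prod
  exact prod_nonneg fun _ _ => wt_nonneg _ _

lemma Wt_mul {q r : ℕ} (h : q.Coprime r) : Wt (q * r) = Wt q * Wt r := by
  unfold Wt
  rw [Nat.factorization_mul_of_coprime h]
  exact Finsupp.prod_add_index_of_disjoint h.disjoint_primeFactors _

lemma Wt_pow {p k : ℕ} (hp : p.Prime) (hk : 0 < k) : Wt (p ^ k) = wt p k := by
  unfold Wt
  rw [hp.factorization_pow, Finsupp.prod, Finsupp.support_single_ne_zero _ hk.ne']
  simp

lemma NN_congr {a b m : ℤ} {x y : ℕ} [NeZero x] [NeZero y] (h : x = y) : NN a b m x = NN a b m y := by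
  subst h; rfl

lemma NN_prime_pow {a b m : ℤ} {p : ℕ} (hp : p.Prime) (hp2 : p ≠ 2) (ha : ¬ (p : ℤ) ∣ a) (hb : ¬ (p : ℤ) ∣ b)
    (hm : ¬ (p : ℤ) ∣ m) (j : ℕ) [NeZero p] : ∀ [NeZero (p ^ (j + 1))],
    NN a b m (p ^ (j + 1)) = p ^ j * NN a b m p := by
  induction j with
  | zero =>
    intro _
    rw [pow_zero, one_mul]
    exact NN_congr (pow_one p)
  | succ j ih =>
    intro _
    have : NeZero (p ^ (j + 1)) := ⟨pow_ne_zero _ hp.ne_zero⟩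
    rw [NN_pow_succ hp hp2 ha hb hm (j + 1) (by omega), ih]
    ring

lemma SB_prime {p : ℕ} [NeZero p] (hp : p.Prime) (hp2 : p ≠ 2) : SB (ZMod p) (2 * (p : ℝ) ^ (3 / 4 : ℝ)) := by
  have := Fact.mk hp
  intro a b m ha hb hm ψ hψ u
  have hch : ringChar (ZMod p) ≠ 2 := by rwa [ZMod.ringChar_zmod_n]
  have hp1 : (1 : ℝ) ≤ p := by exact_mod_cast hp.one_lt.le
  have hpp : (1 : ℝ) ≤ (p : ℝ) ^ (3 / 4 : ℝ) := Real.one_le_rpow hp1 (by norm_num)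
  by_cases hu : u = 0
  · have hk : kap u = p := by
      unfold kap
      rw [hu]
      simp [ZMod.card]
    refine (expS_norm_le a b m ψ u).trans ?_
    have := conic_card_field hch ha.ne_zero hb.ne_zero hm.ne_zero
    rw [ZMod.card] at this
    have h1 : ((conic a b m).card : ℤ) ≤ p + 1 := by linarith [(abs_le.1 this).2]
    have h2 : ((conic a b m).card : ℝ) ≤ p + 1 := by exact_mod_cast h1
    rw [hk]
    nlinarith
  · have h1 := expS_prime_bound hch ha.ne_zero hb.ne_zero hm.ne_zero hψ hu
    rw [ZMod.card] at h1
    have h2 : (1 : ℝ) ≤ kap u := by exact_mod_cast kap_pos u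
    nlinarith

lemma isUnit_not_dvd {q p : ℕ} (hp : p.Prime) (hpq : p ∣ q) {a : ℤ} (h : IsUnit (a : ZMod q)) : ¬ (p : ℤ) ∣ a := by
  intro hd
  have hu := h.map (ZMod.castHom hpq (ZMod p))
  rw [map_intCast, (ZMod.intCast_zmod_eq_zero_iff_dvd a p).2 hd] at hu
  have := Fact.mk hp
  exact not_isUnit_zero hu

lemma SB_prime_pow {p j : ℕ} (hp : p.Prime) (hp2 : p ≠ 2) (hj : 0 < j) [NeZero (p ^ j)] : SB (ZMod (p ^ j)) (2 * (p : ℝ) ^ j) := by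
  have : NeZero p := ⟨hp.ne_zero⟩
  intro a b m ha hb hm ψ hψ u
  obtain ⟨i, rfl⟩ : ∃ i, j = i + 1 := ⟨j - 1, by omega⟩
  have ea : ∀ a : ZMod (p ^ (i + 1)), a = ((a.val : ℤ) : ZMod (p ^ (i + 1))) := by intro a; simp
  have hd : p ∣ p ^ (i + 1) := dvd_pow_self _ (by omega)
  have ha' : ¬ (p : ℤ) ∣ (a.val : ℤ) := isUnit_not_dvd hp hd (by rwa [← ea])
  have hb' : ¬ (p : ℤ) ∣ (b.val : ℤ) := isUnit_not_dvd hp hd (by rwa [← ea])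
  have hm' : ¬ (p : ℤ) ∣ (m.val : ℤ) := isUnit_not_dvd hp hd (by rwa [← ea])
  have h1 := NN_prime_pow hp hp2 ha' hb' hm' i
  have h2 := NN_prime hp hp2 ha' hb' hm'
  have h3 : (conic a b m).card = NN a.val b.val m.val (p ^ (i + 1)) := by
    unfold NN
    rw [← ea a, ← ea b, ← ea m]
  refine (expS_norm_le a b m ψ u).trans ?_
  rw [h3, h1]
  have h4 : (NN a.val b.val m.val p : ℤ) ≤ p + 1 := by linarith [(abs_le.1 h2).2]
  have h5 : (NN a.val b.val m.val p : ℝ) ≤ p + 1 := by exact_mod_cast h4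
  have h6 : (1 : ℝ) ≤ kap u := by exact_mod_cast kap_pos u
  have h7 : (1 : ℝ) ≤ p := by exact_mod_cast hp.one_lt.le
  push_cast
  have h8 : (0 : ℝ) < (p : ℝ) ^ i := by positivity
  calc (p : ℝ) ^ i * (NN a.val b.val m.val p : ℝ) ≤ p ^ i * (2 * p) := by gcongr; linarith
    _ = 2 * p ^ (i + 1) * 1 := by ring
    _ ≤ _ := by gcongr

lemma SB_all (q : ℕ) : ∀ [NeZero q], Odd q → SB (ZMod q) (Wt q) := by
  induction q using Nat.recOnPosPrimePosCoprime with
  | zero => intro h; exact absurd rfl h.out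
  | one =>
    intro _ _ a b m ha hb hm ψ hψ u
    refine (expS_norm_le a b m ψ u).trans ?_
    have h1 : (conic a b m).card ≤ 1 := by
      refine (card_le_univ _).trans ?_
      simp
    have h6 : (1 : ℝ) ≤ kap u := by exact_mod_cast kap_pos u
    have h1' : ((conic a b m).card : ℝ) ≤ 1 := by exact_mod_cast h1
    have : Wt 1 = 1 := by simp [Wt]
    rw [this]; linarith
  | prime_pow p n hp hn =>
    intro _ hodd
    have hp2 : p ≠ 2 := by
      rintro rfl
      exact absurd (Nat.Odd.of_mul_left (n := 2 ^ (n - 1)) (m := 2) (by rwa [← pow_succ', Nat.sub_add_cancel hn])) (by decide)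
    rw [Wt_pow hp hn, wt]
    split_ifs with h
    · have : NeZero p := ⟨hp.ne_zero⟩
      subst h
      have := SB_prime hp hp2
      have key : ∀ x [NeZero x], x = p → SB (ZMod x) (2 * (p : ℝ) ^ (3 / 4 : ℝ)) := by
        intro x _ hx
        subst hx; exact this
      exact key _ (pow_one p)
    · exact SB_prime_pow hp hp2 hn
  | coprime a b ha hb hab iha ihb =>
    intro _ hodd
    have : NeZero a := ⟨by omega⟩
    have : NeZero b := ⟨by omega⟩
    rw [Nat.odd_mul] at hodd
    rw [Wt_mul hab]
    exact SB_equiv (ZMod.chineseRemainder hab).symm (SB_prod (Wt_nonneg _) (iha hodd.1) (ihb hodd.2))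

/-- square part -/
def sqp (q : ℕ) : ℕ := q.factorization.prod fun p k => p ^ (k / 2)

lemma sqp_sq_dvd {q : ℕ} (hq : q ≠ 0) : sqp q ^ 2 ∣ q := by
  conv_rhs => rw [← Nat.prod_factorization_pow_eq_self hq]
  unfold sqp Finsupp.prod
  rw [← prod_pow]
  apply prod_dvd_prod_of_dvd
  intro p _
  rw [← pow_mul]
  exact pow_dvd_pow _ (Nat.div_mul_le_self _ _)

lemma sqp_pos (q : ℕ) : 0 < sqp q := by
  unfold sqp Finsupp.prod
  apply prod_pos
  intro p hp
  have : p.Prime := Nat.prime_of_mem_primeFactors hp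
  have := this.pos
  positivity

lemma Wt_le {q : ℕ} (hq : q ≠ 0) : Wt q ≤ (q.divisors.card : ℝ) * (q : ℝ) ^ (3 / 4 : ℝ) * (sqp q : ℝ) ^ (3 / 4 : ℝ) := by
  have h1 : (q.divisors.card : ℝ) = ∏ p ∈ q.primeFactors, ((q.factorization p : ℝ) + 1) := by
    rw [Nat.card_divisors hq]; push_cast; rfl
  have h2 : (q : ℝ) ^ (3 / 4 : ℝ) = ∏ p ∈ q.primeFactors, ((p : ℝ) ^ (q.factorization p)) ^ (3 / 4 : ℝ) := by
    rw [Real.finsetProd_rpow _ _ (fun i _ => by positivity)]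
    congr 1
    conv_lhs => rw [← Nat.prod_factorization_pow_eq_self hq]
    unfold Finsupp.prod
    push_cast; rfl
  have h3 : (sqp q : ℝ) ^ (3 / 4 : ℝ) = ∏ p ∈ q.primeFactors, ((p : ℝ) ^ (q.factorization p / 2)) ^ (3 / 4 : ℝ) := by
    rw [Real.finsetProd_rpow _ _ (fun i _ => by positivity)]
    congr 1
    unfold sqp Finsupp.prod
    push_cast; rfl
  rw [h1, h2, h3, ← prod_mul_distrib, ← prod_mul_distrib]
  unfold Wt Finsupp.prod
  apply prod_le_prod
  · intro p _; exact wt_nonneg _ _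
  intro p hp
  have hpp : p.Prime := Nat.prime_of_mem_primeFactors hp
  have hk : 0 < q.factorization p := by
    have := (Nat.mem_primeFactors.1 hp).2.1
    exact hpp.factorization_pos_of_dvd hq this
  generalize q.factorization p = k at hk
  have hp1 : (1 : ℝ) ≤ p := by exact_mod_cast hpp.one_lt.le
  have hp0 : (0 : ℝ) ≤ p := by linarith
  unfold wt
  split_ifs with h
  · subst h; norm_num
  · have hk2 : (2 : ℝ) ≤ (k : ℝ) + 1 := by
      have : (1 : ℝ) ≤ k := by exact_mod_cast hk
      linarith
    rw [mul_assoc]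
    apply mul_le_mul hk2 _ (by positivity) (by positivity)
    rw [← Real.rpow_natCast, ← Real.rpow_natCast, ← Real.rpow_mul hp0, ← Real.rpow_mul hp0, ← Real.rpow_add (by linarith)]
    apply Real.rpow_le_rpow_of_exponent_le hp1
    have : k ≤ 3 * (k / 2) := by omega
    have : (k : ℝ) ≤ 3 * ((k / 2 : ℕ) : ℝ) := by exact_mod_cast this
    linarith

end APU

set_option maxHeartbeats 400000

namespace APU

open Finset

/-- annihilator size of one element -/
def kap1 {q : ℕ} [NeZero q] (v : ZMod q) : ℕ := (univ.filter fun t : ZMod q => t * v = 0).card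

lemma kap1_pos {q : ℕ} [NeZero q] (v : ZMod q) : 1 ≤ kap1 v := by
  rw [kap1, Nat.one_le_iff_ne_zero, ← Nat.pos_iff_ne_zero, card_pos]
  exact ⟨0, by simp⟩

lemma kap_le1 {q : ℕ} [NeZero q] (u : ZMod q × ZMod q) : kap u ≤ kap1 u.1 := by
  unfold kap kap1
  exact card_le_card fun t ht => by
    simp only [mem_filter, mem_univ, true_and] at ht ⊢; exact ht.1

lemma kap_le2 {q : ℕ} [NeZero q] (u : ZMod q × ZMod q) : kap u ≤ kap1 u.2 := by
  unfold kap kap1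
  exact card_le_card fun t ht => by
    simp only [mem_filter, mem_univ, true_and] at ht ⊢; exact ht.2

lemma kap1_le {q : ℕ} [NeZero q] (v : ZMod q) : kap1 v ≤ Nat.gcd v.val q := by
  have hq : 0 < q := Nat.pos_of_ne_zero (NeZero.ne q)
  set g := Nat.gcd v.val q with hg
  have hg0 : 0 < g := Nat.gcd_pos_of_pos_right _ hq
  obtain ⟨r, hr⟩ : g ∣ q := Nat.gcd_dvd_right _ _
  have hr0 : 0 < r := Nat.pos_of_mul_pos_left (hr ▸ hq)
  have key : ∀ t : ZMod q, t * v = 0 → r ∣ t.val := by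
    intro t ht
    have h1 : q ∣ t.val * v.val := by
      rw [← ZMod.natCast_eq_zero_iff]; simpa using ht
    obtain ⟨w, hw⟩ : g ∣ v.val := Nat.gcd_dvd_left _ _
    have hc : Nat.Coprime w r := by
      have := Nat.coprime_div_gcd_div_gcd (m := v.val) (n := q) hg0
      rw [← hg] at this
      rwa [Nat.div_eq_of_eq_mul_right hg0 hw, Nat.div_eq_of_eq_mul_right hg0 hr] at this
    rw [hw] at h1
    nth_rewrite 1 [hr] at h1
    have h2 : g * r ∣ g * (t.val * w) := by convert h1 using 1; ring
    exact hc.symm.dvd_of_dvd_mul_right (Nat.dvd_of_mul_dvd_mul_left hg0 h2)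
  unfold kap1
  rw [← card_range g]
  apply card_le_card_of_injOn (fun t => t.val / r)
  · intro t ht
    simp only [coe_filter, mem_univ, true_and, Set.mem_setOf_eq] at ht
    simp only [coe_range, Set.mem_Iio]
    rw [Nat.div_lt_iff_lt_mul hr0]
    rw [← hr]; exact ZMod.val_lt t
  · intro t ht t' ht' h
    simp only [coe_filter, mem_univ, true_and, Set.mem_setOf_eq] at ht ht'
    apply ZMod.val_injective
    have h1 := Nat.div_mul_cancel (key t ht)
    have h2 := Nat.div_mul_cancel (key t' ht')
    simp only at h
    rw [← h1, ← h2, h]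

lemma gcd_sum {q : ℕ} (hq : 0 < q) :
    ∑ v ∈ Icc 1 (q - 1), (Nat.gcd v q : ℝ) / v ≤ (q.divisors.card : ℝ) * (1 + Real.log q) := by
  have hH : ∀ N : ℕ, N ≤ q → ∑ v ∈ Icc 1 N, (1 : ℝ) / v ≤ 1 + Real.log q := by
    intro N hN
    have h1 := harmonic_le_one_add_log N
    have h2 : ((harmonic N : ℚ) : ℝ) = ∑ v ∈ Icc 1 N, (1 : ℝ) / v := by
      rw [harmonic_eq_sum_Icc]; push_cast; simp
    rw [← h2]
    rcases Nat.eq_zero_or_pos N with h | h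
    · subst h
      simp
      have : 0 ≤ Real.log q := Real.log_natCast_nonneg q
      linarith
    · refine h1.trans ?_
      gcongr
  calc ∑ v ∈ Icc 1 (q - 1), (Nat.gcd v q : ℝ) / v
      ≤ ∑ v ∈ Icc 1 (q - 1), ∑ g ∈ q.divisors, if g ∣ v then (g : ℝ) / v else 0 := by
        apply sum_le_sum
        intro v _
        have := single_le_sum (f := fun g => if g ∣ v then (g : ℝ) / v else 0) (s := q.divisors)
          (fun g _ => by split_ifs <;> positivity) (a := Nat.gcd v q)
          (Nat.mem_divisors.2 ⟨Nat.gcd_dvd_right _ _, hq.ne'⟩)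
        simpa [Nat.gcd_dvd_left] using this
    _ = ∑ g ∈ q.divisors, ∑ v ∈ Icc 1 (q - 1), if g ∣ v then (g : ℝ) / v else 0 := sum_comm
    _ ≤ ∑ g ∈ q.divisors, (1 + Real.log q) := by
        apply sum_le_sum
        intro g hg
        have hg0 : 0 < g := Nat.pos_of_mem_divisors hg
        refine le_trans ?_ (hH q le_rfl)
        rw [← sum_filter]
        have : ∑ v ∈ (Icc 1 (q - 1)).filter (g ∣ ·), (g : ℝ) / v = ∑ w ∈ ((Icc 1 (q - 1)).filter (g ∣ ·)).image (· / g), (1 : ℝ) / w := by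
          rw [sum_image]
          · apply sum_congr rfl
            intro v hv
            obtain ⟨w, rfl⟩ := (mem_filter.1 hv).2
            rw [Nat.mul_div_cancel_left _ hg0]
            push_cast
            have : (g : ℝ) ≠ 0 := by positivity
            by_cases hw : w = 0
            · simp [hw]
            · have : (w : ℝ) ≠ 0 := by exact_mod_cast hw
              field_simp
          · intro v hv v' hv' h
            have h1 := Nat.div_mul_cancel (mem_filter.1 hv).2
            have h2 := Nat.div_mul_cancel (mem_filter.1 hv').2
            simp only at h
            rw [← h1, ← h2, h]
        rw [this]
        apply sum_le_sum_of_subset_of_nonneg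
        · intro w hw
          simp only [mem_image, mem_filter, mem_Icc] at hw ⊢
          obtain ⟨v, ⟨⟨h1, h2⟩, w', rfl⟩, rfl⟩ := hw
          rw [Nat.mul_div_cancel_left _ hg0]
          constructor
          · exact Nat.pos_of_mul_pos_left (by omega : 0 < g * w')
          · calc w' ≤ g * w' := Nat.le_mul_of_pos_left _ hg0
              _ ≤ q := by omega
        · intros; positivity
    _ = _ := by rw [sum_const, nsmul_eq_mul]

/-- geometric sum -/
noncomputable def geo {q : ℕ} [NeZero q] (l : ℕ) (v : ZMod q) : ℂ := ∑ i ∈ range l, ZMod.stdAddChar (v * (i : ZMod q))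

lemma geo_le {q : ℕ} [NeZero q] (l : ℕ) (v : ZMod q) : ‖geo l v‖ ≤ l := by
  unfold geo
  refine (norm_sum_le _ _).trans ?_
  simp

lemma geo_bound {q : ℕ} [NeZero q] (l : ℕ) {v : ZMod q} (hv : v ≠ 0) :
    ‖geo l v‖ ≤ (q : ℝ) / (2 * v.val) + q / (2 * (q - v.val : ℕ)) := by
  have hq : 0 < q := Nat.pos_of_ne_zero (NeZero.ne q)
  have hlt := ZMod.val_lt v
  have hpos : 0 < v.val := Nat.pos_of_ne_zero ((ZMod.val_ne_zero v).2 hv)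
  have hqR : (0 : ℝ) < q := by exact_mod_cast hq
  have hvR : (0 : ℝ) < v.val := by exact_mod_cast hpos
  have hsub : ((q - v.val : ℕ) : ℝ) = q - v.val := by push_cast [hlt.le]; ring
  have hvlt : (v.val : ℝ) < q := by exact_mod_cast hlt
  have hz : ∀ i : ℕ, (ZMod.stdAddChar (v * (i : ZMod q)) : ℂ) = (ZMod.stdAddChar v) ^ i := by
    intro i
    rw [← AddChar.map_nsmul_eq_pow, nsmul_eq_mul, mul_comm]
  set z : ℂ := ZMod.stdAddChar v with hzdef
  have hzexp : z = Complex.exp (Complex.I * ((2 * Real.pi * (v.val / q) : ℝ) : ℂ)) := by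
    rw [hzdef, ZMod.stdAddChar_apply, ZMod.toCircle_apply]
    congr 1
    push_cast; ring
  have hnz : ‖z‖ = 1 := AddChar.norm_apply _ _
  have hsin : min ((v.val : ℝ) / q) (1 - v.val / q) * 4 ≤ ‖z - 1‖ := by
    rw [hzexp, Complex.norm_exp_I_mul_ofReal_sub_one]
    have : 2 * Real.pi * (v.val / q : ℝ) / 2 = Real.pi * (v.val / q) := by ring
    rw [this]
    set t : ℝ := (v.val : ℝ) / q with ht
    have ht0 : 0 < t := by positivity
    have ht1 : t < 1 := by rw [ht, div_lt_one hqR]; exact hvlt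
    have hpi := Real.pi_pos
    have hs : 2 * min t (1 - t) ≤ Real.sin (Real.pi * t) := by
      rcases le_total t (1/2) with h | h
      · have := Real.mul_le_sin (x := Real.pi * t) (by positivity) (by nlinarith)
        have e : 2 / Real.pi * (Real.pi * t) = 2 * t := by field_simp
        rw [e] at this
        exact le_trans (by gcongr; exact min_le_left _ _) this
      · have := Real.mul_le_sin (x := Real.pi * (1 - t)) (by apply mul_nonneg hpi.le; linarith) (by nlinarith)
        have e : 2 / Real.pi * (Real.pi * (1 - t)) = 2 * (1 - t) := by field_simp
        have e2 : Real.sin (Real.pi * (1 - t)) = Real.sin (Real.pi * t) := by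
          rw [show Real.pi * (1 - t) = Real.pi - Real.pi * t by ring, Real.sin_pi_sub]
        rw [e, e2] at this
        exact le_trans (by gcongr; exact min_le_right _ _) this
    rw [Real.norm_eq_abs]
    refine le_trans ?_ (le_abs_self _)
    linarith
  have hmin : 0 < min ((v.val : ℝ) / q) (1 - v.val / q) := by
    apply lt_min (by positivity)
    rw [sub_pos, div_lt_one hqR]; exact hvlt
  have hz1 : z ≠ 1 := by
    intro h
    rw [h, sub_self, norm_zero] at hsin
    linarith
  have hgeo : geo l v = (z ^ l - 1) / (z - 1) := by
    unfold geo
    rw [sum_congr rfl fun i _ => hz i, geom_sum_eq hz1]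
  rw [hgeo, norm_div]
  have hnum : ‖z ^ l - 1‖ ≤ 2 := by
    refine (norm_sub_le _ _).trans ?_
    rw [norm_pow, hnz]; norm_num
  have h0 : 0 < ‖z - 1‖ := norm_pos_iff.2 (sub_ne_zero.2 hz1)
  calc ‖z ^ l - 1‖ / ‖z - 1‖ ≤ 2 / (min ((v.val : ℝ) / q) (1 - v.val / q) * 4) := by gcongr
    _ ≤ _ := by
      rw [hsub]
      have hd : 0 < (q : ℝ) - v.val := by linarith
      rcases min_choice ((v.val : ℝ) / q) (1 - v.val / q) with h | h
      · rw [h]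
        have : 2 / ((v.val : ℝ) / q * 4) = q / (2 * v.val) := by field_simp; norm_num
        rw [this]
        have : 0 ≤ (q : ℝ) / (2 * (q - v.val)) := by positivity
        linarith
      · rw [h]
        have : 2 / ((1 - (v.val : ℝ) / q) * 4) = q / (2 * (q - v.val)) := by
          have : 1 - (v.val : ℝ) / q = (q - v.val) / q := by field_simp
          rw [this]; field_simp; norm_num
        rw [this]
        have : 0 ≤ (q : ℝ) / (2 * v.val) := by positivity
        linarith

/-- the factor `τ(q)(1+log q)` -/
noncomputable def Eq' (q : ℕ) : ℝ := (q.divisors.card : ℝ) * (1 + Real.log q)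

lemma Eq'_ge {q : ℕ} (hq : 0 < q) : 1 ≤ Eq' q := by
  unfold Eq'
  have h1 : (1 : ℝ) ≤ q.divisors.card := by
    exact_mod_cast card_pos.2 (Nat.nonempty_divisors.2 hq.ne')
  have h2 : 0 ≤ Real.log q := Real.log_natCast_nonneg q
  nlinarith

lemma geo_sum {q : ℕ} [NeZero q] (l : ℕ) :
    ∑ v ∈ univ.filter (fun v : ZMod q => v ≠ 0), (kap1 v : ℝ) * ‖geo l v‖ ≤ q * Eq' q := by
  have hq : 0 < q := Nat.pos_of_ne_zero (NeZero.ne q)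
  have h1 : ∑ v ∈ univ.filter (fun v : ZMod q => v ≠ 0), (kap1 v : ℝ) * ‖geo l v‖ ≤
      ∑ v ∈ univ.filter (fun v : ZMod q => v ≠ 0), (Nat.gcd v.val q : ℝ) * ((q : ℝ) / (2 * v.val) + q / (2 * (q - v.val : ℕ))) := by
    apply sum_le_sum
    intro v hv
    have := geo_bound l (mem_filter.1 hv).2
    have h2 : (kap1 v : ℝ) ≤ Nat.gcd v.val q := by exact_mod_cast kap1_le v
    gcongr
  refine h1.trans ?_
  have h2 : ∑ v ∈ univ.filter (fun v : ZMod q => v ≠ 0), (Nat.gcd v.val q : ℝ) * ((q : ℝ) / (2 * v.val) + q / (2 * (q - v.val : ℕ)))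
      = ∑ v ∈ Icc 1 (q - 1), (Nat.gcd v q : ℝ) * ((q : ℝ) / (2 * v) + q / (2 * (q - v : ℕ))) := by
    apply sum_bij (fun v _ => v.val)
    · intro v hv
      have := (ZMod.val_ne_zero v).2 (mem_filter.1 hv).2
      have := ZMod.val_lt v
      rw [mem_Icc]; omega
    · intro v _ v' _ h; exact ZMod.val_injective _ h
    · intro w hw
      rw [mem_Icc] at hw
      have hw' : ((w : ZMod q)).val = w := ZMod.val_natCast_of_lt (by omega)
      refine ⟨w, ?_, hw'⟩
      simp only [mem_filter, mem_univ, true_and]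
      intro h
      rw [h] at hw'; simp at hw'; omega
    · intro v hv; rfl
  rw [h2]
  have h3 : ∑ v ∈ Icc 1 (q - 1), (Nat.gcd v q : ℝ) * (q / (2 * (q - v : ℕ))) = ∑ v ∈ Icc 1 (q - 1), (Nat.gcd v q : ℝ) * (q / (2 * v)) := by
    apply sum_bij (fun v _ => q - v)
    · intro v hv; rw [mem_Icc] at hv ⊢; omega
    · intro v hv v' hv' h
      rw [mem_Icc] at hv hv'; omega
    · intro v hv
      rw [mem_Icc] at hv
      exact ⟨q - v, by rw [mem_Icc]; omega, by omega⟩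
    · intro v hv
      rw [mem_Icc] at hv
      have : Nat.gcd (q - v) q = Nat.gcd v q := by
        rw [Nat.gcd_comm, Nat.gcd_comm v]
        exact Nat.gcd_self_sub_right (by omega)
      rw [this]
  simp_rw [mul_add]
  rw [sum_add_distrib, h3, ← sum_add_distrib]
  have h4 : ∀ v ∈ Icc 1 (q - 1), (Nat.gcd v q : ℝ) * (q / (2 * v)) + (Nat.gcd v q : ℝ) * (q / (2 * v)) = q * ((Nat.gcd v q : ℝ) / v) := by
    intro v hv
    rw [mem_Icc] at hv
    have : (v : ℝ) ≠ 0 := by have : v ≠ 0 := by omega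
                             exact_mod_cast this
    field_simp; ring
  rw [sum_congr rfl h4, ← mul_sum]
  unfold Eq'
  have := gcd_sum hq
  gcongr

lemma kap1_unit {q : ℕ} [NeZero q] {l : ZMod q} (hl : IsUnit l) (v : ZMod q) : kap1 (l * v) = kap1 v := by
  unfold kap1
  congr 1
  ext t
  simp only [mem_filter, mem_univ, true_and]
  obtain ⟨u, rfl⟩ := hl
  rw [mul_left_comm, Units.mul_right_eq_zero]

lemma geo_sum' {q : ℕ} [NeZero q] (l : ℕ) {c : ZMod q} (hc : IsUnit c) :
    ∑ v ∈ univ.filter (fun v : ZMod q => v ≠ 0), (kap1 v : ℝ) * ‖geo l (c * v)‖ ≤ q * Eq' q := by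
  refine le_trans (le_of_eq ?_) (geo_sum (q := q) l)
  obtain ⟨u, rfl⟩ := hc
  apply sum_bij (fun v _ => (u : ZMod q) * v)
  · intro v hv
    simp only [mem_filter, mem_univ, true_and] at hv ⊢
    simpa using hv
  · intro v _ v' _ h
    exact (Units.mul_right_inj u).1 h
  · intro v hv
    simp only [mem_filter, mem_univ, true_and] at hv
    exact ⟨(↑u⁻¹ : ZMod q) * v, by simpa using hv, by simp⟩
  · intro v hv
    rw [kap1_unit u.isUnit]

lemma conic_indicator {q : ℕ} [NeZero q] (a b m : ZMod q) (z : ZMod q × ZMod q) :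
    ∑ u : ZMod q × ZMod q, expS a b m ZMod.stdAddChar u * (ZMod.stdAddChar (-(u.1 * z.1)) * ZMod.stdAddChar (-(u.2 * z.2)))
      = if z ∈ conic a b m then (q : ℂ) ^ 2 else 0 := by
  have hprim := ZMod.isPrimitive_stdAddChar q
  unfold expS
  have h1 : ∀ u : ZMod q × ZMod q, (∑ w ∈ conic a b m, (ZMod.stdAddChar (u.1 * w.1 + u.2 * w.2) : ℂ)) * (ZMod.stdAddChar (-(u.1 * z.1)) * ZMod.stdAddChar (-(u.2 * z.2)))
      = ∑ w ∈ conic a b m, (ZMod.stdAddChar (u.1 * (w.1 - z.1)) : ℂ) * ZMod.stdAddChar (u.2 * (w.2 - z.2)) := by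
    intro u
    rw [sum_mul]
    refine sum_congr rfl fun w _ => ?_
    rw [← AddChar.map_add_eq_mul, ← AddChar.map_add_eq_mul, ← AddChar.map_add_eq_mul]
    congr 1; ring
  simp_rw [h1]
  rw [sum_comm]
  have h2 : ∀ w : ZMod q × ZMod q, ∑ u : ZMod q × ZMod q, (ZMod.stdAddChar (u.1 * (w.1 - z.1)) : ℂ) * ZMod.stdAddChar (u.2 * (w.2 - z.2))
      = if w = z then (q : ℂ) ^ 2 else 0 := by
    intro w
    rw [← univ_product_univ, sum_product, ← sum_mul_sum univ univ (fun x => (ZMod.stdAddChar (x * (w.1 - z.1)) : ℂ)) (fun x => (ZMod.stdAddChar (x * (w.2 - z.2)) : ℂ)), AddChar.sum_mulShift _ hprim, AddChar.sum_mulShift _ hprim, ZMod.card]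
    simp only [sub_eq_zero, Prod.ext_iff]
    split_ifs with h1 h2 h3 h3 h4 <;> first | tauto | simp [pow_two]
  simp_rw [h2]
  rw [sum_ite_eq']

theorem box {q : ℕ} [NeZero q] (hodd : Odd q) {a b m c : ℤ} (ha : IsUnit (a : ZMod q)) (hb : IsUnit (b : ZMod q))
    (hm : IsUnit (m : ZMod q)) (hc : IsUnit (c : ZMod q)) (x0 y0 : ℤ) (l1 l2 : ℕ) :
    |(((range l1 ×ˢ range l2).filter fun z => (q : ℤ) ∣ a * (x0 + c * z.1) ^ 2 + b * (y0 + c * z.2) ^ 2 - m).card : ℝ)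
      - (l1 : ℝ) * l2 * NN a b m q / q ^ 2| ≤ Wt q * Eq' q ^ 2 * (1 + ((l1 : ℝ) + l2) / q) := by
  have hq : 0 < q := Nat.pos_of_ne_zero (NeZero.ne q)
  have hqR : (0 : ℝ) < q := by exact_mod_cast hq
  set cnt := ((range l1 ×ˢ range l2).filter fun z => (q : ℤ) ∣ a * (x0 + c * z.1) ^ 2 + b * (y0 + c * z.2) ^ 2 - m).card with hcnt
  have hprim := ZMod.isPrimitive_stdAddChar q
  -- indicator
  have hmem : ∀ i j : ℕ, (((x0 + c * i : ℤ) : ZMod q), ((y0 + c * j : ℤ) : ZMod q)) ∈ conic (a : ZMod q) b m ↔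
      (q : ℤ) ∣ a * (x0 + c * i) ^ 2 + b * (y0 + c * j) ^ 2 - m := by
    intro i j
    simp only [conic, mem_filter, mem_univ, true_and]
    rw [← ZMod.intCast_zmod_eq_zero_iff_dvd]
    push_cast
    rw [sub_eq_zero]
  have hcnt2 : (cnt : ℂ) * q ^ 2 = ∑ u : ZMod q × ZMod q, expS (a : ZMod q) b m ZMod.stdAddChar u *
      ((ZMod.stdAddChar (-(u.1 * (x0 : ZMod q))) * geo l1 (-(c : ZMod q) * u.1)) * (ZMod.stdAddChar (-(u.2 * (y0 : ZMod q))) * geo l2 (-(c : ZMod q) * u.2))) := by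
    have e1 : (cnt : ℂ) * q ^ 2 = ∑ z ∈ range l1 ×ˢ range l2, if (((x0 + c * z.1 : ℤ) : ZMod q), ((y0 + c * z.2 : ℤ) : ZMod q)) ∈ conic (a : ZMod q) b m then (q : ℂ) ^ 2 else 0 := by
      simp_rw [hmem]
      rw [← sum_filter, sum_const, nsmul_eq_mul]
    rw [e1]
    simp_rw [← conic_indicator]
    rw [sum_comm]
    refine sum_congr rfl fun u _ => ?_
    rw [← mul_sum, sum_product]
    congr 1
    unfold geo
    rw [mul_sum, mul_sum, sum_mul_sum]
    refine sum_congr rfl fun i _ => sum_congr rfl fun j _ => ?_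
    simp only [← AddChar.map_add_eq_mul]
    congr 1; push_cast; ring
  rw [← add_sum_erase univ _ (mem_univ (0 : ZMod q × ZMod q))] at hcnt2
  have h0 : expS (a : ZMod q) b m ZMod.stdAddChar 0 = (NN a b m q : ℂ) := by
    simp [expS, NN]
  have hg0 : ∀ l, geo l (0 : ZMod q) = l := by intro l; simp [geo]
  rw [h0] at hcnt2
  simp only [Prod.fst_zero, Prod.snd_zero, zero_mul, mul_zero, neg_zero, AddChar.map_zero_eq_one, one_mul, hg0] at hcnt2
  set S := ∑ u ∈ univ.erase (0 : ZMod q × ZMod q), expS (a : ZMod q) b m ZMod.stdAddChar u *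
      ((ZMod.stdAddChar (-(u.1 * (x0 : ZMod q))) * geo l1 (-(c : ZMod q) * u.1)) * (ZMod.stdAddChar (-(u.2 * (y0 : ZMod q))) * geo l2 (-(c : ZMod q) * u.2))) with hS
  have hsb := SB_all q hodd a b m ha hb hm ZMod.stdAddChar hprim
  let h : ℕ → ZMod q → ℝ := fun l v => if v = 0 then (l : ℝ) else kap1 v * ‖geo l (-(c : ZMod q) * v)‖
  have hh0 : ∀ l v, 0 ≤ h l v := by
    intro l v; simp only [h]; split_ifs <;> positivity
  have hhs : ∀ l, ∑ v, h l v = l + ∑ v ∈ univ.filter (fun v : ZMod q => v ≠ 0), (kap1 v : ℝ) * ‖geo l (-(c : ZMod q) * v)‖ := by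
    intro l
    rw [← add_sum_erase univ _ (mem_univ (0 : ZMod q))]
    congr 1
    · simp [h]
    · rw [filter_ne']
      refine sum_congr rfl fun v hv => ?_
      simp only [h]
      rw [if_neg (mem_erase.1 hv).1]
  have hT : ∀ l, ∑ v ∈ univ.filter (fun v : ZMod q => v ≠ 0), (kap1 v : ℝ) * ‖geo l (-(c : ZMod q) * v)‖ ≤ q * Eq' q :=
    fun l => geo_sum' l hc.neg
  set T1 := ∑ v ∈ univ.filter (fun v : ZMod q => v ≠ 0), (kap1 v : ℝ) * ‖geo l1 (-(c : ZMod q) * v)‖ with hT1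
  set T2 := ∑ v ∈ univ.filter (fun v : ZMod q => v ≠ 0), (kap1 v : ℝ) * ‖geo l2 (-(c : ZMod q) * v)‖ with hT2
  have hT10 : 0 ≤ T1 := sum_nonneg fun _ _ => by positivity
  have hT20 : 0 ≤ T2 := sum_nonneg fun _ _ => by positivity
  have hSb : ‖S‖ ≤ Wt q * ((l1 + T1) * (l2 + T2) - l1 * l2) := by
    have e : (l1 + T1) * (l2 + T2) - l1 * l2 = ∑ u ∈ univ.erase (0 : ZMod q × ZMod q), h l1 u.1 * h l2 u.2 := by
      rw [← hhs l1, ← hhs l2, sum_mul_sum, ← sum_product', univ_product_univ, ← add_sum_erase univ _ (mem_univ (0 : ZMod q × ZMod q))]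
      simp [h]
    rw [e, mul_sum]
    refine (norm_sum_le _ _).trans (sum_le_sum fun u hu => ?_)
    have hu0 : u ≠ 0 := (mem_erase.1 hu).1
    rw [norm_mul, norm_mul, norm_mul, norm_mul, AddChar.norm_apply, AddChar.norm_apply, one_mul, one_mul]
    calc _ ≤ (Wt q * kap u) * (‖geo l1 (-(c : ZMod q) * u.1)‖ * ‖geo l2 (-(c : ZMod q) * u.2)‖) := by gcongr; exact hsb u
      _ = Wt q * (kap u * (‖geo l1 (-(c : ZMod q) * u.1)‖ * ‖geo l2 (-(c : ZMod q) * u.2)‖)) := by ring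
      _ ≤ _ := by
        apply mul_le_mul_of_nonneg_left _ (Wt_nonneg q)
        have k1 : (kap u : ℝ) ≤ kap1 u.1 := by exact_mod_cast kap_le1 u
        have k2 : (kap u : ℝ) ≤ kap1 u.2 := by exact_mod_cast kap_le2 u
        have k3 : (1 : ℝ) ≤ kap1 u.2 := by exact_mod_cast kap1_pos u.2
        simp only [h]
        by_cases c1 : u.1 = 0
        · have c2 : u.2 ≠ 0 := fun h => hu0 (Prod.ext c1 h)
          rw [if_pos c1, if_neg c2]
          calc _ = ‖geo l1 (-(c : ZMod q) * u.1)‖ * (kap u * ‖geo l2 (-(c : ZMod q) * u.2)‖) := by ring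
            _ ≤ _ := by
              gcongr; exact geo_le _ _
        · rw [if_neg c1]
          by_cases c2 : u.2 = 0
          · rw [if_pos c2]
            calc _ = (kap u * ‖geo l1 (-(c : ZMod q) * u.1)‖) * ‖geo l2 (-(c : ZMod q) * u.2)‖ := by ring
              _ ≤ _ := by
                gcongr; exact geo_le _ _
          · rw [if_neg c2]
            calc _ ≤ (kap1 u.1 * kap1 u.2) * (‖geo l1 (-(c : ZMod q) * u.1)‖ * ‖geo l2 (-(c : ZMod q) * u.2)‖) := by
                  gcongr; nlinarith
              _ = _ := by ring
  have hSE : (l1 + T1) * (l2 + T2) - l1 * l2 ≤ q ^ 2 * (Eq' q ^ 2 * (1 + ((l1 : ℝ) + l2) / q)) := by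
    have hE := Eq'_ge hq
    have a1 : (l1 : ℝ) * T2 ≤ l1 * (q * Eq' q) := by gcongr; exact hT l2
    have a2 : (l2 : ℝ) * T1 ≤ l2 * (q * Eq' q) := by gcongr; exact hT l1
    have a3 : T1 * T2 ≤ (q * Eq' q) * (q * Eq' q) := mul_le_mul (hT l1) (hT l2) hT20 (by positivity)
    have a4 : (q : ℝ) ^ 2 * (Eq' q ^ 2 * (1 + ((l1 : ℝ) + l2) / q)) = (q * Eq' q) * (q * Eq' q) + (l1 + l2) * q * Eq' q ^ 2 := by
      field_simp
    have a5 : ((l1 : ℝ) + l2) * q * Eq' q ≤ (l1 + l2) * q * Eq' q ^ 2 := by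
      apply mul_le_mul_of_nonneg_left _ (by positivity)
      nlinarith
    rw [a4]; nlinarith
  have hfin : ((cnt : ℝ) - (l1 : ℝ) * l2 * NN a b m q / q ^ 2 : ℝ) = (S / q ^ 2 : ℂ) := by
    have : S = cnt * q ^ 2 - NN a b m q * (l1 * l2) := by rw [hcnt2]; ring
    rw [this]
    have : (q : ℂ) ≠ 0 := by exact_mod_cast hq.ne'
    push_cast
    field_simp
  rw [← Real.norm_eq_abs, ← Complex.norm_real, hfin, norm_div, norm_pow, Complex.norm_natCast, div_le_iff₀ (by positivity)]
  refine hSb.trans ?_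
  calc _ ≤ Wt q * (q ^ 2 * (Eq' q ^ 2 * (1 + ((l1 : ℝ) + l2) / q))) := mul_le_mul_of_nonneg_left hSE (Wt_nonneg q)
    _ = _ := by ring

end APU

set_option maxHeartbeats 400000

namespace APU

open Finset ArithmeticFunction
open scoped ArithmeticFunction.Moebius

lemma hyper {β : Type*} [AddCommMonoid β] (Y : ℕ) (F : ℕ → ℕ → β) :
    ∑ δ ∈ Icc 1 Y, ∑ e ∈ δ.divisors, F e (δ / e) = ∑ e ∈ Icc 1 Y, ∑ f ∈ Icc 1 (Y / e), F e f := by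
  rw [sum_sigma', sum_sigma']
  refine sum_bij' (fun x _ => ⟨x.2, x.1 / x.2⟩) (fun x _ => ⟨x.1 * x.2, x.1⟩) ?_ ?_ ?_ ?_ ?_
  · rintro ⟨δ, e⟩ h
    simp only [mem_sigma, mem_Icc, Nat.mem_divisors] at h ⊢
    obtain ⟨⟨h1, h2⟩, h3, h4⟩ := h
    have he : 0 < e := Nat.pos_of_dvd_of_pos h3 h1
    have := Nat.le_of_dvd h1 h3
    refine ⟨⟨he, by omega⟩, Nat.div_pos this he, Nat.div_le_div_right h2⟩
  · rintro ⟨e, f⟩ h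
    simp only [mem_sigma, mem_Icc, Nat.mem_divisors] at h ⊢
    obtain ⟨⟨h1, h2⟩, h3, h4⟩ := h
    have := (Nat.le_div_iff_mul_le h1).1 h4
    refine ⟨⟨Nat.mul_pos h1 h3, by rwa [mul_comm]⟩, dvd_mul_right _ _, (Nat.mul_pos h1 h3).ne'⟩
  · rintro ⟨δ, e⟩ h
    simp only [mem_sigma, mem_Icc, Nat.mem_divisors] at h
    simp only [Sigma.mk.injEq, heq_eq_eq, and_true]
    exact Nat.mul_div_cancel' h.2.1
  · rintro ⟨e, f⟩ h
    simp only [mem_sigma, mem_Icc] at h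
    simp only [Sigma.mk.injEq, heq_eq_eq, true_and]
    exact Nat.mul_div_cancel_left _ h.1.1
  · intros; rfl

lemma divisors_sqfree {n : ℕ} (hn : n ≠ 0) :
    n.divisors.filter Squarefree = (∏ p ∈ n.primeFactors, p).divisors := by
  have hne : (∏ p ∈ n.primeFactors, p) ≠ 0 := prod_ne_zero_iff.2 fun p hp => (Nat.prime_of_mem_primeFactors hp).ne_zero
  ext e
  simp only [mem_filter, Nat.mem_divisors]
  constructor
  · rintro ⟨⟨h1, h2⟩, h3⟩
    refine ⟨?_, hne⟩
    rw [← Nat.prod_primeFactors_of_squarefree h3]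
    exact prod_dvd_prod_of_subset _ _ _ (Nat.primeFactors_mono h1 hn)
  · rintro ⟨h1, h2⟩
    refine ⟨⟨h1.trans (Nat.prod_primeFactors_dvd n), hn⟩, ?_⟩
    refine Squarefree.squarefree_of_dvd h1 ?_
    rw [← Nat.radical_eq_prod_primeFactors]
    exact UniqueFactorizationMonoid.squarefree_radical

lemma rad_primeFactors {n : ℕ} : (∏ p ∈ n.primeFactors, p).primeFactors = n.primeFactors :=
  Nat.primeFactors_prod fun p hp => Nat.prime_of_mem_primeFactors hp

lemma rad_squarefree {n : ℕ} : Squarefree (∏ p ∈ n.primeFactors, p) := by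
  rw [← Nat.radical_eq_prod_primeFactors]
  exact UniqueFactorizationMonoid.squarefree_radical

/-- squarefree-supported product -/
noncomputable def sqf (h : ℕ → ℝ) (e : ℕ) : ℝ := if Squarefree e then ∏ p ∈ e.primeFactors, h p else 0

lemma sum_sqf (h : ℕ → ℝ) {n : ℕ} (hn : n ≠ 0) :
    ∑ e ∈ n.divisors, sqf h e = ∏ p ∈ n.primeFactors, (1 + h p) := by
  unfold sqf
  rw [← sum_filter, divisors_sqfree hn]
  have h1 := (IsMultiplicative.prodPrimeFactors h).prodPrimeFactors_one_add_of_squarefree (rad_squarefree (n := n))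
  rw [rad_primeFactors] at h1
  have h2 : ∏ p ∈ n.primeFactors, (1 + h p) = ∏ p ∈ n.primeFactors, (1 + prodPrimeFactors h p) := by
    refine prod_congr rfl fun p hp => ?_
    have := Nat.prime_of_mem_primeFactors hp
    rw [prodPrimeFactors_apply this.ne_zero, this.primeFactors, prod_singleton]
  rw [h2, h1]
  refine sum_congr rfl fun e he => ?_
  rw [prodPrimeFactors_apply (Nat.pos_of_mem_divisors he).ne']

lemma sum_mu_mul (f : ArithmeticFunction ℝ) (hf : f.IsMultiplicative) {n : ℕ} (hn : n ≠ 0) :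
    ∑ d ∈ n.divisors, (μ d : ℝ) * f d = ∏ p ∈ n.primeFactors, (1 - f p) := by
  have h1 := hf.prodPrimeFactors_one_sub_of_squarefree f (rad_squarefree (n := n))
  rw [rad_primeFactors] at h1
  rw [h1, ← divisors_sqfree hn]
  symm
  apply sum_subset (filter_subset _ _)
  intro d hd hd'
  have : ¬ Squarefree d := fun h => hd' (mem_filter.2 ⟨hd, h⟩)
  rw [moebius_eq_zero_of_not_squarefree this]; simp

lemma sum_mu_gcd {n f : ℕ} (hn : n ≠ 0) :
    ∑ d ∈ n.divisors, (if d ∣ f then (μ d : ℝ) else 0) = if f.Coprime n then 1 else 0 := by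
  rw [← sum_filter]
  have h1 : n.divisors.filter (· ∣ f) = (Nat.gcd f n).divisors := by
    ext d
    simp only [mem_filter, Nat.mem_divisors, Nat.dvd_gcd_iff]
    have : f.gcd n ≠ 0 := fun h => hn (Nat.gcd_eq_zero_iff.1 h).2
    tauto
  rw [h1]
  have h2 := congrArg (fun g : ArithmeticFunction ℤ => g (Nat.gcd f n)) moebius_mul_coe_zeta
  rw [coe_mul_zeta_apply, one_apply] at h2
  have h3 : ((∑ d ∈ (Nat.gcd f n).divisors, μ d : ℤ) : ℝ) = ((if Nat.gcd f n = 1 then 1 else 0 : ℤ) : ℝ) := by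
    rw [h2]
  push_cast at h3
  rw [h3]

lemma two_pow_le_tau {n : ℕ} (hn : n ≠ 0) : 2 ^ n.primeFactors.card ≤ n.divisors.card := by
  rw [Nat.card_divisors hn, ← prod_const]
  apply prod_le_prod'
  intro p hp
  have := (Nat.prime_of_mem_primeFactors hp).factorization_pos_of_dvd hn (Nat.dvd_of_mem_primeFactors hp)
  omega

/-- total version of `NN` -/
def nn (a b m : ℤ) (q : ℕ) : ℕ := if h : q = 0 then 0 else have : NeZero q := ⟨h⟩; NN a b m q

lemma nn_eq (a b m : ℤ) (q : ℕ) [h : NeZero q] : nn a b m q = NN a b m q := by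
  unfold nn
  rw [dif_neg h.out]

lemma nn_one (a b m : ℤ) : nn a b m 1 = 1 := by
  rw [nn_eq]
  unfold NN conic
  rw [filter_true_of_mem]
  · simp
  · intro x _; exact Subsingleton.elim _ _

lemma nn_mul (a b m : ℤ) {q r : ℕ} (hq : q ≠ 0) (hr : r ≠ 0) (h : q.Coprime r) : nn a b m (q * r) = nn a b m q * nn a b m r := by
  have : NeZero q := ⟨hq⟩
  have : NeZero r := ⟨hr⟩
  have : NeZero (q * r) := ⟨mul_ne_zero hq hr⟩
  rw [nn_eq, nn_eq, nn_eq, NN_mul a b m h]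

/-- the arithmetic conditions for `δ` -/
def okd (a b m : ℤ) (δ : ℕ) : Prop := ∀ p : ℕ, p.Prime → p ∣ δ → p ≠ 2 ∧ ¬ (p : ℤ) ∣ a ∧ ¬ (p : ℤ) ∣ b ∧ ¬ (p : ℤ) ∣ m

lemma nn_div (a b m : ℤ) (δ : ℕ) (hδ : δ ≠ 0) (hok : okd a b m δ) :
    (nn a b m δ : ℝ) / δ = ∏ p ∈ δ.primeFactors, (nn a b m p : ℝ) / p := by
  induction δ using Nat.recOnPosPrimePosCoprime with
  | zero => exact absurd rfl hδ
  | one => simp [nn_one]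
  | prime_pow p n hp hn =>
    obtain ⟨j, rfl⟩ : ∃ j, n = j + 1 := ⟨n - 1, by omega⟩
    obtain ⟨h2, ha, hb, hm⟩ := hok p hp (dvd_pow_self _ (by omega))
    have : NeZero p := ⟨hp.ne_zero⟩
    have : NeZero (p ^ (j + 1)) := ⟨hδ⟩
    rw [Nat.primeFactors_prime_pow (by omega) hp, prod_singleton, nn_eq, nn_eq, NN_prime_pow hp h2 ha hb hm]
    have : (p : ℝ) ≠ 0 := by exact_mod_cast hp.ne_zero
    push_cast
    field_simp
    ring
  | coprime x y hx hy hxy ihx ihy =>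
    have hx0 : x ≠ 0 := by omega
    have hy0 : y ≠ 0 := by omega
    rw [hxy.primeFactors_mul, prod_union hxy.disjoint_primeFactors, ← ihx hx0 fun p hp h => hok p hp (h.mul_right _),
      ← ihy hy0 fun p hp h => hok p hp (h.mul_left _), nn_mul a b m hx0 hy0 hxy]
    push_cast
    exact mul_div_mul_comm _ _ _ _

/-- correction terms -/
noncomputable def eta (a b m : ℤ) (e : ℕ) : ℝ := sqf (fun p => (nn a b m p : ℝ) / p - 1) e

lemma nn_div_eq (a b m : ℤ) {δ : ℕ} (hδ : δ ≠ 0) (hok : okd a b m δ) :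
    (nn a b m δ : ℝ) / δ = ∑ e ∈ δ.divisors, eta a b m e := by
  unfold eta
  rw [sum_sqf _ hδ, nn_div a b m δ hδ hok]
  exact prod_congr rfl fun p _ => by ring

lemma eta_one (a b m : ℤ) : eta a b m 1 = 1 := by simp [eta, sqf]

lemma eta_abs (a b m : ℤ) {e : ℕ} (hok : okd a b m e) : |eta a b m e| ≤ 1 / e := by
  unfold eta sqf
  split_ifs with h
  · rw [abs_prod]
    conv_rhs => rw [← Nat.prod_primeFactors_of_squarefree h]
    push_cast
    rw [one_div, ← prod_inv_distrib]
    apply prod_le_prod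
    · intros; positivity
    intro p hp
    have hpp := Nat.prime_of_mem_primeFactors hp
    have : NeZero p := ⟨hpp.ne_zero⟩
    obtain ⟨h2, ha, hb, hm⟩ := hok p hpp (Nat.dvd_of_mem_primeFactors hp)
    have h1 := NN_prime hpp h2 ha hb hm
    have h1' : |(NN a b m p : ℝ) - p| ≤ 1 := by exact_mod_cast h1
    have hp0 : (0 : ℝ) < p := by exact_mod_cast hpp.pos
    rw [nn_eq]
    have : (NN a b m p : ℝ) / p - 1 = ((NN a b m p : ℝ) - p) / p := by field_simp
    rw [this, abs_div, abs_of_pos hp0, inv_eq_one_div]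
    gcongr
  · simp

lemma nn_div_le (a b m : ℤ) {δ : ℕ} (hδ : δ ≠ 0) (hok : okd a b m δ) : (nn a b m δ : ℝ) / δ ≤ δ.divisors.card := by
  rw [nn_div_eq a b m hδ hok, ← nsmul_one, ← sum_const]
  apply sum_le_sum
  intro e he
  have h1 := eta_abs a b m (e := e) fun p hp h => hok p hp (h.trans (Nat.dvd_of_mem_divisors he))
  have h2 : (1 : ℝ) ≤ e := by exact_mod_cast Nat.pos_of_mem_divisors he
  have h3 : (1 : ℝ) / e ≤ 1 := by rw [div_le_one (by linarith)]; exact h2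
  exact (le_abs_self _).trans (h1.trans h3)

lemma chi_one_n {s0 D : ℕ} (h2 : 2 ∣ s0) {e : ℕ} (he : 2 ≤ e) (h : chi s0 D e ≠ 0) : 3 ≤ e := by
  have : e.Coprime s0 := by by_contra h'; exact h (chi_eq_zero h')
  have := coprime_odd h2 this
  obtain ⟨k, hk⟩ := this
  omega

lemma chi_real_abs (s0 D n : ℕ) : |(chi s0 D n : ℝ)| ≤ 1 := by exact_mod_cast chi_abs_le s0 D n

lemma inv_sq_sum (Y : ℕ) : ∑ e ∈ Icc 3 Y, (1 : ℝ) / e ^ 2 ≤ 1 / 2 := by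
  have : ∀ Y : ℕ, 2 ≤ Y → ∑ e ∈ Icc 3 Y, (1 : ℝ) / e ^ 2 ≤ 1 / 2 - 1 / Y := by
    intro Y hY
    induction Y, hY using Nat.le_induction with
    | base => norm_num
    | succ n hn ih =>
      rw [sum_Icc_succ_top (by omega)]
      have hn' : (2 : ℝ) ≤ n := by exact_mod_cast hn
      have : (1 : ℝ) / ((n + 1 : ℕ) : ℝ) ^ 2 ≤ 1 / n - 1 / ((n + 1 : ℕ) : ℝ) := by
        push_cast
        rw [div_sub_div _ _ (by linarith) (by linarith), div_le_div_iff₀ (by positivity) (by positivity)]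
        nlinarith
      linarith
  rcases le_or_gt 2 Y with h | h
  · refine (this Y h).trans ?_
    have : (0 : ℝ) ≤ 1 / Y := by positivity
    linarith
  · rw [Icc_eq_empty (by omega)]; norm_num

theorem W_bound {s0 D : ℕ} (hs : 0 < s0) (hD : 2 * D ∣ s0) : ∃ c C : ℝ, 0 < c ∧ 0 < C ∧ ∀ (a b m : ℤ) (n Y : ℕ), n ≠ 0 → 1 ≤ Y →
    (∀ p : ℕ, p.Prime → ¬ p ∣ s0 → ¬ p ∣ n → ¬ (p : ℤ) ∣ a ∧ ¬ (p : ℤ) ∣ b ∧ ¬ (p : ℤ) ∣ m) →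
    c / n.divisors.card - C * n.divisors.card * (1 + Real.log Y) / Y ≤
      |∑ δ ∈ (Icc 1 Y).filter (fun δ => δ.Coprime n), (chi s0 D δ : ℝ) * nn a b m δ / δ ^ 2| := by
  obtain ⟨L, C, hL, hC, hLC⟩ := chi_partial hs hD
  have h2 : 2 ∣ s0 := (Dvd.intro _ rfl).trans hD
  refine ⟨|L| / 2, C, by positivity, hC, ?_⟩
  intro a b m n Y hn hY hp
  set c : ℕ → ℝ := fun k => if k.Coprime n then (chi s0 D k : ℝ) else 0 with hc
  have hcmul : ∀ x y, c (x * y) = c x * c y := by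
    intro x y
    simp only [hc]
    by_cases hx : x.Coprime n
    · by_cases hy : y.Coprime n
      · rw [if_pos hx, if_pos hy, if_pos (Nat.Coprime.mul_left hx hy), chi_mul h2]; push_cast; rfl
      · rw [if_neg hy, if_neg (fun h => hy (Nat.Coprime.coprime_mul_left h)), mul_zero]
    · rw [if_neg hx, if_neg (fun h => hx (Nat.Coprime.coprime_mul_right h)), zero_mul]
  have hcabs : ∀ k, |c k| ≤ 1 := by
    intro k; simp only [hc]
    split_ifs
    · exact chi_real_abs _ _ _
    · simp
  have hcok : ∀ k, c k ≠ 0 → okd a b m k := by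
    intro k hk p hpp hpk
    have h1 : k.Coprime n := by by_contra h; exact hk (by simp only [hc]; rw [if_neg h])
    have h3 : k.Coprime s0 := by
      by_contra h; apply hk; simp only [hc]; rw [if_pos h1, chi_eq_zero h]; simp
    have h4 : ¬ p ∣ s0 := fun h => Nat.not_coprime_of_dvd_of_dvd hpp.one_lt hpk h h3
    have h5 : ¬ p ∣ n := fun h => Nat.not_coprime_of_dvd_of_dvd hpp.one_lt hpk h h1
    exact ⟨fun h => h4 (h ▸ h2), hp p hpp h4 h5⟩
  have hYR : (1 : ℝ) ≤ Y := by exact_mod_cast hY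
  set P : ℝ := ∏ p ∈ n.primeFactors, (1 - (chi s0 D p : ℝ) / p) with hP
  have hPlow : 1 / (n.divisors.card : ℝ) ≤ P := by
    have h1 : ((1 : ℝ) / 2) ^ n.primeFactors.card ≤ P := by
      rw [← prod_const]
      apply prod_le_prod
      · intros; norm_num
      intro p hp
      have h3 : (2 : ℝ) ≤ p := by exact_mod_cast (Nat.prime_of_mem_primeFactors hp).two_le
      have h4 := (abs_le.1 (chi_real_abs s0 D p)).2
      have : (chi s0 D p : ℝ) / p ≤ 1 / 2 := by
        rw [div_le_div_iff₀ (by linarith) (by norm_num)]; linarith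
      linarith
    refine le_trans ?_ h1
    rw [one_div_pow]
    apply one_div_le_one_div_of_le (by positivity)
    exact_mod_cast two_pow_le_tau hn
  -- inner sum
  have hinner : ∀ e ∈ Icc 1 Y, |∑ f ∈ Icc 1 (Y / e), c f / f - L * P| ≤ C * n.divisors.card * (e / Y) := by
    intro e he
    rw [mem_Icc] at he
    have he0 : 0 < e := he.1
    set X := Y / e with hX
    have e1 : ∑ f ∈ Icc 1 X, c f / f = ∑ t ∈ n.divisors, (μ t : ℝ) * ((chi s0 D t : ℝ) / t) * ∑ g ∈ Icc 1 (X / t), (chi s0 D g : ℝ) / g := by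
      calc ∑ f ∈ Icc 1 X, c f / f = ∑ f ∈ Icc 1 X, ∑ t ∈ n.divisors, (if t ∣ f then (μ t : ℝ) else 0) * ((chi s0 D f : ℝ) / f) := by
            refine sum_congr rfl fun f _ => ?_
            rw [← sum_mul, sum_mu_gcd hn]
            simp only [hc]; split_ifs <;> simp
        _ = ∑ t ∈ n.divisors, ∑ f ∈ Icc 1 X, (if t ∣ f then (μ t : ℝ) else 0) * ((chi s0 D f : ℝ) / f) := sum_comm
        _ = _ := by
            refine sum_congr rfl fun t ht => ?_
            have ht0 : 0 < t := Nat.pos_of_mem_divisors ht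
            simp_rw [ite_mul, zero_mul]
            rw [← sum_filter, mul_sum]
            symm
            apply sum_bij (fun g _ => t * g)
            · intro g hg
              rw [mem_Icc] at hg
              simp only [mem_filter, mem_Icc, dvd_mul_right, and_true]
              exact ⟨Nat.mul_pos ht0 hg.1, by rw [mul_comm]; exact (Nat.le_div_iff_mul_le ht0).1 hg.2⟩
            · intro g _ g' _ h; exact Nat.eq_of_mul_eq_mul_left ht0 h
            · intro f hf
              simp only [mem_filter, mem_Icc] at hf
              obtain ⟨⟨h3, h4⟩, g, rfl⟩ := hf
              refine ⟨g, ?_, rfl⟩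
              rw [mem_Icc]
              exact ⟨Nat.pos_of_mul_pos_left h3, by rw [Nat.le_div_iff_mul_le ht0, mul_comm]; exact h4⟩
            · intro g hg
              rw [chi_mul h2]
              push_cast
              rw [mul_div_mul_comm]; ring
    have e2 : P = ∑ t ∈ n.divisors, (μ t : ℝ) * ((chi s0 D t : ℝ) / t) := by
      let f : ArithmeticFunction ℝ := ⟨fun t => (chi s0 D t : ℝ) / t, by simp⟩
      have hf : f.IsMultiplicative := by
        refine ⟨by simp [f, chi_one], ?_⟩
        intro x y _
        simp only [f, coe_mk]
        rw [chi_mul h2]; push_cast; rw [mul_div_mul_comm]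
      have := sum_mu_mul f hf hn
      exact this.symm
    rw [e1, e2, mul_sum, ← sum_sub_distrib]
    refine (abs_sum_le_sum_abs _ _).trans ?_
    rw [mul_comm C, mul_assoc, ← nsmul_eq_mul, ← sum_const]
    apply sum_le_sum
    intro t ht
    have ht0 : 0 < t := Nat.pos_of_mem_divisors ht
    have ht0R : (0 : ℝ) < t := by exact_mod_cast ht0
    have heR : (0 : ℝ) < e := by exact_mod_cast he0
    have e3 : (μ t : ℝ) * ((chi s0 D t : ℝ) / t) * ∑ g ∈ Icc 1 (X / t), (chi s0 D g : ℝ) / g - L * ((μ t : ℝ) * ((chi s0 D t : ℝ) / t))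
       = (μ t : ℝ) * ((chi s0 D t : ℝ)) / t * (∑ g ∈ Icc 1 (X / t), (chi s0 D g : ℝ) / g - L) := by ring
    rw [e3, abs_mul, abs_div, abs_mul, abs_of_pos ht0R]
    have m1 : |(μ t : ℝ)| ≤ 1 := by exact_mod_cast abs_moebius_le_one
    have m2 := chi_real_abs s0 D t
    have m3 := hLC (X / t)
    have m4 : (1 : ℝ) / ((X / t : ℕ) + 1) ≤ t * e / Y := by
      rw [div_le_div_iff₀ (by positivity) (by linarith), one_mul]
      have : Y < (X / t + 1) * (t * e) := by
        rw [hX, Nat.div_div_eq_div_mul, mul_comm e t]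
        have := Nat.lt_mul_div_succ Y (Nat.mul_pos ht0 he0)
        rw [mul_comm]; exact this
      have : (Y : ℝ) < (((X / t : ℕ) : ℝ) + 1) * (t * e) := by exact_mod_cast this
      linarith
    calc |(μ t : ℝ)| * |(chi s0 D t : ℝ)| / t * |∑ g ∈ Icc 1 (X / t), (chi s0 D g : ℝ) / g - L| ≤
          1 * 1 / t * (C / ((X / t : ℕ) + 1)) := by gcongr
      _ = 1 / t * (C * (1 / ((X / t : ℕ) + 1))) := by ring
      _ ≤ 1 / t * (C * (t * e / Y)) := by gcongr
      _ = C * (e / Y) := by field_simp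
  -- main sum
  have hmain : ∑ δ ∈ (Icc 1 Y).filter (fun δ => δ.Coprime n), (chi s0 D δ : ℝ) * nn a b m δ / δ ^ 2
      = ∑ e ∈ Icc 1 Y, c e * eta a b m e / e * ∑ f ∈ Icc 1 (Y / e), c f / f := by
    rw [sum_filter]
    have : ∀ δ ∈ Icc 1 Y, (if δ.Coprime n then (chi s0 D δ : ℝ) * nn a b m δ / δ ^ 2 else 0)
        = ∑ e ∈ δ.divisors, (c e * eta a b m e / e) * (c (δ / e : ℕ) / (δ / e : ℕ)) := by
      intro δ hδ
      rw [mem_Icc] at hδ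
      have hδ0 : (δ : ℝ) ≠ 0 := by have : δ ≠ 0 := by omega
                                   exact_mod_cast this
      have e1 : (if δ.Coprime n then (chi s0 D δ : ℝ) * nn a b m δ / δ ^ 2 else 0) = c δ / δ * (nn a b m δ / δ) := by
        simp only [hc]; split_ifs
        · field_simp
        · simp
      rw [e1]
      by_cases h0 : c δ = 0
      · rw [h0, zero_div, zero_mul]
        symm
        apply sum_eq_zero
        intro e he
        have : c e * c (δ / e) = 0 := by
          rw [← hcmul, Nat.mul_div_cancel' (Nat.dvd_of_mem_divisors he), h0]
        rcases mul_eq_zero.1 this with h | h <;> rw [h] <;> simp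
      · rw [nn_div_eq a b m (by omega) (hcok δ h0), mul_sum]
        refine sum_congr rfl fun e he => ?_
        have hed := Nat.dvd_of_mem_divisors he
        have h3 : δ = e * (δ / e) := (Nat.mul_div_cancel' hed).symm
        have h4 : c δ = c e * c (δ / e) := by rw [← hcmul, ← h3]
        have h5 : (δ : ℝ) = e * (δ / e : ℕ) := by exact_mod_cast h3
        rw [h4, h5, mul_div_mul_comm]; ring
    rw [sum_congr rfl this, hyper Y (fun e f => (c e * eta a b m e / e) * (c f / f))]
    refine sum_congr rfl fun e _ => ?_
    rw [mul_sum]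
  rw [hmain]
  set A := ∑ e ∈ Icc 1 Y, c e * eta a b m e / e with hA
  have hcoef : ∀ e ∈ Icc 1 Y, |c e * eta a b m e / e| ≤ 1 / e ^ 2 := by
    intro e he
    rw [mem_Icc] at he
    have heR : (0 : ℝ) < e := by exact_mod_cast he.1
    by_cases h0 : c e = 0
    · rw [h0]; simp
    · have := eta_abs a b m (hcok e h0)
      rw [abs_div, abs_mul, abs_of_pos heR]
      calc |c e| * |eta a b m e| / e ≤ 1 * (1 / e) / e := by gcongr; exact hcabs e
        _ = _ := by field_simp
  have hAlow : 1 / 2 ≤ A := by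
    rw [hA, ← sum_erase_add _ _ (left_mem_Icc.2 hY)]
    have hc1 : c 1 = 1 := by simp [hc, chi_one]
    rw [hc1, eta_one]
    have : |∑ e ∈ (Icc 1 Y).erase 1, c e * eta a b m e / e| ≤ 1 / 2 := by
      refine (abs_sum_le_sum_abs _ _).trans ?_
      refine le_trans ?_ (inv_sq_sum Y)
      have hsub : ∀ e ∈ (Icc 1 Y).erase 1, e ∉ Icc 3 Y → c e * eta a b m e / e = 0 := by
        intro e he he'
        simp only [mem_erase, mem_Icc] at he he'
        have : c e = 0 := by
          by_contra h
          have h3 : chi s0 D e ≠ 0 := by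
            intro h4; apply h; simp only [hc]; rw [h4]; simp
          have := chi_one_n h2 (by omega) h3
          omega
        rw [this]; simp
      calc ∑ e ∈ (Icc 1 Y).erase 1, |c e * eta a b m e / e| = ∑ e ∈ Icc 3 Y, |c e * eta a b m e / e| := by
            symm
            apply sum_subset
            · intro e he; simp only [mem_erase, mem_Icc] at he ⊢; omega
            · intro e he he'; rw [hsub e he he']; simp
        _ ≤ _ := sum_le_sum fun e he => hcoef e (by simp only [mem_Icc] at he ⊢; omega)
    have := (abs_le.1 this).1
    rw [Nat.cast_one, mul_one, div_one]; linarith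
  have hdiff : |∑ e ∈ Icc 1 Y, c e * eta a b m e / e * ∑ f ∈ Icc 1 (Y / e), c f / f - A * (L * P)| ≤ C * n.divisors.card * (1 + Real.log Y) / Y := by
    rw [hA, sum_mul, ← sum_sub_distrib]
    refine (abs_sum_le_sum_abs _ _).trans ?_
    calc _ ≤ ∑ e ∈ Icc 1 Y, C * n.divisors.card / Y * (1 / e) := by
          apply sum_le_sum
          intro e he
          rw [← mul_sub, abs_mul]
          have heR : (0 : ℝ) < e := by exact_mod_cast (mem_Icc.1 he).1
          calc _ ≤ 1 / e ^ 2 * (C * n.divisors.card * (e / Y)) := by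
                gcongr
                · exact hcoef e he
                · exact hinner e he
            _ = _ := by field_simp
      _ = C * n.divisors.card / Y * ∑ e ∈ Icc 1 Y, (1 : ℝ) / e := by rw [mul_sum]
      _ ≤ C * n.divisors.card / Y * (1 + Real.log Y) := by
          gcongr
          have h1 := harmonic_le_one_add_log Y
          have h2 : ((harmonic Y : ℚ) : ℝ) = ∑ v ∈ Icc 1 Y, (1 : ℝ) / v := by
            rw [harmonic_eq_sum_Icc]; push_cast; simp
          rw [← h2]; exact h1
      _ = _ := by ring
  have hAP : |L| / 2 / n.divisors.card ≤ |A * (L * P)| := by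
    have hA0 : 0 ≤ A := by linarith
    have hτ : (0 : ℝ) < n.divisors.card := by exact_mod_cast card_pos.2 (Nat.nonempty_divisors.2 hn)
    have hP0 : 0 ≤ P := le_trans (by positivity) hPlow
    rw [abs_mul, abs_mul, abs_of_nonneg hA0, abs_of_nonneg hP0]
    calc |L| / 2 / n.divisors.card = 1 / 2 * (|L| * (1 / n.divisors.card)) := by ring
      _ ≤ _ := by gcongr
  have := abs_sub_abs_le_abs_sub (A * (L * P)) (∑ e ∈ Icc 1 Y, c e * eta a b m e / e * ∑ f ∈ Icc 1 (Y / e), c f / f)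
  rw [abs_sub_comm] at this
  linarith

end APU

set_option maxHeartbeats 400000

namespace APU

open Finset

lemma sqp_sum : ∃ C : ℝ, 0 < C ∧ ∀ X : ℕ, ∑ q ∈ Icc 1 X, (sqp q : ℝ) ^ (3/4 : ℝ) ≤ C * X := by
  have hs : Summable (fun s : ℕ => 1 / (s : ℝ) ^ (5/4 : ℝ)) :=
    Real.summable_one_div_nat_rpow.2 (by norm_num)
  have hnn : ∀ s : ℕ, 0 ≤ 1 / (s : ℝ) ^ (5/4 : ℝ) := fun s => by positivity
  refine ⟨∑' s : ℕ, 1 / (s : ℝ) ^ (5/4 : ℝ) + 1, by positivity, fun X => ?_⟩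
  have h1 : ∀ q ∈ Icc 1 X, (sqp q : ℝ) ^ (3/4 : ℝ) ≤
      ∑ s ∈ Icc 1 X, if s ^ 2 ∣ q then (s : ℝ) ^ (3/4 : ℝ) else 0 := by
    intro q hq
    rw [mem_Icc] at hq
    have hq0 : q ≠ 0 := by omega
    have hd := sqp_sq_dvd hq0
    have hpos : 0 < sqp q := Nat.pos_of_ne_zero fun h => by
      rw [h] at hd; simp at hd; omega
    have hle : sqp q ≤ X := by
      have := Nat.le_of_dvd (by omega) hd
      nlinarith
    have := single_le_sum (f := fun s : ℕ => if s ^ 2 ∣ q then (s : ℝ) ^ (3/4 : ℝ) else 0)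
      (fun s _ => by split_ifs <;> positivity) (mem_Icc.2 ⟨hpos, hle⟩)
    simpa [hd] using this
  refine (sum_le_sum h1).trans ?_
  rw [sum_comm]
  have h2 : ∀ s ∈ Icc 1 X, (∑ q ∈ Icc 1 X, if s ^ 2 ∣ q then (s : ℝ) ^ (3/4 : ℝ) else 0) ≤
      X * (1 / (s : ℝ) ^ (5/4 : ℝ)) := by
    intro s hs
    rw [mem_Icc] at hs
    have hs0 : (0 : ℝ) < s := by exact_mod_cast hs.1
    rw [← sum_filter, sum_const, nsmul_eq_mul]
    have h3 : ((Icc 1 X).filter fun q => s ^ 2 ∣ q).card = X / s ^ 2 := by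
      have := Nat.Ioc_filter_dvd_card_eq_div X (s ^ 2)
      rw [← this]; rfl
    rw [h3]
    have h4 : ((X / s ^ 2 : ℕ) : ℝ) ≤ X / (s : ℝ) ^ 2 := by
      have := Nat.cast_div_le (α := ℝ) (m := X) (n := s ^ 2)
      simpa using this
    have h5 : (s : ℝ) ^ (3/4 : ℝ) * (s : ℝ) ^ (5/4 : ℝ) = (s : ℝ) ^ 2 := by
      rw [← Real.rpow_add hs0, ← Real.rpow_natCast]; norm_num
    calc _ ≤ X / (s : ℝ) ^ 2 * (s : ℝ) ^ (3/4 : ℝ) := by gcongr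
      _ = _ := by rw [← h5]; field_simp
  refine (sum_le_sum h2).trans ?_
  rw [← mul_sum, mul_comm]
  have := hs.sum_le_tsum (Icc 1 X) (fun s _ => hnn s)
  gcongr
  linarith

lemma sqp_term {V : ℝ} (hV : 0 < V) {q : ℕ} (hq : q ≠ 0) :
    (q : ℝ) ^ (-(1/4) : ℝ) * (sqp q : ℝ) ^ (3/4 : ℝ) ≤
      (if (q : ℝ) ≤ V then V ^ (1/8 : ℝ) else 0) + V ^ (-(1/4) : ℝ) * (sqp q : ℝ) ^ (3/4 : ℝ) := by
  have hq0 : (0 : ℝ) < q := by exact_mod_cast Nat.pos_of_ne_zero hq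
  split_ifs with h
  · have h1 : (sqp q : ℝ) ^ (3/4 : ℝ) ≤ (q : ℝ) ^ (3/8 : ℝ) := by
      have : (sqp q : ℝ) ^ 2 ≤ q := by exact_mod_cast Nat.le_of_dvd (Nat.pos_of_ne_zero hq) (sqp_sq_dvd hq)
      calc (sqp q : ℝ) ^ (3/4 : ℝ) = ((sqp q : ℝ) ^ 2) ^ (3/8 : ℝ) := by
            rw [← Real.rpow_natCast, ← Real.rpow_mul (by positivity)]; norm_num
        _ ≤ _ := by gcongr
    have h2 : (q : ℝ) ^ (-(1/4) : ℝ) * (q : ℝ) ^ (3/8 : ℝ) = (q : ℝ) ^ (1/8 : ℝ) := by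
      rw [← Real.rpow_add hq0]; norm_num
    have h3 : (q : ℝ) ^ (1/8 : ℝ) ≤ V ^ (1/8 : ℝ) := by gcongr
    have h4 : 0 ≤ V ^ (-(1/4) : ℝ) * (sqp q : ℝ) ^ (3/4 : ℝ) := by positivity
    have h5 : (q : ℝ) ^ (-(1/4) : ℝ) * (sqp q : ℝ) ^ (3/4 : ℝ) ≤ (q : ℝ) ^ (-(1/4) : ℝ) * (q : ℝ) ^ (3/8 : ℝ) := by gcongr
    linarith
  · rw [zero_add]
    have : (q : ℝ) ^ (-(1/4) : ℝ) ≤ V ^ (-(1/4) : ℝ) :=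
      Real.rpow_le_rpow_of_nonpos hV (not_le.1 h).le (by norm_num)
    gcongr

/-- Sum of the box errors. -/
theorem Wt_sum : ∃ C : ℝ, 1 ≤ C ∧ ∀ (X : ℕ) (t l : ℝ), 1 ≤ X → 0 ≤ l → 1 ≤ t →
    (∀ q ∈ Icc 1 X, (q.divisors.card : ℝ) ≤ t) → 1 + Real.log X ≤ t →
    ∑ q ∈ Icc 1 X, Wt q * Eq' q ^ 2 * (1 + 2 * l / q) ≤
      C * t ^ 5 * ((X : ℝ) ^ (7/4 : ℝ) + l * (X : ℝ) ^ (9/10 : ℝ)) := by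
  obtain ⟨C, hC, hsum⟩ := sqp_sum
  refine ⟨2 * C + 4, by linarith, fun X t l hX hl ht htau hlog => ?_⟩
  have hX0 : (0 : ℝ) < X := by exact_mod_cast hX
  set V : ℝ := (X : ℝ) ^ (4/5 : ℝ) with hV
  have hV0 : 0 < V := by positivity
  have key : ∀ q ∈ Icc 1 X, Wt q * Eq' q ^ 2 * (1 + 2 * l / q) ≤
      t ^ 5 * ((X : ℝ) ^ (3/4 : ℝ) * (sqp q : ℝ) ^ (3/4 : ℝ) + 2 * l *
        ((if (q : ℝ) ≤ V then V ^ (1/8 : ℝ) else 0) + V ^ (-(1/4) : ℝ) * (sqp q : ℝ) ^ (3/4 : ℝ))) := by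
    intro q hq
    have hq' := mem_Icc.1 hq
    have hq0 : q ≠ 0 := by omega
    have hqR : (0 : ℝ) < q := by exact_mod_cast hq'.1
    have h1 : Wt q ≤ t * (q : ℝ) ^ (3/4 : ℝ) * (sqp q : ℝ) ^ (3/4 : ℝ) := by
      refine (Wt_le hq0).trans ?_
      have := htau q hq
      gcongr
    have hqX : (q : ℝ) ≤ X := by exact_mod_cast hq'.2
    have h2 : Eq' q ≤ t * t := by
      unfold Eq'
      have := htau q hq
      have h3 : Real.log q ≤ Real.log X := Real.log_le_log hqR hqX
      have h4 : 0 ≤ Real.log q := Real.log_nonneg (by exact_mod_cast hq'.1)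
      have h5 : 1 + Real.log q ≤ t := by linarith
      gcongr
    have h20 : 0 ≤ Eq' q := by
      unfold Eq'
      have h4 : 0 ≤ Real.log q := Real.log_nonneg (by exact_mod_cast hq'.1)
      positivity
    have h6 := sqp_term hV0 hq0
    calc Wt q * Eq' q ^ 2 * (1 + 2 * l / q)
        ≤ (t * (q : ℝ) ^ (3/4 : ℝ) * (sqp q : ℝ) ^ (3/4 : ℝ)) * (t * t) ^ 2 * (1 + 2 * l / q) := by
          have := Wt_nonneg q
          gcongr
      _ = t ^ 5 * ((q : ℝ) ^ (3/4 : ℝ) * (sqp q : ℝ) ^ (3/4 : ℝ) + 2 * l * ((q : ℝ) ^ (-(1/4) : ℝ) * (sqp q : ℝ) ^ (3/4 : ℝ))) := by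
          have : (q : ℝ) ^ (3/4 : ℝ) = (q : ℝ) ^ (-(1/4) : ℝ) * q := by
            rw [← Real.rpow_add_one hqR.ne']; norm_num
          rw [this]
          field_simp
      _ ≤ _ := by gcongr
  refine (sum_le_sum key).trans ?_
  rw [← mul_sum, sum_add_distrib, ← mul_sum, ← mul_sum, sum_add_distrib, ← mul_sum]
  have hA := hsum X
  have hB : ∑ q ∈ Icc 1 X, (if (q : ℝ) ≤ V then V ^ (1/8 : ℝ) else 0) ≤ V * V ^ (1/8 : ℝ) := by
    rw [← sum_filter, sum_const, nsmul_eq_mul]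
    have : (((Icc 1 X).filter fun q : ℕ => (q : ℝ) ≤ V).card : ℝ) ≤ V := by
      have h1 : ((Icc 1 X).filter fun q : ℕ => (q : ℝ) ≤ V) ⊆ Icc 1 ⌊V⌋₊ := by
        intro q hq
        rw [mem_filter, mem_Icc] at hq
        exact mem_Icc.2 ⟨hq.1.1, Nat.le_floor hq.2⟩
      have h2 := card_le_card h1
      rw [Nat.card_Icc, Nat.add_sub_cancel] at h2
      exact (Nat.cast_le.2 h2).trans (Nat.floor_le hV0.le)
    gcongr
  have hX1 : (1 : ℝ) ≤ X := by exact_mod_cast hX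
  have e1 : V * V ^ (1/8 : ℝ) = (X : ℝ) ^ (9/10 : ℝ) := by
    rw [hV, ← Real.rpow_mul hX0.le, ← Real.rpow_add hX0]; norm_num
  have e2 : V ^ (-(1/4) : ℝ) * X = (X : ℝ) ^ (4/5 : ℝ) := by
    rw [hV, ← Real.rpow_mul hX0.le, ← Real.rpow_add_one hX0.ne']; norm_num
  have e3 : (X : ℝ) ^ (4/5 : ℝ) ≤ (X : ℝ) ^ (9/10 : ℝ) := Real.rpow_le_rpow_of_exponent_le hX1 (by norm_num)
  have e4 : (X : ℝ) ^ (3/4 : ℝ) * X = (X : ℝ) ^ (7/4 : ℝ) := by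
    rw [← Real.rpow_add_one hX0.ne']; norm_num
  rw [e1] at hB
  set S := ∑ q ∈ Icc 1 X, (sqp q : ℝ) ^ (3/4 : ℝ)
  have f1 : (X : ℝ) ^ (3/4 : ℝ) * S ≤ C * (X : ℝ) ^ (7/4 : ℝ) := by
    rw [← e4]
    calc (X : ℝ) ^ (3/4 : ℝ) * S ≤ (X : ℝ) ^ (3/4 : ℝ) * (C * X) := by gcongr
      _ = _ := by ring
  have f2 : V ^ (-(1/4) : ℝ) * S ≤ C * (X : ℝ) ^ (9/10 : ℝ) := by
    calc V ^ (-(1/4) : ℝ) * S ≤ V ^ (-(1/4) : ℝ) * (C * X) := by gcongr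
      _ = C * (V ^ (-(1/4) : ℝ) * X) := by ring
      _ ≤ _ := by rw [e2]; gcongr
  have f3 : 0 ≤ (X : ℝ) ^ (7/4 : ℝ) := by positivity
  have f4 : 0 ≤ (X : ℝ) ^ (9/10 : ℝ) := by positivity
  calc _ ≤ t ^ 5 * (C * (X : ℝ) ^ (7/4 : ℝ) + 2 * l * ((X : ℝ) ^ (9/10 : ℝ) + C * (X : ℝ) ^ (9/10 : ℝ))) := by gcongr
    _ ≤ t ^ 5 * ((2 * C + 4) * ((X : ℝ) ^ (7/4 : ℝ) + l * (X : ℝ) ^ (9/10 : ℝ))) := by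
      gcongr
      have : 0 ≤ l * (X : ℝ) ^ (9/10 : ℝ) := by positivity
      nlinarith
    _ = _ := by ring

end APU

set_option maxHeartbeats 400000

namespace APU

open Finset

/-- the binary form along a progression -/
def Bf (a b Q x0 y0 : ℤ) (z : ℕ × ℕ) : ℤ := a * (x0 + Q * z.1) ^ 2 + b * (y0 + Q * z.2) ^ 2

/-- number of `i < l` in the class of `u` modulo `d` -/
def cls (l d u : ℕ) : ℕ := (l - u + d - 1) / d

lemma lt_cls {l d u i : ℕ} (hd : 0 < d) : i < cls l d u ↔ u + d * i < l := by
  unfold cls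
  rw [Nat.lt_iff_add_one_le, Nat.le_div_iff_mul_le hd]
  constructor <;> intro h
  · nlinarith [show (i + 1) * d = d * i + d by ring, show d * i + d ≤ l - u + d - 1 by nlinarith, (by omega : d * i + d ≤ l - u + d - 1 → u + d * i < l) (by nlinarith)]
  · have : d * i + d ≤ l - u + d - 1 := by omega
    nlinarith

lemma cls_le (l d u : ℕ) (hd : 0 < d) : cls l d u ≤ l := by
  unfold cls
  rcases Nat.eq_zero_or_pos l with h | h
  · subst h; rw [Nat.zero_sub, zero_add]; exact (Nat.div_eq_of_lt (by omega)).le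
  · rw [Nat.div_le_iff_le_mul_add_pred hd]
    have : l * 1 + d * 1 ≤ d * l + 1 := by nlinarith
    omega

lemma cls_abs (l d u : ℕ) (hu : u < d) : |(cls l d u : ℝ) - l / d| ≤ 1 := by
  have hd : 0 < d := by omega
  have hdR : (0 : ℝ) < d := by exact_mod_cast hd
  have h1 : cls l d u * d ≤ l + d := by
    have := Nat.div_mul_le_self (l - u + d - 1) d
    unfold cls; omega
  have h2 : l ≤ cls l d u * d + d := by
    by_contra h
    have := (not_congr (lt_cls (l := l) (u := u) (i := cls l d u) hd)).1 (lt_irrefl _)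
    have h3 : d * cls l d u = cls l d u * d := by ring
    omega
  have h1R : (cls l d u : ℝ) * d ≤ l + d := by exact_mod_cast h1
  have h2R : (l : ℝ) ≤ cls l d u * d + d := by exact_mod_cast h2
  have e : (l : ℝ) / d * d = l := by field_simp
  rw [abs_le]
  constructor <;> nlinarith

lemma Bf_shift (a b Q x0 y0 : ℤ) (d u v i j : ℕ) :
    Bf a b Q x0 y0 (u + d * i, v + d * j) = a * ((x0 + Q * u) + (Q * d) * i) ^ 2 + b * ((y0 + Q * v) + (Q * d) * j) ^ 2 := by
  unfold Bf; push_cast; ring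

lemma Bf_dvd_shift (a b Q x0 y0 : ℤ) (d u v i j : ℕ) :
    (d : ℤ) ∣ Bf a b Q x0 y0 (u + d * i, v + d * j) ↔ (d : ℤ) ∣ Bf a b Q x0 y0 (u, v) := by
  apply dvd_iff_dvd_of_dvd_sub
  rw [Bf_shift]; unfold Bf
  exact ⟨a * (Q * i * (2 * (x0 + Q * u) + Q * d * i)) + b * (Q * j * (2 * (y0 + Q * v) + Q * d * j)), by push_cast; ring⟩

lemma cls_split (a b Q x0 y0 : ℤ) (l d : ℕ) (hd : 0 < d) (P : ℕ × ℕ → Prop) [DecidablePred P] :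
    ((range l ×ˢ range l).filter fun z => (d : ℤ) ∣ Bf a b Q x0 y0 z ∧ P z).card =
    ∑ w ∈ (range d ×ˢ range d).filter (fun w => (d : ℤ) ∣ Bf a b Q x0 y0 w),
      ((range (cls l d w.1) ×ˢ range (cls l d w.2)).filter fun z => P (w.1 + d * z.1, w.2 + d * z.2)).card := by
  rw [card_eq_sum_card_fiberwise (f := fun z : ℕ × ℕ => (z.1 % d, z.2 % d))
    (t := (range d ×ˢ range d).filter (fun w => (d : ℤ) ∣ Bf a b Q x0 y0 w))]
  · apply sum_congr rfl
    rintro ⟨u, v⟩ hw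
    rw [mem_filter, mem_product, mem_range, mem_range] at hw
    dsimp only at hw ⊢
    symm
    apply card_bij (fun z _ => (u + d * z.1, v + d * z.2))
    · rintro ⟨i, j⟩ hz
      simp only [mem_filter, mem_product, mem_range] at hz ⊢
      rw [lt_cls hd, lt_cls hd] at hz
      refine ⟨⟨hz.1, (Bf_dvd_shift _ _ _ _ _ _ _ _ _ _).2 hw.2, hz.2⟩, ?_⟩
      rw [Nat.add_mul_mod_self_left, Nat.add_mul_mod_self_left, Nat.mod_eq_of_lt hw.1.1, Nat.mod_eq_of_lt hw.1.2]
    · rintro ⟨i, j⟩ _ ⟨i', j'⟩ _ h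
      simp only [Prod.mk.injEq] at h ⊢
      exact ⟨Nat.eq_of_mul_eq_mul_left hd (by omega), Nat.eq_of_mul_eq_mul_left hd (by omega)⟩
    · rintro ⟨i, j⟩ hz
      simp only [mem_filter, mem_product, mem_range, Prod.mk.injEq] at hz
      obtain ⟨⟨hlt, hdv, hP⟩, rfl, rfl⟩ := hz
      have e1 := Nat.mod_add_div i d
      have e2 := Nat.mod_add_div j d
      refine ⟨(i / d, j / d), ?_, by simp only [e1, e2]⟩
      simp only [mem_filter, mem_product, mem_range]
      rw [lt_cls hd, lt_cls hd, e1, e2]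
      exact ⟨hlt, hP⟩
  · rintro ⟨i, j⟩ hz
    simp only [coe_filter, mem_product, mem_range, Set.mem_setOf_eq] at hz ⊢
    refine ⟨⟨Nat.mod_lt _ hd, Nat.mod_lt _ hd⟩, ?_⟩
    rw [← Bf_dvd_shift a b Q x0 y0 d (i % d) (j % d) (i / d) (j / d), Nat.mod_add_div, Nat.mod_add_div]
    exact hz.2.1

/-- number of points of the square with `d ∣ B` -/
def Gc (a b Q x0 y0 : ℤ) (l d : ℕ) : ℕ := ((range l ×ˢ range l).filter fun z => (d : ℤ) ∣ Bf a b Q x0 y0 z).card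

lemma Gc_eq (a b Q x0 y0 : ℤ) (l d : ℕ) (hd : 0 < d) : Gc a b Q x0 y0 l d =
    ∑ w ∈ (range d ×ˢ range d).filter (fun w => (d : ℤ) ∣ Bf a b Q x0 y0 w), cls l d w.1 * cls l d w.2 := by
  have := cls_split a b Q x0 y0 l d hd (fun _ => True)
  simp only [and_true] at this
  unfold Gc
  rw [this]
  apply sum_congr rfl
  intro w _
  simp

lemma cnt0 (a b Q x0 y0 : ℤ) (l d : ℕ) (hd : 0 < d) :
    |(Gc a b Q x0 y0 l d : ℝ) - Gc a b Q x0 y0 d d * (l : ℝ) ^ 2 / d ^ 2| ≤ Gc a b Q x0 y0 d d * (2 * l / d + 1) := by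
  have hdR : (0 : ℝ) < d := by exact_mod_cast hd
  have e : (Gc a b Q x0 y0 d d : ℝ) * (l : ℝ) ^ 2 / d ^ 2 =
      ∑ w ∈ (range d ×ˢ range d).filter (fun w => (d : ℤ) ∣ Bf a b Q x0 y0 w), ((l : ℝ) / d) ^ 2 := by
    rw [sum_const, nsmul_eq_mul]; unfold Gc; ring
  rw [e, Gc_eq a b Q x0 y0 l d hd]
  push_cast
  rw [← sum_sub_distrib]
  refine (abs_sum_le_sum_abs _ _).trans ?_
  have : ∀ w ∈ (range d ×ˢ range d).filter (fun w => (d : ℤ) ∣ Bf a b Q x0 y0 w),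
      |(cls l d w.1 : ℝ) * cls l d w.2 - ((l : ℝ) / d) ^ 2| ≤ 2 * l / d + 1 := by
    intro w hw
    rw [mem_filter, mem_product, mem_range, mem_range] at hw
    have h1 := cls_abs l d w.1 hw.1.1
    have h2 := cls_abs l d w.2 hw.1.2
    have h0 : 0 ≤ (l : ℝ) / d := by positivity
    set x := (cls l d w.1 : ℝ)
    set y := (cls l d w.2 : ℝ)
    set r := (l : ℝ) / d
    have : x * y - r ^ 2 = (x - r) * (y - r) + r * (x - r) + r * (y - r) := by ring
    rw [this]
    have e2 : 2 * (l : ℝ) / d = 2 * r := by ring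
    rw [e2]
    calc _ ≤ |(x - r) * (y - r)| + |r * (x - r)| + |r * (y - r)| := abs_add_three _ _ _
      _ = |x - r| * |y - r| + r * |x - r| + r * |y - r| := by rw [abs_mul, abs_mul, abs_mul, abs_of_nonneg h0]
      _ ≤ 1 * 1 + r * 1 + r * 1 := by gcongr
      _ = _ := by ring
  refine (sum_le_sum this).trans ?_
  rw [sum_const, nsmul_eq_mul]; rfl

lemma cnt1 {a b m Q : ℤ} (x0 y0 : ℤ) (l d δ : ℕ) (hd : 0 < d) (hδ : δ ≠ 0) (hodd : Odd δ)
    (ha : IsUnit (a : ZMod δ)) (hb : IsUnit (b : ZMod δ)) (hm : IsUnit (m : ZMod δ)) (hQ : IsUnit (Q : ZMod δ))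
    (hdu : IsUnit (d : ZMod δ)) :
    |(((range l ×ˢ range l).filter fun z => (d : ℤ) ∣ Bf a b Q x0 y0 z ∧ (δ : ℤ) ∣ Bf a b Q x0 y0 z - m).card : ℝ)
      - Gc a b Q x0 y0 l d * (nn a b m δ / (δ : ℝ) ^ 2)| ≤
      Gc a b Q x0 y0 d d * (Wt δ * Eq' δ ^ 2 * (1 + 2 * l / δ)) := by
  have : NeZero δ := ⟨hδ⟩
  have hδR : (0 : ℝ) < δ := by exact_mod_cast Nat.pos_of_ne_zero hδ
  rw [cls_split a b Q x0 y0 l d hd (fun z => (δ : ℤ) ∣ Bf a b Q x0 y0 z - m), Gc_eq a b Q x0 y0 l d hd]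
  push_cast
  rw [sum_mul, ← sum_sub_distrib]
  refine (abs_sum_le_sum_abs _ _).trans ?_
  have key : ∀ w ∈ (range d ×ˢ range d).filter (fun w => (d : ℤ) ∣ Bf a b Q x0 y0 w),
      |(((range (cls l d w.1) ×ˢ range (cls l d w.2)).filter fun z => (δ : ℤ) ∣ Bf a b Q x0 y0 (w.1 + d * z.1, w.2 + d * z.2) - m).card : ℝ)
        - (cls l d w.1 : ℝ) * cls l d w.2 * (nn a b m δ / (δ : ℝ) ^ 2)| ≤ Wt δ * Eq' δ ^ 2 * (1 + 2 * l / δ) := by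
    intro w _
    have hc : IsUnit (((Q * d : ℤ)) : ZMod δ) := by push_cast; exact hQ.mul hdu
    have := box hodd ha hb hm hc (x0 + Q * w.1) (y0 + Q * w.2) (cls l d w.1) (cls l d w.2)
    simp only [← Bf_shift] at this
    rw [nn_eq, ← mul_div_assoc]
    refine this.trans ?_
    have h1 : (cls l d w.1 : ℝ) ≤ l := by exact_mod_cast cls_le l d w.1 hd
    have h2 : (cls l d w.2 : ℝ) ≤ l := by exact_mod_cast cls_le l d w.2 hd
    have h3 := Wt_nonneg δ
    have h4 : (cls l d w.1 : ℝ) + cls l d w.2 ≤ 2 * l := by linarith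
    gcongr
  refine (sum_le_sum key).trans ?_
  rw [sum_const, nsmul_eq_mul]; rfl

lemma card_congr_le {l d k : ℕ} (hk : l ≤ d * k) (T : Finset ℕ) (hT : T ⊆ range l) (hc : ∀ i ∈ T, ∀ j ∈ T, i ≡ j [MOD d]) :
    T.card ≤ k := by
  rw [← card_range k]
  apply card_le_card_of_injOn (fun i => i / d)
  · intro i hi
    have := mem_range.1 (hT hi)
    simp only [coe_range, Set.mem_Iio]
    exact Nat.div_lt_of_lt_mul (by omega)
  · intro i hi j hj h
    have h1 := hc i hi j hj
    dsimp only at h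
    rw [← Nat.mod_add_div i d, ← Nat.mod_add_div j d, h1, h]

lemma roots_le {b Q y0 c : ℤ} {d : ℕ} (hsq : Squarefree d) (hb : IsCoprime b d) (hQ : IsCoprime Q d) {l k : ℕ} (hk : l ≤ d * k) :
    ((range l).filter fun j : ℕ => (d : ℤ) ∣ c + b * (y0 + Q * j) ^ 2).card ≤ d.divisors.card * k := by
  set T := (range l).filter fun j : ℕ => (d : ℤ) ∣ c + b * (y0 + Q * j) ^ 2 with hT
  rcases T.eq_empty_or_nonempty with h | ⟨j0, hj0⟩
  · rw [h]; simp
  have hd0 : d ≠ 0 := hsq.ne_zero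
  set v0 := y0 + Q * j0 with hv0
  have hj0' := (mem_filter.1 hj0).2
  have hmem : ∀ j ∈ T, (d : ℤ) ∣ ((y0 + Q * j) - v0) * ((y0 + Q * j) + v0) := by
    intro j hj
    have h1 := (mem_filter.1 hj).2
    have h2 : (d : ℤ) ∣ b * (((y0 + Q * j) - v0) * ((y0 + Q * j) + v0)) := by
      have := dvd_sub h1 hj0'
      rw [show c + b * (y0 + Q * j) ^ 2 - (c + b * (y0 + Q * j0) ^ 2) = b * (((y0 + Q * j) - v0) * ((y0 + Q * j) + v0)) by rw [hv0]; ring] at this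
      exact this
    exact hb.symm.dvd_of_dvd_mul_left h2
  have hsub : T ⊆ d.divisors.biUnion fun d1 => T.filter fun j : ℕ => (d1 : ℤ) ∣ (y0 + Q * j) - v0 ∧ ((d / d1 : ℕ) : ℤ) ∣ (y0 + Q * j) + v0 := by
    intro j hj
    rw [mem_biUnion]
    set g := Int.gcd ((y0 + Q * j) - v0) d with hg
    have hgd : g ∣ d := by
      have := Int.gcd_dvd_right ((y0 + Q * j) - v0) (d : ℤ)
      exact_mod_cast this
    refine ⟨g, Nat.mem_divisors.2 ⟨hgd, hd0⟩, mem_filter.2 ⟨hj, Int.gcd_dvd_left _ _, ?_⟩⟩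
    have h1 := hmem j hj
    have hg0 : g ≠ 0 := fun h => hd0 (by rw [h] at hgd; simpa using hgd)
    obtain ⟨x, hx⟩ : (g : ℤ) ∣ (y0 + Q * j) - v0 := Int.gcd_dvd_left _ _
    obtain ⟨e, he⟩ := hgd
    have hcop : IsCoprime x (e : ℤ) := by
      rw [Int.isCoprime_iff_gcd_eq_one]
      have : g = g * Int.gcd x e := by
        conv_lhs => rw [hg, hx, he]
        push_cast
        rw [Int.gcd_mul_left]; simp
      exact Nat.eq_of_mul_eq_mul_left (Nat.pos_of_ne_zero hg0) (by linarith)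
    have h3 : d / g = e := by rw [he]; exact Nat.mul_div_cancel_left _ (Nat.pos_of_ne_zero hg0)
    rw [h3]
    rw [hx, he] at h1
    push_cast at h1
    rw [mul_assoc] at h1
    have h4 := (mul_dvd_mul_iff_left (by exact_mod_cast hg0)).1 h1
    exact hcop.symm.dvd_of_dvd_mul_left h4
  refine (card_le_card hsub).trans (card_biUnion_le.trans ?_)
  rw [← smul_eq_mul, ← sum_const]
  apply sum_le_sum
  intro d1 hd1
  apply card_congr_le hk
  · exact (filter_subset _ _).trans (filter_subset _ _)
  · intro i hi j hj
    have hi' := (mem_filter.1 hi).2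
    have hj' := (mem_filter.1 hj).2
    have hdd := Nat.dvd_of_mem_divisors hd1
    have h1 : (d1 : ℤ) ∣ Q * (j - i) := by
      have := dvd_sub hj'.1 hi'.1
      rwa [show (y0 + Q * j) - v0 - ((y0 + Q * i) - v0) = Q * (j - i) by ring] at this
    have h2 : ((d / d1 : ℕ) : ℤ) ∣ Q * (j - i) := by
      have := dvd_sub hj'.2 hi'.2
      rwa [show (y0 + Q * j) + v0 - ((y0 + Q * i) + v0) = Q * (j - i) by ring] at this
    have hcop : IsCoprime (d1 : ℤ) ((d / d1 : ℕ) : ℤ) := by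
      rw [Nat.isCoprime_iff_coprime]
      apply Nat.coprime_of_squarefree_mul
      rw [Nat.mul_div_cancel' hdd]; exact hsq
    have h3 := hcop.mul_dvd h1 h2
    rw [← Nat.cast_mul, Nat.mul_div_cancel' hdd] at h3
    have h4 := hQ.symm.dvd_of_dvd_mul_left h3
    exact (Nat.modEq_iff_dvd).2 h4

lemma cntT {a b Q : ℤ} (x0 y0 : ℤ) {d : ℕ} (hsq : Squarefree d) (hb : IsCoprime b d) (hQ : IsCoprime Q d) {l k : ℕ} (hk : l ≤ d * k) :
    Gc a b Q x0 y0 l d ≤ l * (d.divisors.card * k) := by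
  unfold Gc
  rw [card_eq_sum_card_fiberwise (f := Prod.fst) (t := range l)]
  · conv_rhs => rw [← card_range l, ← smul_eq_mul, ← sum_const]
    apply sum_le_sum
    intro i hi
    refine le_trans ?_ (roots_le (c := a * (x0 + Q * i) ^ 2) (y0 := y0) hsq hb hQ hk)
    apply card_le_card_of_injOn Prod.snd
    · rintro ⟨i', j⟩ h
      rw [mem_coe, mem_filter, mem_filter, mem_product, mem_range, mem_range] at h
      rw [mem_coe, mem_filter, mem_range]
      obtain ⟨⟨⟨h1, h2⟩, h3⟩, rfl⟩ := h
      exact ⟨h2, h3⟩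
    · rintro ⟨i1, j1⟩ h1 ⟨i2, j2⟩ h2 h
      rw [mem_coe, mem_filter] at h1 h2
      rw [Prod.mk.injEq]
      exact ⟨h1.2.trans h2.2.symm, h⟩
  · rintro ⟨i, j⟩ h
    simp only [coe_filter, mem_product, Set.mem_setOf_eq, coe_range, Set.mem_Iio, mem_range] at h ⊢
    exact h.1.1

end APU

set_option maxHeartbeats 400000

namespace APU

open Finset ArithmeticFunction
open scoped ArithmeticFunction.Moebius

lemma Gc_nn {a b Q : ℤ} (x0 y0 : ℤ) {d : ℕ} (hd : d ≠ 0) (hQ : IsCoprime Q d) :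
    Gc a b Q x0 y0 d d = nn a b 0 d := by
  have : NeZero d := ⟨hd⟩
  rw [nn_eq]
  unfold Gc NN conic
  have hu : IsUnit (Q : ZMod d) := by
    obtain ⟨u, v, h⟩ := hQ
    have := congrArg (Int.cast : ℤ → ZMod d) h
    push_cast at this
    rw [ZMod.natCast_self, mul_zero, add_zero] at this
    exact IsUnit.of_mul_eq_one u (by rw [mul_comm]; exact this)
  obtain ⟨Qi, hQi⟩ := hu.exists_right_inv
  have hcast : ∀ z : ℕ × ℕ, (d : ℤ) ∣ Bf a b Q x0 y0 z ↔ (a : ZMod d) * (x0 + Q * z.1) ^ 2 + b * (y0 + Q * z.2) ^ 2 = ((0 : ℤ) : ZMod d) := by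
    intro z
    rw [← ZMod.intCast_zmod_eq_zero_iff_dvd]
    unfold Bf; push_cast; rfl
  have hinj : ∀ x : ZMod d, ∀ i j : ℕ, i < d → j < d → x + Q * (i : ZMod d) = x + Q * (j : ZMod d) → i = j := by
    intro x i j hi hj h
    have h1 := hu.mul_left_cancel (add_left_cancel h)
    have := (ZMod.natCast_eq_natCast_iff' i j d).1 h1
    rwa [Nat.mod_eq_of_lt hi, Nat.mod_eq_of_lt hj] at this
  apply card_bij (fun z _ => ((x0 : ZMod d) + Q * (z.1 : ZMod d), (y0 : ZMod d) + Q * (z.2 : ZMod d)))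
  · intro z hz
    rw [mem_filter] at hz ⊢
    exact ⟨mem_univ _, (hcast z).1 hz.2⟩
  · rintro ⟨i, j⟩ h1 ⟨i', j'⟩ h2 h
    rw [mem_filter, mem_product, mem_range, mem_range] at h1 h2
    rw [Prod.mk.injEq] at h ⊢
    exact ⟨hinj _ _ _ h1.1.1 h2.1.1 h.1, hinj _ _ _ h1.1.2 h2.1.2 h.2⟩
  · rintro ⟨x, y⟩ h
    rw [mem_filter] at h
    have e : ∀ x x0 : ZMod d, x0 + Q * ((((x - x0) * Qi).val : ℕ) : ZMod d) = x := by
      intro x x0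
      rw [ZMod.natCast_val, ZMod.cast_id', id, mul_comm, mul_assoc, mul_comm Qi, hQi]; ring
    refine ⟨(((x - x0) * Qi).val, ((y - y0) * Qi).val), ?_, by rw [e, e]⟩
    rw [mem_filter, mem_product, mem_range, mem_range, hcast]
    refine ⟨⟨ZMod.val_lt _, ZMod.val_lt _⟩, ?_⟩
    dsimp only
    rw [e, e]
    exact h.2

section sieve
variable {a b Q : ℤ} (x0 y0 : ℤ) {R l D0 : ℕ} {t : ℝ}

lemma tau_dvd {d R : ℕ} (hR : R ≠ 0) (h : d ∣ R) : d.divisors.card ≤ R.divisors.card :=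
  card_le_card (Nat.divisors_subset_of_dvd hR h)

lemma g_le (hsq : Squarefree R) (hb : IsCoprime b R) (hQ : IsCoprime Q R) {d : ℕ} (hd : d ∣ R) :
    Gc a b Q x0 y0 d d ≤ d * R.divisors.card := by
  have h1 : (d : ℤ) ∣ R := by exact_mod_cast hd
  refine (cntT (a := a) x0 y0 (hsq.squarefree_of_dvd hd) (hb.of_isCoprime_of_dvd_right h1)
    (hQ.of_isCoprime_of_dvd_right h1) (l := d) (k := 1) (by omega)).trans ?_
  rw [mul_one]
  exact Nat.mul_le_mul_left _ (tau_dvd hsq.ne_zero hd)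

theorem sieve_tail (hsq : Squarefree R) (hb : IsCoprime b R) (hQ : IsCoprime Q R) (hD : 1 ≤ D0)
    (ht : (R.divisors.card : ℝ) ≤ t) :
    ∑ d ∈ R.divisors.filter (fun d => ¬ d ≤ D0), (Gc a b Q x0 y0 l d : ℝ) ≤ t ^ 2 * l * (l / D0 + 1) := by
  have hD0 : (0 : ℝ) < D0 := by exact_mod_cast hD
  have ht0 : 0 ≤ t := le_trans (by positivity) ht
  have key : ∀ d ∈ R.divisors.filter (fun d => ¬ d ≤ D0), (Gc a b Q x0 y0 l d : ℝ) ≤ l * (t * ((l : ℝ) / D0 + 1)) := by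
    intro d hd
    rw [mem_filter, not_le] at hd
    have hdR := Nat.dvd_of_mem_divisors hd.1
    have h1 : (d : ℤ) ∣ R := by exact_mod_cast hdR
    have hd0 : 0 < d := by omega
    have h2 := cntT (a := a) x0 y0 (hsq.squarefree_of_dvd hdR) (hb.of_isCoprime_of_dvd_right h1)
      (hQ.of_isCoprime_of_dvd_right h1) (l := l) (k := l / d + 1) (by
        have := Nat.div_add_mod l d
        have := Nat.mod_lt l hd0
        rw [mul_add]; omega)
    have h3 : (Gc a b Q x0 y0 l d : ℝ) ≤ l * (d.divisors.card * ((l / d : ℕ) + 1)) := by exact_mod_cast h2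
    refine h3.trans ?_
    have h4 : (d.divisors.card : ℝ) ≤ t := le_trans (by exact_mod_cast tau_dvd hsq.ne_zero hdR) ht
    have h5 : ((l / d : ℕ) : ℝ) ≤ (l : ℝ) / D0 := by
      refine (Nat.cast_div_le).trans ?_
      have : (D0 : ℝ) ≤ d := by exact_mod_cast hd.2.le
      gcongr
    gcongr
  refine (sum_le_sum key).trans ?_
  rw [sum_const, nsmul_eq_mul]
  have h6 : ((R.divisors.filter (fun d => ¬ d ≤ D0)).card : ℝ) ≤ t :=
    le_trans (by exact_mod_cast card_filter_le _ _) ht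
  calc _ ≤ t * (l * (t * ((l : ℝ) / D0 + 1))) := by gcongr
    _ = _ := by ring

theorem sieve_main (hsq : Squarefree R) (hodd : Odd R) (hb : IsCoprime b R) (hQ : IsCoprime Q R) (hD : 1 ≤ D0)
    (ht : (R.divisors.card : ℝ) ≤ t) :
    (l : ℝ) ^ 2 / t ^ 2 - t ^ 2 * (2 * l + D0) - (l : ℝ) ^ 2 * t ^ 2 / D0 ≤
      ∑ d ∈ R.divisors.filter (fun d => d ≤ D0), (μ d : ℝ) * Gc a b Q x0 y0 l d := by
  have hD0 : (0 : ℝ) < D0 := by exact_mod_cast hD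
  have hR0 := hsq.ne_zero
  have hτ1 : (1 : ℝ) ≤ R.divisors.card := by
    have : 0 < R.divisors.card := card_pos.2 ⟨1, Nat.mem_divisors.2 ⟨one_dvd _, hR0⟩⟩
    exact_mod_cast this
  have ht1 : 1 ≤ t := hτ1.trans ht
  have ht0 : 0 < t := by linarith
  have hcop : ∀ d, d ∣ R → IsCoprime Q (d : ℤ) := fun d hd => hQ.of_isCoprime_of_dvd_right (by exact_mod_cast hd)
  have hmu : ∀ d, |(μ d : ℝ)| ≤ 1 := fun d => by exact_mod_cast abs_moebius_le_one
  set f : ArithmeticFunction ℝ := ⟨fun d => (nn a b 0 d : ℝ) / (d : ℝ) ^ 2, by simp⟩ with hf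
  have hfa : ∀ d, f d = (nn a b 0 d : ℝ) / (d : ℝ) ^ 2 := fun d => rfl
  have hfm : f.IsMultiplicative := by
    rw [IsMultiplicative.iff_ne_zero]
    refine ⟨by rw [hfa, nn_one]; simp, ?_⟩
    intro m n hm hn hmn
    rw [hfa, hfa, hfa, nn_mul a b 0 hm hn hmn]
    push_cast
    rw [mul_pow, mul_div_mul_comm]
  have hprod := sum_mu_mul f hfm hR0
  have hg : ∀ d, d ∣ R → (Gc a b Q x0 y0 d d : ℝ) ≤ d * t := by
    intro d hd
    have : (Gc a b Q x0 y0 d d : ℝ) ≤ d * R.divisors.card := by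
      exact_mod_cast g_le (a := a) x0 y0 hsq hb hQ hd
    refine this.trans (by gcongr)
  have hgn : ∀ d, d ∣ R → (nn a b 0 d : ℝ) = Gc a b Q x0 y0 d d := fun d hd => by
    rw [Gc_nn x0 y0 (ne_zero_of_dvd_ne_zero hR0 hd) (hcop d hd)]
  -- the product
  have hlow : 1 / t ^ 2 ≤ ∏ p ∈ R.primeFactors, (1 - f p) := by
    have h1 : ∀ p ∈ R.primeFactors, (1 / 4 : ℝ) ≤ 1 - f p := by
      intro p hp
      have hpp := Nat.prime_of_mem_primeFactors hp
      have hpd := Nat.dvd_of_mem_primeFactors hp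
      have h3 : 3 ≤ p := by
        have := hpp.two_le
        rcases Nat.lt_or_ge p 3 with h | h
        · have : p = 2 := by omega
          subst this
          exact absurd hpd (by rw [← even_iff_two_dvd]; exact Nat.not_even_iff_odd.2 hodd)
        · exact h
      have hz : (p : ℤ) ∣ R := by exact_mod_cast hpd
      have h4 := cntT (a := a) x0 y0 hpp.squarefree (hb.of_isCoprime_of_dvd_right hz) (hcop p hpd) (l := p) (k := 1) (by omega)
      rw [hpp.divisors, card_pair hpp.one_lt.ne, mul_one] at h4
      rw [hfa, hgn p hpd]
      have h5 : (Gc a b Q x0 y0 p p : ℝ) ≤ p * 2 := by exact_mod_cast h4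
      have h6 : (3 : ℝ) ≤ p := by exact_mod_cast h3
      have : (Gc a b Q x0 y0 p p : ℝ) / (p : ℝ) ^ 2 ≤ 3 / 4 := by
        rw [div_le_iff₀ (by positivity)]
        nlinarith
      linarith
    have h2 : (1 / 4 : ℝ) ^ R.primeFactors.card ≤ ∏ p ∈ R.primeFactors, (1 - f p) := by
      rw [← prod_const]
      exact prod_le_prod (fun _ _ => by norm_num) h1
    refine le_trans ?_ h2
    have h3 : (2 : ℝ) ^ R.primeFactors.card ≤ t := le_trans (by exact_mod_cast two_pow_le_tau hR0) ht
    rw [one_div_pow]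
    have : (4 : ℝ) ^ R.primeFactors.card = (2 ^ R.primeFactors.card) ^ 2 := by
      rw [← pow_mul, mul_comm, pow_mul]; norm_num
    rw [this]
    gcongr
  rw [← hprod] at hlow
  -- split
  have hsplit := sum_filter_add_sum_filter_not R.divisors (fun d => d ≤ D0) (fun d => (μ d : ℝ) * f d)
  have hcard : ∀ P : ℕ → Prop, ∀ [DecidablePred P], ((R.divisors.filter P).card : ℝ) ≤ t := fun P _ =>
    le_trans (by exact_mod_cast card_filter_le _ _) ht
  have htail : |∑ d ∈ R.divisors.filter (fun d => ¬ d ≤ D0), (μ d : ℝ) * f d| ≤ t ^ 2 / D0 := by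
    refine (abs_sum_le_sum_abs _ _).trans ?_
    have h1 : ∀ d ∈ R.divisors.filter (fun d => ¬ d ≤ D0), |(μ d : ℝ) * f d| ≤ t / D0 := by
      intro d hd
      rw [mem_filter, not_le] at hd
      have hdR := Nat.dvd_of_mem_divisors hd.1
      have hd0 : (0 : ℝ) < d := by
        have : 0 < d := by omega
        exact_mod_cast this
      rw [abs_mul, hfa, hgn d hdR, abs_of_nonneg (a := (Gc a b Q x0 y0 d d : ℝ) / (d : ℝ) ^ 2) (by positivity)]
      have h2 : (Gc a b Q x0 y0 d d : ℝ) / (d : ℝ) ^ 2 ≤ t / D0 := by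
        rw [div_le_div_iff₀ (by positivity) hD0]
        have h3 := hg d hdR
        have h4 : (D0 : ℝ) ≤ d := by exact_mod_cast hd.2.le
        calc (Gc a b Q x0 y0 d d : ℝ) * D0 ≤ (d * t) * d := by gcongr
          _ = _ := by ring
      calc _ ≤ 1 * (t / D0) := by gcongr; exact hmu d
        _ = _ := one_mul _
    refine (sum_le_sum h1).trans ?_
    rw [sum_const, nsmul_eq_mul]
    calc _ ≤ t * (t / D0) := by gcongr; exact hcard _
      _ = _ := by ring
  have hhead : |∑ d ∈ R.divisors.filter (fun d => d ≤ D0), (μ d : ℝ) * Gc a b Q x0 y0 l d -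
      (l : ℝ) ^ 2 * ∑ d ∈ R.divisors.filter (fun d => d ≤ D0), (μ d : ℝ) * f d| ≤ t ^ 2 * (2 * l + D0) := by
    rw [mul_sum, ← sum_sub_distrib]
    refine (abs_sum_le_sum_abs _ _).trans ?_
    have h1 : ∀ d ∈ R.divisors.filter (fun d => d ≤ D0), |(μ d : ℝ) * Gc a b Q x0 y0 l d - (l : ℝ) ^ 2 * ((μ d : ℝ) * f d)| ≤ t * (2 * l + D0) := by
      intro d hd
      rw [mem_filter] at hd
      have hdR := Nat.dvd_of_mem_divisors hd.1
      have hd0 : 0 < d := Nat.pos_of_dvd_of_pos hdR (Nat.pos_of_ne_zero hR0)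
      have hd0' : (0 : ℝ) < d := by exact_mod_cast hd0
      have h2 := cnt0 a b Q x0 y0 l d hd0
      have e : (μ d : ℝ) * Gc a b Q x0 y0 l d - (l : ℝ) ^ 2 * ((μ d : ℝ) * f d) =
          μ d * (Gc a b Q x0 y0 l d - Gc a b Q x0 y0 d d * (l : ℝ) ^ 2 / d ^ 2) := by
        rw [hfa, hgn d hdR]; ring
      rw [e, abs_mul]
      calc _ ≤ 1 * ((Gc a b Q x0 y0 d d : ℝ) * (2 * (l : ℝ) / d + 1)) := by gcongr; exact hmu d
        _ ≤ 1 * ((d * t) * (2 * (l : ℝ) / d + 1)) := by gcongr; exact hg d hdR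
        _ = t * (2 * l + d) := by field_simp
        _ ≤ _ := by
          have : (d : ℝ) ≤ D0 := by exact_mod_cast hd.2
          gcongr
    refine (sum_le_sum h1).trans ?_
    rw [sum_const, nsmul_eq_mul]
    calc _ ≤ t * (t * (2 * l + D0)) := by gcongr; exact hcard _
      _ = _ := by ring
  set A := ∑ d ∈ R.divisors.filter (fun d => d ≤ D0), (μ d : ℝ) * f d
  set A' := ∑ d ∈ R.divisors.filter (fun d => ¬ d ≤ D0), (μ d : ℝ) * f d
  have h7 := (abs_le.1 hhead).1
  have h8 := (abs_le.1 htail).2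
  have h9 : 1 / t ^ 2 - t ^ 2 / D0 ≤ A := by linarith
  have h10 : (l : ℝ) ^ 2 * (1 / t ^ 2 - t ^ 2 / D0) ≤ (l : ℝ) ^ 2 * A := by gcongr
  have e : (l : ℝ) ^ 2 * (1 / t ^ 2 - t ^ 2 / D0) = (l : ℝ) ^ 2 / t ^ 2 - (l : ℝ) ^ 2 * t ^ 2 / D0 := by ring
  linarith

end sieve

/-- the sieve weight and its truncation -/
lemma eps_trunc {R : ℕ} (hR : R ≠ 0) (D0 : ℕ) (B : ℤ) :
    |(if B.natAbs.Coprime R then (1 : ℝ) else 0) -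
      ∑ d ∈ R.divisors.filter (fun d => d ≤ D0), (if (d : ℤ) ∣ B then (μ d : ℝ) else 0)| ≤
    ∑ d ∈ R.divisors.filter (fun d => ¬ d ≤ D0), (if (d : ℤ) ∣ B then (1 : ℝ) else 0) := by
  rw [← sum_mu_gcd hR]
  simp only [Int.natCast_dvd]
  rw [← sum_filter_add_sum_filter_not R.divisors (fun d => d ≤ D0), add_sub_cancel_left]
  refine (abs_sum_le_sum_abs _ _).trans (sum_le_sum fun d _ => ?_)
  split_ifs
  · exact_mod_cast abs_moebius_le_one
  · simp

end APU

set_option maxHeartbeats 400000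

namespace APU

open Finset ArithmeticFunction
open scoped ArithmeticFunction.Moebius

/-- total box error -/
noncomputable def Ebox (l X : ℕ) : ℝ := ∑ q ∈ Icc 1 X, Wt q * Eq' q ^ 2 * (1 + 2 * (l : ℝ) / q)

lemma Ebox_term (l q : ℕ) : 0 ≤ Wt q * Eq' q ^ 2 * (1 + 2 * (l : ℝ) / q) := by
  have := Wt_nonneg q
  positivity

lemma unit_of_coprime {x : ℤ} {δ : ℕ} (h : IsCoprime x (δ : ℤ)) : IsUnit (x : ZMod δ) := by
  obtain ⟨u, v, h⟩ := h
  have := congrArg (Int.cast : ℤ → ZMod δ) h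
  push_cast at this
  rw [ZMod.natCast_self, mul_zero, add_zero] at this
  exact IsUnit.of_mul_eq_one u (by rw [mul_comm]; exact this)

lemma okd_of_coprime {a b m : ℤ} {δ : ℕ} (hodd : Odd δ) (ha : IsCoprime a (δ : ℤ)) (hb : IsCoprime b (δ : ℤ))
    (hm : IsCoprime m (δ : ℤ)) : okd a b m δ := by
  intro p hp hpd
  have hz : (p : ℤ) ∣ δ := by exact_mod_cast hpd
  have hne : ∀ x : ℤ, IsCoprime x (δ : ℤ) → ¬ (p : ℤ) ∣ x := by
    intro x hx hpx
    have := hx.isUnit_of_dvd' hpx hz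
    exact hp.one_lt.ne' (by simpa using Int.isUnit_iff_natAbs_eq.1 this)
  refine ⟨?_, hne a ha, hne b hb, hne m hm⟩
  rintro rfl
  exact (Nat.not_even_iff_odd.2 hodd) (even_iff_two_dvd.2 hpd)

section moment
variable {s0 D : ℕ} {a b m Q : ℤ} (x0 y0 : ℤ) {n R l D0 Y Y1 : ℕ} {t F : ℝ}

/-- the truncated divisor sum -/
noncomputable def wz (s0 D : ℕ) (a b m Q x0 y0 : ℤ) (n Y : ℕ) (z : ℕ × ℕ) : ℝ :=
  ∑ δ ∈ (Icc 1 Y).filter (fun δ => δ.Coprime n), if (δ : ℤ) ∣ Bf a b Q x0 y0 z - m then (chi s0 D δ : ℝ) else 0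

/-- the window -/
noncomputable def Vz (s0 : ℕ) (a b m Q x0 y0 : ℤ) (n Y1 Y : ℕ) (z : ℕ × ℕ) : ℝ :=
  ∑ δ ∈ (Icc Y1 (Y + 2)).filter (fun δ => δ.Coprime s0 ∧ δ.Coprime n), if (δ : ℤ) ∣ Bf a b Q x0 y0 z - m then (1 : ℝ) else 0

theorem moment (h2 : 2 ∣ s0) 
    (hu : ∀ δ : ℕ, δ.Coprime s0 → δ.Coprime n → IsCoprime a (δ : ℤ) ∧ IsCoprime b (δ : ℤ) ∧ IsCoprime m (δ : ℤ) ∧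
      IsCoprime Q (δ : ℤ) ∧ IsCoprime (R : ℤ) (δ : ℤ))
    (hsq : Squarefree R) (hb : IsCoprime b R) (hQ : IsCoprime Q R) (hD : 1 ≤ D0)
    (ht : (R.divisors.card : ℝ) ≤ t) (htδ : ∀ δ ∈ Icc 1 (Y + 2), (δ.divisors.card : ℝ) ≤ t) (hY1 : 1 ≤ Y1) (hYY : Y1 ≤ Y)
    (hF : ∀ z ∈ range l ×ˢ range l, |wz s0 D a b m Q x0 y0 n Y z| ≤ F)
    (hV : ∀ z ∈ range l ×ˢ range l, (Bf a b Q x0 y0 z).natAbs.Coprime R →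
      2 * |wz s0 D a b m Q x0 y0 n Y z| ≤ Vz s0 a b m Q x0 y0 n Y1 Y z) :
    |∑ δ ∈ (Icc 1 Y).filter (fun δ => δ.Coprime n), (chi s0 D δ : ℝ) * nn a b m δ / δ ^ 2| *
      ∑ d ∈ R.divisors.filter (fun d => d ≤ D0), (μ d : ℝ) * Gc a b Q x0 y0 l d ≤
    (l : ℝ) ^ 2 * t * ((Y : ℝ) + 3 - Y1) / Y1 + Ebox l (Y + 2) + F * (t ^ 2 * l * (l / D0 + 1)) + t ^ 2 * D0 * Ebox l Y := by
  set S := range l ×ˢ range l with hS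
  set Δ := (Icc 1 Y).filter (fun δ => δ.Coprime n) with hΔ
  set W := ∑ δ ∈ Δ, (chi s0 D δ : ℝ) * nn a b m δ / δ ^ 2 with hW
  set w := wz s0 D a b m Q x0 y0 n Y with hw
  set DD := R.divisors.filter (fun d => d ≤ D0) with hDD
  set M := ∑ d ∈ DD, (μ d : ℝ) * Gc a b Q x0 y0 l d with hM
  have hR0 := hsq.ne_zero
  have hτ1 : (1 : ℝ) ≤ R.divisors.card := by
    have : 0 < R.divisors.card := card_pos.2 ⟨1, Nat.mem_divisors.2 ⟨one_dvd _, hR0⟩⟩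
    exact_mod_cast this
  have ht1 : 1 ≤ t := hτ1.trans ht
  have ht0 : 0 < t := by linarith
  have hE : ∀ X, 0 ≤ Ebox l X := fun X => sum_nonneg fun q _ => Ebox_term l q
  have hmu : ∀ d, |(μ d : ℝ)| ≤ 1 := fun d => by exact_mod_cast abs_moebius_le_one
  have hdR : ∀ d ∈ R.divisors, ∀ δ : ℕ, IsCoprime (R : ℤ) (δ : ℤ) → IsUnit (d : ZMod δ) := by
    intro d hd δ h
    have h1 : (d : ℤ) ∣ R := by exact_mod_cast Nat.dvd_of_mem_divisors hd
    have := unit_of_coprime (h.of_isCoprime_of_dvd_left h1)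
    exact_mod_cast this
  -- counts
  have hcnt : ∀ d ∈ R.divisors, ∀ δ : ℕ, δ ≠ 0 → δ.Coprime s0 → δ.Coprime n →
    |((S.filter fun z => (d : ℤ) ∣ Bf a b Q x0 y0 z ∧ (δ : ℤ) ∣ Bf a b Q x0 y0 z - m).card : ℝ)
      - Gc a b Q x0 y0 l d * (nn a b m δ / (δ : ℝ) ^ 2)| ≤
      Gc a b Q x0 y0 d d * (Wt δ * Eq' δ ^ 2 * (1 + 2 * l / δ)) := by
    intro d hd δ hδ h1 h2'
    obtain ⟨ua, ub, um, uQ, uR⟩ := hu δ h1 h2'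
    exact cnt1 x0 y0 l d δ (Nat.pos_of_mem_divisors hd) hδ (coprime_odd h2 h1) (unit_of_coprime ua) (unit_of_coprime ub)
      (unit_of_coprime um) (unit_of_coprime uQ) (hdR d hd δ uR)
  -- claim 1
  have c1 : |∑ z ∈ S, (∑ d ∈ DD, (if (d : ℤ) ∣ Bf a b Q x0 y0 z then (μ d : ℝ) else 0)) * w z - W * M| ≤
      t ^ 2 * D0 * Ebox l Y := by
    have e1 : ∑ z ∈ S, (∑ d ∈ DD, (if (d : ℤ) ∣ Bf a b Q x0 y0 z then (μ d : ℝ) else 0)) * w z =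
        ∑ d ∈ DD, ∑ δ ∈ Δ, (μ d : ℝ) * (chi s0 D δ : ℝ) *
          ((S.filter fun z => (d : ℤ) ∣ Bf a b Q x0 y0 z ∧ (δ : ℤ) ∣ Bf a b Q x0 y0 z - m).card : ℝ) := by
      simp only [hw, wz, sum_mul_sum]
      rw [sum_comm]
      apply sum_congr rfl
      intro d _
      rw [sum_comm]
      apply sum_congr rfl
      intro δ _
      rw [card_filter]
      push_cast
      rw [mul_sum]
      apply sum_congr rfl
      intro z _
      by_cases h1 : (d : ℤ) ∣ Bf a b Q x0 y0 z <;> by_cases h2 : (δ : ℤ) ∣ Bf a b Q x0 y0 z - m <;> simp [h1, h2]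
    have e2 : W * M = ∑ d ∈ DD, ∑ δ ∈ Δ, (μ d : ℝ) * (chi s0 D δ : ℝ) * (Gc a b Q x0 y0 l d * (nn a b m δ / (δ : ℝ) ^ 2)) := by
      rw [hW, hM, mul_comm, sum_mul_sum]
      apply sum_congr rfl
      intro d _
      apply sum_congr rfl
      intro δ _
      ring
    rw [e1, e2, ← sum_sub_distrib]
    refine (abs_sum_le_sum_abs _ _).trans ?_
    have key : ∀ d ∈ DD, |∑ δ ∈ Δ, (μ d : ℝ) * (chi s0 D δ : ℝ) *
          ((S.filter fun z => (d : ℤ) ∣ Bf a b Q x0 y0 z ∧ (δ : ℤ) ∣ Bf a b Q x0 y0 z - m).card : ℝ) -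
          ∑ δ ∈ Δ, (μ d : ℝ) * (chi s0 D δ : ℝ) * (Gc a b Q x0 y0 l d * (nn a b m δ / (δ : ℝ) ^ 2))| ≤ t * D0 * Ebox l Y := by
      intro d hd
      have hd' := mem_filter.1 hd
      rw [← sum_sub_distrib]
      refine (abs_sum_le_sum_abs _ _).trans ?_
      have hg : (Gc a b Q x0 y0 d d : ℝ) ≤ t * D0 := by
        have h1 : (Gc a b Q x0 y0 d d : ℝ) ≤ d * R.divisors.card := by
          exact_mod_cast g_le (a := a) x0 y0 hsq hb hQ (Nat.dvd_of_mem_divisors hd'.1)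
        have h2 : (d : ℝ) ≤ D0 := by exact_mod_cast hd'.2
        calc _ ≤ _ := h1
          _ ≤ (D0 : ℝ) * t := by gcongr
          _ = _ := mul_comm _ _
      unfold Ebox
      rw [mul_sum]
      refine le_trans (sum_le_sum (g := fun q => t * D0 * (Wt q * Eq' q ^ 2 * (1 + 2 * (l : ℝ) / q))) ?_)
        (sum_le_sum_of_subset_of_nonneg (filter_subset _ _) fun q _ _ => mul_nonneg (by positivity) (Ebox_term l q))
      intro δ hδ
      have hδ' := mem_filter.1 hδ
      have hδ0 : δ ≠ 0 := by have := mem_Icc.1 hδ'.1; omega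
      rw [← mul_sub, abs_mul, abs_mul]
      by_cases hc : δ.Coprime s0
      · have h1 := hcnt d hd'.1 δ hδ0 hc hδ'.2
        have h2 := Ebox_term l δ
        calc _ ≤ 1 * 1 * ((Gc a b Q x0 y0 d d : ℝ) * (Wt δ * Eq' δ ^ 2 * (1 + 2 * (l : ℝ) / δ))) := by
              gcongr
              · exact hmu d
              · exact chi_real_abs _ _ _
          _ = (Gc a b Q x0 y0 d d : ℝ) * (Wt δ * Eq' δ ^ 2 * (1 + 2 * (l : ℝ) / δ)) := by ring
          _ ≤ _ := by gcongr
      · rw [chi_eq_zero hc]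
        have := Ebox_term l δ
        simp only [Int.cast_zero, abs_zero, mul_zero, zero_mul]
        positivity
    refine (sum_le_sum key).trans ?_
    rw [sum_const, nsmul_eq_mul]
    have hc : (DD.card : ℝ) ≤ t := le_trans (by exact_mod_cast card_filter_le _ _) ht
    have := hE Y
    calc _ ≤ t * (t * D0 * Ebox l Y) := by gcongr
      _ = _ := by ring
  -- claim 2
  have c2 : |∑ z ∈ S, (if (Bf a b Q x0 y0 z).natAbs.Coprime R then (1 : ℝ) else 0) * w z -
      ∑ z ∈ S, (∑ d ∈ DD, (if (d : ℤ) ∣ Bf a b Q x0 y0 z then (μ d : ℝ) else 0)) * w z| ≤ F * (t ^ 2 * l * (l / D0 + 1)) := by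
    rw [← sum_sub_distrib]
    refine (abs_sum_le_sum_abs _ _).trans ?_
    rcases S.eq_empty_or_nonempty with hSe | ⟨z0, hz0⟩
    · rw [hSe, sum_empty]
      have hl : l = 0 := by simpa [hS] using hSe
      rw [hl]; simp
    have hF0 : 0 ≤ F := (abs_nonneg _).trans (hF z0 hz0)
    have h1 : ∀ z ∈ S, |(if (Bf a b Q x0 y0 z).natAbs.Coprime R then (1 : ℝ) else 0) * w z -
        (∑ d ∈ DD, (if (d : ℤ) ∣ Bf a b Q x0 y0 z then (μ d : ℝ) else 0)) * w z| ≤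
        F * ∑ d ∈ R.divisors.filter (fun d => ¬ d ≤ D0), (if (d : ℤ) ∣ Bf a b Q x0 y0 z then (1 : ℝ) else 0) := by
      intro z hz
      rw [← sub_mul, abs_mul, mul_comm F]
      have := eps_trunc hR0 D0 (Bf a b Q x0 y0 z)
      have h3 := hF z hz
      gcongr
    refine (sum_le_sum h1).trans ?_
    rw [← mul_sum, sum_comm]
    have h4 := sieve_tail (a := a) x0 y0 (l := l) hsq hb hQ hD ht
    refine mul_le_mul_of_nonneg_left (le_trans (le_of_eq ?_) h4) hF0
    apply sum_congr rfl
    intro d _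
    unfold Gc
    rw [card_filter]
    push_cast
    rfl
  -- claim 3
  have c3 : |∑ z ∈ S, (if (Bf a b Q x0 y0 z).natAbs.Coprime R then (1 : ℝ) else 0) * w z| ≤
      (l : ℝ) ^ 2 * t * ((Y : ℝ) + 3 - Y1) / Y1 + Ebox l (Y + 2) := by
    refine (abs_sum_le_sum_abs _ _).trans ?_
    have hV0 : ∀ z, 0 ≤ Vz s0 a b m Q x0 y0 n Y1 Y z := fun z => sum_nonneg fun δ _ => by split_ifs <;> norm_num
    have h1 : ∀ z ∈ S, |(if (Bf a b Q x0 y0 z).natAbs.Coprime R then (1 : ℝ) else 0) * w z| ≤ Vz s0 a b m Q x0 y0 n Y1 Y z := by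
      intro z hz
      by_cases h : (Bf a b Q x0 y0 z).natAbs.Coprime R
      · rw [if_pos h, one_mul]
        have := hV z hz h
        have := abs_nonneg (w z)
        linarith
      · rw [if_neg h, zero_mul, abs_zero]; exact hV0 z
    refine (sum_le_sum h1).trans ?_
    unfold Vz
    rw [sum_comm]
    have h3 : ∀ δ ∈ (Icc Y1 (Y + 2)).filter (fun δ => δ.Coprime s0 ∧ δ.Coprime n),
        ∑ z ∈ S, (if (δ : ℤ) ∣ Bf a b Q x0 y0 z - m then (1 : ℝ) else 0) ≤
        (l : ℝ) ^ 2 * t / Y1 + Wt δ * Eq' δ ^ 2 * (1 + 2 * (l : ℝ) / δ) := by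
      intro δ hδ
      rw [mem_filter, mem_Icc] at hδ
      obtain ⟨⟨hδ1, hδ2⟩, hδ3, hδ4⟩ := hδ
      have hδ0 : δ ≠ 0 := by omega
      have hδR : (0 : ℝ) < δ := by exact_mod_cast Nat.pos_of_ne_zero hδ0
      have h4 := hcnt 1 (Nat.mem_divisors.2 ⟨one_dvd _, hR0⟩) δ hδ0 hδ3 hδ4
      have g1 : ∀ l : ℕ, Gc a b Q x0 y0 l 1 = l ^ 2 := by
        intro l
        unfold Gc
        rw [filter_true_of_mem]
        · rw [card_product, card_range, sq]
        · intro z _; simp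
      rw [g1, g1] at h4
      simp only [Nat.cast_one, one_dvd, true_and, one_pow, one_mul, isUnit_one, IsUnit.dvd] at h4
      have h5 := (abs_le.1 h4).2
      obtain ⟨ua, ub, um, uQ, uR⟩ := hu δ hδ3 hδ4
      have h6 := nn_div_le a b m hδ0 (okd_of_coprime (coprime_odd h2 hδ3) ua ub um)
      have h7 := htδ δ (mem_Icc.2 ⟨by omega, hδ2⟩)
      have hY1R : (0 : ℝ) < Y1 := by exact_mod_cast hY1
      have h8 : (nn a b m δ : ℝ) / (δ : ℝ) ^ 2 ≤ t / Y1 := by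
        have : (nn a b m δ : ℝ) / (δ : ℝ) ^ 2 = (nn a b m δ : ℝ) / δ / δ := by rw [sq, div_div]
        rw [this]
        have : (Y1 : ℝ) ≤ δ := by exact_mod_cast hδ1
        have h9 := h6.trans h7
        gcongr
      have h10 : ((l ^ 2 : ℕ) : ℝ) * ((nn a b m δ : ℝ) / (δ : ℝ) ^ 2) ≤ (l : ℝ) ^ 2 * (t / Y1) := by
        push_cast; gcongr
      have e : ∑ z ∈ S, (if (δ : ℤ) ∣ Bf a b Q x0 y0 z - m then (1 : ℝ) else 0) =
          ((S.filter fun z => (δ : ℤ) ∣ Bf a b Q x0 y0 z - m).card : ℝ) := by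
        rw [card_filter]; push_cast; rfl
      rw [e, mul_div_assoc]
      linarith
    refine (sum_le_sum h3).trans ?_
    rw [sum_add_distrib, sum_const, nsmul_eq_mul]
    have hY1R : (0 : ℝ) < Y1 := by exact_mod_cast hY1
    have h11 : ((((Icc Y1 (Y + 2)).filter (fun δ => δ.Coprime s0 ∧ δ.Coprime n)).card : ℕ) : ℝ) ≤ (Y : ℝ) + 3 - Y1 := by
      have := card_filter_le (Icc Y1 (Y + 2)) (fun δ => δ.Coprime s0 ∧ δ.Coprime n)
      rw [Nat.card_Icc] at this
      have h12 : ((Icc Y1 (Y + 2)).filter (fun δ => δ.Coprime s0 ∧ δ.Coprime n)).card + Y1 ≤ Y + 3 := by omega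
      have h13 : ((((Icc Y1 (Y + 2)).filter (fun δ => δ.Coprime s0 ∧ δ.Coprime n)).card : ℕ) : ℝ) + Y1 ≤ (Y : ℝ) + 3 := by exact_mod_cast h12
      linarith
    apply add_le_add
    · calc _ ≤ ((Y : ℝ) + 3 - Y1) * ((l : ℝ) ^ 2 * t / Y1) := by gcongr
        _ = _ := by ring
    · unfold Ebox
      apply sum_le_sum_of_subset_of_nonneg
      · intro δ hδ
        rw [mem_filter, mem_Icc] at hδ
        rw [mem_Icc]; omega
      · intro q _ _; exact Ebox_term l q
  have c4 : |W| * M ≤ |W * M| := by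
    rw [abs_mul]; gcongr; exact le_abs_self M
  have c5 := abs_le.1 c1
  have c6 := abs_le.1 c2
  have c7 := abs_le.1 c3
  refine c4.trans (abs_le.2 ⟨?_, ?_⟩) <;> linarith

end moment

end APU

set_option maxHeartbeats 400000

namespace APU

open Finset ArithmeticFunction
open scoped ArithmeticFunction.Moebius

/-- Dirichlet's hyperbola trick with a window. -/
lemma window {s0 D : ℕ} (hD : 2 * D ∣ s0) {k Y Y1 : ℕ} (hk : 0 < k) (hkc : k.Coprime s0)
    (hchi : chi s0 D k = 1) (hrho : rho s0 D k = 0) (hY : k < (Y + 1) ^ 2) (hY1 : Y1 * Y ≤ k) :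
    2 * |∑ δ ∈ k.divisors.filter (fun δ => δ ≤ Y), chi s0 D δ| ≤
      (k.divisors.filter (fun δ => Y1 ≤ δ ∧ δ ≤ Y)).card := by
  have h2 : 2 ∣ s0 := (dvd_mul_right 2 D).trans hD
  have hDs : D ∣ s0 := (dvd_mul_left D 2).trans hD
  have hinv : ∀ δ ∈ k.divisors, chi s0 D (k / δ) = chi s0 D δ := by
    intro δ hδ
    have hd := Nat.dvd_of_mem_divisors hδ
    have h3 := chi_mul h2 D δ (k / δ)
    rw [Nat.mul_div_cancel' hd, hchi] at h3
    rcases chi_sq hDs (Nat.Coprime.coprime_dvd_left hd hkc) with h | h <;> rw [h] at h3 ⊢ <;> linarith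
  have e1 : rho s0 D k = ∑ δ ∈ k.divisors.filter (fun δ => δ ≤ Y), chi s0 D δ +
      ∑ δ ∈ k.divisors.filter (fun δ => ¬ δ ≤ Y), chi s0 D δ := by
    unfold rho
    rw [sum_filter_add_sum_filter_not]
  have e2 : ∑ δ ∈ k.divisors.filter (fun δ => ¬ δ ≤ Y), chi s0 D δ =
      ∑ δ ∈ k.divisors.filter (fun δ => ¬ k / δ ≤ Y), chi s0 D δ := by
    rw [sum_filter, sum_filter, ← Nat.sum_div_divisors]
    apply sum_congr rfl
    intro δ hδ
    rw [hinv δ hδ]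
  have e3 : k.divisors.filter (fun δ => ¬ k / δ ≤ Y) = (k.divisors.filter (fun δ => δ ≤ Y)).filter (fun δ => ¬ k / δ ≤ Y) := by
    ext δ
    simp only [mem_filter]
    constructor
    · rintro ⟨h1, h3⟩
      refine ⟨⟨h1, ?_⟩, h3⟩
      by_contra h4
      have h5 := Nat.div_mul_cancel (Nat.dvd_of_mem_divisors h1)
      nlinarith
    · rintro ⟨⟨h1, _⟩, h3⟩
      exact ⟨h1, h3⟩
  have e4 := sum_filter_add_sum_filter_not (k.divisors.filter (fun δ => δ ≤ Y)) (fun δ => k / δ ≤ Y) (fun δ => chi s0 D δ)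
  have h5 : |∑ δ ∈ (k.divisors.filter (fun δ => δ ≤ Y)).filter (fun δ => k / δ ≤ Y), chi s0 D δ| ≤
      (k.divisors.filter (fun δ => Y1 ≤ δ ∧ δ ≤ Y)).card := by
    refine (abs_sum_le_sum_abs _ _).trans ?_
    have : ∑ δ ∈ (k.divisors.filter (fun δ => δ ≤ Y)).filter (fun δ => k / δ ≤ Y), |chi s0 D δ| ≤
        ((k.divisors.filter (fun δ => δ ≤ Y)).filter (fun δ => k / δ ≤ Y)).card := by
      rw [card_eq_sum_ones]; push_cast
      exact sum_le_sum fun δ _ => chi_abs_le _ _ _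
    refine this.trans ?_
    have : (k.divisors.filter (fun δ => δ ≤ Y)).filter (fun δ => k / δ ≤ Y) ⊆ k.divisors.filter (fun δ => Y1 ≤ δ ∧ δ ≤ Y) := by
      intro δ hδ
      simp only [mem_filter] at hδ ⊢
      refine ⟨hδ.1.1, ?_, hδ.1.2⟩
      have h5 := Nat.div_mul_cancel (Nat.dvd_of_mem_divisors hδ.1.1)
      have hY0 : 0 < Y := by
        rcases Nat.eq_zero_or_pos Y with h | h
        · subst h; have := hδ.2; have : k / δ = 0 := by omega
          rw [this] at h5; omega
        · exact h
      by_contra h6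
      have h7 : δ * Y < Y1 * Y := by nlinarith
      have h8 : k / δ * δ ≤ Y * δ := Nat.mul_le_mul_right _ hδ.2
      nlinarith
    exact_mod_cast card_le_card this
  rw [hrho, e2, e3] at e1
  set X := ∑ δ ∈ k.divisors.filter (fun δ => δ ≤ Y), chi s0 D δ
  rw [show (2 : ℤ) * |X| = |2 * X| by rw [abs_mul]; norm_num]
  rw [show 2 * X = ∑ δ ∈ (k.divisors.filter (fun δ => δ ≤ Y)).filter (fun δ => k / δ ≤ Y), chi s0 D δ by linarith]
  exact h5

/-- Divisors of `k` versus divisors of `m - B`. -/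
lemma dvd_transfer {s0 n H A1 ν m : ℕ} {B k : ℤ} (hn : n = H * m) (hA1 : A1 ∣ s0)
    (hν : ∀ p : ℕ, p.Prime → p ∣ ν → p ∣ s0) (heq : (A1 : ℤ) * (m - B) = ν * H ^ 2 * k) {δ : ℕ}
    (h1 : δ.Coprime s0) (h2 : δ.Coprime n) : (δ : ℤ) ∣ B - m ↔ (δ : ℤ) ∣ k := by
  have cA : IsCoprime (δ : ℤ) (A1 : ℤ) := Nat.isCoprime_iff_coprime.2 (h1.coprime_dvd_right hA1)
  have cν : IsCoprime (δ : ℤ) (ν : ℤ) := by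
    rw [Nat.isCoprime_iff_coprime]
    apply Nat.coprime_of_dvd
    intro p hp h3 h4
    have := Nat.dvd_gcd h3 (hν p hp h4)
    rw [h1] at this
    exact hp.one_lt.ne' (Nat.dvd_one.1 this)
  have cH : IsCoprime (δ : ℤ) ((H : ℤ) ^ 2) := by
    apply IsCoprime.pow_right
    exact Nat.isCoprime_iff_coprime.2 (h2.coprime_dvd_right ⟨m, hn⟩)
  constructor
  · intro h
    have h3 : (δ : ℤ) ∣ ν * H ^ 2 * k := by
      rw [← heq]
      exact Dvd.dvd.mul_left (by rw [← neg_sub]; exact (dvd_neg).2 h) _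
    exact (cν.mul_right cH).dvd_of_dvd_mul_left h3
  · intro h
    have h3 : (δ : ℤ) ∣ (A1 : ℤ) * (m - B) := by rw [heq]; exact h.mul_left _
    rw [← neg_sub]
    exact (dvd_neg).2 (cA.dvd_of_dvd_mul_left h3)

end APU

set_option maxHeartbeats 400000

namespace APU

lemma numerics (c C C5 κ : ℝ) (hc : 0 < c) (hC : 0 < C) (hC5 : 0 < C5) (hκ : 0 < κ) : ∃ U0 : ℝ, 1 ≤ U0 ∧ ∀ u ≥ U0,
    ∀ L Y D0 Y1 W M E1 E2 : ℝ, u ^ 4890 ≤ L → u ^ 4990 ≤ Y → u ^ 200 ≤ D0 → D0 ≤ u ^ 201 →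
    Y * (1 - κ / u ^ 200) - 1 ≤ Y1 → c / u - C * u * u / Y ≤ W →
    L ^ 2 / u ^ 2 - u ^ 2 * (2 * L + D0) - L ^ 2 * u ^ 2 / D0 ≤ M →
    E1 ≤ C5 * u ^ 5 * (u ^ 8754 + L * u ^ 4502) → E2 ≤ C5 * u ^ 5 * (u ^ 8754 + L * u ^ 4502) →
    W * M ≤ L ^ 2 * u * (Y + 3 - Y1) / Y1 + E1 + u * (u ^ 2 * L * (L / D0 + 1)) + u ^ 2 * D0 * E2 → False := by
  refine ⟨max (max 100 (2 / c)) (max (max C C5) κ), le_trans (by norm_num) ((le_max_left _ _).trans (le_max_left _ _)), ?_⟩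
  intro u hu L Y D0 Y1 W M E1 E2 hL hY hD1 hD2 hY1 hW hM hE1 hE2 hmain
  have hu100 : 100 ≤ u := le_trans ((le_max_left _ _).trans (le_max_left _ _)) hu
  have huc : 2 / c ≤ u := le_trans ((le_max_right _ _).trans (le_max_left _ _)) hu
  have huC : C ≤ u := le_trans (((le_max_left _ _).trans (le_max_left _ _)).trans (le_max_right _ _)) hu
  have huC5 : C5 ≤ u := le_trans (((le_max_right _ _).trans (le_max_left _ _)).trans (le_max_right _ _)) hu
  have huκ : κ ≤ u := le_trans ((le_max_right _ _).trans (le_max_right _ _)) hu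
  have hu0 : 0 < u := by linarith
  have hu1 : 1 ≤ u := by linarith
  have hL0 : 0 < L := lt_of_lt_of_le (by positivity) hL
  have hY0 : 0 < Y := lt_of_lt_of_le (by positivity) hY
  have hD0 : 0 < D0 := lt_of_lt_of_le (by positivity) hD1
  have mono : ∀ i j : ℕ, i ≤ j → u ^ i ≤ u ^ j := fun i j h => pow_le_pow_right₀ hu1 h
  -- lower bound for W
  have hcu : 2 / u ≤ c := by
    rw [div_le_iff₀ hc] at huc
    rw [div_le_iff₀ hu0]; linarith
  have w1 : C * u * u / Y ≤ 1 / u ^ 2 := by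
    rw [div_le_div_iff₀ hY0 (by positivity)]
    calc C * u * u * u ^ 2 ≤ u * u * u * u ^ 2 := by gcongr
      _ = u ^ 5 := by ring
      _ ≤ u ^ 4990 := mono _ _ (by norm_num)
      _ ≤ _ := by linarith
  have w2 : 2 / u ^ 2 ≤ c / u := by
    rw [sq, ← div_div]; gcongr
  have w3 : 1 / u ^ 2 ≤ W := by
    have : 2 / u ^ 2 = 1 / u ^ 2 + 1 / u ^ 2 := by ring
    linarith
  -- lower bound for M
  have m1 : u ^ 2 * (2 * L + D0) ≤ L ^ 2 / u ^ 50 := by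
    rw [le_div_iff₀ (by positivity)]
    have h1 : 2 * L + D0 ≤ u * L := by
      have : D0 ≤ L := hD2.trans ((mono 201 4890 (by norm_num)).trans hL)
      nlinarith
    calc u ^ 2 * (2 * L + D0) * u ^ 50 ≤ u ^ 2 * (u * L) * u ^ 50 := by gcongr
      _ = u ^ 53 * L := by ring
      _ ≤ u ^ 4890 * L := mul_le_mul_of_nonneg_right (mono _ _ (by norm_num)) hL0.le
      _ ≤ L * L := by gcongr
      _ = _ := by ring
  have m2 : L ^ 2 * u ^ 2 / D0 ≤ L ^ 2 / u ^ 50 := by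
    rw [div_le_div_iff₀ hD0 (by positivity)]
    calc L ^ 2 * u ^ 2 * u ^ 50 = L ^ 2 * u ^ 52 := by ring
      _ ≤ L ^ 2 * u ^ 200 := mul_le_mul_of_nonneg_left (mono _ _ (by norm_num)) (by positivity)
      _ ≤ _ := by gcongr
  have m3 : L ^ 2 / u ^ 50 ≤ L ^ 2 / u ^ 2 / 100 := by
    rw [div_div]
    gcongr
    calc u ^ 2 * 100 ≤ u ^ 2 * u := by gcongr
      _ = u ^ 3 := by ring
      _ ≤ _ := mono _ _ (by norm_num)
  have mp : 0 < L ^ 2 / u ^ 2 := by positivity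
  have m4 : L ^ 2 / u ^ 2 / 2 ≤ M := by linarith
  have lower : L ^ 2 / u ^ 2 / 2 * (1 / u ^ 2) ≤ W * M := by
    have hM0 : 0 ≤ M := by linarith
    rw [mul_comm W]; gcongr
  -- upper bounds
  have k1 : κ / u ^ 200 ≤ 1 / u ^ 199 := by
    rw [div_le_div_iff₀ (by positivity) (by positivity)]
    calc κ * u ^ 199 ≤ u * u ^ 199 := by gcongr
      _ = _ := by ring
  have k2 : 1 / u ^ 199 ≤ 1 / 100 := by
    gcongr
    calc (100 : ℝ) ≤ u := hu100
      _ = u ^ 1 := by ring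
      _ ≤ _ := mono _ _ (by norm_num)
  have hY100 : u ^ 200 ≤ Y := (mono 200 4990 (by norm_num)).trans hY
  have hYY : 100 ≤ Y := by
    calc (100 : ℝ) ≤ u := hu100
      _ = u ^ 1 := by ring
      _ ≤ _ := mono 1 200 (by norm_num)
      _ ≤ _ := hY100
  have y1 : Y / 2 ≤ Y1 := by nlinarith
  have hY10 : 0 < Y1 := by linarith
  have x1 : L ^ 2 * u * (Y + 3 - Y1) / Y1 ≤ L ^ 2 / u ^ 50 := by
    rw [div_le_div_iff₀ hY10 (by positivity)]
    have h1 : (Y + 3 - Y1) * u ^ 199 ≤ Y * 5 := by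
      have : Y + 3 - Y1 ≤ Y * (1 / u ^ 199) + 4 := by nlinarith
      calc (Y + 3 - Y1) * u ^ 199 ≤ (Y * (1 / u ^ 199) + 4) * u ^ 199 := by gcongr
        _ = Y + 4 * u ^ 199 := by field_simp
        _ ≤ _ := by
          have := mono 199 200 (by norm_num)
          linarith
    have h2 : u ^ 51 * 10 ≤ u ^ 199 := by
      calc u ^ 51 * 10 ≤ u ^ 51 * u := by gcongr; linarith
        _ = u ^ 52 := by ring
        _ ≤ _ := mono _ _ (by norm_num)
    rcases le_or_gt (Y + 3 - Y1) 0 with h3 | h3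
    · calc L ^ 2 * u * (Y + 3 - Y1) * u ^ 50 = (L ^ 2 * u * u ^ 50) * (Y + 3 - Y1) := by ring
        _ ≤ 0 := mul_nonpos_of_nonneg_of_nonpos (by positivity) h3
        _ ≤ _ := by positivity
    · have h4 : (Y + 3 - Y1) * (u ^ 51 * 10) ≤ Y * 5 := le_trans (by gcongr) h1
      have h5 : (Y + 3 - Y1) * u ^ 51 ≤ Y1 := by linarith
      calc L ^ 2 * u * (Y + 3 - Y1) * u ^ 50 = L ^ 2 * ((Y + 3 - Y1) * u ^ 51) := by ring
        _ ≤ _ := by gcongr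
  have e0 : C5 * u ^ 5 * (u ^ 8754 + L * u ^ 4502) ≤ L ^ 2 / u ^ 300 := by
    rw [le_div_iff₀ (by positivity)]
    have h1 : u ^ 8754 ≤ L ^ 2 / u ^ 388 := by
      rw [le_div_iff₀ (by positivity)]
      calc u ^ 8754 * u ^ 388 = u ^ 9142 := by ring
        _ ≤ u ^ 9780 := mono _ _ (by norm_num)
        _ = (u ^ 4890) ^ 2 := by ring
        _ ≤ _ := by gcongr
    have h2 : L * u ^ 4502 ≤ L ^ 2 / u ^ 388 := by
      rw [le_div_iff₀ (by positivity)]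
      calc L * u ^ 4502 * u ^ 388 = L * u ^ 4890 := by ring
        _ ≤ L * L := by gcongr
        _ = _ := by ring
    calc C5 * u ^ 5 * (u ^ 8754 + L * u ^ 4502) * u ^ 300 ≤ u * u ^ 5 * (L ^ 2 / u ^ 388 + L ^ 2 / u ^ 388) * u ^ 300 := by gcongr
      _ = L ^ 2 * (2 * u ^ 306 / u ^ 388) := by ring
      _ ≤ L ^ 2 * 1 := by
        gcongr
        rw [div_le_one (by positivity)]
        calc 2 * u ^ 306 ≤ u * u ^ 306 := by gcongr; linarith
          _ = u ^ 307 := by ring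
          _ ≤ _ := mono _ _ (by norm_num)
      _ = _ := by ring
  have x2 : E1 ≤ L ^ 2 / u ^ 50 := by
    refine (hE1.trans e0).trans ?_
    exact div_le_div_of_nonneg_left (by positivity) (by positivity) (mono _ _ (by norm_num))
  have x3 : u * (u ^ 2 * L * (L / D0 + 1)) ≤ L ^ 2 / u ^ 50 := by
    rw [le_div_iff₀ (by positivity)]
    have h1 : L / D0 + 1 ≤ 2 * L / u ^ 200 := by
      have h2 : L / D0 ≤ L / u ^ 200 := by gcongr
      have h3 : 1 ≤ L / u ^ 200 := by
        rw [one_le_div (by positivity)]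
        exact (mono 200 4890 (by norm_num)).trans hL
      rw [mul_div_assoc]; linarith
    calc u * (u ^ 2 * L * (L / D0 + 1)) * u ^ 50 ≤ u * (u ^ 2 * L * (2 * L / u ^ 200)) * u ^ 50 := by gcongr
      _ = L ^ 2 * (2 * u ^ 53 / u ^ 200) := by ring
      _ ≤ L ^ 2 * 1 := by
        gcongr
        rw [div_le_one (by positivity)]
        calc 2 * u ^ 53 ≤ u * u ^ 53 := by gcongr; linarith
          _ = u ^ 54 := by ring
          _ ≤ _ := mono _ _ (by norm_num)
      _ = _ := by ring
  have x4 : u ^ 2 * D0 * E2 ≤ L ^ 2 / u ^ 50 := by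
    calc u ^ 2 * D0 * E2 ≤ u ^ 2 * D0 * (L ^ 2 / u ^ 300) := by
          have := hE2.trans e0
          gcongr
      _ ≤ u ^ 2 * u ^ 201 * (L ^ 2 / u ^ 300) := by gcongr
      _ = L ^ 2 * (u ^ 203 / u ^ 300) := by ring
      _ ≤ L ^ 2 * (1 / u ^ 50) := by
        apply mul_le_mul_of_nonneg_left _ (by positivity)
        rw [div_le_div_iff₀ (by positivity) (by positivity)]
        calc u ^ 203 * u ^ 50 = u ^ 253 := by ring
          _ ≤ 1 * u ^ 300 := by rw [one_mul]; exact mono _ _ (by norm_num)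
      _ = _ := by ring
  have fin : L ^ 2 / u ^ 50 ≤ L ^ 2 / u ^ 2 * (1 / u ^ 2) / 100 := by
    have : L ^ 2 / u ^ 2 * (1 / u ^ 2) / 100 = L ^ 2 / (u ^ 4 * 100) := by field_simp
    rw [this]
    gcongr
    calc u ^ 4 * 100 ≤ u ^ 4 * u := by gcongr
      _ = u ^ 5 := by ring
      _ ≤ _ := mono _ _ (by norm_num)
  have pos : 0 < L ^ 2 / u ^ 2 * (1 / u ^ 2) := by positivity
  linarith

end APU

set_option maxHeartbeats 400000

namespace APU
open Finset

lemma params (K0 : ℝ) : ∃ m0 : ℕ, ∀ m : ℕ, m0 ≤ m → ∃ u : ℝ, K0 ≤ u ∧ 1 ≤ u ∧ u ^ 10000 = (m : ℝ) ∧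
    (∀ n : ℕ, 1 ≤ n → (n : ℝ) ≤ u ^ 40000 → (n.divisors.card : ℝ) ≤ u) ∧
    ∀ x : ℝ, 1 ≤ x → x ≤ u ^ 40000 → 1 + Real.log x ≤ u := by
  obtain ⟨C, hC, hτ⟩ := tau_bound (1 / 80000) (by norm_num)
  have hlog : ∀ᶠ u : ℝ in Filter.atTop, 40000 * Real.log u ≤ u / 2 := by
    have := Real.isLittleO_log_id_atTop.bound (c := 1 / 80000) (by norm_num)
    filter_upwards [this, Filter.eventually_ge_atTop 1] with u hu h1
    rw [Real.norm_of_nonneg (Real.log_nonneg h1), id, Real.norm_of_nonneg (by linarith)] at hu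
    linarith
  have htend : Filter.Tendsto (fun m : ℕ => (m : ℝ) ^ (1 / 10000 : ℝ)) Filter.atTop Filter.atTop :=
    (tendsto_rpow_atTop (by norm_num)).comp tendsto_natCast_atTop_atTop
  have hev := htend.eventually (hlog.and ((Filter.eventually_ge_atTop K0).and
    ((Filter.eventually_ge_atTop 2).and (Filter.eventually_ge_atTop (C ^ 2)))))
  obtain ⟨m0, hm0⟩ := Filter.eventually_atTop.1 hev
  refine ⟨m0, fun m hm => ⟨(m : ℝ) ^ (1 / 10000 : ℝ), ?_⟩⟩
  obtain ⟨h1, h2, h3, h4⟩ := hm0 m hm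
  set u := (m : ℝ) ^ (1 / 10000 : ℝ) with hu
  have hu0 : 0 < u := by linarith
  have hum : u ^ 10000 = (m : ℝ) := by
    rw [hu, ← Real.rpow_natCast, ← Real.rpow_mul (by positivity)]
    norm_num
  refine ⟨h2, by linarith, hum, ?_, ?_⟩
  · intro n hn hnm
    refine (hτ n hn).trans ?_
    have h5 : (n : ℝ) ^ (1 / 80000 : ℝ) ≤ u ^ (1 / 2 : ℝ) := by
      calc (n : ℝ) ^ (1 / 80000 : ℝ) ≤ (u ^ 40000) ^ (1 / 80000 : ℝ) :=
            Real.rpow_le_rpow (by positivity) hnm (by norm_num)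
        _ = u ^ (1 / 2 : ℝ) := by
            rw [← Real.rpow_natCast, ← Real.rpow_mul hu0.le]; norm_num
    have h6 : C ≤ u ^ (1 / 2 : ℝ) := by
      rw [← Real.sqrt_eq_rpow]
      exact Real.le_sqrt_of_sq_le h4
    calc C * (n : ℝ) ^ (1 / 80000 : ℝ) ≤ u ^ (1 / 2 : ℝ) * u ^ (1 / 2 : ℝ) :=
          mul_le_mul h6 h5 (by positivity) (by positivity)
      _ = u := by rw [← Real.rpow_add hu0]; norm_num
  · intro x hx hxm
    have : Real.log x ≤ 40000 * Real.log u := by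
      calc Real.log x ≤ Real.log (u ^ 40000) := Real.log_le_log (by linarith) hxm
        _ = _ := by rw [Real.log_pow]; norm_num
    linarith

lemma wz_abs_le {s0 D : ℕ} {a b m Q x0 y0 : ℤ} {n Y : ℕ} {z : ℕ × ℕ} (h : Bf a b Q x0 y0 z - m ≠ 0) :
    |wz s0 D a b m Q x0 y0 n Y z| ≤ ((Bf a b Q x0 y0 z - m).natAbs.divisors.card : ℝ) := by
  unfold wz
  refine (abs_sum_le_sum_abs _ _).trans ?_
  rw [card_eq_sum_ones, Nat.cast_sum]
  calc ∑ δ ∈ (Icc 1 Y).filter (fun δ => δ.Coprime n), |if (δ : ℤ) ∣ Bf a b Q x0 y0 z - m then (chi s0 D δ : ℝ) else 0|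
      ≤ ∑ δ ∈ (Icc 1 Y).filter (fun δ => δ.Coprime n), if (δ : ℤ) ∣ Bf a b Q x0 y0 z - m then (1 : ℝ) else 0 := by
        apply sum_le_sum
        intro δ _
        split_ifs
        · exact chi_real_abs _ _ _
        · simp
    _ = ∑ δ ∈ ((Icc 1 Y).filter (fun δ => δ.Coprime n)).filter (fun δ : ℕ => (δ : ℤ) ∣ Bf a b Q x0 y0 z - m), (1 : ℝ) := by
        rw [← sum_filter]
    _ ≤ _ := by
        push_cast
        apply sum_le_sum_of_subset_of_nonneg
        · intro δ hδ
          rw [mem_filter] at hδ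
          exact Nat.mem_divisors.2 ⟨Int.natCast_dvd.1 hδ.2, Int.natAbs_ne_zero.2 h⟩
        · intros; norm_num

lemma hV_step {s0 D A1 ν H m n R : ℕ} {a b Q x0 y0 : ℤ} {Y Y1 : ℕ} {z : ℕ × ℕ} {k : ℤ} (hs : 0 < s0) (hD : 2 * D ∣ s0)
    (hA1 : A1 ∣ s0) (hν : ∀ p : ℕ, p.Prime → p ∣ ν → p ∣ s0) (hn : n = H * m) (hY1 : 1 ≤ Y1)
    (hR : ∀ p : ℕ, p.Prime → ¬ p ∣ s0 → p ∣ m → p ∣ R)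
    (heq : (A1 : ℤ) * (m - Bf a b Q x0 y0 z) = ν * H ^ 2 * k) (hk : 0 < k) (hkc : IsCoprime k ((s0 : ℤ) * H))
    (hchi : chi s0 D k.toNat = 1) (hrho : rho s0 D k.toNat = 0) (hcop : (Bf a b Q x0 y0 z).natAbs.Coprime R)
    (hY : k.toNat < (Y + 1) ^ 2) (hYY : Y1 * Y ≤ k.toNat) :
    2 * |wz s0 D a b m Q x0 y0 n Y z| ≤ Vz s0 a b m Q x0 y0 n Y1 Y z := by
  obtain ⟨k', rfl⟩ : ∃ k' : ℕ, k = k' := ⟨k.toNat, (Int.toNat_of_nonneg hk.le).symm⟩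
  rw [Int.toNat_natCast] at *
  have hk' : 0 < k' := by exact_mod_cast hk
  set B := Bf a b Q x0 y0 z with hB
  have c1 : k'.Coprime (s0 * H) := by
    rw [← Nat.isCoprime_iff_coprime]; exact_mod_cast hkc
  have cs : k'.Coprime s0 := c1.coprime_dvd_right (dvd_mul_right _ _)
  have cH : k'.Coprime H := c1.coprime_dvd_right (dvd_mul_left _ _)
  have cm : k'.Coprime m := by
    apply Nat.coprime_of_dvd
    intro p hp h1 h2
    have h3 : ¬ p ∣ s0 := fun h3 => hp.one_lt.ne' (Nat.dvd_one.1 (by rw [← cs]; exact Nat.dvd_gcd h1 h3))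
    have h4 : (p : ℤ) ∣ (A1 : ℤ) * (m - B) := by
      rw [heq]; exact Dvd.dvd.mul_left (by exact_mod_cast h1) _
    have h5 : (p : ℤ) ∣ m - B := by
      rcases (Nat.prime_iff_prime_int.1 hp).dvd_or_dvd h4 with h5 | h5
      · exact absurd ((by exact_mod_cast h5 : p ∣ A1).trans hA1) h3
      · exact h5
    have h6 : (p : ℤ) ∣ B := by
      have : (p : ℤ) ∣ m := by exact_mod_cast h2
      have := dvd_sub this h5
      rwa [sub_sub_cancel] at this
    have h7 : p ∣ B.natAbs := Int.natCast_dvd.1 h6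
    exact hp.one_lt.ne' (Nat.dvd_one.1 (by rw [← hcop]; exact Nat.dvd_gcd h7 (hR p hp h3 h2)))
  have cn : k'.Coprime n := by rw [hn]; exact Nat.Coprime.mul_right cH cm
  have hw := window hD hk' cs hchi hrho hY hYY
  have e1 : wz s0 D a b m Q x0 y0 n Y z = ((∑ δ ∈ k'.divisors.filter (fun δ => δ ≤ Y), chi s0 D δ : ℤ) : ℝ) := by
    unfold wz
    rw [← sum_filter]
    push_cast
    symm
    apply sum_subset
    · intro δ hδ
      rw [mem_filter, Nat.mem_divisors] at hδ
      have h1 := Nat.Coprime.coprime_dvd_left hδ.1.1 cn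
      have h2 := Nat.Coprime.coprime_dvd_left hδ.1.1 cs
      rw [mem_filter, mem_filter, mem_Icc]
      refine ⟨⟨⟨Nat.pos_of_dvd_of_pos hδ.1.1 hk', hδ.2⟩, h1⟩, ?_⟩
      exact (dvd_transfer hn hA1 hν heq h2 h1).2 (by exact_mod_cast hδ.1.1)
    · intro δ hδ hnot
      rw [mem_filter, mem_filter, mem_Icc] at hδ
      by_cases h2 : δ.Coprime s0
      · exfalso; apply hnot
        rw [mem_filter, Nat.mem_divisors]
        refine ⟨⟨?_, hk'.ne'⟩, hδ.1.1.2⟩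
        exact_mod_cast (dvd_transfer hn hA1 hν heq h2 hδ.1.2).1 hδ.2
      · rw [chi_eq_zero h2]; simp
  have e2 : ((k'.divisors.filter (fun δ => Y1 ≤ δ ∧ δ ≤ Y)).card : ℝ) ≤ Vz s0 a b m Q x0 y0 n Y1 Y z := by
    unfold Vz
    rw [← sum_filter, sum_const, nsmul_eq_mul, mul_one]
    norm_cast
    apply card_le_card
    intro δ hδ
    rw [mem_filter, Nat.mem_divisors] at hδ
    have h1 := Nat.Coprime.coprime_dvd_left hδ.1.1 cn
    have h2 := Nat.Coprime.coprime_dvd_left hδ.1.1 cs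
    rw [mem_filter, mem_filter, mem_Icc]
    refine ⟨⟨⟨hδ.2.1, by omega⟩, h2, h1⟩, ?_⟩
    exact (dvd_transfer hn hA1 hν heq h2 h1).2 (by exact_mod_cast hδ.1.1)
  refine le_trans ?_ e2
  rw [e1]
  exact_mod_cast hw

end APU

set_option maxHeartbeats 1000000

namespace APU
open Finset
open scoped ArithmeticFunction.Moebius

theorem main_count {a b D s0 Nb A1 ν : ℕ} (ha : 0 < a) (hb : 0 < b) (hs : 0 < s0) (hNb : 0 < Nb) (hA : 0 < A1)
    (hν0 : 0 < ν) (hD : 2 * D ∣ s0) (has : a ∣ s0) (hbs : b ∣ s0) (hAs : A1 ∣ s0)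
    (hNs : ∀ p : ℕ, p.Prime → p ∣ Nb → p ∣ s0) (hν : ∀ p : ℕ, p.Prime → p ∣ ν → p ∣ s0) :
    ∃ m0 : ℕ, ∀ m : ℕ, m0 ≤ m → ∀ H : ℕ, 0 < H → H ^ 10000 ≤ m → H.Coprime m → H.Coprime s0 → ∀ r1 r2 : ℤ,
      (∀ z1 z2 : ℤ, ((Nb * H ^ 3 : ℕ) : ℤ) ∣ z1 - r1 → ((Nb * H ^ 3 : ℕ) : ℤ) ∣ z2 - r2 → ∃ k : ℤ,
        (A1 : ℤ) * (m - (a * z1 ^ 2 + b * z2 ^ 2)) = ν * H ^ 2 * k ∧ IsCoprime k ((s0 : ℤ) * H) ∧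
        (0 < k → chi s0 D k.toNat = 1)) →
      ∃ z1 z2 k : ℤ, ((Nb * H ^ 3 : ℕ) : ℤ) ∣ z1 - r1 ∧ ((Nb * H ^ 3 : ℕ) : ℤ) ∣ z2 - r2 ∧ 0 < k ∧
        (A1 : ℤ) * (m - (a * z1 ^ 2 + b * z2 ^ 2)) = ν * H ^ 2 * k ∧ IsCoprime k ((s0 : ℤ) * H) ∧
        rho s0 D k.toNat ≠ 0 ∧
        ∀ p : ℕ, p.Prime → ¬ p ∣ s0 → p ∣ m → ¬ (p : ℤ) ∣ a * z1 ^ 2 + b * z2 ^ 2 := by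
  obtain ⟨c, C, hc, hC, hW⟩ := W_bound hs hD
  obtain ⟨C5, hC5, hE⟩ := Wt_sum
  set κ : ℝ := (a : ℝ) + b with hκ
  have ha' : (0 : ℝ) < a := by exact_mod_cast ha
  have hb' : (0 : ℝ) < b := by exact_mod_cast hb
  have hκ0 : 0 < κ := by positivity
  obtain ⟨U0, hU0, hnum⟩ := numerics c C C5 κ hc hC (by linarith) hκ0
  obtain ⟨m0, hm0⟩ := params (U0 + κ + Nb + ν + A1 + 10)
  refine ⟨m0, fun m hm H hH0 hHm hHcm hHcs r1 r2 hz => ?_⟩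
  obtain ⟨u, huK, hu1, hum, hτ, hlog⟩ := hm0 m hm
  have hNb' : (1 : ℝ) ≤ Nb := by exact_mod_cast hNb
  have hν' : (1 : ℝ) ≤ ν := by exact_mod_cast hν0
  have hA' : (1 : ℝ) ≤ A1 := by exact_mod_cast hA
  have hH' : (1 : ℝ) ≤ H := by exact_mod_cast hH0
  have huU : U0 ≤ u := by linarith
  have huκ : κ ≤ u := by linarith
  have huN : (Nb : ℝ) ≤ u := by linarith
  have huν : (ν : ℝ) ≤ u := by linarith
  have huA : (A1 : ℝ) ≤ u := by linarith
  have hu10 : 10 ≤ u := by linarith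
  have hu0 : 0 < u := by linarith
  have mono : ∀ i j : ℕ, i ≤ j → u ^ i ≤ u ^ j := fun i j h => pow_le_pow_right₀ hu1 h
  have step : ∀ (i : ℕ) (x : ℝ), x ≤ 10 * u ^ i → x ≤ u ^ (i + 1) := fun i x hx => by
    refine hx.trans ?_
    rw [pow_succ']; gcongr
  have hHu : (H : ℝ) ≤ u := by
    have : (H : ℝ) ^ 10000 ≤ u ^ 10000 := by rw [hum]; exact_mod_cast hHm
    exact le_of_pow_le_pow_left₀ (by norm_num) hu0.le this
  have hm1 : (0 : ℝ) < m := by rw [← hum]; positivity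
  have hmpos : 0 < m := by exact_mod_cast hm1
  have h2 : 2 ∣ s0 := (dvd_mul_right 2 D).trans hD
  -- parameters
  set Q : ℕ := Nb * H ^ 3 with hQ
  have hQ0 : 0 < Q := by positivity
  have hQ0' : (0 : ℝ) < Q := by exact_mod_cast hQ0
  have hQu : (Q : ℝ) ≤ u ^ 4 := by
    rw [hQ]; push_cast
    calc (Nb : ℝ) * H ^ 3 ≤ u * u ^ 3 := by gcongr
      _ = u ^ 4 := by ring
  set x0 : ℤ := r1 % Q with hx0
  set y0 : ℤ := r2 % Q with hy0
  have hQz : (0 : ℤ) < Q := by exact_mod_cast hQ0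
  have hx0a : 0 ≤ x0 := Int.emod_nonneg _ hQz.ne'
  have hx0b : x0 < Q := Int.emod_lt_of_pos _ hQz
  have hy0a : 0 ≤ y0 := Int.emod_nonneg _ hQz.ne'
  have hy0b : y0 < Q := Int.emod_lt_of_pos _ hQz
  set l : ℕ := ⌊u ^ 4900 / Q⌋₊ with hl
  have hlQ : (l : ℝ) * Q ≤ u ^ 4900 := by
    rw [← le_div_iff₀ hQ0']; exact Nat.floor_le (by positivity)
  have hlL : u ^ 4890 ≤ (l : ℝ) := by
    have h1 : u ^ 4896 ≤ u ^ 4900 / Q := by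
      rw [le_div_iff₀ hQ0']
      calc u ^ 4896 * Q ≤ u ^ 4896 * u ^ 4 := by gcongr
        _ = _ := by ring
    have h3 := Nat.lt_floor_add_one (u ^ 4900 / (Q : ℝ))
    rw [← hl] at h3
    have h4 : u ^ 4890 + 1 ≤ u ^ 4896 := by
      refine le_trans (step 4890 _ ?_) (mono 4891 4896 (by norm_num))
      have : 1 ≤ u ^ 4890 := one_le_pow₀ hu1
      linarith
    linarith
  have hνH : 0 < ν * H ^ 2 := by positivity
  set K : ℕ := A1 * m / (ν * H ^ 2) with hK
  set Y : ℕ := Nat.sqrt K with hY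
  have hKup : (K : ℝ) * (ν * H ^ 2) ≤ A1 * m := by
    have := Nat.div_mul_le_self (A1 * m) (ν * H ^ 2)
    exact_mod_cast this
  have hKlow : (A1 : ℝ) * m < (K + 1) * (ν * H ^ 2) := by
    have := Nat.lt_div_mul_add hνH (a := A1 * m)
    have h3 : A1 * m < (K + 1) * (ν * H ^ 2) := by rw [add_mul, one_mul]; exact this
    exact_mod_cast h3
  have hYK : (Y : ℝ) * Y ≤ K := by exact_mod_cast Nat.sqrt_le K
  have hYK2 : (K : ℝ) + 1 ≤ (Y + 1) * (Y + 1) := by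
    exact_mod_cast Nat.succ_le_of_lt (Nat.lt_succ_sqrt K)
  have hYlow : u ^ 4990 ≤ (Y : ℝ) := by
    by_contra hcon
    push Not at hcon
    have h3 : (1 : ℝ) ≤ u ^ 4990 := one_le_pow₀ hu1
    have h4 : (A1 : ℝ) * m < (4 * u ^ 9980) * (u * u ^ 2) := by
      refine hKlow.trans_le ?_
      have h5 : (K : ℝ) + 1 ≤ 4 * u ^ 9980 := by
        refine hYK2.trans ?_
        calc ((Y : ℝ) + 1) * (Y + 1) ≤ (2 * u ^ 4990) * (2 * u ^ 4990) := by gcongr <;> linarith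
          _ = _ := by ring
      gcongr
    have h6 : (m : ℝ) ≤ A1 * m := by nlinarith
    have h7 : 4 * u ^ 9980 * (u * u ^ 2) ≤ u ^ 10000 := by
      calc 4 * u ^ 9980 * (u * u ^ 2) = 4 * u ^ 9983 := by ring
        _ ≤ u ^ 9984 := step 9983 _ (by have : 0 < u ^ 9983 := (by positivity); linarith)
        _ ≤ _ := mono _ _ (by norm_num)
    rw [hum] at h7
    linarith
  have hKm : (K : ℝ) ≤ A1 * m := by
    refine le_trans ?_ hKup
    have h3 : (1 : ℝ) ≤ (ν * H ^ 2 : ℕ) := by exact_mod_cast hνH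
    push_cast at h3
    exact le_mul_of_one_le_right (by positivity) h3
  have hYup : (Y : ℝ) ≤ u ^ 5001 := by
    have h3 : (Y : ℝ) ^ 2 ≤ (u ^ 5001) ^ 2 := by
      calc (Y : ℝ) ^ 2 ≤ A1 * m := by rw [sq]; exact hYK.trans hKm
        _ ≤ u * u ^ 10000 := by rw [hum]; gcongr
        _ = u ^ 10001 := by ring
        _ ≤ u ^ 10002 := mono _ _ (by norm_num)
        _ = _ := by ring
    exact le_of_pow_le_pow_left₀ (by norm_num) (by positivity) h3
  have hYup2 : ((Y + 2 : ℕ) : ℝ) ≤ u ^ 5002 := by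
    push_cast
    apply step 5001
    have : 1 ≤ u ^ 5001 := one_le_pow₀ hu1
    linarith
  have hYpos : (0 : ℝ) < Y := lt_of_lt_of_le (by positivity) hYlow
  have hY1' : 1 ≤ Y := by exact_mod_cast hYpos
  have hκs : κ / u ^ 200 ≤ 1 / 2 := by
    rw [div_le_div_iff₀ (by positivity) (by norm_num)]
    have h3 := step 1 (κ * 2) (by rw [pow_one]; linarith)
    have h4 := mono 2 200 (by norm_num)
    norm_num at h3
    linarith
  set Y1 : ℕ := ⌊(Y : ℝ) * (1 - κ / u ^ 200)⌋₊ with hY1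
  have hY1le : (Y1 : ℝ) ≤ Y * (1 - κ / u ^ 200) := Nat.floor_le (mul_nonneg hYpos.le (by linarith))
  have hY1ge : (Y : ℝ) * (1 - κ / u ^ 200) - 1 ≤ Y1 := by
    have := Nat.lt_floor_add_one ((Y : ℝ) * (1 - κ / u ^ 200))
    linarith
  have hY2 : 2 ≤ (Y : ℝ) := by
    have := mono 1 4990 (by norm_num)
    rw [pow_one] at this; linarith
  have hY1one : 1 ≤ Y1 := by
    apply Nat.le_floor
    push_cast
    nlinarith
  have hY1Y : Y1 ≤ Y := by
    have h3 : (Y1 : ℝ) ≤ Y := hY1le.trans (by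
      have : 0 < κ / u ^ 200 := by positivity
      nlinarith)
    exact_mod_cast h3
  set D0 : ℕ := ⌈u ^ 200⌉₊ with hD0
  have hD0a : u ^ 200 ≤ (D0 : ℝ) := Nat.le_ceil _
  have hD0b : (D0 : ℝ) ≤ u ^ 201 := by
    have h3 := Nat.ceil_lt_add_one (show 0 ≤ u ^ 200 by positivity)
    apply step 200
    have : 1 ≤ u ^ 200 := one_le_pow₀ hu1
    linarith
  have hD01 : 1 ≤ D0 := by
    have : (0 : ℝ) < D0 := lt_of_lt_of_le (by positivity) hD0a
    exact_mod_cast this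
  set n : ℕ := H * m with hn
  set R : ℕ := ∏ p ∈ m.primeFactors.filter (fun p => ¬ p ∣ s0), p with hR
  have hRp : ∀ p : ℕ, p.Prime → (p ∣ R ↔ p ∣ m ∧ ¬ p ∣ s0) := by
    intro p hp
    rw [hR, Prime.dvd_finset_prod_iff hp.prime]
    constructor
    · rintro ⟨q, hq, hpq⟩
      rw [mem_filter, Nat.mem_primeFactors] at hq
      rw [(Nat.prime_dvd_prime_iff_eq hp hq.1.1).1 hpq]
      exact ⟨hq.1.2.1, hq.2⟩
    · rintro ⟨h3, h4⟩
      exact ⟨p, by rw [mem_filter, Nat.mem_primeFactors]; exact ⟨⟨hp, h3, hmpos.ne'⟩, h4⟩, dvd_rfl⟩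
  have hRsq : Squarefree R := by
    rw [hR]
    apply Finset.squarefree_prod_of_pairwise_isCoprime
    · intro p hp q hq hpq
      rw [mem_coe, mem_filter, Nat.mem_primeFactors] at hp hq
      exact Nat.coprime_iff_isRelPrime.1 ((Nat.coprime_primes hp.1.1 hq.1.1).2 hpq)
    · intro p hp
      rw [mem_filter, Nat.mem_primeFactors] at hp
      exact hp.1.1.squarefree
  have hRm : R ∣ m := by
    rw [hR]
    exact (prod_dvd_prod_of_subset _ _ _ (filter_subset _ _)).trans (Nat.prod_primeFactors_dvd m)
  have hRs : R.Coprime s0 := Nat.coprime_of_dvd fun p hp h3 h4 => ((hRp p hp).1 h3).2 h4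
  have hRodd : Odd R := coprime_odd h2 hRs
  have cop_of : ∀ (x δ : ℕ), δ.Coprime s0 → (∀ p : ℕ, p.Prime → p ∣ x → p ∣ s0) → IsCoprime (x : ℤ) (δ : ℤ) := by
    intro x δ h3 h4
    rw [Nat.isCoprime_iff_coprime]
    apply Nat.coprime_of_dvd
    intro p hp h5 h6
    exact hp.one_lt.ne' (Nat.dvd_one.1 (by rw [← h3]; exact Nat.dvd_gcd h6 (h4 p hp h5)))
  have hQcop : ∀ δ : ℕ, δ.Coprime s0 → δ.Coprime H → IsCoprime (Q : ℤ) (δ : ℤ) := by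
    intro δ h3 h4
    rw [hQ]; push_cast
    apply IsCoprime.mul_left (cop_of _ _ h3 hNs)
    apply IsCoprime.pow_left
    exact Nat.isCoprime_iff_coprime.2 h4.symm
  have hRH : R.Coprime H := Nat.Coprime.coprime_dvd_left hRm hHcm.symm
  have hu : ∀ δ : ℕ, δ.Coprime s0 → δ.Coprime n → IsCoprime (a : ℤ) (δ : ℤ) ∧ IsCoprime (b : ℤ) (δ : ℤ) ∧
      IsCoprime (m : ℤ) (δ : ℤ) ∧ IsCoprime (Q : ℤ) (δ : ℤ) ∧ IsCoprime (R : ℤ) (δ : ℤ) := by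
    intro δ h3 h4
    have h5 : δ.Coprime H := h4.coprime_dvd_right (dvd_mul_right _ _)
    have h6 : δ.Coprime m := h4.coprime_dvd_right (dvd_mul_left _ _)
    refine ⟨cop_of _ _ h3 fun p _ h => h.trans has, cop_of _ _ h3 fun p _ h => h.trans hbs,
      Nat.isCoprime_iff_coprime.2 h6.symm, hQcop δ h3 h5, Nat.isCoprime_iff_coprime.2 (h6.coprime_dvd_right hRm).symm⟩
  have hbR : IsCoprime (b : ℤ) (R : ℤ) := cop_of _ _ hRs fun p _ h => h.trans hbs
  have hQR : IsCoprime (Q : ℤ) (R : ℤ) := hQcop R hRs hRH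
  have htR : (R.divisors.card : ℝ) ≤ u := by
    apply hτ R (Nat.pos_of_dvd_of_pos hRm hmpos)
    calc (R : ℝ) ≤ m := by exact_mod_cast Nat.le_of_dvd hmpos hRm
      _ = u ^ 10000 := hum.symm
      _ ≤ _ := mono _ _ (by norm_num)
  have htδ : ∀ δ ∈ Icc 1 (Y + 2), (δ.divisors.card : ℝ) ≤ u := by
    intro δ hδ
    rw [mem_Icc] at hδ
    apply hτ δ hδ.1
    calc (δ : ℝ) ≤ (Y + 2 : ℕ) := by exact_mod_cast hδ.2
      _ ≤ u ^ 5002 := hYup2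
      _ ≤ _ := mono _ _ (by norm_num)
  have hn0 : n ≠ 0 := by positivity
  have htn : (n.divisors.card : ℝ) ≤ u := by
    apply hτ n (Nat.pos_of_ne_zero hn0)
    rw [hn]; push_cast
    calc (H : ℝ) * m ≤ u * u ^ 10000 := by rw [hum]; gcongr
      _ = u ^ 10001 := by ring
      _ ≤ _ := mono _ _ (by norm_num)
  -- bounds for B
  have hBb : ∀ z ∈ range l ×ˢ range l, 0 ≤ Bf a b Q x0 y0 z ∧ ((Bf a b Q x0 y0 z : ℤ) : ℝ) ≤ κ * u ^ 9800 := by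
    intro z hz'
    rw [mem_product, mem_range, mem_range] at hz'
    refine ⟨by unfold Bf; positivity, ?_⟩
    have key : ∀ (x : ℤ) (t : ℕ), 0 ≤ x → x < Q → t < l → ((x : ℝ) + Q * t) ^ 2 ≤ u ^ 9800 := by
      intro x t h3 h4 h5
      have h6 : (x : ℝ) + Q * t ≤ u ^ 4900 := by
        have h7 : (x : ℝ) ≤ Q := by exact_mod_cast h4.le
        have h8 : (t : ℝ) + 1 ≤ l := by exact_mod_cast h5
        nlinarith
      have h9 : (0 : ℝ) ≤ x := by exact_mod_cast h3
      calc ((x : ℝ) + Q * t) ^ 2 ≤ (u ^ 4900) ^ 2 := by gcongr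
        _ = _ := by ring
    have k1 := key x0 z.1 hx0a hx0b hz'.1
    have k2 := key y0 z.2 hy0a hy0b hz'.2
    unfold Bf
    push_cast
    rw [hκ, add_mul]
    gcongr
  have hBm : ∀ z ∈ range l ×ˢ range l, Bf a b Q x0 y0 z < m := by
    intro z hz'
    have h3 := (hBb z hz').2
    have h4 : κ * u ^ 9800 < m := by
      rw [← hum]
      calc κ * u ^ 9800 ≤ u * u ^ 9800 := by gcongr
        _ = u ^ 9801 := by ring
        _ < u ^ 10000 := pow_lt_pow_right₀ (by linarith) (by norm_num)
    exact_mod_cast h3.trans_lt h4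
  have hF : ∀ z ∈ range l ×ˢ range l, |wz s0 D a b m Q x0 y0 n Y z| ≤ u := by
    intro z hz'
    have h3 := hBm z hz'
    have h4 := (hBb z hz').1
    refine (wz_abs_le (by omega)).trans (hτ _ (by omega) ?_)
    calc (((Bf a b Q x0 y0 z - m).natAbs : ℕ) : ℝ) ≤ m := by
          have : (Bf a b Q x0 y0 z - m).natAbs ≤ m := by omega
          exact_mod_cast this
      _ = u ^ 10000 := hum.symm
      _ ≤ _ := mono _ _ (by norm_num)
  by_contra hcon
  have hV : ∀ z ∈ range l ×ˢ range l, (Bf a b Q x0 y0 z).natAbs.Coprime R →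
      2 * |wz s0 D a b m Q x0 y0 n Y z| ≤ Vz s0 a b m Q x0 y0 n Y1 Y z := by
    intro z hz' hcop
    have h3 := hBm z hz'
    have h4 := (hBb z hz').1
    have d1 : (Q : ℤ) ∣ (x0 + Q * z.1) - r1 := by
      refine ⟨z.1 - r1 / Q, ?_⟩
      have := Int.emod_add_mul_ediv r1 Q
      rw [hx0]; linear_combination this
    have d2 : (Q : ℤ) ∣ (y0 + Q * z.2) - r2 := by
      refine ⟨z.2 - r2 / Q, ?_⟩
      have := Int.emod_add_mul_ediv r2 Q
      rw [hy0]; linear_combination this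
    obtain ⟨k, hk1, hk2, hk3⟩ := hz _ _ d1 d2
    have hk1' : (A1 : ℤ) * (m - Bf a b Q x0 y0 z) = ν * H ^ 2 * k := hk1
    have hνHz : (0 : ℤ) < ν * H ^ 2 := by exact_mod_cast hνH
    have hk : 0 < k := by
      have h5 : (0 : ℤ) < (A1 : ℤ) * (m - Bf a b Q x0 y0 z) := mul_pos (by exact_mod_cast hA) (by omega)
      rw [hk1'] at h5
      exact pos_of_mul_pos_right h5 hνHz.le
    have hkr : ((k.toNat : ℕ) : ℝ) = (k : ℝ) := by
      have := Int.toNat_of_nonneg hk.le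
      exact_mod_cast congrArg (Int.cast : ℤ → ℝ) this
    have hkR : (A1 : ℝ) * (m - ((Bf a b Q x0 y0 z : ℤ) : ℝ)) = ν * H ^ 2 * k := by exact_mod_cast hk1'
    have hνHr : (0 : ℝ) < ν * H ^ 2 := by exact_mod_cast hνH
    refine hV_step hs hD hAs hν hn hY1one (fun p hp h5 h6 => (hRp p hp).2 ⟨h6, h5⟩) hk1' hk hk2 (hk3 hk) ?_ hcop ?_ ?_
    · by_contra hrho
      apply hcon
      refine ⟨_, _, k, d1, d2, hk, hk1, hk2, hrho, ?_⟩
      intro p hp h5 h6 h7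
      have h8 : p ∣ (Bf a b Q x0 y0 z).natAbs := Int.natCast_dvd.1 h7
      exact hp.one_lt.ne' (Nat.dvd_one.1 (by rw [← hcop]; exact Nat.dvd_gcd h8 ((hRp p hp).2 ⟨h6, h5⟩)))
    · have h5 : k.toNat ≤ K := by
        rw [hK, Nat.le_div_iff_mul_le hνH]
        zify
        rw [Int.toNat_of_nonneg hk.le]
        nlinarith
      calc k.toNat ≤ K := h5
        _ < (Y + 1) * (Y + 1) := Nat.lt_succ_sqrt K
        _ = _ := by ring
    · have h5 : (Y1 : ℝ) * Y ≤ k := by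
        have h6 : (Y1 : ℝ) * Y ≤ K * (1 - κ / u ^ 200) := by
          calc (Y1 : ℝ) * Y ≤ Y * (1 - κ / u ^ 200) * Y := by gcongr
            _ = (Y * Y) * (1 - κ / u ^ 200) := by ring
            _ ≤ _ := mul_le_mul_of_nonneg_right hYK (by linarith)
        refine h6.trans ?_
        rw [← mul_le_mul_iff_of_pos_left hνHr, ← hkR]
        calc (ν : ℝ) * H ^ 2 * (K * (1 - κ / u ^ 200)) = K * (ν * H ^ 2) * (1 - κ / u ^ 200) := by ring
          _ ≤ A1 * m * (1 - κ / u ^ 200) := mul_le_mul_of_nonneg_right hKup (by linarith)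
          _ = A1 * (m - κ * u ^ 9800) := by
            have : (m : ℝ) * (κ / u ^ 200) = κ * u ^ 9800 := by
              rw [← hum]; field_simp
            linear_combination -(A1 : ℝ) * this
          _ ≤ _ := by
            have := (hBb z hz').2
            gcongr
      rw [← hkr] at h5
      exact_mod_cast h5
  have hmom := moment (F := u) x0 y0 h2 hu hRsq hbR hQR hD01 htR htδ hY1one hY1Y hF hV
  have hsv := sieve_main (l := l) (a := (a : ℤ)) x0 y0 hRsq hRodd hbR hQR hD01 htR
  have hWb := hW a b m n Y hn0 hY1' (by
    intro p hp h3 h4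
    have h5 : p.Coprime s0 := (Nat.Prime.coprime_iff_not_dvd hp).2 h3
    have h6 : p.Coprime n := (Nat.Prime.coprime_iff_not_dvd hp).2 h4
    obtain ⟨g1, g2, g3, -, -⟩ := hu p h5 h6
    have hne : ∀ x : ℤ, IsCoprime x (p : ℤ) → ¬ (p : ℤ) ∣ x := by
      intro x hx hpx
      have := hx.isUnit_of_dvd' hpx dvd_rfl
      exact hp.one_lt.ne' (by simpa using Int.isUnit_iff_natAbs_eq.1 this)
    exact ⟨hne _ g1, hne _ g2, hne _ g3⟩)
  have hEb : ∀ X : ℕ, 1 ≤ X → X ≤ Y + 2 → Ebox l X ≤ C5 * u ^ 5 * (u ^ 8754 + l * u ^ 4502) := by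
    intro X hX1 hX2
    have hXr : (X : ℝ) ≤ u ^ 5002 := le_trans (by exact_mod_cast hX2) hYup2
    have hX1r : (1 : ℝ) ≤ X := by exact_mod_cast hX1
    refine (hE X u l hX1 (by positivity) hu1 (fun q hq => htδ q ?_) (hlog X hX1r (hXr.trans (mono _ _ (by norm_num))))).trans ?_
    · rw [mem_Icc] at hq ⊢
      exact ⟨hq.1, hq.2.trans hX2⟩
    · have pw : ∀ (e : ℝ) (j : ℕ), 0 ≤ e → 5002 * e ≤ j → (X : ℝ) ^ e ≤ u ^ j := by
        intro e j he hj
        calc (X : ℝ) ^ e ≤ (u ^ 5002) ^ e := Real.rpow_le_rpow (by positivity) hXr he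
          _ = u ^ (5002 * e) := by
            rw [← Real.rpow_natCast, ← Real.rpow_mul hu0.le]; norm_num
          _ ≤ u ^ (j : ℝ) := Real.rpow_le_rpow_of_exponent_le hu1 hj
          _ = _ := Real.rpow_natCast _ _
      have p1 := pw (7 / 4) 8754 (by norm_num) (by norm_num)
      have p2 := pw (9 / 10) 4502 (by norm_num) (by norm_num)
      gcongr
  have hτn1 : (1 : ℝ) ≤ n.divisors.card := by
    have : 0 < n.divisors.card := card_pos.2 ⟨1, Nat.mem_divisors.2 ⟨one_dvd _, hn0⟩⟩
    exact_mod_cast this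
  refine hnum u huU l Y D0 Y1 _ _ _ _ hlL hYlow hD0a hD0b hY1ge (le_trans ?_ hWb) hsv
    (hEb (Y + 2) (by omega) le_rfl) (hEb Y hY1' (by omega)) hmom
  have q1 : c / u ≤ c / (n.divisors.card : ℝ) := by gcongr
  have q2 : C * (n.divisors.card : ℝ) * (1 + Real.log Y) / Y ≤ C * u * u / Y := by
    have h3 := hlog Y (by linarith) (hYup.trans (mono _ _ (by norm_num)))
    gcongr
  linarith

end APU

set_option maxHeartbeats 400000

namespace APU
open Finset

/-- pigeonhole solution of the Legendre equation -/
lemma legendre {D a : ℕ} (hD : 2 ≤ D) (ha : Squarefree a) (hc : a.Coprime D) {s r : ℤ}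
    (hs : (a : ℤ) ∣ s ^ 2 + D) (hr : (D : ℤ) ∣ r ^ 2 - a) :
    ∃ X Y Z : ℤ, Z ≠ 0 ∧ X ^ 2 + D * Y ^ 2 = a * Z ^ 2 := by
  have ha0 : 0 < a := Nat.pos_of_ne_zero ha.ne_zero
  by_cases ha1 : a = 1
  · exact ⟨1, 0, 1, by norm_num, by rw [ha1]; ring⟩
  set bx := Nat.sqrt (a * D)
  set by' := Nat.sqrt a
  set bz := Nat.sqrt D
  have : NeZero a := ⟨ha0.ne'⟩
  have : NeZero D := ⟨by omega⟩
  let box : Finset (ℕ × ℕ × ℕ) := range (bx + 1) ×ˢ range (by' + 1) ×ˢ range (bz + 1)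
  let φ : ℕ × ℕ × ℕ → ZMod a × ZMod D := fun t => (((t.1 : ℤ) - s * t.2.1 : ℤ), ((t.1 : ℤ) - r * t.2.2 : ℤ))
  have hcard : (univ : Finset (ZMod a × ZMod D)).card < box.card := by
    have h1 : (univ : Finset (ZMod a × ZMod D)).card = a * D := by
      rw [card_univ, Fintype.card_prod, ZMod.card, ZMod.card]
    have h2 : box.card = (bx + 1) * ((by' + 1) * (bz + 1)) := by
      simp only [box, card_product, card_range]
    rw [h1, h2]
    have e1 : a * D < (bx + 1) * (bx + 1) := Nat.lt_succ_sqrt _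
    have e2 : a < (by' + 1) * (by' + 1) := Nat.lt_succ_sqrt _
    have e3 : D < (bz + 1) * (bz + 1) := Nat.lt_succ_sqrt _
    have e4 : (a * D) * (a * D) < ((bx + 1) * ((by' + 1) * (bz + 1))) * ((bx + 1) * ((by' + 1) * (bz + 1))) := by
      calc (a * D) * (a * D) < ((bx + 1) * (bx + 1)) * (((by' + 1) * (by' + 1)) * ((bz + 1) * (bz + 1))) :=
            Nat.mul_lt_mul_of_lt_of_le e1 (Nat.mul_le_mul e2.le e3.le) (by positivity)
        _ = _ := by ring
    exact Nat.mul_self_lt_mul_self_iff.1 e4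
  obtain ⟨t, ht, t', ht', hne, heq⟩ := exists_ne_map_eq_of_card_lt_of_maps_to (f := φ) hcard (fun _ _ => mem_univ _)
  simp only [box, mem_product, mem_range] at ht ht'
  obtain ⟨x, y, z⟩ := t
  obtain ⟨x', y', z'⟩ := t'
  simp only [φ, Prod.mk.injEq] at heq ht ht'
  obtain ⟨h1, h2⟩ := heq
  rw [ZMod.intCast_eq_intCast_iff_dvd_sub] at h1 h2
  set X : ℤ := (x' : ℤ) - x with hX
  set Y : ℤ := (y' : ℤ) - y with hY
  set Z : ℤ := (z' : ℤ) - z with hZ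
  have d1 : (a : ℤ) ∣ X - s * Y := by rw [hX, hY]; convert h1 using 1; ring
  have d2 : (D : ℤ) ∣ X - r * Z := by rw [hX, hZ]; convert h2 using 1; ring
  have hXb : X ^ 2 ≤ a * D := by
    have : |X| ≤ bx := by rw [abs_le]; omega
    have h3 : ((bx * bx : ℕ) : ℤ) ≤ ((a * D : ℕ) : ℤ) := by exact_mod_cast Nat.sqrt_le _
    push_cast at h3
    have := abs_le.1 this
    nlinarith
  have hYb : Y ^ 2 ≤ a := by
    have : |Y| ≤ by' := by rw [abs_le]; omega
    have h3 : ((by' * by' : ℕ) : ℤ) ≤ (a : ℤ) := by exact_mod_cast Nat.sqrt_le _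
    push_cast at h3
    have := abs_le.1 this
    nlinarith
  have hZb : Z ^ 2 ≤ D := by
    have : |Z| ≤ bz := by rw [abs_le]; omega
    have h3 : ((bz * bz : ℕ) : ℤ) ≤ (D : ℤ) := by exact_mod_cast Nat.sqrt_le _
    push_cast at h3
    have := abs_le.1 this
    nlinarith
  have hcop : IsCoprime (a : ℤ) (D : ℤ) := Nat.isCoprime_iff_coprime.2 hc
  have hdiv : (a * D : ℤ) ∣ X ^ 2 + D * Y ^ 2 - a * Z ^ 2 := by
    apply hcop.mul_dvd
    · have : X ^ 2 + D * Y ^ 2 - a * Z ^ 2 = (X - s * Y) * (X + s * Y) + (s ^ 2 + D) * Y ^ 2 - a * Z ^ 2 := by ring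
      rw [this]
      exact dvd_sub (dvd_add (d1.mul_right _) (hs.mul_right _)) (dvd_mul_right _ _)
    · have : X ^ 2 + D * Y ^ 2 - a * Z ^ 2 = (X - r * Z) * (X + r * Z) + (r ^ 2 - a) * Z ^ 2 + D * Y ^ 2 := by ring
      rw [this]
      exact dvd_add (dvd_add (d2.mul_right _) (hr.mul_right _)) (dvd_mul_right _ _)
  obtain ⟨q, hq⟩ := hdiv
  have haz : (0 : ℤ) < a := by exact_mod_cast ha0
  have hDz : (2 : ℤ) ≤ D := by exact_mod_cast hD
  have haD : (0 : ℤ) < a * D := by positivity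
  have hq1 : -1 ≤ q := by
    have : -(a * D : ℤ) ≤ a * D * q := by
      rw [← hq]; nlinarith [sq_nonneg X, sq_nonneg Y]
    by_contra hcon
    push Not at hcon
    nlinarith
  have hq2 : q ≤ 2 := by
    have : a * D * q ≤ 2 * (a * D : ℤ) := by
      rw [← hq]; nlinarith [sq_nonneg Z]
    by_contra hcon
    push Not at hcon
    nlinarith
  have hnz : ¬ (X = 0 ∧ Y = 0 ∧ Z = 0) := by
    rintro ⟨h3, h4, h5⟩
    apply hne
    rw [Prod.mk.injEq, Prod.mk.injEq]
    omega
  have hq3 : q ≠ -1 := by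
    rintro rfl
    have haZ : (a : ℤ) * Z ^ 2 ≤ a * D := mul_le_mul_of_nonneg_left hZb haz.le
    have hDY : 0 ≤ (D : ℤ) * Y ^ 2 := by positivity
    have hX0 : X ^ 2 = 0 := le_antisymm (by linarith) (sq_nonneg X)
    have hY0 : (D : ℤ) * Y ^ 2 = 0 := le_antisymm (by linarith) hDY
    have hX0 : X = 0 := by simpa using hX0
    have hZ2 : Z ^ 2 = D := by
      have : (a : ℤ) * Z ^ 2 = a * D := by rw [hX0] at hq; linarith
      exact mul_left_cancel₀ haz.ne' this
    have h3 : (D : ℤ) ∣ r * Z := by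
      rw [hX0, zero_sub, dvd_neg] at d2; exact d2
    have h4 : IsCoprime (D : ℤ) r := by
      have : IsCoprime (D : ℤ) (r ^ 2) := by
        obtain ⟨w, hw⟩ := hr
        have : r ^ 2 = a + D * w := by linarith
        rw [this]
        exact hcop.symm.add_mul_left_right w
      exact (IsCoprime.pow_right_iff (by norm_num)).1 this
    obtain ⟨w, hw⟩ := h4.dvd_of_dvd_mul_left h3
    rw [hw] at hZ2
    have h5 : (D : ℤ) * w ^ 2 = 1 := by
      have : (D : ℤ) * (D * w ^ 2) = D * 1 := by linarith
      exact mul_left_cancel₀ (by omega) this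
    have := Int.le_of_dvd one_pos (Dvd.intro _ h5)
    omega
  have hq4 : q ≠ 2 := by
    rintro rfl
    have haZ : 0 ≤ (a : ℤ) * Z ^ 2 := by positivity
    have hYa : Y ^ 2 = a := by
      apply le_antisymm hYb
      have h3 : (D : ℤ) * a ≤ D * Y ^ 2 := by linarith
      exact le_of_mul_le_mul_left h3 (by linarith)
    have h3 : Y.natAbs * Y.natAbs = a := by
      zify; rw [← abs_mul, abs_mul_self]; linarith
    have h4 := ha Y.natAbs (by rw [h3])
    rw [Nat.isUnit_iff] at h4
    rw [h4] at h3
    omega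
  have hq5 : q = 0 ∨ q = 1 := by omega
  rcases hq5 with rfl | rfl
  · refine ⟨X, Y, Z, ?_, by linarith⟩
    intro hZ0
    rw [hZ0] at hq
    apply hnz
    have hDY : 0 ≤ (D : ℤ) * Y ^ 2 := by positivity
    have h3 : X ^ 2 = 0 := le_antisymm (by linarith) (sq_nonneg X)
    have h4 : Y ^ 2 = 0 := by
      have : (D : ℤ) * Y ^ 2 = 0 := le_antisymm (by linarith [sq_nonneg X]) hDY
      exact (mul_eq_zero.1 this).resolve_left (by linarith)
    exact ⟨by simpa using h3, by simpa using h4, hZ0⟩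
  · refine ⟨X * Z - D * Y, X + Y * Z, Z ^ 2 + D, by nlinarith [sq_nonneg Z], ?_⟩
    linear_combination (Z ^ 2 + (D : ℤ)) * hq

lemma split_of_rho {s0 D k p e : ℕ} (h2 : 2 ∣ s0) (hDs : D ∣ s0) (hp : p.Prime) (hrho : rho s0 D (p ^ e * k) ≠ 0) (hps : ¬ p ∣ s0)
    (hk : ¬ p ∣ k) (he : Odd e) : chi s0 D p = 1 := by
  have hpc : p.Coprime s0 := (Nat.Prime.coprime_iff_not_dvd hp).2 hps
  rcases chi_sq hDs hpc with h | h
  · exact h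
  exfalso
  apply hrho
  have hcop : (p ^ e).Coprime k := Nat.Coprime.pow_left _ ((Nat.Prime.coprime_iff_not_dvd hp).2 hk)
  unfold rho
  rw [Nat.divisors_mul, Finset.mul_def, sum_image hcop.mul_injOn_divisors, sum_product,
    Nat.sum_divisors_prime_pow hp, sum_comm]
  apply sum_eq_zero
  intro δ _
  have h3 : ∀ i, chi s0 D (p ^ i) = (-1) ^ i := by
    intro i
    induction i with
    | zero => simpa using chi_one s0 D
    | succ i ih => rw [pow_succ, chi_mul h2, ih, h, pow_succ]
  simp only [chi_mul h2, h3]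
  rw [← sum_mul]
  have h4 : ∑ i ∈ range (e + 1), (-1 : ℤ) ^ i = 0 := by
    rw [neg_one_geom_sum, if_pos (he.add_one)]
  rw [h4, zero_mul]

lemma split_of_norm {D p : ℕ} (hp : p.Prime) (j : ℕ) : ∀ (x y u : ℤ), ¬ (p : ℤ) ∣ u →
    x ^ 2 + D * y ^ 2 = p ^ (2 * j + 1) * u → ∃ s : ℤ, (p : ℤ) ∣ s ^ 2 + D := by
  have hpz := Nat.prime_iff_prime_int.1 hp
  induction j with
  | zero =>
    intro x y u hu h
    by_cases hy : (p : ℤ) ∣ y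
    · exfalso
      have hx : (p : ℤ) ∣ x ^ 2 := by
        have : x ^ 2 = p ^ (2 * 0 + 1) * u - D * y ^ 2 := by linarith
        rw [this, mul_zero, zero_add, pow_one]
        exact dvd_sub (dvd_mul_right _ _) (Dvd.dvd.mul_left (hy.trans (dvd_pow_self _ (by norm_num))) _)
      have hx := hpz.dvd_of_dvd_pow hx
      obtain ⟨x1, rfl⟩ := hx
      obtain ⟨y1, rfl⟩ := hy
      apply hu
      refine ⟨x1 ^ 2 + D * y1 ^ 2, ?_⟩
      apply mul_left_cancel₀ hpz.ne_zero
      linear_combination -h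
    · have hc : IsCoprime (p : ℤ) y := (hpz.coprime_iff_not_dvd).2 hy
      obtain ⟨v, w, hvw⟩ := hc
      refine ⟨x * w, ?_⟩
      have : (x * w) ^ 2 + D = w ^ 2 * (x ^ 2 + D * y ^ 2) + D * (p * v) * (1 + w * y) := by
        linear_combination (-(D : ℤ) - D * w * y) * hvw
      rw [this, h]
      refine dvd_add (Dvd.dvd.mul_left (Dvd.dvd.mul_right (dvd_pow_self _ (by norm_num)) _) _) ?_
      exact Dvd.dvd.mul_right (Dvd.dvd.mul_left (dvd_mul_right _ _) _) _
  | succ j ih =>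
    intro x y u hu h
    by_cases hy : (p : ℤ) ∣ y
    · have hx : (p : ℤ) ∣ x ^ 2 := by
        have : x ^ 2 = p ^ (2 * (j + 1) + 1) * u - D * y ^ 2 := by linarith
        rw [this]
        exact dvd_sub (Dvd.dvd.mul_right (dvd_pow_self _ (by norm_num)) _) (Dvd.dvd.mul_left (hy.trans (dvd_pow_self _ (by norm_num))) _)
      have hx := hpz.dvd_of_dvd_pow hx
      obtain ⟨x1, rfl⟩ := hx
      obtain ⟨y1, rfl⟩ := hy
      apply ih x1 y1 u hu
      apply mul_left_cancel₀ (pow_ne_zero 2 hpz.ne_zero)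
      linear_combination h
    · have hc : IsCoprime (p : ℤ) y := (hpz.coprime_iff_not_dvd).2 hy
      obtain ⟨v, w, hvw⟩ := hc
      refine ⟨x * w, ?_⟩
      have : (x * w) ^ 2 + D = w ^ 2 * (x ^ 2 + D * y ^ 2) + D * (p * v) * (1 + w * y) := by
        linear_combination (-(D : ℤ) - D * w * y) * hvw
      rw [this, h]
      refine dvd_add (Dvd.dvd.mul_left (Dvd.dvd.mul_right (dvd_pow_self _ (by norm_num)) _) _) ?_
      exact Dvd.dvd.mul_right (Dvd.dvd.mul_left (dvd_mul_right _ _) _) _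

/-- square root of `-D` modulo a squarefree number, from primes -/
lemma sqrt_mod_squarefree {D a : ℕ} (ha : Squarefree a) (h : ∀ p : ℕ, p.Prime → p ∣ a → ∃ s : ℤ, (p : ℤ) ∣ s ^ 2 + D) :
    ∃ s : ℤ, (a : ℤ) ∣ s ^ 2 + D := by
  induction a using Nat.recOnMul with
  | zero => exact absurd ha not_squarefree_zero
  | one => exact ⟨0, by simp⟩
  | prime p hp => exact h p hp dvd_rfl
  | mul m n hm hn =>
    have hc : m.Coprime n := Nat.coprime_of_squarefree_mul ha
    obtain ⟨s1, h1⟩ := hm ha.of_mul_left (fun p hp hd => h p hp (hd.mul_right _))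
    obtain ⟨s2, h2⟩ := hn ha.of_mul_right (fun p hp hd => h p hp (hd.mul_left _))
    have hcz : IsCoprime (m : ℤ) (n : ℤ) := Nat.isCoprime_iff_coprime.2 hc
    obtain ⟨u, v, huv⟩ := id hcz
    refine ⟨s1 * (v * n) + s2 * (u * m), ?_⟩
    push_cast
    apply hcz.mul_dvd
    · have : (s1 * (v * n) + s2 * (u * m)) ^ 2 + D = (s1 ^ 2 + D) + m * ((s2 - s1) * u * (2 * s1 + (s2 - s1) * (u * m))) := by
        have : v * n = 1 - u * m := by linarith
        rw [this]; ring
      rw [this]; exact dvd_add h1 (dvd_mul_right _ _)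
    · have : (s1 * (v * n) + s2 * (u * m)) ^ 2 + D = (s2 ^ 2 + D) + n * ((s1 - s2) * v * (2 * s2 + (s1 - s2) * (v * n))) := by
        have : u * m = 1 - v * n := by linarith
        rw [this]; ring
      rw [this]; exact dvd_add h2 (dvd_mul_right _ _)

end APU

set_option maxHeartbeats 400000

namespace APU
open Finset

lemma chi_one_sqrt {s0 D p : ℕ} (hDs : D ∣ s0) (hp : p.Prime) (hps : ¬ p ∣ s0) (h : chi s0 D p = 1) :
    ∃ s : ℤ, (p : ℤ) ∣ s ^ 2 + D := by
  have : Fact p.Prime := ⟨hp⟩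
  have hpc : p.Coprime s0 := (Nat.Prime.coprime_iff_not_dvd hp).2 hps
  unfold chi at h
  rw [if_pos hpc, ← jacobiSym.legendreSym.to_jacobiSym] at h
  have hne : ((-(D : ℤ) : ℤ) : ZMod p) ≠ 0 := by
    intro h0
    rw [(legendreSym.eq_zero_iff p _).2 h0] at h
    norm_num at h
  obtain ⟨r, hr⟩ := (legendreSym.eq_one_iff p hne).1 h
  refine ⟨r.val, ?_⟩
  rw [← ZMod.intCast_zmod_eq_zero_iff_dvd]
  push_cast at hr ⊢
  rw [ZMod.natCast_zmod_val]
  linear_combination -hr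

lemma theta_exists {s0 D ν n k : ℕ} (hD2 : 2 ≤ D) (hD : 2 * D ∣ s0) (hn0 : 0 < n) (hk0 : 0 < k)
    (hν : ∀ p : ℕ, p.Prime → p ∣ ν → p ∣ s0) (hn : n.Coprime s0) (hk : k.Coprime s0) (hnk : (D : ℤ) ∣ k - n)
    {c1 c2 : ℤ} (hc : c1 ^ 2 + D * c2 ^ 2 = ν * n) (hrho : rho s0 D k ≠ 0) :
    ∃ X Y Z : ℤ, Z ≠ 0 ∧ X ^ 2 + D * Y ^ 2 = n * k * Z ^ 2 := by
  have h2 : 2 ∣ s0 := (dvd_mul_right 2 D).trans hD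
  have hDs : D ∣ s0 := (dvd_mul_left D 2).trans hD
  obtain ⟨a, b, hab, ha⟩ := Nat.sq_mul_squarefree (n * k)
  have hnkc : (n * k).Coprime s0 := Nat.Coprime.mul_left hn hk
  have hnk0 : n * k ≠ 0 := by positivity
  have hb0 : b ≠ 0 := by rintro rfl; simp at hab; omega
  have had : a ∣ n * k := by rw [← hab]; exact dvd_mul_left _ _
  have hbd : b ∣ n * k := by rw [← hab, sq, mul_assoc]; exact dvd_mul_right _ _
  have hacop : a.Coprime D := (Nat.Coprime.coprime_dvd_left had hnkc).coprime_dvd_right hDs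
  have hbcop : b.Coprime D := (Nat.Coprime.coprime_dvd_left hbd hnkc).coprime_dvd_right hDs
  obtain ⟨s, hs⟩ : ∃ s : ℤ, (a : ℤ) ∣ s ^ 2 + D := by
    apply sqrt_mod_squarefree ha
    intro p hp hpa
    have hps : ¬ p ∣ s0 := fun h3 => hp.one_lt.ne' (Nat.dvd_one.1 (by
      rw [← hnkc]; exact Nat.dvd_gcd (hpa.trans had) h3))
    obtain ⟨i, n1, hn1, hni⟩ := Nat.exists_eq_pow_mul_and_not_dvd hn0.ne' p hp.one_lt.ne'
    obtain ⟨j, k1, hk1, hkj⟩ := Nat.exists_eq_pow_mul_and_not_dvd hk0.ne' p hp.one_lt.ne'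
    have hsum : i + j = 2 * b.factorization p + 1 := by
      have e1 : (n * k).factorization p = i + j := by
        rw [Nat.factorization_mul hn0.ne' hk0.ne', Finsupp.add_apply, hni, hkj]
        have hn10 : n1 ≠ 0 := by rintro rfl; simp at hn1
        have hk10 : k1 ≠ 0 := by rintro rfl; simp at hk1
        rw [Nat.factorization_mul (pow_ne_zero _ hp.ne_zero) hn10, Nat.factorization_mul (pow_ne_zero _ hp.ne_zero) hk10]
        simp [Nat.factorization_eq_zero_of_not_dvd hn1, Nat.factorization_eq_zero_of_not_dvd hk1, hp.factorization_self]
      have e2 : a.factorization p = 1 := by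
        have h3 := (Nat.squarefree_iff_factorization_le_one ha.ne_zero).1 ha p
        have h4 := (hp.dvd_iff_one_le_factorization ha.ne_zero).1 hpa
        omega
      rw [← e1, ← hab, Nat.factorization_mul (pow_ne_zero _ hb0) ha.ne_zero, Finsupp.add_apply, e2,
        Nat.factorization_pow]
      simp
    rcases Nat.even_or_odd i with hi | hi
    · have hj : Odd j := by
        rcases Nat.even_or_odd j with hj | hj
        · obtain ⟨x, hx⟩ := hi
          obtain ⟨y, hy⟩ := hj
          omega
        · exact hj
      rw [hkj] at hrho
      exact chi_one_sqrt hDs hp hps (split_of_rho h2 hDs hp hrho hps hk1 hj)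
    · obtain ⟨x, hx⟩ := hi
      apply split_of_norm hp x c1 c2 (ν * n1)
      · intro h3
        have h3 : p ∣ ν * n1 := by exact_mod_cast h3
        rcases hp.dvd_mul.1 h3 with h4 | h4
        · exact hps (hν p hp h4)
        · exact hn1 h4
      · rw [hc, hni, ← hx]; push_cast; ring
  have hbz : IsCoprime (b : ℤ) (D : ℤ) := Nat.isCoprime_iff_coprime.2 hbcop
  obtain ⟨u, v, huv⟩ := id hbz
  have hr : (D : ℤ) ∣ (n * u) ^ 2 - a := by
    have h3 : (D : ℤ) ∣ b ^ 2 * ((n * u) ^ 2 - a) := by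
      have habz : (b : ℤ) ^ 2 * a = n * k := by exact_mod_cast hab
      obtain ⟨w, hw⟩ := hnk
      refine ⟨-n * w + n ^ 2 * v * (-2 + v * D), ?_⟩
      have h4 : u * b = 1 - v * D := by linarith
      have : (b : ℤ) ^ 2 * ((n * u) ^ 2 - a) = n ^ 2 * (u * b) ^ 2 - b ^ 2 * a := by ring
      rw [this, h4, habz]
      linear_combination -(n : ℤ) * hw
    exact (hbz.symm.pow_right (n := 2)).dvd_of_dvd_mul_left h3
  obtain ⟨X, Y, Z, hZ, h⟩ := legendre hD2 ha hacop hs hr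
  refine ⟨b * X, b * Y, Z, hZ, ?_⟩
  have habz : (b : ℤ) ^ 2 * a = n * k := by exact_mod_cast hab
  rw [← habz]
  linear_combination (b : ℤ) ^ 2 * h

/-- the sign condition at `p` -/
def Good (p : ℕ) (T X : ℤ) : Prop := ∃ o : ℕ, (p : ℤ) ^ o ∣ T - X ∧ (p : ℤ) ^ o ∣ T + X ∧ ¬ (p : ℤ) ^ (o + 1) ∣ T + X

lemma dvd_exact {p : ℕ} (hp : p.Prime) {x : ℤ} (hx : x ≠ 0) : ∃ o : ℕ, (p : ℤ) ^ o ∣ x ∧ ¬ (p : ℤ) ^ (o + 1) ∣ x := by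
  have hf : FiniteMultiplicity (p : ℤ) x := by
    rw [Int.finiteMultiplicity_iff]
    exact ⟨by simpa using hp.one_lt.ne', hx⟩
  exact ⟨multiplicity (p : ℤ) x, pow_multiplicity_dvd _ _, hf.not_pow_dvd_of_multiplicity_lt (Nat.lt_succ_self _)⟩

/-- either `(T, X)` or `(T, -X)` is good -/
lemma good_or {p : ℕ} (hp : p.Prime) {T : ℤ} (X : ℤ) (hT : T ≠ 0) : Good p T X ∨ Good p T (-X) := by
  have key : ∀ A B : ℤ, A + B ≠ 0 → (∃ o : ℕ, (p : ℤ) ^ o ∣ A ∧ (p : ℤ) ^ o ∣ B ∧ ¬ (p : ℤ) ^ (o + 1) ∣ A) ∨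
      (∃ o : ℕ, (p : ℤ) ^ o ∣ A ∧ (p : ℤ) ^ o ∣ B ∧ ¬ (p : ℤ) ^ (o + 1) ∣ B) := by
    intro A B hAB
    have hg : (gcd A B : ℤ) ≠ 0 := by
      intro h
      rw [_root_.gcd_eq_zero_iff] at h
      exact hAB (by rw [h.1, h.2, add_zero])
    obtain ⟨o, h1, h2⟩ := dvd_exact hp hg
    by_cases h3 : (p : ℤ) ^ (o + 1) ∣ A
    · right
      exact ⟨o, h1.trans (GCDMonoid.gcd_dvd_left _ _), h1.trans (GCDMonoid.gcd_dvd_right _ _), fun h4 => h2 (GCDMonoid.dvd_gcd h3 h4)⟩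
    · left
      exact ⟨o, h1.trans (GCDMonoid.gcd_dvd_left _ _), h1.trans (GCDMonoid.gcd_dvd_right _ _), h3⟩
  rcases key (T + X) (T - X) (by intro h; apply hT; omega) with ⟨o, h1, h2, h3⟩ | ⟨o, h1, h2, h3⟩
  · exact Or.inl ⟨o, h2, h1, h3⟩
  · exact Or.inr ⟨o, by rw [sub_neg_eq_add]; exact h1, by rw [← sub_eq_add_neg]; exact h2,
      by rw [← sub_eq_add_neg]; exact h3⟩

end APU

set_option maxHeartbeats 400000

namespace APU
open Finset

lemma good_of {p o J : ℕ} (hp : p.Prime) {T X u U V r r' : ℤ} (hu : ¬ (p : ℤ) ∣ u) (hU : (p : ℤ) ^ o ∣ U) (hV : (p : ℤ) ^ o ∣ V)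
    (hU' : ¬ (p : ℤ) ^ (o + 1) ∣ U) (hJ : o < J) (h1 : T + X = u * U + p ^ J * r) (h2 : T - X = u * V + p ^ J * r') :
    Good p T X := by
  have hoJ : (p : ℤ) ^ (o + 1) ∣ p ^ J := pow_dvd_pow _ hJ
  have hoJ' : (p : ℤ) ^ o ∣ p ^ J := pow_dvd_pow _ hJ.le
  refine ⟨o, ?_, ?_, ?_⟩
  · rw [h2]; exact dvd_add (hV.mul_left _) (hoJ'.mul_right _)
  · rw [h1]; exact dvd_add (hU.mul_left _) (hoJ'.mul_right _)
  · rw [h1]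
    intro h
    have h3 : (p : ℤ) ^ (o + 1) ∣ u * U := (dvd_add_left (hoJ.mul_right _)).1 h
    have hpz : Prime (p : ℤ) := Nat.prime_iff_prime_int.1 hp
    have hc : IsCoprime ((p : ℤ) ^ (o + 1)) u := ((Prime.coprime_iff_not_dvd hpz).2 hu).pow_left
    exact hU' (hc.dvd_of_dvd_mul_left h3)

lemma not_pow_dvd_big {p : ℕ} (hp : p.Prime) {z : ℤ} (hz : z ≠ 0) {J : ℕ} (hJ : z.natAbs < J) : ¬ (p : ℤ) ^ J ∣ z := by
  intro h
  have h1 : p ^ J ∣ z.natAbs := by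
    have := Int.natAbs_dvd_natAbs.2 h
    rwa [Int.natAbs_pow, Int.natAbs_natCast] at this
  have h2 := Nat.le_of_dvd (Int.natAbs_pos.2 hz) h1
  have h3 : J < p ^ J := Nat.lt_pow_self hp.one_lt
  omega

lemma sign_fix {S : Finset ℕ} (hS : ∀ p ∈ S, p.Prime) {D T : ℤ} (hD : 0 < D) (hT : T ≠ 0) (X Y : ℤ) :
    ∃ P1 P2 : ℤ, P1 ^ 2 + D * P2 ^ 2 ≠ 0 ∧ ∀ p ∈ S, Good p (T * (P1 ^ 2 + D * P2 ^ 2))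
      (X * (P1 ^ 2 - D * P2 ^ 2) - 2 * D * P1 * P2 * Y) := by
  classical
  set J : ℕ := (D * (T + X)).natAbs + (D * (T - X)).natAbs + (T + X).natAbs + 1 with hJ
  have hprod : ∀ (S' : Finset ℕ), S' ⊆ S → ∀ p ∈ S, p ∉ S' → ¬ (p : ℤ) ∣ ∏ q ∈ S', (q : ℤ) ^ J := by
    intro S' hS' p hp hpn h
    have hpz : Prime (p : ℤ) := Nat.prime_iff_prime_int.1 (hS p hp)
    obtain ⟨q, hq, h⟩ := (Prime.dvd_finset_prod_iff hpz _).1 h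
    have h1 : (p : ℤ) ∣ q := hpz.dvd_of_dvd_pow h
    have h2 := (Nat.prime_dvd_prime_iff_eq (hS p hp) (hS q (hS' hq))).1 (by exact_mod_cast h1)
    exact hpn (h2 ▸ hq)
  have hprod' : ∀ (S' : Finset ℕ), ∀ p ∈ S', ∃ r : ℤ, ∏ q ∈ S', (q : ℤ) ^ J = p ^ J * r := fun S' p hp => by
    obtain ⟨r, hr⟩ := Finset.dvd_prod_of_mem (fun q : ℕ => (q : ℤ) ^ J) hp
    exact ⟨r, hr⟩
  set S1 := S.filter (fun p => ¬ Good p T X) with hS1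
  set S2 := S.filter (fun p => Good p T X) with hS2
  set P1 := ∏ q ∈ S1, (q : ℤ) ^ J with hP1
  set P2 := ∏ q ∈ S2, (q : ℤ) ^ J with hP2
  have hP10 : P1 ≠ 0 := Finset.prod_ne_zero_iff.2 (fun q hq => pow_ne_zero _ (by
    exact_mod_cast (hS q (Finset.mem_filter.1 hq).1).ne_zero))
  refine ⟨P1, P2, ?_, ?_⟩
  · have : 0 < P1 ^ 2 := by positivity
    have : 0 ≤ D * P2 ^ 2 := by positivity
    omega
  intro p hpS
  have hp := hS p hpS
  have hpz : Prime (p : ℤ) := Nat.prime_iff_prime_int.1 hp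
  by_cases hg : Good p T X
  · have h1 : ¬ (p : ℤ) ∣ P1 := hprod S1 (Finset.filter_subset _ _) p hpS (by simp [hS1, hg])
    obtain ⟨r, hr⟩ := hprod' S2 p (by simp [hS2, hg, hpS])
    obtain ⟨o, ho1, ho2, ho3⟩ := hg
    have hne : T + X ≠ 0 := by rintro h; rw [h] at ho3; exact ho3 (dvd_zero _)
    have hoJ : o < J := by
      by_contra hcon
      exact not_pow_dvd_big hp hne (J := J) (by omega) ((pow_dvd_pow _ (not_lt.1 hcon)).trans ho2)
    have e : P2 = p ^ J * r := hr
    exact good_of hp (u := P1 ^ 2) (U := T + X) (V := T - X) (o := o) (J := J) (fun h => h1 (hpz.dvd_of_dvd_pow h)) ho2 ho1 ho3 hoJ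
      (r := r * (D * P2 * (T - X) - 2 * D * P1 * Y)) (r' := r * (D * P2 * (T + X) + 2 * D * P1 * Y))
      (by linear_combination (D * P2 * (T - X) - 2 * D * P1 * Y) * e) (by linear_combination (D * P2 * (T + X) + 2 * D * P1 * Y) * e)
  · have h1 : ¬ (p : ℤ) ∣ P2 := hprod S2 (Finset.filter_subset _ _) p hpS (by simp [hS2, hg])
    obtain ⟨r, hr⟩ := hprod' S1 p (by simp [hS1, hg, hpS])
    obtain ⟨o, ho1, ho2, ho3⟩ := (good_or hp X hT).resolve_left hg
    rw [sub_neg_eq_add] at ho1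
    rw [← sub_eq_add_neg] at ho2 ho3
    obtain ⟨d, ⟨D', hd1⟩, hd2⟩ := dvd_exact hp hD.ne'
    have hpD' : ¬ (p : ℤ) ∣ D' := by
      rintro ⟨z, hz⟩; exact hd2 ⟨z, by rw [hd1, hz]; ring⟩
    have hne : T - X ≠ 0 := by rintro h; rw [h] at ho3; exact ho3 (dvd_zero _)
    have hU : (p : ℤ) ^ (d + o) ∣ D * (T - X) := by rw [pow_add]; exact mul_dvd_mul ⟨D', hd1⟩ ho2
    have hV : (p : ℤ) ^ (d + o) ∣ D * (T + X) := by rw [pow_add]; exact mul_dvd_mul ⟨D', hd1⟩ ho1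
    have hU' : ¬ (p : ℤ) ^ (d + o + 1) ∣ D * (T - X) := by
      intro h
      rw [hd1, add_assoc, pow_add, mul_assoc] at h
      have h := (mul_dvd_mul_iff_left (pow_ne_zero d hpz.ne_zero)).1 h
      exact ho3 ((((Prime.coprime_iff_not_dvd hpz).2 hpD').pow_left).dvd_of_dvd_mul_left h)
    have hoJ : d + o < J := by
      by_contra hcon
      exact not_pow_dvd_big hp (mul_ne_zero hD.ne' hne) (J := J) (by omega) ((pow_dvd_pow _ (not_lt.1 hcon)).trans hU)
    have e : P1 = p ^ J * r := hr
    exact good_of hp (u := P2 ^ 2) (U := D * (T - X)) (V := D * (T + X)) (o := d + o) (J := J) (fun h => h1 (hpz.dvd_of_dvd_pow h)) hU hV hU' hoJ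
      (r := r * (P1 * (T + X) - 2 * D * P2 * Y)) (r' := r * (P1 * (T - X) + 2 * D * P2 * Y))
      (by linear_combination (P1 * (T + X) - 2 * D * P2 * Y) * e) (by linear_combination (P1 * (T - X) + 2 * D * P2 * Y) * e)

/-- decomposition into an `s0`-smooth part and a part coprime to `s0` -/
lemma split_smooth (s0 : ℕ) : ∀ x : ℕ, x ≠ 0 → ∃ e y : ℕ, x = e * y ∧ y.Coprime s0 ∧ ∀ p : ℕ, p.Prime → p ∣ e → p ∣ s0 := by
  intro x
  induction x using Nat.strong_induction_on with
  | _ x ih =>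
    intro hx
    by_cases hc : x.Coprime s0
    · exact ⟨1, x, by simp, hc, fun p hp h => absurd (Nat.dvd_one.1 h) hp.one_lt.ne'⟩
    · obtain ⟨p, hp, ⟨y, rfl⟩, hps⟩ := Nat.Prime.not_coprime_iff_dvd.1 hc
      have hy : y ≠ 0 := by rintro rfl; simp at hx
      obtain ⟨e, z, h1, h2, h3⟩ := ih y (by nlinarith [hp.two_le, Nat.pos_of_ne_zero hy]) hy
      refine ⟨p * e, z, by rw [h1]; ring, h2, fun q hq h => ?_⟩
      rcases hq.dvd_mul.1 h with h | h
      · rwa [(Nat.prime_dvd_prime_iff_eq hq hp).1 h]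
      · exact h3 q hq h

end APU

set_option maxHeartbeats 400000

namespace APU
open Finset

/-- local divisibility at one prime -/
lemma rot_local {p : ℕ} (hp : p.Prime) {D N n k X Y Z j : ℤ} (hpN : (p : ℤ) ∣ N) (hpn : ¬ (p : ℤ) ∣ n)
    (hj : k - n = 16 * D * N * j) (hXY : X ^ 2 + D * Y ^ 2 = n * k * Z ^ 2) (hg : Good p (n * Z) X) :
    2 * (n * Z + X) + Z * (k - n) ≠ 0 ∧
    ∀ i : ℕ, (p : ℤ) ^ i ∣ (2 * (n * Z + X) + Z * (k - n)) * N →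
      (p : ℤ) ^ i ∣ (k - n) * (n * Z + X) ∧ (p : ℤ) ^ i ∣ (k - n) * Y := by
  have hpz : Prime (p : ℤ) := Nat.prime_iff_prime_int.1 hp
  obtain ⟨o, ⟨t', ht'⟩, ⟨t, ht⟩, h3⟩ := hg
  have hpt : ¬ (p : ℤ) ∣ t := by
    rintro ⟨z, hz⟩; exact h3 ⟨z, by rw [ht, hz]; ring⟩
  obtain ⟨z, hz⟩ : (p : ℤ) ^ o ∣ 2 * Z := by
    have h4 : (p : ℤ) ^ o ∣ n * (2 * Z) := ⟨t + t', by linear_combination ht + ht'⟩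
    exact (((Prime.coprime_iff_not_dvd hpz).2 hpn).pow_left).dvd_of_dvd_mul_left h4
  obtain ⟨y, hy⟩ : (p : ℤ) ^ o ∣ 8 * D * Y := by
    rw [← Int.pow_dvd_pow_iff (n := 2) (by norm_num)]
    refine ⟨64 * D * (t' * t) + 256 * D ^ 2 * n * N * j * z ^ 2, ?_⟩
    have e1 : (n * Z - X) * (n * Z + X) = (p : ℤ) ^ o * t' * (p ^ o * t) := by rw [ht', ht]
    have e2 : (2 * Z) ^ 2 = (p ^ o * z) ^ 2 := by rw [hz]
    linear_combination 64 * D * hXY + 64 * D * e1 + 256 * D ^ 2 * n * N * j * e2 + 64 * D * n * Z ^ 2 * hj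
  set u := t + 4 * D * N * j * z with hu
  have hpu : ¬ (p : ℤ) ∣ u := by
    intro h
    apply hpt
    have h5 : (p : ℤ) ∣ 4 * D * N * j * z := by
      obtain ⟨w, hw⟩ := hpN
      exact ⟨4 * D * w * j * z, by rw [hw]; ring⟩
    exact (dvd_add_left h5).1 h
  have hE : 2 * (n * Z + X) + Z * (k - n) = p ^ o * (2 * u) := by
    rw [hu]; linear_combination 2 * ht + Z * hj + 8 * D * N * j * hz
  refine ⟨?_, ?_⟩
  · rw [hE]
    have : u ≠ 0 := by rintro h; rw [h] at hpu; exact hpu (dvd_zero _)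
    exact mul_ne_zero (pow_ne_zero _ hpz.ne_zero) (by omega)
  · intro i hi
    have h6 : (p : ℤ) ^ i ∣ 2 * p ^ o * N := by
      rw [hE] at hi
      have : (p : ℤ) ^ i ∣ u * (2 * p ^ o * N) := by convert hi using 1; ring
      exact (((Prime.coprime_iff_not_dvd hpz).2 hpu).pow_left).dvd_of_dvd_mul_left this
    constructor
    · exact h6.trans ⟨8 * D * j * t, by linear_combination (n * Z + X) * hj + 16 * D * N * j * ht⟩
    · exact h6.trans ⟨j * y, by linear_combination Y * hj + 2 * N * j * hy⟩

lemma rotation {s0 D N ν n k : ℕ} (hD2 : 2 ≤ D) (hD : 2 * D ∣ s0) (hs0 : s0 ∣ N) (hN0 : 0 < N)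
    (hN : ∀ p : ℕ, p.Prime → p ∣ N → p ∣ s0) (hn0 : 0 < n) (hk0 : 0 < k)
    (hν : ∀ p : ℕ, p.Prime → p ∣ ν → p ∣ s0) (hn : n.Coprime s0) (hk : k.Coprime s0)
    (hnk : ((16 * D * N : ℕ) : ℤ) ∣ k - n)
    {c1 c2 : ℤ} (hc : c1 ^ 2 + D * c2 ^ 2 = ν * n) (hrho : rho s0 D k ≠ 0) :
    ∃ (A1 A2 : ℤ) (b : ℕ), 0 < b ∧ b.Coprime s0 ∧ (N : ℤ) ∣ A1 - b * c1 ∧ (N : ℤ) ∣ A2 - b * c2 ∧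
      A1 ^ 2 + D * A2 ^ 2 = ν * k * b ^ 2 := by
  have hDz : (D : ℤ) ∣ k - n := Dvd.dvd.trans ⟨16 * N, by push_cast; ring⟩ hnk
  obtain ⟨X0, Y0, Z0, hZ0, h0⟩ := theta_exists hD2 hD hn0 hk0 hν hn hk hDz hc hrho
  have hs00 : s0 ≠ 0 := by rintro rfl; simp at hs0; omega
  obtain ⟨P1, P2, hP, hgood⟩ := sign_fix (S := s0.primeFactors) (fun p hp => Nat.prime_of_mem_primeFactors hp)
    (D := D) (T := n * Z0) (by exact_mod_cast (by omega : 0 < D)) (mul_ne_zero (by exact_mod_cast hn0.ne') hZ0) X0 Y0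
  obtain ⟨X, hX⟩ : ∃ X, X = X0 * (P1 ^ 2 - D * P2 ^ 2) - 2 * D * P1 * P2 * Y0 := ⟨_, rfl⟩
  obtain ⟨Y, hY⟩ : ∃ Y, Y = Y0 * (P1 ^ 2 - D * P2 ^ 2) + 2 * P1 * P2 * X0 := ⟨_, rfl⟩
  obtain ⟨Z, hZ⟩ : ∃ Z, Z = Z0 * (P1 ^ 2 + D * P2 ^ 2) := ⟨_, rfl⟩
  have hXY : X ^ 2 + D * Y ^ 2 = n * k * Z ^ 2 := by
    rw [hX, hY, hZ]
    linear_combination (P1 ^ 2 + D * P2 ^ 2) ^ 2 * h0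
  obtain ⟨j, hj⟩ := hnk
  have hj' : (k : ℤ) - n = 16 * D * N * j := by rw [hj]; push_cast; ring
  have hloc : ∀ p : ℕ, p.Prime → p ∣ s0 → _ := fun p hp hps =>
    rot_local hp (D := D) (N := N) (n := n) (k := k) (X := X) (Y := Y) (Z := Z) (j := j)
    (by exact_mod_cast hps.trans hs0) (by
      intro h
      have h : p ∣ n := by exact_mod_cast h
      exact hp.one_lt.ne' (Nat.dvd_one.1 (by rw [← hn]; exact Nat.dvd_gcd h hps))) hj' hXY (by
      have := hgood p (Nat.mem_primeFactors.2 ⟨hp, hps, hs00⟩)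
      rw [hX, hZ, ← mul_assoc]; exact this)
  obtain ⟨E, hE⟩ : ∃ E : ℤ, E = 2 * (n * Z + X) + Z * (k - n) := ⟨_, rfl⟩
  rw [← hE] at hloc
  have hE0 : E ≠ 0 := (hloc 2 Nat.prime_two ((dvd_mul_right 2 D).trans hD)).1
  obtain ⟨e, E', heE, hE', he⟩ := split_smooth s0 E.natAbs (Int.natAbs_ne_zero.2 hE0)
  -- signed
  obtain ⟨e', hee, hEe⟩ : ∃ e' : ℤ, e'.natAbs = e ∧ E = e' * E' := by
    rcases Int.natAbs_eq E with h | h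
    · exact ⟨e, by simp, by rw [h, heE]; push_cast; ring⟩
    · exact ⟨-e, by simp, by rw [h, heE]; push_cast; ring⟩
  have he'0 : e' ≠ 0 := by rintro rfl; simp at hEe; exact hE0 hEe
  have hE'0 : 0 < E' := by
    rcases Nat.eq_zero_or_pos E' with h | h
    · rw [h] at hEe; simp at hEe; exact absurd hEe hE0
    · exact h
  have hdvd : ∀ W : ℤ, (∀ p : ℕ, p.Prime → p ∣ s0 → ∀ i : ℕ, (p : ℤ) ^ i ∣ E * N → (p : ℤ) ^ i ∣ W) → e' * N ∣ W := by
    intro W hW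
    rw [← Int.natAbs_dvd_natAbs, Int.natAbs_mul, hee, Int.natAbs_natCast, Nat.dvd_iff_prime_pow_dvd_dvd]
    intro p i hp hi
    rcases Nat.eq_zero_or_pos i with rfl | hi0
    · simp
    have hps : p ∣ s0 := by
      rcases hp.dvd_mul.1 ((dvd_pow_self p hi0.ne').trans hi) with h | h
      · exact he p hp h
      · exact hN p hp h
    have := hW p hp hps i (by
      rw [hEe]
      have h1 : ((p ^ i : ℕ) : ℤ) ∣ ((e * N : ℕ) : ℤ) := by exact_mod_cast hi
      push_cast at h1
      rw [← hee, Int.natCast_natAbs] at h1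
      have h2 : |e'| * (N : ℤ) ∣ e' * E' * N := ⟨(SignType.sign e' : ℤ) * E', by
        have := sign_mul_abs e'; linear_combination -(E' : ℤ) * N * this⟩
      exact h1.trans h2)
    rw [← Int.natAbs_dvd_natAbs] at this
    simpa [Int.natAbs_pow] using this
  obtain ⟨u, hu⟩ := hdvd ((k - n) * (n * Z + X)) (fun p hp hps i hi => ((hloc p hp hps).2 i hi).1)
  obtain ⟨v, hv⟩ := hdvd ((k - n) * Y) (fun p hp hps i hi => ((hloc p hp hps).2 i hi).2)
  -- (nE + (k-n)(T+X) - (k-n) Y √-D)/e = (n E' + N u) - N v √-D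
  refine ⟨c1 * (n * E' + N * u) + D * c2 * (N * v), c2 * (n * E' + N * u) - c1 * (N * v), n * E', by positivity,
    Nat.Coprime.mul_left hn hE', ⟨c1 * u + D * c2 * v, by push_cast; ring⟩, ⟨c2 * u - c1 * v, by push_cast; ring⟩, ?_⟩
  have key : (n * E' + N * u) ^ 2 + D * (N * v) ^ 2 = n * k * (E' : ℤ) ^ 2 := by
    have h1 : e' ^ 2 * ((n * E' + N * u) ^ 2 + D * (N * v) ^ 2) = e' ^ 2 * (n * k * (E' : ℤ) ^ 2) := by
      have a1 : e' ^ 2 * ((n * E' + N * u) ^ 2 + D * (N * v) ^ 2) = (n * (e' * E') + e' * N * u) ^ 2 + D * (e' * N * v) ^ 2 := by ring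
      have a2 : e' ^ 2 * (n * k * (E' : ℤ) ^ 2) = n * k * (e' * E') ^ 2 := by ring
      rw [a1, a2, ← hEe, ← hu, ← hv, hE]
      linear_combination ((k : ℤ) - n) ^ 2 * hXY
    exact mul_left_cancel₀ (pow_ne_zero 2 he'0) h1
  push_cast
  linear_combination (c1 ^ 2 + D * c2 ^ 2) * key + n * k * (E' : ℤ) ^ 2 * hc

/-- primitive version, with the square root `s` of `-D` modulo `b²` -/
lemma rotation' {s0 D N ν n k : ℕ} (hD2 : 2 ≤ D) (hD : 2 * D ∣ s0) (hs0 : s0 ∣ N) (hN0 : 0 < N)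
    (hN : ∀ p : ℕ, p.Prime → p ∣ N → p ∣ s0) (hn0 : 0 < n) (hk0 : 0 < k)
    (hν : ∀ p : ℕ, p.Prime → p ∣ ν → p ∣ s0) (hn : n.Coprime s0) (hk : k.Coprime s0)
    (hnk : ((16 * D * N : ℕ) : ℤ) ∣ k - n)
    {c1 c2 : ℤ} (hc : c1 ^ 2 + D * c2 ^ 2 = ν * n) (hrho : rho s0 D k ≠ 0) :
    ∃ (A1 A2 b s : ℤ), 0 < b ∧ IsCoprime b N ∧ (N : ℤ) ∣ A1 - b * c1 ∧ (N : ℤ) ∣ A2 - b * c2 ∧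
      A1 ^ 2 + D * A2 ^ 2 = ν * k * b ^ 2 ∧ b ^ 2 ∣ s * A2 - A1 ∧ b ^ 2 ∣ s ^ 2 + D := by
  obtain ⟨A1, A2, b, hb0, hb, h1, h2, h3⟩ := rotation hD2 hD hs0 hN0 hN hn0 hk0 hν hn hk hnk hc hrho
  have hbN : IsCoprime (b : ℤ) N := by
    rw [Nat.isCoprime_iff_coprime]
    by_contra hcon
    obtain ⟨p, hp, h4, h5⟩ := Nat.Prime.not_coprime_iff_dvd.1 hcon
    exact hp.one_lt.ne' (Nat.dvd_one.1 (by rw [← hb]; exact Nat.dvd_gcd h4 (hN p hp h5)))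
  obtain ⟨g, hg⟩ : ∃ g : ℕ, g = Int.gcd (Int.gcd A1 A2) b := ⟨_, rfl⟩
  have hg0 : g ≠ 0 := by
    intro h
    rw [h] at hg
    have := (Int.gcd_eq_zero_iff.1 hg.symm).2
    omega
  have hgA : (g : ℤ) ∣ (Int.gcd A1 A2 : ℤ) := by rw [hg]; exact Int.gcd_dvd_left _ _
  have hgb : (g : ℤ) ∣ b := by rw [hg]; exact Int.gcd_dvd_right _ _
  obtain ⟨B1, hB1⟩ := hgA.trans (Int.gcd_dvd_left A1 A2)
  obtain ⟨B2, hB2⟩ := hgA.trans (Int.gcd_dvd_right A1 A2)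
  obtain ⟨β, hβ⟩ := hgb
  have hgz : (g : ℤ) ≠ 0 := by exact_mod_cast hg0
  have hβ0 : 0 < β := by
    have : 0 < (g : ℤ) * β := by rw [← hβ]; exact_mod_cast hb0
    exact pos_of_mul_pos_right this (by positivity)
  have hgN : IsCoprime (N : ℤ) g := (hbN.of_isCoprime_of_dvd_left ⟨β, hβ⟩).symm
  have hnorm : B1 ^ 2 + D * B2 ^ 2 = ν * k * β ^ 2 := by
    apply mul_left_cancel₀ (pow_ne_zero 2 hgz)
    rw [hB1, hB2, hβ] at h3
    linear_combination h3
  have hcop : IsCoprime (β ^ 2) B2 := by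
    apply IsCoprime.pow_left
    rw [Int.isCoprime_iff_gcd_eq_one]
    by_contra hcon
    obtain ⟨p, hp, hpg⟩ := Nat.exists_prime_and_dvd hcon
    have hpz : Prime (p : ℤ) := Nat.prime_iff_prime_int.1 hp
    have h4 : (p : ℤ) ∣ β := (Int.natCast_dvd_natCast.2 hpg).trans (Int.gcd_dvd_left _ _)
    have h5 : (p : ℤ) ∣ B2 := (Int.natCast_dvd_natCast.2 hpg).trans (Int.gcd_dvd_right _ _)
    have h6 : (p : ℤ) ∣ B1 := by
      apply hpz.dvd_of_dvd_pow (n := 2)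
      have : B1 ^ 2 = β * (ν * k * β) - B2 * (D * B2) := by linear_combination hnorm
      rw [this]
      exact dvd_sub (h4.mul_right _) (h5.mul_right _)
    have h7 : ((g * p : ℕ) : ℤ) ∣ (g : ℤ) := by
      conv_rhs => rw [hg]
      rw [Int.natCast_dvd_natCast]
      apply Int.dvd_gcd
      · apply Int.dvd_coe_gcd
        · rw [hB1]; push_cast; exact mul_dvd_mul_left _ h6
        · rw [hB2]; push_cast; exact mul_dvd_mul_left _ h5
      · rw [hβ]; push_cast; exact mul_dvd_mul_left _ h4
    have h8 := Nat.le_of_dvd (Nat.pos_of_ne_zero hg0) (Int.natCast_dvd_natCast.1 h7)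
    nlinarith [hp.two_le, Nat.pos_of_ne_zero hg0]
  obtain ⟨u, v, huv⟩ := id hcop
  have hs : β ^ 2 ∣ (v * B1) * B2 - B1 := ⟨-u * B1, by linear_combination B1 * huv⟩
  refine ⟨B1, B2, β, v * B1, hβ0, hbN.of_isCoprime_of_dvd_left ⟨g, by rw [hβ]; ring⟩, ?_, ?_, hnorm, hs, ?_⟩
  · apply hgN.dvd_of_dvd_mul_left
    obtain ⟨w, hw⟩ := h1
    exact ⟨w, by linear_combination hw - hB1 + c1 * hβ⟩
  · apply hgN.dvd_of_dvd_mul_left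
    obtain ⟨w, hw⟩ := h2
    exact ⟨w, by linear_combination hw - hB2 + c2 * hβ⟩
  · have h9 : β ^ 2 ∣ B2 ^ 2 * ((v * B1) ^ 2 + D) := by
      have : B2 ^ 2 * ((v * B1) ^ 2 + D) = (v * B1 * B2 - B1) * (v * B1 * B2 + B1) + β ^ 2 * (ν * k) := by
        linear_combination hnorm
      rw [this]
      exact dvd_add (hs.mul_right _) (dvd_mul_right _ _)
    exact (hcop.pow_right (n := 2)).dvd_of_dvd_mul_left h9

end APU

set_option maxHeartbeats 400000

namespace APU
open Finset

lemma reduce_form {D : ℤ} (hD : 0 < D) : ∀ (M : ℕ) (a b c : ℤ), 0 < a → a.toNat = M → a * c - b ^ 2 = D →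
    ∃ p q r t a' b' c' : ℤ, p * t - q * r = 1 ∧ 0 < a' ∧ a' * c' - b' ^ 2 = D ∧ 2 * |b'| ≤ a' ∧ a' ≤ c' ∧
      ∀ x y, a * x ^ 2 + 2 * b * x * y + c * y ^ 2 =
        a' * (p * x + q * y) ^ 2 + 2 * b' * (p * x + q * y) * (r * x + t * y) + c' * (r * x + t * y) ^ 2 := by
  intro M
  induction M using Nat.strong_induction_on with
  | _ M ih =>
    intro a b c ha hM hdet
    obtain ⟨j, hj⟩ : ∃ j, j = (2 * b + a) / (2 * a) := ⟨_, rfl⟩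
    obtain ⟨b0, hb0⟩ : ∃ b0, b0 = b - a * j := ⟨_, rfl⟩
    obtain ⟨c0, hc0⟩ : ∃ c0, c0 = c - 2 * b * j + a * j ^ 2 := ⟨_, rfl⟩
    have h1 := Int.emod_add_mul_ediv (2 * b + a) (2 * a)
    have h2 := Int.emod_nonneg (2 * b + a) (by omega : 2 * a ≠ 0)
    have h3 := Int.emod_lt_of_pos (2 * b + a) (by omega : 0 < 2 * a)
    rw [← hj] at h1
    have hb : 2 * |b0| ≤ a := by
      rcases abs_cases b0 with ⟨h, _⟩ | ⟨h, _⟩ <;> rw [h, hb0] <;> linarith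
    have hdet0 : a * c0 - b0 ^ 2 = D := by rw [hc0, hb0]; linear_combination hdet
    have heq : ∀ x y, a * x ^ 2 + 2 * b * x * y + c * y ^ 2 = a * (x + j * y) ^ 2 + 2 * b0 * (x + j * y) * y + c0 * y ^ 2 := by
      intro x y; rw [hb0, hc0]; ring
    by_cases hac : a ≤ c0
    · refine ⟨1, j, 0, 1, a, b0, c0, by ring, ha, hdet0, hb, hac, fun x y => ?_⟩
      rw [heq]; ring
    · have hc0p : 0 < c0 := by
        have : 0 < a * c0 := by have := sq_nonneg b0; linarith
        exact pos_of_mul_pos_right this ha.le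
      obtain ⟨p, q, r, t, a', b', c', e1, e2, e3, e4, e5, e6⟩ := ih c0.toNat (by omega) c0 (-b0) a hc0p rfl (by linear_combination hdet0)
      refine ⟨-q, p - q * j, -t, r - t * j, a', b', c', by linear_combination e1, e2, e3, e4, e5, fun x y => ?_⟩
      have := e6 y (-(x + j * y))
      rw [heq]
      linear_combination this

lemma crt_finset {N : ℕ} (τ : ℤ) (r : ℕ → ℤ) (P : Finset ℕ) (hP : ∀ p ∈ P, p.Prime ∧ ¬ p ∣ N) :
    ∃ x : ℤ, (N : ℤ) ∣ x - τ ∧ ∀ p ∈ P, (p : ℤ) ∣ x - r p := by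
  classical
  induction P using Finset.induction_on with
  | empty => exact ⟨τ, by simp, by simp⟩
  | insert p P hp ih =>
    obtain ⟨x, h1, h2⟩ := ih (fun q hq => hP q (mem_insert_of_mem hq))
    obtain ⟨hpp, hpN⟩ := hP p (mem_insert_self _ _)
    have hpz : Prime (p : ℤ) := Nat.prime_iff_prime_int.1 hpp
    have hc : IsCoprime (p : ℤ) ((N : ℤ) * ∏ q ∈ P, (q : ℤ)) := by
      rw [Prime.coprime_iff_not_dvd hpz]
      intro h
      rcases hpz.dvd_mul.1 h with h | h
      · exact hpN (by exact_mod_cast h)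
      · obtain ⟨q, hq, h⟩ := (Prime.dvd_finset_prod_iff hpz _).1 h
        have := (Nat.prime_dvd_prime_iff_eq hpp (hP q (mem_insert_of_mem hq)).1).1 (by exact_mod_cast h)
        exact hp (this ▸ hq)
    obtain ⟨u, v, huv⟩ := hc
    refine ⟨x + (N * ∏ q ∈ P, (q : ℤ)) * (v * (r p - x)), ?_, ?_⟩
    · rw [add_sub_right_comm]
      exact dvd_add h1 (((dvd_mul_right _ _)).mul_right _)
    · intro q hq
      rcases mem_insert.1 hq with rfl | hq
      · exact ⟨-u * (r q - x), by linear_combination (r q - x) * huv⟩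
      · rw [add_sub_right_comm]
        exact dvd_add (h2 q hq) (((Finset.dvd_prod_of_mem _ hq).mul_left _).mul_right _)

lemma pick {P : Finset ℕ} {N : ℕ} (hN : 0 < N) (hP : ∀ p ∈ P, p.Prime ∧ 3 ≤ p ∧ ¬ p ∣ N) (bad : ℕ → ℤ → Prop)
    (hper : ∀ p ∈ P, ∀ x y : ℤ, (p : ℤ) ∣ x - y → bad p x → bad p y)
    (h3 : ∀ p ∈ P, ∀ x y z : ℤ, bad p x → bad p y → bad p z → (p : ℤ) ∣ x - y ∨ (p : ℤ) ∣ x - z ∨ (p : ℤ) ∣ y - z) (τ : ℤ) :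
    ∃ x : ℤ, (N : ℤ) ∣ x - τ ∧ 0 ≤ x ∧ x ≤ N * 64 ^ P.card ∧ ∀ p ∈ P, ¬ bad p x := by
  classical
  set w := P.card with hw
  have hgood : ∀ p ∈ P, ∃ r : ℤ, ¬ bad p r := by
    intro p hp
    by_contra hcon
    push Not at hcon
    obtain ⟨_, h4, _⟩ := hP p hp
    rcases h3 p hp 0 1 2 (hcon 0) (hcon 1) (hcon 2) with h | h | h
    all_goals
      norm_num at h
      try have h := Int.le_of_dvd (by norm_num) h
      try omega
  choose! r hr using hgood
  set P1 := P.filter (fun p => p ≤ 2 * w) with hP1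
  obtain ⟨x0, hx0, hx1⟩ := crt_finset (N := N) τ r P1 (fun p hp => ⟨(hP p (mem_filter.1 hp).1).1, (hP p (mem_filter.1 hp).1).2.2⟩)
  set Q := ∏ p ∈ P1, p with hQ
  have hQ0 : 0 < Q := Finset.prod_pos (fun p hp => (hP p (mem_filter.1 hp).1).1.pos)
  have hQle : Q ≤ 16 ^ w := by
    calc Q ≤ primorial (2 * w) := by
          unfold primorial
          apply Finset.prod_le_prod_of_subset_of_one_le'
          · intro p hp
            simp only [hP1, mem_filter] at hp
            simp only [mem_filter, mem_range]
            exact ⟨by omega, (hP p hp.1).1⟩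
          · intro p hp _
            exact (mem_filter.1 hp).2.one_lt.le
      _ ≤ 4 ^ (2 * w) := primorial_le_four_pow _
      _ = 16 ^ w := by rw [pow_mul]; norm_num
  set y := x0 % ((N * Q : ℕ) : ℤ) with hy
  have hNQ : 0 < ((N * Q : ℕ) : ℤ) := by exact_mod_cast Nat.mul_pos hN hQ0
  have hyx : ((N * Q : ℕ) : ℤ) ∣ y - x0 := Dvd.intro (-(x0 / ((N * Q : ℕ) : ℤ))) (by
    have := Int.emod_add_mul_ediv x0 ((N * Q : ℕ) : ℤ)
    linarith)
  have hy0 : 0 ≤ y := Int.emod_nonneg _ hNQ.ne'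
  have hy1 : y < ((N * Q : ℕ) : ℤ) := Int.emod_lt_of_pos _ hNQ
  have hex : ∃ s ∈ range (2 * w + 1), ∀ p ∈ P, ¬ p ≤ 2 * w → ¬ bad p (y + ((N * Q : ℕ) : ℤ) * s) := by
    by_contra hcon
    push Not at hcon
    have hsub : range (2 * w + 1) ⊆ (P.filter (fun p => ¬ p ≤ 2 * w)).biUnion
        (fun p => (range (2 * w + 1)).filter (fun s : ℕ => bad p (y + ((N * Q : ℕ) : ℤ) * s))) := by
      intro s hs
      obtain ⟨p, hp, hp2, hb⟩ := hcon s hs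
      simp only [mem_biUnion, mem_filter]
      exact ⟨p, ⟨hp, by omega⟩, hs, hb⟩
    have h4 := (card_le_card hsub).trans card_biUnion_le
    have h5 : ∀ p ∈ P.filter (fun p => ¬ p ≤ 2 * w),
        ((range (2 * w + 1)).filter (fun s : ℕ => bad p (y + ((N * Q : ℕ) : ℤ) * s))).card ≤ 2 := by
      intro p hp
      obtain ⟨hpP, hp2⟩ := mem_filter.1 hp
      obtain ⟨hpp, hp3, hpN⟩ := hP p hpP
      have hpz : Prime (p : ℤ) := Nat.prime_iff_prime_int.1 hpp
      by_contra hc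
      obtain ⟨s1, m1, s2, m2, s3, m3, n1, n2, n3⟩ := Finset.two_lt_card.1 (not_le.1 hc)
      have hne : ∀ s s' : ℕ, s < 2 * w + 1 → s' < 2 * w + 1 → s ≠ s' →
          ¬ (p : ℤ) ∣ (y + ((N * Q : ℕ) : ℤ) * s) - (y + ((N * Q : ℕ) : ℤ) * s') := by
        intro s s' hs hs' hss h
        have h6 : (p : ℤ) ∣ ((N * Q : ℕ) : ℤ) * ((s : ℤ) - s') := by convert h using 1; ring
        rcases hpz.dvd_mul.1 h6 with h7 | h7
        · have h8 : p ∣ N * Q := by exact_mod_cast h7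
          rcases hpp.dvd_mul.1 h8 with h8 | h8
          · exact hpN h8
          · obtain ⟨q, hq, h9⟩ := (Prime.dvd_finset_prod_iff hpp.prime _).1 h8
            have h10 := (Nat.prime_dvd_prime_iff_eq hpp (hP q (mem_filter.1 hq).1).1).1 h9
            exact hp2 (h10 ▸ (mem_filter.1 hq).2)
        · have h8 := Int.eq_zero_of_abs_lt_dvd h7 (by rw [abs_lt]; omega)
          omega
      simp only [mem_filter, mem_range] at m1 m2 m3
      rcases h3 p hpP _ _ _ m1.2 m2.2 m3.2 with h | h | h
      · exact hne _ _ m1.1 m2.1 n1 h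
      · exact hne _ _ m1.1 m3.1 n2 h
      · exact hne _ _ m2.1 m3.1 n3 h
    have h6 := h4.trans (Finset.sum_le_card_nsmul _ _ 2 h5)
    have h7 : (P.filter (fun p => ¬ p ≤ 2 * w)).card ≤ w := card_filter_le _ _
    rw [card_range, smul_eq_mul] at h6
    omega
  obtain ⟨s, hs, hsg⟩ := hex
  have hs := mem_range.1 hs
  refine ⟨y + ((N * Q : ℕ) : ℤ) * s, ?_, by positivity, ?_, ?_⟩
  · have h4 : (N : ℤ) ∣ ((N * Q : ℕ) : ℤ) := ⟨Q, by push_cast; ring⟩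
    have : y + ((N * Q : ℕ) : ℤ) * s - τ = (y - x0) + (x0 - τ) + ((N * Q : ℕ) : ℤ) * s := by ring
    rw [this]
    exact dvd_add (dvd_add (h4.trans hyx) hx0) (h4.mul_right _)
  · have h4 : ∀ t : ℕ, 2 * t + 1 ≤ 4 ^ t := by
      intro t; induction t with
      | zero => simp
      | succ t ih => rw [pow_succ]; omega
    have h5 : N * Q * (2 * w + 1) ≤ N * 64 ^ w := by
      rw [mul_assoc, show (64 : ℕ) = 16 * 4 by norm_num, mul_pow]
      exact Nat.mul_le_mul_left _ (Nat.mul_le_mul hQle (h4 w))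
    have h6 : y + ((N * Q : ℕ) : ℤ) * s ≤ ((N * Q * (2 * w + 1) : ℕ) : ℤ) := by
      have h7 : N * Q * (s + 1) ≤ N * Q * (2 * w + 1) := Nat.mul_le_mul_left _ (by omega)
      have h7' : ((N * Q * (s + 1) : ℕ) : ℤ) ≤ ((N * Q * (2 * w + 1) : ℕ) : ℤ) := by exact_mod_cast h7
      have h8 : ((N * Q * (s + 1) : ℕ) : ℤ) = ((N * Q : ℕ) : ℤ) * s + ((N * Q : ℕ) : ℤ) := by push_cast; ring
      linarith
    exact h6.trans (by exact_mod_cast h5)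
  · intro p hp hb
    by_cases hp2 : p ≤ 2 * w
    · have hpP1 : p ∈ P1 := mem_filter.2 ⟨hp, hp2⟩
      apply hr p hp
      refine hper p hp _ _ ?_ hb
      have h4 : (p : ℤ) ∣ ((N * Q : ℕ) : ℤ) := by
        exact_mod_cast (Finset.dvd_prod_of_mem (fun q : ℕ => q) hpP1).mul_left N
      have : y + ((N * Q : ℕ) : ℤ) * s - r p = (y - x0) + (x0 - r p) + ((N * Q : ℕ) : ℤ) * s := by ring
      rw [this]
      exact dvd_add (dvd_add (h4.trans hyx) (hx1 p hpP1)) (h4.mul_right _)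
    · exact hsg p hp hp2 hb

end APU

set_option maxHeartbeats 400000

namespace APU
open Finset

lemma omega_small (K C1 : ℕ) : ∃ m0 : ℕ, ∀ m ≥ m0, C1 * (2 ^ m.primeFactors.card) ^ K ≤ m := by
  obtain ⟨C, hC1, hC⟩ := tau_bound (1 / (2 * K + 2)) (by positivity)
  obtain ⟨B, hB⟩ := exists_nat_ge (C1 * C ^ K)
  refine ⟨B ^ 2 + 1, fun m hm => ?_⟩
  have hm1 : 1 ≤ m := by omega
  have hm1' : (1 : ℝ) ≤ m := by exact_mod_cast hm1
  have h1 : ((2 ^ m.primeFactors.card : ℕ) : ℝ) ≤ C * (m : ℝ) ^ (1 / (2 * K + 2) : ℝ) :=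
    le_trans (by exact_mod_cast two_pow_le_tau (by omega)) (hC m hm1)
  have h2 : (((2 ^ m.primeFactors.card : ℕ) : ℝ)) ^ K ≤ C ^ K * (m : ℝ) ^ (1 / 2 : ℝ) := by
    calc _ ≤ (C * (m : ℝ) ^ (1 / (2 * K + 2) : ℝ)) ^ K := pow_le_pow_left₀ (by positivity) h1 K
      _ = C ^ K * (m : ℝ) ^ (1 / (2 * K + 2) * K : ℝ) := by rw [mul_pow, ← Real.rpow_mul_natCast (by positivity)]
      _ ≤ C ^ K * (m : ℝ) ^ (1 / 2 : ℝ) := by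
          apply mul_le_mul_of_nonneg_left _ (by positivity)
          apply Real.rpow_le_rpow_of_exponent_le hm1'
          rw [one_div, inv_mul_le_iff₀ (by positivity)]
          linarith
  have h3 : (B : ℝ) ≤ (m : ℝ) ^ (1 / 2 : ℝ) := by
    rw [← Real.sqrt_eq_rpow]
    apply Real.le_sqrt_of_sq_le
    have : (B ^ 2 : ℕ) ≤ m := by omega
    exact_mod_cast this
  have h4 : ((C1 * (2 ^ m.primeFactors.card) ^ K : ℕ) : ℝ) ≤ m := by
    calc ((C1 * (2 ^ m.primeFactors.card) ^ K : ℕ) : ℝ) = C1 * ((2 ^ m.primeFactors.card : ℕ) : ℝ) ^ K := by push_cast; ring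
      _ ≤ C1 * (C ^ K * (m : ℝ) ^ (1 / 2 : ℝ)) := mul_le_mul_of_nonneg_left h2 (by positivity)
      _ = (C1 * C ^ K) * (m : ℝ) ^ (1 / 2 : ℝ) := by ring
      _ ≤ (m : ℝ) ^ (1 / 2 : ℝ) * (m : ℝ) ^ (1 / 2 : ℝ) := mul_le_mul_of_nonneg_right (hB.trans h3) (by positivity)
      _ = m := by rw [← Real.rpow_add (by positivity)]; norm_num
  exact_mod_cast h4

/-- a small value of a definite form in given residue classes, prime to `m` -/
lemma pick_form {a b c : ℤ} {D N m : ℕ} (hDN : 2 * D ∣ N) (hN : 0 < N) (hm : m ≠ 0) (hdet : a * c - b ^ 2 = D) (t1 t2 : ℤ) :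
    ∃ w1 w2 : ℤ, (N : ℤ) ∣ w1 - t1 ∧ (N : ℤ) ∣ w2 - t2 ∧ 0 ≤ w1 ∧ 0 ≤ w2 ∧ w1 ≤ N * 64 ^ m.primeFactors.card ∧
      w2 ≤ N * 64 ^ m.primeFactors.card ∧
      ∀ p : ℕ, p.Prime → p ∣ m → ¬ p ∣ N → ¬ (p : ℤ) ∣ a * w1 ^ 2 + 2 * b * w1 * w2 + c * w2 ^ 2 := by
  set P := m.primeFactors.filter (fun p => ¬ p ∣ N) with hPdef
  have hP : ∀ p ∈ P, p.Prime ∧ 3 ≤ p ∧ ¬ p ∣ N := by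
    intro p hp
    obtain ⟨h1, h2⟩ := mem_filter.1 hp
    have hpp := Nat.prime_of_mem_primeFactors h1
    refine ⟨hpp, ?_, h2⟩
    rcases hpp.eq_two_or_odd with h | h
    · exact absurd (h ▸ (dvd_mul_right 2 D).trans hDN) h2
    · have := hpp.two_le; omega
  have hcard : P.card ≤ m.primeFactors.card := card_filter_le _ _
  have hpow : (N : ℤ) * 64 ^ P.card ≤ N * 64 ^ m.primeFactors.card :=
    mul_le_mul_of_nonneg_left (pow_le_pow_right₀ (by norm_num) hcard) (by positivity)
  obtain ⟨w2, h1, h2, h3, h4⟩ := pick hN hP (fun p x => (p : ℤ) ∣ x)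
    (fun p hp x y h hx => by have := dvd_sub hx h; simpa using this) (fun p hp x y z hx hy hz => Or.inl (dvd_sub hx hy)) t2
  obtain ⟨w1, g1, g2, g3, g4⟩ := pick hN hP (fun p x => (p : ℤ) ∣ a * x ^ 2 + 2 * b * x * w2 + c * w2 ^ 2)
    (fun p hp x y h hx => by
      have : a * y ^ 2 + 2 * b * y * w2 + c * w2 ^ 2 = (a * x ^ 2 + 2 * b * x * w2 + c * w2 ^ 2) - (x - y) * (a * (x + y) + 2 * b * w2) := by ring
      rw [this]
      exact dvd_sub hx (h.mul_right _))
    (fun p hp x y z hx hy hz => by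
      obtain ⟨hpp, hp3, hpN⟩ := hP p hp
      have hpz : Prime (p : ℤ) := Nat.prime_iff_prime_int.1 hpp
      by_contra hcon
      push Not at hcon
      obtain ⟨n1, n2, n3⟩ := hcon
      have e1 : (p : ℤ) ∣ a * (x + y) + 2 * b * w2 := by
        have : (p : ℤ) ∣ (x - y) * (a * (x + y) + 2 * b * w2) := by have h := dvd_sub hx hy; ring_nf at h ⊢; exact h
        exact (hpz.dvd_mul.1 this).resolve_left n1
      have e2 : (p : ℤ) ∣ a * (x + z) + 2 * b * w2 := by
        have : (p : ℤ) ∣ (x - z) * (a * (x + z) + 2 * b * w2) := by have h := dvd_sub hx hz; ring_nf at h ⊢; exact h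
        exact (hpz.dvd_mul.1 this).resolve_left n2
      have e3 : (p : ℤ) ∣ a := by
        have : (p : ℤ) ∣ (y - z) * a := by have h := dvd_sub e1 e2; ring_nf at h ⊢; exact h
        exact (hpz.dvd_mul.1 this).resolve_left n3
      have e4 : (p : ℤ) ∣ 2 * b * w2 := (dvd_add_right (e3.mul_right _)).1 e1
      have e5 : (p : ℤ) ∣ 2 * b := (hpz.dvd_mul.1 e4).resolve_right (h4 p hp)
      have e6 : (p : ℤ) ∣ 2 * D := by
        rw [← hdet, show 2 * (a * c - b ^ 2) = a * (2 * c) - (2 * b) * b by ring]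
        exact dvd_sub (e3.mul_right _) (e5.mul_right _)
      exact hpN (Dvd.dvd.trans (by exact_mod_cast e6) hDN)) t1
  exact ⟨w1, w2, g1, h1, g2, h2, g3.trans hpow, h3.trans hpow, fun p hp hpm hpN =>
    g4 p (mem_filter.2 ⟨Nat.mem_primeFactors.2 ⟨hp, hpm, hm⟩, hpN⟩)⟩

end APU

set_option maxHeartbeats 400000

namespace APU
open Finset

/-- value of the form attached to a data tuple -/
def gv (a b c x y : ℤ) : ℤ := a * x ^ 2 + 2 * b * x * y + c * y ^ 2

/-- the finite set of data -/
noncomputable def dataB (D N : ℕ) : Finset (ℤ × ℤ × ℤ × ℤ × ℤ) :=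
  by classical exact (Icc (-(2 * D : ℤ)) (2 * D) ×ˢ Icc (-(2 * D : ℤ)) (2 * D) ×ˢ Icc (-(2 * D : ℤ)) (2 * D) ×ˢ
    Icc (0 : ℤ) N ×ˢ Icc (0 : ℤ) N).filter (fun d => 0 < d.1 ∧ d.1 * d.2.2.1 - d.2.1 ^ 2 = D ∧
      IsCoprime (gv d.1 d.2.1 d.2.2.1 d.2.2.2.1 d.2.2.2.2) N)

lemma gv_congr {a b c N x y x' y' : ℤ} (h1 : N ∣ x - x') (h2 : N ∣ y - y') : N ∣ gv a b c x y - gv a b c x' y' := by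
  obtain ⟨u, hu⟩ := h1
  obtain ⟨v, hv⟩ := h2
  refine ⟨a * u * (x + x') + 2 * b * (u * y + x' * v) + c * v * (y + y'), ?_⟩
  unfold gv
  linear_combination (a * (x + x') + 2 * b * y) * hu + (2 * b * x' + c * (y + y')) * hv

lemma coprime_congr {N x y : ℤ} (h : N ∣ x - y) (hy : IsCoprime y N) : IsCoprime x N := by
  obtain ⟨w, hw⟩ := h
  have : x = y + w * N := by linear_combination hw
  rw [this]
  exact IsCoprime.add_mul_right_left hy w

lemma data_value {D N m : ℕ} (hD0 : 0 < D) (hDN : 2 * D ∣ N) (hN : 0 < N) (hm : m ≠ 0) {d : ℤ × ℤ × ℤ × ℤ × ℤ} (hd : d ∈ dataB D N) :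
    ∃ h : ℕ, 0 < h ∧ h ≤ 8 * D * N ^ 2 * (2 ^ m.primeFactors.card) ^ 12 ∧ h.Coprime m ∧ h.Coprime N ∧
      ∃ w1 w2 : ℤ, (N : ℤ) ∣ w1 - d.2.2.2.1 ∧ (N : ℤ) ∣ w2 - d.2.2.2.2 ∧ (h : ℤ) = gv d.1 d.2.1 d.2.2.1 w1 w2 := by
  obtain ⟨a, b, c, t1, t2⟩ := d
  simp only [dataB, mem_filter, mem_product, mem_Icc] at hd
  obtain ⟨⟨⟨ha1, ha2⟩, ⟨hb1, hb2⟩, ⟨hc1, hc2⟩, _⟩, ha, hdet, hcop⟩ := hd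
  obtain ⟨w1, w2, h1, h2, h3, h4, h5, h6, h7⟩ := pick_form hDN hN hm hdet t1 t2
  have hg := coprime_congr (gv_congr (a := a) (b := b) (c := c) h1 h2) hcop
  have hne : gv a b c w1 w2 ≠ 0 := by
    intro h0
    rw [h0, isCoprime_zero_left, Int.isUnit_iff] at hg
    have := Nat.le_of_dvd hN hDN
    omega
  have hpos : 0 < gv a b c w1 w2 := by
    have h8 : a * gv a b c w1 w2 = (a * w1 + b * w2) ^ 2 + D * w2 ^ 2 := by
      unfold gv; linear_combination w2 ^ 2 * hdet
    have h9 : 0 ≤ a * gv a b c w1 w2 := by rw [h8]; positivity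
    exact lt_of_le_of_ne (nonneg_of_mul_nonneg_right h9 ha) hne.symm
  obtain ⟨h, hh⟩ := Int.eq_ofNat_of_zero_le hpos.le
  have hhN : h.Coprime N := by rw [hh] at hg; exact Nat.isCoprime_iff_coprime.1 hg
  refine ⟨h, by omega, ?_, ?_, hhN, w1, w2, h1, h2, hh.symm⟩
  · have e : (64 : ℤ) ^ m.primeFactors.card = (2 ^ m.primeFactors.card) ^ 6 := by
      rw [← pow_mul, mul_comm, pow_mul]; norm_num
    rw [e] at h5 h6
    set W : ℤ := N * (2 ^ m.primeFactors.card) ^ 6 with hW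
    have hW0 : 0 ≤ W := by positivity
    have i1 : gv a b c w1 w2 ≤ 2 * D * (w1 + w2) ^ 2 := by
      unfold gv
      have j1 : 0 ≤ (2 * D - a) * w1 ^ 2 := mul_nonneg (by linarith) (sq_nonneg _)
      have j2 : 0 ≤ (2 * D - b) * (w1 * w2) := mul_nonneg (by linarith) (mul_nonneg h3 h4)
      have j3 : 0 ≤ (2 * D - c) * w2 ^ 2 := mul_nonneg (by linarith) (sq_nonneg _)
      linarith
    have i2 : (w1 + w2) ^ 2 ≤ (W + W) ^ 2 := pow_le_pow_left₀ (add_nonneg h3 h4) (add_le_add h5 h6) 2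
    have i3 : gv a b c w1 w2 ≤ 2 * D * (W + W) ^ 2 := i1.trans (mul_le_mul_of_nonneg_left i2 (by positivity))
    rw [hh, hW] at i3
    have i4 : (h : ℤ) ≤ 8 * D * N ^ 2 * (2 ^ m.primeFactors.card) ^ 12 := i3.trans (le_of_eq (by ring))
    exact_mod_cast i4
  · by_contra hcon
    obtain ⟨p, hp, p1, p2⟩ := Nat.Prime.not_coprime_iff_dvd.1 hcon
    have hpN : ¬ p ∣ N := fun h8 => hp.one_lt.ne' (Nat.dvd_one.1 (by rw [← hhN]; exact Nat.dvd_gcd p1 h8))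
    apply h7 p hp p2 hpN
    have : (p : ℤ) ∣ h := by exact_mod_cast p1
    rw [← (show gv a b c w1 w2 = h from hh)] at this
    exact this

lemma lemma_B {D s0 N : ℕ} (hD2 : 2 ≤ D) (hD : 2 * D ∣ s0) (hs0 : s0 ∣ N) (hN0 : 0 < N)
    (hN : ∀ p : ℕ, p.Prime → p ∣ N → p ∣ s0) :
    ∃ m0 : ℕ, ∀ m ≥ m0, ∃ H : ℕ, 0 < H ∧ H ^ 10000 ≤ m ∧ H.Coprime m ∧ H.Coprime s0 ∧ H ≡ 1 [MOD 16 * D * N] ∧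
      ∀ (c1 c2 : ℤ) (ν n k : ℕ), c1 ^ 2 + D * c2 ^ 2 = ν * n → (∀ p : ℕ, p.Prime → p ∣ ν → p ∣ s0) → 0 < n → 0 < k →
        n.Coprime s0 → k.Coprime s0 → ((16 * D * N : ℕ) : ℤ) ∣ k - n → rho s0 D k ≠ 0 →
        ∃ x y : ℤ, x ^ 2 + D * y ^ 2 = ν * H ^ 2 * k ∧ (N : ℤ) ∣ x - c1 ∧ (N : ℤ) ∣ y - c2 := by
  classical
  have hDN : 2 * D ∣ N := hD.trans hs0
  set L := (dataB D N).card * (16 * D * N).totient * 10000 with hL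
  obtain ⟨m0, hm0⟩ := omega_small (12 * L) ((8 * D * N ^ 2) ^ L)
  refine ⟨m0 + 1, fun m hm => ?_⟩
  have hmne : m ≠ 0 := by omega
  have hdat := fun d (hd : d ∈ dataB D N) => data_value (by omega) hDN hN0 hmne hd
  choose! h hh0 hhle hhm hhN hhw using hdat
  set Pr := ∏ d ∈ dataB D N, h d with hPr
  have hPrN : Pr.Coprime N := Nat.Coprime.prod_left (fun d hd => hhN d hd)
  have hPrbig : Pr.Coprime (16 * D * N) := by
    have h2N : 2 ∣ N := (dvd_mul_right 2 D).trans hDN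
    have h2 : Pr.Coprime 16 := Nat.Coprime.pow_right 4 (hPrN.coprime_dvd_right h2N)
    exact (h2.mul_right (hPrN.coprime_dvd_right ((dvd_mul_left D 2).trans hDN))).mul_right hPrN
  have hφ : (16 * D * N).totient ≠ 0 := by
    rw [Ne, Nat.totient_eq_zero]; exact (by positivity)
  set H := Pr ^ (16 * D * N).totient with hH
  have hH1 : H ≡ 1 [MOD 16 * D * N] := Nat.ModEq.pow_totient hPrbig
  refine ⟨H, Nat.pos_of_ne_zero (pow_ne_zero _ (Finset.prod_ne_zero_iff.2 (fun d hd => (hh0 d hd).ne'))), ?_,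
    Nat.Coprime.pow_left _ (Nat.Coprime.prod_left (fun d hd => hhm d hd)),
    Nat.Coprime.pow_left _ (hPrN.coprime_dvd_right hs0), hH1, ?_⟩
  · calc H ^ 10000 = Pr ^ ((16 * D * N).totient * 10000) := by rw [hH, ← pow_mul]
      _ ≤ ((8 * D * N ^ 2 * (2 ^ m.primeFactors.card) ^ 12) ^ (dataB D N).card) ^ ((16 * D * N).totient * 10000) :=
          Nat.pow_le_pow_left (Finset.prod_le_pow_card _ _ _ hhle) _
      _ = (8 * D * N ^ 2) ^ L * (2 ^ m.primeFactors.card) ^ (12 * L) := by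
          rw [← pow_mul, ← mul_assoc, ← hL, mul_pow, ← pow_mul]
      _ ≤ m := hm0 m (by omega)
  · intro c1 c2 ν n k hc hν hn0 hk0 hn hk hnk hrho
    obtain ⟨A1, A2, b, s, hb0, hbN, hA1, hA2, hnorm, hs1, hs2⟩ := rotation' hD2 hD hs0 hN0 hN hn0 hk0 hν hn hk hnk hc hrho
    obtain ⟨g1, hg1⟩ := hs1
    obtain ⟨r, hr⟩ := hs2
    have hDz : (0 : ℤ) < D := by exact_mod_cast (by omega : 0 < D)
    obtain ⟨p, q, r', t, a', b', c', hdet, ha', hdet', hb', hac', hform⟩ := reduce_form hDz _ b (-s) (b * r) hb0 rfl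
      (by linear_combination -hr)
    obtain ⟨u, v, huv⟩ := id hbN
    have hNz : (0 : ℤ) < N := by exact_mod_cast hN0
    have hval : ∀ x y : ℤ, gv a' b' c' (p * x + q * y) (r' * x + t * y) = b * x ^ 2 - 2 * s * x * y + b * r * y ^ 2 := by
      intro x y; unfold gv; linear_combination -(hform x y)
    have hmod : ∀ z : ℤ, (N : ℤ) ∣ z % N - z := fun z => ⟨-(z / N), by have := Int.emod_add_mul_ediv z N; linarith⟩
    have hbnd : a' ≤ 2 * D ∧ c' ≤ 2 * D ∧ |b'| ≤ a' := by
      have k1 : |b'| ≤ a' := by have := abs_nonneg b'; omega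
      have k2 : 4 * b' ^ 2 ≤ a' ^ 2 := by
        have := mul_self_le_mul_self (by positivity) hb'
        have k3 : |b'| * |b'| = b' * b' := abs_mul_abs_self b'
        linarith
      have k4 : a' * a' ≤ a' * c' := mul_le_mul_of_nonneg_left hac' ha'.le
      have k5 : a' ≤ a' * a' := le_mul_of_one_le_left ha'.le ha'
      have k6 : c' ≤ a' * c' := le_mul_of_one_le_left (by linarith) ha'
      refine ⟨by linarith, by linarith, k1⟩
    have hd : (a', b', c', (p * u) % N, (r' * u) % N) ∈ dataB D N := by
      simp only [dataB, mem_filter, mem_product, mem_Icc]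
      obtain ⟨k1, k2, k3⟩ := hbnd
      have k4 := abs_le.1 k3
      refine ⟨⟨⟨by linarith, k1⟩, ⟨by linarith, by linarith⟩, ⟨by linarith, k2⟩, ⟨Int.emod_nonneg _ hNz.ne', (Int.emod_lt_of_pos _ hNz).le⟩,
        ⟨Int.emod_nonneg _ hNz.ne', (Int.emod_lt_of_pos _ hNz).le⟩⟩, ha', hdet', ?_⟩
      refine coprime_congr (gv_congr (hmod _) (hmod _)) ?_
      have := hval u 0
      simp only [mul_zero, add_zero] at this
      rw [this]
      have hu : IsCoprime u (N : ℤ) := ⟨b, v, by linear_combination huv⟩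
      have : IsCoprime (b * u ^ 2) (N : ℤ) := hbN.mul_left hu.pow_left
      convert this using 1; ring
    obtain ⟨w1, w2, hw1, hw2, hhv⟩ := hhw _ hd
    set hd' := h (a', b', c', (p * u) % N, (r' * u) % N) with hhd
    obtain ⟨H', hH'⟩ : hd' ∣ H := (Finset.dvd_prod_of_mem h hd).trans (dvd_pow_self _ hφ)
    simp only at hw1 hw2 hhv
    obtain ⟨x, hx⟩ : ∃ x, x = t * w1 - q * w2 := ⟨_, rfl⟩
    obtain ⟨y, hy⟩ : ∃ y, y = -r' * w1 + p * w2 := ⟨_, rfl⟩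
    have hw1' : p * x + q * y = w1 := by rw [hx, hy]; linear_combination w1 * hdet
    have hw2' : r' * x + t * y = w2 := by rw [hx, hy]; linear_combination w2 * hdet
    rw [← hw1', ← hw2', hval] at hhv
    have hyN : (N : ℤ) ∣ y := by
      have k1 := dvd_add hw1 (hmod (p * u))
      have k2 := dvd_add hw2 (hmod (r' * u))
      have : y = -r' * (w1 - p * u % N + (p * u % N - p * u)) + p * (w2 - r' * u % N + (r' * u % N - r' * u)) := by rw [hy]; ring
      rw [this]
      exact dvd_add (k1.mul_left _) (k2.mul_left _)
    obtain ⟨y', hy'⟩ := hyN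
    obtain ⟨K1, hK1⟩ : ∃ K1, K1 = x ^ 2 * A1 + 2 * b * x * y * (s * g1 - r * A2) + y ^ 2 * (s * r * A2 - (s ^ 2 - D) * g1) := ⟨_, rfl⟩
    obtain ⟨K2, hK2⟩ : ∃ K2, K2 = x ^ 2 * A2 - 2 * b * x * y * g1 + y ^ 2 * (2 * s * g1 - r * A2) := ⟨_, rfl⟩
    obtain ⟨β1, hβ1⟩ : ∃ β1, β1 = b * x - s * y := ⟨_, rfl⟩
    have e1 : b ^ 2 * K1 = (β1 ^ 2 - D * y ^ 2) * A1 - 2 * D * β1 * y * A2 := by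
      rw [hK1, hβ1]
      linear_combination (-2 * b * x * y * s + (s ^ 2 - D) * y ^ 2) * hg1 + (2 * b * x * y * A2 - y ^ 2 * s * A2) * hr
    have e2 : b ^ 2 * K2 = (β1 ^ 2 - D * y ^ 2) * A2 + 2 * β1 * y * A1 := by
      rw [hK2, hβ1]
      linear_combination (2 * b * x * y - 2 * s * y ^ 2) * hg1 + y ^ 2 * A2 * hr
    have e3 : β1 ^ 2 + D * y ^ 2 = b * hd' := by
      rw [hhv, hβ1]; linear_combination y ^ 2 * hr
    have e4 : K1 ^ 2 + D * K2 ^ 2 = ν * hd' ^ 2 * k := by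
      apply mul_left_cancel₀ (pow_ne_zero 4 hb0.ne')
      have : b ^ 4 * (K1 ^ 2 + D * K2 ^ 2) = (b ^ 2 * K1) ^ 2 + D * (b ^ 2 * K2) ^ 2 := by ring
      rw [this, e1, e2]
      have : ((β1 ^ 2 - D * y ^ 2) * A1 - 2 * D * β1 * y * A2) ^ 2 + D * ((β1 ^ 2 - D * y ^ 2) * A2 + 2 * β1 * y * A1) ^ 2 =
        (β1 ^ 2 + D * y ^ 2) ^ 2 * (A1 ^ 2 + D * A2 ^ 2) := by ring
      rw [this, e3, hnorm]; ring
    have hHN : (N : ℤ) ∣ (H : ℤ) - 1 := by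
      have k1 := (Nat.modEq_iff_dvd.1 hH1.symm)
      exact Dvd.dvd.trans ⟨16 * D, by push_cast; ring⟩ k1
    obtain ⟨h1, hh1⟩ := hHN
    obtain ⟨f1, hf1⟩ := hA1
    obtain ⟨f2, hf2⟩ := hA2
    have hH'z : (H : ℤ) = hd' * H' := by exact_mod_cast hH'
    refine ⟨H' * K1, H' * K2, ?_, ?_, ?_⟩
    · rw [hH'z]; linear_combination (H' : ℤ) ^ 2 * e4
    · refine ⟨H' * (x ^ 2 * f1 + y' * (2 * b * x * (s * g1 - r * A2) + y * (s * r * A2 - (s ^ 2 - D) * g1))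
        + y' * c1 * (2 * s * x - b * r * y)) + h1 * c1, ?_⟩
      rw [hK1]
      linear_combination H' * x ^ 2 * hf1 + H' * (2 * b * x * (s * g1 - r * A2) + y * (s * r * A2 - (s ^ 2 - D) * g1) + c1 * (2 * s * x - b * r * y)) * hy'
        + c1 * hh1 - c1 * hH'z - c1 * H' * hhv
    · refine ⟨H' * (x ^ 2 * f2 + y' * (-2 * b * x * g1 + y * (2 * s * g1 - r * A2)) + y' * c2 * (2 * s * x - b * r * y)) + h1 * c2, ?_⟩
      rw [hK2]
      linear_combination H' * x ^ 2 * hf2 + H' * (-2 * b * x * g1 + y * (2 * s * g1 - r * A2) + c2 * (2 * s * x - b * r * y)) * hy'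
        + c2 * hh1 - c2 * hH'z - c2 * H' * hhv

end APU

set_option maxHeartbeats 400000

namespace APU
open Finset

lemma NN_pos' {a b m : ℤ} (q : ℕ) : 0 < q → (∀ p : ℕ, p.Prime → p ∣ q → p ≠ 2 ∧ ¬ (p : ℤ) ∣ a ∧ ¬ (p : ℤ) ∣ b ∧ ¬ (p : ℤ) ∣ m) →
    ∀ [NeZero q], 0 < NN a b m q := by
  induction q using Nat.recOnPosPrimePosCoprime with
  | zero => intro h; exact absurd h (lt_irrefl _)
  | one => 
    intro _ _ _
    unfold NN
    rw [Finset.card_pos]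
    exact ⟨(0, 0), by simp [conic]; exact Subsingleton.elim _ _⟩
  | prime_pow p n hp hn =>
    intro _ h _
    obtain ⟨h1, h2, h3, h4⟩ := h p hp (dvd_pow_self p hn.ne')
    obtain ⟨j, rfl⟩ : ∃ j, n = j + 1 := ⟨n - 1, by omega⟩
    have : NeZero p := ⟨hp.ne_zero⟩
    rw [NN_prime_pow hp h1 h2 h3 h4 j]
    have h5 := abs_le.1 (NN_prime hp h1 h2 h3 h4)
    have := hp.two_le
    have : 0 < NN a b m p := by omega
    exact Nat.mul_pos (pow_pos hp.pos _) this
  | coprime x y hx hy hxy ihx ihy =>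
    intro _ h _
    have : NeZero x := ⟨by omega⟩
    have : NeZero y := ⟨by omega⟩
    rw [NN_mul a b m hxy]
    exact Nat.mul_pos (ihx (by omega) (fun p hp hpx => h p hp (hpx.mul_right _))) (ihy (by omega) (fun p hp hpx => h p hp (hpx.mul_left _)))

lemma conic_sol {a b m : ℤ} {q : ℕ} (hq : 0 < q) (h : ∀ p : ℕ, p.Prime → p ∣ q → p ≠ 2 ∧ ¬ (p : ℤ) ∣ a ∧ ¬ (p : ℤ) ∣ b ∧ ¬ (p : ℤ) ∣ m) :
    ∃ z1 z2 : ℤ, (q : ℤ) ∣ a * z1 ^ 2 + b * z2 ^ 2 - m := by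
  have : NeZero q := ⟨hq.ne'⟩
  have h1 := NN_pos' q hq h
  unfold NN at h1
  obtain ⟨⟨z1, z2⟩, hz⟩ := Finset.card_pos.1 h1
  simp [conic] at hz
  refine ⟨z1.val, z2.val, ?_⟩
  rw [← ZMod.intCast_zmod_eq_zero_iff_dvd]
  push_cast
  rw [ZMod.natCast_zmod_val, ZMod.natCast_zmod_val, sub_eq_zero]
  linear_combination hz

lemma sqrt_chi_one {s0 D p : ℕ} (hDs : D ∣ s0) (hp : p.Prime) (hpc : p.Coprime s0) {s : ℤ} (h : (p : ℤ) ∣ s ^ 2 + D) :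
    chi s0 D p = 1 := by
  have : Fact p.Prime := ⟨hp⟩
  unfold chi
  rw [if_pos hpc, ← jacobiSym.legendreSym.to_jacobiSym]
  have hne : ((-(D : ℤ) : ℤ) : ZMod p) ≠ 0 := by
    rw [Ne, ZMod.intCast_zmod_eq_zero_iff_dvd, dvd_neg]
    intro h0
    have h0 : p ∣ D := by exact_mod_cast h0
    exact hp.one_lt.ne' (Nat.dvd_one.1 (by rw [← hpc]; exact Nat.dvd_gcd dvd_rfl (h0.trans hDs)))
  rw [legendreSym.eq_one_iff p hne]
  refine ⟨s, ?_⟩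
  rw [← ZMod.intCast_zmod_eq_zero_iff_dvd] at h
  push_cast at h ⊢
  linear_combination -h

lemma chi_pow {s0 D : ℕ} (h2 : 2 ∣ s0) (a e : ℕ) : chi s0 D (a ^ e) = chi s0 D a ^ e := by
  induction e with
  | zero => simp [chi_one]
  | succ e ih => rw [pow_succ, chi_mul h2, ih, pow_succ]

lemma chi_eq_one_of {s0 D : ℕ} (h2 : 2 ∣ s0) (hDs : D ∣ s0) : ∀ n : ℕ, n ≠ 0 → n.Coprime s0 →
    (∀ p e u : ℕ, p.Prime → n = p ^ e * u → ¬ p ∣ u → Odd e → chi s0 D p = 1) → chi s0 D n = 1 := by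
  intro n
  induction n using Nat.strong_induction_on with
  | _ n ih =>
    intro hn hc h
    by_cases h1 : n = 1
    · rw [h1]; exact chi_one _ _
    obtain ⟨p, hp, hpn⟩ := Nat.exists_prime_and_dvd h1
    obtain ⟨e, u, hu, hne⟩ := Nat.exists_eq_pow_mul_and_not_dvd hn p hp.one_lt.ne'
    have he : e ≠ 0 := by rintro rfl; rw [pow_zero, one_mul] at hne; exact hu (hne ▸ hpn)
    have hu0 : u ≠ 0 := by rintro rfl; simp at hu
    have hpe : 1 < p ^ e := Nat.one_lt_pow he hp.one_lt
    have hpc : p.Coprime s0 := Nat.Coprime.coprime_dvd_left hpn hc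
    rw [hne, chi_mul h2, chi_pow h2, ih u (by rw [hne]; exact lt_mul_of_one_lt_left (Nat.pos_of_ne_zero hu0) hpe) hu0
      (Nat.Coprime.coprime_dvd_left ⟨p ^ e, by rw [hne]; ring⟩ hc), mul_one]
    · rcases Nat.even_or_odd e with ⟨f, hf⟩ | ho
      · rw [hf, ← two_mul, pow_mul]
        rcases chi_sq hDs hpc with h3 | h3 <;> rw [h3] <;> simp
      · rw [h p e u hp hne hu ho, one_pow]
    · intro q f w hq hqu hqw hf
      have hqp : ¬ q ∣ p ^ e := by
        intro h3
        have := (Nat.prime_dvd_prime_iff_eq hq hp).1 (hq.dvd_of_dvd_pow h3)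
        apply hu
        rw [hqu, ← this]
        exact (dvd_pow_self q hf.pos.ne').mul_right _
      refine h q f (p ^ e * w) hq (by rw [hne, hqu]; ring) ?_ hf
      intro h3
      rcases hq.dvd_mul.1 h3 with h4 | h4
      · exact hqp h4
      · exact hqw h4

lemma chi_norm {s0 D ν n : ℕ} (h2 : 2 ∣ s0) (hDs : D ∣ s0) (hν : ∀ p : ℕ, p.Prime → p ∣ ν → p ∣ s0) (hn0 : 0 < n) (hn : n.Coprime s0)
    {c1 c2 : ℤ} (hc : c1 ^ 2 + D * c2 ^ 2 = ν * n) : chi s0 D n = 1 := by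
  apply chi_eq_one_of h2 hDs n hn0.ne' hn
  intro p e u hp hne hu ⟨j, hj⟩
  have hpn : p ∣ n := by rw [hne, hj, pow_succ]; exact ⟨p ^ (2 * j) * u, by ring⟩
  have hpc : p.Coprime s0 := Nat.Coprime.coprime_dvd_left hpn hn
  have hps : ¬ p ∣ s0 := (Nat.Prime.coprime_iff_not_dvd hp).1 hpc
  obtain ⟨s, hs⟩ := split_of_norm hp j c1 c2 (ν * u) (by
    intro h3
    have h3 : p ∣ ν * u := by exact_mod_cast h3
    rcases hp.dvd_mul.1 h3 with h4 | h4
    · exact hps (hν p hp h4)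
    · exact hu h4) (by rw [hc, hne, hj]; push_cast; ring)
  exact sqrt_chi_one hDs hp hpc hs

end APU

set_option maxHeartbeats 400000

namespace APU
open Finset

theorem diag {A1 A2 A3 A4 s0 N ν : ℕ} (hA1 : 0 < A1) (hA3 : 0 < A3) (hA4 : 0 < A4) (hD2 : 2 ≤ A1 * A2)
    (hs : 0 < s0) (hD : 2 * (A1 * A2) ∣ s0) (hs3 : A3 ∣ s0) (hs4 : A4 ∣ s0) (hsN : s0 ∣ N) (hN0 : 0 < N)
    (hN : ∀ p : ℕ, p.Prime → p ∣ N → p ∣ s0) (hν0 : 0 < ν) (hν : ∀ p : ℕ, p.Prime → p ∣ ν → p ∣ s0) :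
    ∃ m0 : ℕ, ∀ m : ℕ, m0 ≤ m → ∀ (b1 b2 b3 b4 : ℤ) (n : ℕ), 0 < n → n.Coprime s0 →
      (A1 : ℤ) * (A1 * b1 ^ 2 + A2 * b2 ^ 2) = ν * n →
      ((ν * (16 * (A1 * A2) * (A1 * N)) : ℕ) : ℤ) ∣ m - (A1 * b1 ^ 2 + A2 * b2 ^ 2 + A3 * b3 ^ 2 + A4 * b4 ^ 2) →
      ∃ y1 y2 y3 y4 : ℤ, (N : ℤ) ∣ y1 - b1 ∧ (N : ℤ) ∣ y2 - b2 ∧ (N : ℤ) ∣ y3 - b3 ∧ (N : ℤ) ∣ y4 - b4 ∧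
        A1 * y1 ^ 2 + A2 * y2 ^ 2 + A3 * y3 ^ 2 + A4 * y4 ^ 2 = m ∧
        ∀ p : ℕ, p.Prime → ¬ p ∣ s0 → ¬ ((p : ℤ) ∣ y1 ∧ (p : ℤ) ∣ y2 ∧ (p : ℤ) ∣ y3 ∧ (p : ℤ) ∣ y4) := by
  obtain ⟨D, hDdef⟩ : ∃ D, D = A1 * A2 := ⟨_, rfl⟩
  rw [← hDdef] at hD2 hD ⊢
  obtain ⟨E, hE⟩ : ∃ E, E = 16 * D * (A1 * N) := ⟨_, rfl⟩
  rw [← hE]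
  have hA1s : A1 ∣ s0 := Dvd.dvd.trans ⟨2 * A2, by rw [hDdef]; ring⟩ hD
  have h2s : 2 ∣ s0 := (dvd_mul_right 2 D).trans hD
  have hDs : D ∣ s0 := (dvd_mul_left D 2).trans hD
  have hE0 : 0 < E := by rw [hE]; positivity
  have hEp : ∀ p : ℕ, p.Prime → p ∣ E → p ∣ s0 := by
    intro p hp h
    rw [hE, show 16 = 2 ^ 4 by norm_num] at h
    rcases hp.dvd_mul.1 h with h | h
    · rcases hp.dvd_mul.1 h with h | h
      · exact (hp.dvd_of_dvd_pow h).trans h2s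
      · exact h.trans hDs
    · rcases hp.dvd_mul.1 h with h | h
      · exact h.trans hA1s
      · exact hN p hp h
  have hNbp : ∀ p : ℕ, p.Prime → p ∣ ν * E → p ∣ s0 := fun p hp h => by
    rcases hp.dvd_mul.1 h with h | h
    · exact hν p hp h
    · exact hEp p hp h
  have hsE : 4 * s0 ∣ E := by
    obtain ⟨w, rfl⟩ := hsN
    exact ⟨4 * D * A1 * w, by rw [hE]; ring⟩
  obtain ⟨m1, hm1⟩ := lemma_B (N := A1 * N) hD2 hD (hsN.trans (dvd_mul_left N A1)) (by positivity) (fun p hp h => by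
    rcases hp.dvd_mul.1 h with h | h
    · exact h.trans hA1s
    · exact hN p hp h)
  obtain ⟨m2, hm2⟩ := main_count (ν := ν) (Nb := ν * E) hA3 hA4 hs (by positivity) hA1 hν0 hD hs3 hs4 hA1s hNbp hν
  refine ⟨m1 + m2, fun m hm b1 b2 b3 b4 n hn0 hn hnorm hmod => ?_⟩
  obtain ⟨H, hH0, hHm, hHcm, hHs, hH1, hB⟩ := hm1 m (by omega)
  rw [← hE] at hH1 hB
  have hc : (A1 * b1 : ℤ) ^ 2 + D * b2 ^ 2 = ν * n := by rw [← hnorm, hDdef]; push_cast; ring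
  have hchin := chi_norm h2s hDs hν hn0 hn hc
  have hHprime : ∀ p : ℕ, p.Prime → p ∣ H → ¬ p ∣ s0 := fun p hp h h' =>
    hp.one_lt.ne' (Nat.dvd_one.1 (by rw [← hHs]; exact Nat.dvd_gcd h h'))
  have hcopP : ∀ x : ℕ, (∀ p : ℕ, p.Prime → p ∣ x → p ∣ s0) → Nat.Coprime H x := by
    intro x hx
    by_contra hcon
    obtain ⟨p, hp, p1, p2⟩ := Nat.Prime.not_coprime_iff_dvd.1 hcon
    exact hHprime p hp p1 (hx p hp p2)
  obtain ⟨z1, z2, hz⟩ := conic_sol (a := A3) (b := A4) (m := m - H ^ 2) (q := H ^ 3) (by positivity) (by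
    intro p hp h
    have h := hp.dvd_of_dvd_pow h
    have hps := hHprime p hp h
    refine ⟨fun h' => hps (h' ▸ h2s), fun h' => hps (Dvd.dvd.trans (by exact_mod_cast h') hs3),
      fun h' => hps (Dvd.dvd.trans (by exact_mod_cast h') hs4), fun h' => ?_⟩
    have h3 : (p : ℤ) ∣ (H : ℤ) ^ 2 := dvd_pow (by exact_mod_cast h) (by norm_num)
    have h4 : (p : ℤ) ∣ m := by have := dvd_add h' h3; simpa using this
    exact hp.one_lt.ne' (Nat.dvd_one.1 (by rw [← hHcm]; exact Nat.dvd_gcd h (by exact_mod_cast h4))))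
  have hcop : IsCoprime ((H ^ 3 : ℕ) : ℤ) ((ν * E : ℕ) : ℤ) := Nat.isCoprime_iff_coprime.2 ((hcopP _ hNbp).pow_left 3)
  have hcrt : ∀ b z : ℤ, ∃ r : ℤ, ((ν * E : ℕ) : ℤ) ∣ r - b ∧ ((H ^ 3 : ℕ) : ℤ) ∣ r - z := by
    intro b z
    obtain ⟨u, v, huv⟩ := hcop
    exact ⟨b * (u * (H ^ 3 : ℕ)) + z * (v * (ν * E : ℕ)), ⟨v * (z - b), by linear_combination b * huv⟩,
      ⟨u * (b - z), by linear_combination z * huv⟩⟩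
  obtain ⟨r1, hr1, hr1'⟩ := hcrt b3 z1
  obtain ⟨r2, hr2, hr2'⟩ := hcrt b4 z2
  have hHE : (E : ℤ) ∣ (H : ℤ) ^ 2 - 1 := by
    have k1 : (E : ℤ) ∣ (H : ℤ) - 1 := by exact_mod_cast (Nat.modEq_iff_dvd.1 hH1.symm)
    rw [show (H : ℤ) ^ 2 - 1 = (H - 1) * (H + 1) by ring]
    exact k1.mul_right _
  have hνz : (ν : ℤ) ≠ 0 := by exact_mod_cast hν0.ne'
  have hHz : (H : ℤ) ≠ 0 := by exact_mod_cast hH0.ne'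
  have hHcν : IsCoprime (H : ℤ) ν := Nat.isCoprime_iff_coprime.2 (hcopP _ hν)
  have hHcs : IsCoprime (H : ℤ) s0 := Nat.isCoprime_iff_coprime.2 hHs
  have hsEz : (s0 : ℤ) ∣ E := by exact_mod_cast (dvd_mul_left s0 4).trans hsE
  have hn' : IsCoprime (n : ℤ) s0 := Nat.isCoprime_iff_coprime.2 hn
  have key : ∀ x1 x2 : ℤ, ((ν * E * H ^ 3 : ℕ) : ℤ) ∣ x1 - r1 → ((ν * E * H ^ 3 : ℕ) : ℤ) ∣ x2 - r2 → ∃ k : ℤ,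
      (A1 : ℤ) * (m - (A3 * x1 ^ 2 + A4 * x2 ^ 2)) = ν * H ^ 2 * k ∧ IsCoprime k ((s0 : ℤ) * H) ∧ (E : ℤ) ∣ k - n := by
    intro x1 x2 h1 h2
    have d1 : ((ν * E : ℕ) : ℤ) ∣ ((ν * E * H ^ 3 : ℕ) : ℤ) := by exact_mod_cast dvd_mul_right _ _
    have d2 : ((H ^ 3 : ℕ) : ℤ) ∣ ((ν * E * H ^ 3 : ℕ) : ℤ) := by exact_mod_cast dvd_mul_left _ _
    obtain ⟨f, hf⟩ : ((ν * E : ℕ) : ℤ) ∣ gv A3 0 A4 x1 x2 - gv A3 0 A4 b3 b4 := gv_congr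
      (by have := dvd_add (d1.trans h1) hr1; simpa using this) (by have := dvd_add (d1.trans h2) hr2; simpa using this)
    obtain ⟨g, hg⟩ : ((H ^ 3 : ℕ) : ℤ) ∣ gv A3 0 A4 x1 x2 - gv A3 0 A4 z1 z2 := gv_congr
      (by have := dvd_add (d2.trans h1) hr1'; simpa using this) (by have := dvd_add (d2.trans h2) hr2'; simpa using this)
    unfold gv at hf hg
    obtain ⟨w, hw⟩ := hmod
    obtain ⟨t, ht⟩ := hz
    push_cast at hf hg hw ht
    obtain ⟨κ, hκ⟩ : ∃ κ : ℤ, κ = n + E * (A1 * (w - f)) := ⟨_, rfl⟩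
    have e1 : (A1 : ℤ) * (m - (A3 * x1 ^ 2 + A4 * x2 ^ 2)) = ν * κ := by
      rw [hκ]; linear_combination (A1 : ℤ) * hw - A1 * hf + hnorm
    have e2 : (A1 : ℤ) * (m - (A3 * x1 ^ 2 + A4 * x2 ^ 2)) = H ^ 2 * (A1 * (1 - H * (t + g))) := by
      linear_combination -(A1 : ℤ) * hg - A1 * ht
    obtain ⟨k, hk⟩ : (H : ℤ) ^ 2 ∣ κ := by
      have : (H : ℤ) ^ 2 ∣ ν * κ := ⟨_, e1.symm.trans e2⟩
      exact hHcν.pow_left.dvd_of_dvd_mul_left this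
    have e3 : ν * k = A1 * (1 - H * (t + g)) := by
      apply mul_left_cancel₀ (pow_ne_zero 2 hHz)
      rw [← e2, e1, hk]; ring
    have e4 : (E : ℤ) ∣ k - n := by
      obtain ⟨v, hv⟩ := hHE
      exact ⟨A1 * (w - f) - v * k, by linear_combination hκ - hk - k * hv⟩
    refine ⟨k, by rw [e1, hk]; ring, IsCoprime.mul_right ?_ ?_, e4⟩
    · exact coprime_congr (hsEz.trans e4) hn'
    · have hA1H : IsCoprime (A1 : ℤ) H := (hHcs.of_isCoprime_of_dvd_right (by exact_mod_cast hA1s)).symm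
      have h3 : IsCoprime (1 - (H : ℤ) * (t + g)) H := ⟨1, t + g, by ring⟩
      have h4 := hA1H.mul_left h3
      rw [← e3] at h4
      exact h4.of_mul_left_right
  have hchik : ∀ k : ℤ, (E : ℤ) ∣ k - n → 0 < k → chi s0 D k.toNat = 1 := by
    intro k hk hk0
    rw [← hchin]
    apply chi_periodic hD
    refine (Nat.modEq_iff_dvd.2 ?_).symm
    rw [Int.toNat_of_nonneg hk0.le]
    exact Dvd.dvd.trans (by exact_mod_cast hsE) hk
  obtain ⟨x1, x2, k, hx1, hx2, hk0, hkeq, hkc, hrho, hprim⟩ := hm2 m (by omega) H hH0 hHm hHcm hHs r1 r2 (by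
    intro x1 x2 h1 h2
    obtain ⟨k, e1, e2, e3⟩ := key x1 x2 h1 h2
    exact ⟨k, e1, e2, hchik k e3⟩)
  obtain ⟨k', e1, _, e3⟩ := key x1 x2 hx1 hx2
  have hkk : k = k' := by
    apply mul_left_cancel₀ (mul_ne_zero hνz (pow_ne_zero 2 hHz))
    rw [← hkeq, ← e1]
  rw [← hkk] at e3
  obtain ⟨κ, rfl⟩ := Int.eq_ofNat_of_zero_le hk0.le
  obtain ⟨x, y, hxy, hxN, hyN⟩ := hB (A1 * b1) b2 ν n κ hc hν hn0 (by exact_mod_cast hk0) hn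
    (Nat.isCoprime_iff_coprime.1 hkc.of_mul_right_left) e3 hrho
  push_cast at hxN hyN
  obtain ⟨q, hq⟩ := hxN
  have hA1z : (A1 : ℤ) ≠ 0 := by exact_mod_cast hA1.ne'
  have hNνE : (N : ℤ) ∣ ((ν * E : ℕ) : ℤ) := ⟨ν * (16 * D * A1), by rw [hE]; push_cast; ring⟩
  have d1 : ((ν * E : ℕ) : ℤ) ∣ ((ν * E * H ^ 3 : ℕ) : ℤ) := by exact_mod_cast dvd_mul_right _ _
  have hsum : A1 * (b1 + N * q) ^ 2 + A2 * y ^ 2 + A3 * x1 ^ 2 + A4 * x2 ^ 2 = (m : ℤ) := by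
    apply mul_left_cancel₀ hA1z
    have hxx : x = A1 * (b1 + N * q) := by linear_combination hq
    rw [hxx, hDdef] at hxy
    push_cast at hxy hkeq
    linear_combination hxy - hkeq
  refine ⟨b1 + N * q, y, x1, x2, ⟨q, by ring⟩, (dvd_mul_left _ _).trans hyN, ?_, ?_, hsum, ?_⟩
  · have := dvd_add (hNνE.trans (d1.trans hx1)) (hNνE.trans hr1); simpa using this
  · have := dvd_add (hNνE.trans (d1.trans hx2)) (hNνE.trans hr2); simpa using this
  · rintro p hp hps ⟨p1, p2, p3, p4⟩
    have h34 : (p : ℤ) ∣ A3 * x1 ^ 2 + A4 * x2 ^ 2 := by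
      rw [sq, sq]; exact dvd_add ((p3.mul_right _).mul_left _) ((p4.mul_right _).mul_left _)
    have hpm : (p : ℤ) ∣ m := by
      rw [← hsum, add_assoc]
      refine dvd_add ?_ h34
      rw [sq, sq]; exact dvd_add ((p1.mul_right _).mul_left _) ((p2.mul_right _).mul_left _)
    exact hprim p hp hps (by exact_mod_cast hpm) h34

end APU
set_option maxHeartbeats 400000
namespace APU
open Finset

/-- the bilinear form of a matrix -/
def bl {n : ℕ} {R : Type*} [CommRing R] (M : Matrix (Fin n) (Fin n) R) (x y : Fin n → R) : R :=
  x ⬝ᵥ (M.mulVec y)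

section
variable {n : ℕ} {R : Type*} [CommRing R] (M : Matrix (Fin n) (Fin n) R)

lemma bl_add_left (x y z) : bl M (x + y) z = bl M x z + bl M y z := by
  simp [bl, add_dotProduct]
lemma bl_add_right (x y z) : bl M x (y + z) = bl M x y + bl M x z := by
  simp [bl, Matrix.mulVec_add, dotProduct_add]
lemma bl_sub_left (x y z) : bl M (x - y) z = bl M x z - bl M y z := by
  simp [bl, sub_dotProduct]
lemma bl_sub_right (x y z) : bl M x (y - z) = bl M x y - bl M x z := by
  simp [bl, Matrix.mulVec_sub, dotProduct_sub]
lemma bl_smul_left (c : R) (x z) : bl M (c • x) z = c * bl M x z := by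
  simp [bl]
lemma bl_smul_right (c : R) (x z) : bl M x (c • z) = c * bl M x z := by
  simp [bl, Matrix.mulVec_smul]
variable {M}
lemma bl_comm (h : M.IsSymm) (x y) : bl M x y = bl M y x := by
  rw [bl, bl, Matrix.dotProduct_mulVec, dotProduct_comm, ← Matrix.mulVec_transpose, h.eq]
lemma bl_single (i j : Fin n) : bl M (Pi.single i 1) (Pi.single j 1) = M i j := by
  simp [bl]
lemma bl_eq_sum (x y) : bl M x y = ∑ i, ∑ j, M i j * x i * y j := by
  simp only [bl, dotProduct, Matrix.mulVec, mul_sum]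
  exact sum_congr rfl fun i _ => sum_congr rfl fun j _ => by ring
lemma gram_eq (b : Fin n → Fin n → R) :
    (Matrix.of fun i j => bl M (b i) (b j)) = Matrix.of b * M * (Matrix.of b).transpose := by
  ext i j
  rw [mul_assoc, Matrix.mul_apply]
  simp only [Matrix.of_apply, bl, dotProduct]
  refine sum_congr rfl fun k _ => ?_
  congr 1
end

/-- partial orthogonalisation at `p` -/
def St {n : ℕ} (p : ℕ) (M : Matrix (Fin n) (Fin n) ℤ) (b : Fin n → Fin n → ℤ) (s : Finset (Fin n)) :
    Prop :=
  ¬ (p:ℤ) ∣ (Matrix.of b).det ∧ (∀ i ∈ s, ¬ (p:ℤ) ∣ bl M (b i) (b i)) ∧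
    ∀ i ∈ s, ∀ j, j ≠ i → (p:ℤ)^3 ∣ bl M (b i) (b j)

lemma inv_mod_cube {p : ℕ} (hp : p.Prime) {a : ℤ} (ha : ¬ (p:ℤ) ∣ a) : ∃ u : ℤ, (p:ℤ)^3 ∣ u*a - 1 := by
  have h : IsCoprime ((p:ℤ)^3) a :=
    ((Prime.coprime_iff_not_dvd (Nat.prime_iff_prime_int.1 hp)).2 ha).pow_left
  obtain ⟨x, y, hxy⟩ := h
  exact ⟨y, -x, by linear_combination hxy⟩

lemma St.ext {n p : ℕ} (hp : p.Prime) {M : Matrix (Fin n) (Fin n) ℤ} (hM : M.IsSymm)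
    {b : Fin n → Fin n → ℤ} {s : Finset (Fin n)} (h : St p M b s) {i : Fin n} (hi : i ∉ s)
    (hu : ¬ (p:ℤ) ∣ bl M (b i) (b i)) : ∃ b', St p M b' (insert i s) ∧ b' i = b i ∧
      ∀ j ≠ i, (p:ℤ)^3 ∣ bl M (b i) (b i) * bl M (b' j) (b' j) -
        (bl M (b i) (b i) * bl M (b j) (b j) - bl M (b i) (b j)^2) := by
  obtain ⟨hd, h1, h2⟩ := h
  obtain ⟨u, w, hw⟩ := inv_mod_cube hp hu
  set c : Fin n → ℤ := fun j => if j = i then 0 else u * bl M (b i) (b j) with hc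
  have hci : c i = 0 := by simp [hc]
  have hcj : ∀ j ≠ i, c j = u * bl M (b i) (b j) := fun j hj => by simp [hc, hj]
  have key : ∀ j k, bl M (b j - c j • b i) (b k - c k • b i) = bl M (b j) (b k) - c k * bl M (b i) (b j)
      - c j * bl M (b i) (b k) + c j * c k * bl M (b i) (b i) := by
    intro j k
    simp only [bl_sub_left, bl_sub_right, bl_smul_left, bl_smul_right, bl_comm hM (b j) (b i)]
    ring
  have hp3 : (p:ℤ) ∣ (p:ℤ)^3 := dvd_pow_self _ (by norm_num)
  have hcs : ∀ j ∈ s, (p:ℤ)^3 ∣ bl M (b i) (b j) := fun j hj => by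
    rw [bl_comm hM]; exact h2 j hj i (fun e => hi (e ▸ hj))
  refine ⟨fun j => b j - c j • b i, ⟨?_, ?_, ?_⟩, by simp [hci], ?_⟩
  · rw [Matrix.det_eq_of_forall_row_eq_smul_add_const (B := Matrix.of b) (fun j => - c j) i (by simp [hci])]
    · exact hd
    · intro j k; simp [sub_eq_add_neg]
  · intro j hj hdv
    rcases eq_or_ne j i with rfl | hji
    · simp only [hci, zero_smul, sub_zero] at hdv; exact hu hdv
    · have hjs : j ∈ s := (mem_insert.1 hj).resolve_left hji
      obtain ⟨z, hz⟩ := hp3.trans (hcs j hjs)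
      obtain ⟨y, hy⟩ := hdv
      rw [key, hcj j hji, hz] at hy
      exact h1 j hjs ⟨y + 2 * (u*(p*z)) * z - u^2 * (p*z)*z * bl M (b i) (b i), by linear_combination hy⟩
  · intro j hj k hkj
    rw [key]
    rcases eq_or_ne j i with rfl | hji
    · rw [hci, hcj k hkj]
      exact ⟨-w * bl M (b j) (b k), by linear_combination -bl M (b j) (b k) * hw⟩
    · have hjs : j ∈ s := (mem_insert.1 hj).resolve_left hji
      obtain ⟨z, hz⟩ := hcs j hjs
      obtain ⟨y, hy⟩ := h2 j hjs k hkj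
      rw [hy, hcj j hji, hz]
      exact ⟨y - c k * z - u*z * bl M (b i) (b k) + u*z*c k * bl M (b i) (b i), by ring⟩
  · intro j hji
    rw [key, hcj j hji]
    exact ⟨bl M (b i) (b j)^2 * (p^3*w*w), by
      linear_combination (bl M (b i) (b j)^2 * (u * bl M (b i) (b i) - 1 + (p:ℤ)^3*w)) * hw⟩

lemma St.step {n p : ℕ} (hp : p.Prime) {M : Matrix (Fin n) (Fin n) ℤ} (hM : M.IsSymm)
    {b : Fin n → Fin n → ℤ} {s : Finset (Fin n)} (h : St p M b s) {a i j : Fin n} (ha : a ∈ s) (hi : i ∉ s)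
    (hj : j ∉ s) (hij : i ≠ j) (hii : (p:ℤ) ∣ bl M (b i) (b i)) (hjj : (p:ℤ) ∣ bl M (b j) (b j))
    (hu : ¬ (p:ℤ) ∣ bl M (b i) (b j)) : ∃ b', St p M b' (insert j s) := by
  have hpi := Nat.prime_iff_prime_int.1 hp
  have hai : i ≠ a := fun e => hi (e ▸ ha)
  have haj : j ≠ a := fun e => hj (e ▸ ha)
  have h' := h
  obtain ⟨hd, h1, h2⟩ := h
  have hp3 : (p:ℤ) ∣ (p:ℤ)^3 := dvd_pow_self _ (by norm_num)
  set b1 := Function.update b a (b a + b i) with hb1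
  have e1 : b1 a = b a + b i := by simp [hb1]
  have e2 : ∀ k ≠ a, b1 k = b k := fun k hk => by simp [hb1, hk]
  have hS : St p M b1 (s.erase a) := by
    refine ⟨?_, ?_, ?_⟩
    · have : Matrix.of b1 = (Matrix.of b).updateRow a ((Matrix.of b) a + (Matrix.of b) i) := rfl
      rw [this, Matrix.det_updateRow_add_self _ hai.symm]; exact hd
    · intro k hk; rw [e2 k (ne_of_mem_erase hk)]; exact h1 k (mem_of_mem_erase hk)
    · intro k hk l hl
      have hks := mem_of_mem_erase hk
      rw [e2 k (ne_of_mem_erase hk)]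
      rcases eq_or_ne l a with rfl | hla
      · rw [e1, bl_add_right]
        exact dvd_add (h2 k hks _ hl) (h2 k hks _ (fun e => hi (e ▸ hks)))
      · rw [e2 l hla]; exact h2 k hks l hl
  have hua : ¬ (p:ℤ) ∣ bl M (b1 a) (b1 a) := by
    intro hdv
    rw [e1, bl_add_left, bl_add_right, bl_add_right, bl_comm hM (b i) (b a)] at hdv
    have h3 := hp3.trans (h2 a ha i hai)
    apply h1 a ha
    have := dvd_sub (dvd_sub (dvd_sub hdv h3) h3) hii
    ring_nf at this; exact this
  obtain ⟨b2, hS2, -, hsch⟩ := hS.ext hp hM (notMem_erase a s) hua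
  rw [insert_erase ha] at hS2
  obtain ⟨b3, hS3, -⟩ := hS2.ext hp hM hj (by
    intro hdv
    have h4 := hp3.trans (hsch j haj)
    rw [e2 j haj] at h4
    have h5 : (p:ℤ) ∣ bl M (b1 a) (b j) ^ 2 := by
      have := dvd_add (dvd_sub h4 (hdv.mul_left (bl M (b1 a) (b1 a)))) (hjj.mul_left (bl M (b1 a) (b1 a)))
      ring_nf at this ⊢; exact this
    have h6 := hpi.dvd_of_dvd_pow h5
    rw [e1, bl_add_left] at h6
    exact hu ((dvd_add_right (hp3.trans (h2 a ha j haj))).1 h6))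
  exact ⟨b3, hS3⟩

lemma St.complete {n p : ℕ} (hp : p.Prime) {M : Matrix (Fin n) (Fin n) ℤ} (hM : M.IsSymm) :
    ∀ (d : ℕ) {b : Fin n → Fin n → ℤ} {s : Finset (Fin n)}, St p M b s → s.Nonempty → n - #s = d →
    ∃ b s, St p M b s ∧ ∀ i ∉ s, ∀ j ∉ s, (p:ℤ) ∣ bl M (b i) (b j) := by
  intro d
  induction d using Nat.strong_induction_on with
  | _ d ih =>
    intro b s hS hs hd
    by_cases hall : ∀ i ∉ s, ∀ j ∉ s, (p:ℤ) ∣ bl M (b i) (b j)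
    · exact ⟨b, s, hS, hall⟩
    have hlt : ∀ j ∉ s, n - #(insert j s) < d := by
      intro j hj
      have := card_le_univ (insert j s)
      rw [Fintype.card_fin] at this
      rw [card_insert_of_notMem hj] at this ⊢
      omega
    have hdone : ∀ j ∉ s, (∃ b', St p M b' (insert j s)) →
        ∃ b s, St p M b s ∧ ∀ i ∉ s, ∀ j ∉ s, (p:ℤ) ∣ bl M (b i) (b j) := by
      rintro j hj ⟨b', hb'⟩
      exact ih _ (hlt j hj) hb' (insert_nonempty _ _) rfl
    by_cases hdiag : ∃ i ∉ s, ¬ (p:ℤ) ∣ bl M (b i) (b i)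
    · obtain ⟨i, hi, hu⟩ := hdiag
      obtain ⟨b', hb', -⟩ := hS.ext hp hM hi hu
      exact hdone i hi ⟨b', hb'⟩
    · push Not at hdiag hall
      obtain ⟨i, hi, j, hj, hu⟩ := hall
      obtain ⟨a, ha⟩ := hs
      refine hdone j hj (hS.step hp hM ha hi hj ?_ (hdiag i hi) (hdiag j hj) hu)
      rintro rfl
      exact hu (hdiag i hi)

/-- divisibility of the determinant from divisible columns -/
lemma St.det_dvd {n p : ℕ} (hp : p.Prime) {M : Matrix (Fin n) (Fin n) ℤ} (hM : M.IsSymm)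
    {b : Fin n → Fin n → ℤ} {s : Finset (Fin n)} (h : St p M b s) (e : ℕ) (he : e ≤ 3)
    (hall : ∀ i ∉ s, ∀ j ∉ s, (p:ℤ)^e ∣ bl M (b i) (b j)) : (p:ℤ)^(e*(n-#s)) ∣ M.det := by
  obtain ⟨hd, h1, h2⟩ := h
  have hpi := Nat.prime_iff_prime_int.1 hp
  set v : Fin n → ℤ := fun i => if i ∈ s then 1 else (p:ℤ)^e with hv
  have hdv : ∀ i j, v i ∣ bl M (b i) (b j) := by
    intro i j
    by_cases hi : i ∈ s
    · simp [hv, hi]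
    · simp only [hv, hi, if_false]
      by_cases hj : j ∈ s
      · rw [bl_comm hM]
        exact (pow_dvd_pow _ he).trans (h2 j hj i (fun e => hi (e ▸ hj)))
      · exact hall i hi j hj
  choose A hA using hdv
  have h3 : (Matrix.of fun i j => bl M (b i) (b j)).det = (∏ i, v i) * (Matrix.of A).det := by
    rw [← Matrix.det_mul_column]
    congr 1; ext i j; simp [hA i j]
  rw [gram_eq, Matrix.det_mul, Matrix.det_mul, Matrix.det_transpose] at h3
  have h4 : ∏ i, v i = (p:ℤ)^(e*(n-#s)) := by
    rw [hv, prod_ite, prod_const_one, one_mul, prod_const, ← pow_mul]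
    congr 2
    have : (univ.filter fun x => x ∉ s) = sᶜ := by ext; simp
    rw [this, card_compl, Fintype.card_fin]
  rw [h4] at h3
  have hco : IsCoprime ((p:ℤ)^(e*(n-#s))) ((Matrix.of b).det) :=
    ((Prime.coprime_iff_not_dvd hpi).2 hd).pow_left
  apply hco.dvd_of_dvd_mul_left
  apply hco.dvd_of_dvd_mul_left
  exact ⟨(Matrix.of A).det, by linear_combination h3⟩

end APU
set_option maxHeartbeats 400000
namespace APU
open Finset

lemma hensel_int {p : ℕ} (hp : p.Prime) {a b c : ℤ} (hb : ¬ (p:ℤ) ∣ b) (ha : (p:ℤ) ∣ a) (K : ℕ) :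
    ∃ t : ℤ, (p:ℤ) ∣ t ∧ (p:ℤ)^K ∣ c*t^2 + b*t + a := by
  have hpi := Nat.prime_iff_prime_int.1 hp
  have main : ∀ K : ℕ, ∃ t : ℤ, (p:ℤ) ∣ t ∧ (p:ℤ)^(K+1) ∣ c*t^2 + b*t + a := by
    intro K
    induction K with
    | zero => exact ⟨0, dvd_zero _, by simpa using ha⟩
    | succ K ih =>
      obtain ⟨t, ht, w, hw⟩ := ih
      have hco : IsCoprime (p:ℤ) (2*c*t + b) := by
        rw [Prime.coprime_iff_not_dvd hpi]
        intro h
        exact hb ((dvd_add_right (ht.mul_left (2*c))).1 h)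
      obtain ⟨x, y, hxy⟩ := hco
      refine ⟨t - p^(K+1) * (w*y), ht.sub (Dvd.dvd.mul_right (dvd_pow_self _ (by omega)) _), ?_⟩
      exact ⟨w*x + c*p^K*(w*y)^2, by linear_combination hw - (p:ℤ)^(K+1)*w*hxy⟩
  obtain ⟨t, h1, h2⟩ := main K
  exact ⟨t, h1, (pow_dvd_pow _ (Nat.le_succ K)).trans h2⟩

/-- primitive representation modulo a power of `p` -/
def Rep {n : ℕ} (p : ℕ) (M : Matrix (Fin n) (Fin n) ℤ) (m : ℤ) (K : ℕ) : Prop :=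
  ∃ x : Fin n → ℤ, (p:ℤ)^K ∣ bl M x x - m ∧ ∃ i, ¬ (p:ℤ) ∣ x i

variable {n : ℕ} {M : Matrix (Fin n) (Fin n) ℤ}

lemma prim_of_not_dvd {p : ℕ} {x v : Fin n → ℤ} (h : ¬ (p:ℤ) ∣ bl M x v) : ∃ i, ¬ (p:ℤ) ∣ x i := by
  by_contra hc
  push Not at hc
  refine h ?_
  unfold bl dotProduct
  exact dvd_sum fun i _ => (hc i).mul_right _

lemma bl_line (hM : M.IsSymm) (x v : Fin n → ℤ) (t : ℤ) :
    bl M (x + t • v) (x + t • v) = bl M x x + 2 * t * bl M x v + t^2 * bl M v v := by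
  simp only [bl_add_left, bl_add_right, bl_smul_left, bl_smul_right, bl_comm hM v x]; ring

lemma rep_odd {p : ℕ} (hp : p.Prime) (hp2 : p ≠ 2) (hM : M.IsSymm) {x v : Fin n → ℤ} {m : ℤ} (K : ℕ)
    (h : (p:ℤ) ∣ bl M x x - m) (hv : ¬ (p:ℤ) ∣ bl M x v) : Rep p M m K := by
  have hpi := Nat.prime_iff_prime_int.1 hp
  obtain ⟨t, ht, w, hw⟩ := hensel_int hp (c := bl M v v) (b := 2 * bl M x v) (a := bl M x x - m) (by
    intro h2
    rcases hpi.dvd_or_dvd h2 with h2 | h2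
    · exact hp2 ((Nat.prime_dvd_prime_iff_eq hp Nat.prime_two).1 (by exact_mod_cast h2))
    · exact hv h2) h K
  refine ⟨x + t • v, ⟨w, by rw [bl_line hM]; linear_combination hw⟩, prim_of_not_dvd (M := M) (v := v) ?_⟩
  rw [bl_add_left, bl_smul_left]
  exact fun h3 => hv ((dvd_add_left (ht.mul_right _)).1 h3)

lemma rep_two_a (hM : M.IsSymm) {x v : Fin n → ℤ} {m : ℤ} (K : ℕ)
    (h : (8:ℤ) ∣ bl M x x - m) (hv : ¬ (2:ℤ) ∣ bl M x v) : Rep 2 M m K := by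
  obtain ⟨a, ha⟩ := h
  obtain ⟨t, ht, w, hw⟩ := hensel_int Nat.prime_two (c := bl M v v) (b := bl M x v) (a := 2*a) hv
    ⟨a, by push_cast; ring⟩ K
  refine ⟨x + (2*t) • v, ⟨4*w, by rw [bl_line hM]; linear_combination 4*hw + ha⟩,
    prim_of_not_dvd (M := M) (v := v) ?_⟩
  rw [bl_add_left, bl_smul_left, mul_assoc]
  exact fun h3 => hv ((dvd_add_left (Dvd.intro _ rfl)).1 h3)

lemma rep_two_b (hM : M.IsSymm) {x v : Fin n → ℤ} {m : ℤ} (K : ℕ)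
    (h : (8:ℤ) ∣ bl M x x - m) (hv : ¬ (4:ℤ) ∣ bl M x v) (hv4 : (4:ℤ) ∣ bl M v v)
    (hz : ∀ z, (2:ℤ) ∣ bl M z v) : Rep 2 M m K := by
  obtain ⟨a, ha⟩ := h
  obtain ⟨c, hc⟩ := hv4
  obtain ⟨b, hb⟩ := hz x
  obtain ⟨t, ⟨t', ht⟩, w, hw⟩ := hensel_int Nat.prime_two (c := c) (b := b) (a := 2*a) (by
    rintro ⟨z, rfl⟩
    exact hv ⟨z, by rw [hb]; push_cast; ring⟩) ⟨a, by push_cast; ring⟩ K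
  refine ⟨x + t • v, ⟨4*w, by rw [bl_line hM, hb, hc]; linear_combination 4*hw + ha⟩, ?_⟩
  by_contra hcon
  push Not at hcon
  choose z hzz using hcon
  have h1 : x + t • v = (2:ℤ) • z := by
    ext i; simpa using hzz i
  have h2 : bl M (x + t • v) v = 2 * bl M z v := by rw [h1, bl_smul_left]
  obtain ⟨y, hy⟩ := hz z
  rw [bl_add_left, bl_smul_left, hc, hy] at h2
  exact hv ⟨y - t*c, by linear_combination h2⟩

lemma dvd_bl_of_basis {p : ℕ} (hp : p.Prime) {b : Fin n → Fin n → ℤ} (hd : ¬ (p:ℤ) ∣ (Matrix.of b).det)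
    {v : Fin n → ℤ} (h : ∀ i, (p:ℤ) ∣ bl M (b i) v) (z : Fin n → ℤ) : (p:ℤ) ∣ bl M z v := by
  have hpi := Nat.prime_iff_prime_int.1 hp
  unfold bl dotProduct
  refine dvd_sum fun i _ => Dvd.dvd.mul_left ?_ _
  have h1 : ((Matrix.of b).adjugate.mulVec ((Matrix.of b).mulVec (M.mulVec v))) i
      = (Matrix.of b).det * (M.mulVec v) i := by
    rw [Matrix.mulVec_mulVec, Matrix.adjugate_mul, Matrix.smul_mulVec, Matrix.one_mulVec]; rfl
  have h2 : (p:ℤ) ∣ (Matrix.of b).det * (M.mulVec v) i := by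
    rw [← h1]
    have h3 : (p:ℤ) ∣ ∑ j, (Matrix.of b).adjugate i j * bl M (b j) v :=
      dvd_sum fun j _ => Dvd.dvd.mul_left (h j) _
    exact h3
  exact (hpi.dvd_or_dvd h2).resolve_left hd

/-- finite check modulo 8 behind `dec1` -/
def chk1 : Bool :=
  [1,3,5,7].all fun e1 => [1,3,5,7].all fun e2 => [1,3,5,7].all fun e3 => [2,6].all fun d =>
  [0,1,2,3,4,5,6,7].all fun m =>
  [0,1,2].any fun x1 => [0,1,2].any fun x2 => [0,1,2].any fun x3 => [0,1].any fun t =>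
    (Nat.beq x1 1 || Nat.beq x2 1 || Nat.beq x3 1) &&
      Nat.beq ((x1*x1*e1+x2*x2*e2+x3*x3*e3+t*t*d) % 8) m

/-- finite check modulo 8 behind `dec2` -/
def chk2 : Bool :=
  [1,3,5,7].all fun e1 => [1,3,5,7].all fun e2 => [1,3,5,7].all fun e3 => [1,2,3,5,6,7].all fun m =>
  [0,1,2].any fun x1 => [0,1,2].any fun x2 => [0,1,2].any fun x3 => [0,1].any fun t =>
    (Nat.beq x1 1 || Nat.beq x2 1 || Nat.beq x3 1) &&
      Nat.beq ((x1*x1*e1+x2*x2*e2+x3*x3*e3+t*t*4) % 8) m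

/-- finite check modulo 8 behind `dec3` -/
def chk3 : Bool :=
  [1,3,5,7].all fun e1 => [1,3,5,7].all fun e2 => [1,3,5,7].all fun e3 => [1,3,5,7].all fun e4 =>
  [0,4].all fun m =>
  [0,1].any fun x1 => [0,1].any fun x2 => [0,1].any fun x3 => [0,1].any fun x4 => [0,1].any fun t =>
    (Nat.beq x1 1 || Nat.beq x2 1 || Nat.beq x3 1) &&
      Nat.beq ((x1*x1*e1+x2*x2*e2+x3*x3*e3+x4*x4*e4+t*t*4) % 8) m

lemma chk1_true : chk1 = true := by rfl
lemma chk2_true : chk2 = true := by rfl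
lemma chk3_true : chk3 = true := by rfl

lemma z8_unit_val : ∀ e : ZMod 8, e*e = 1 → e.val ∈ [1,3,5,7] := by decide
lemma z8_val : ∀ e : ZMod 8, e.val ∈ [0,1,2,3,4,5,6,7] := by decide
lemma z8_two : ∀ d : ZMod 8, (d = 2 ∨ d = 6) → d.val ∈ [2,6] := by decide
lemma z8_ne : ∀ m : ZMod 8, m ≠ 0 → m ≠ 4 → m.val ∈ [1,2,3,5,6,7] := by decide
lemma z8_four : ∀ m : ZMod 8, (m = 0 ∨ m = 4) → m.val ∈ [0,4] := by decide

lemma z8_of {k : ℕ} {m : ZMod 8} (h : k % 8 = m.val) : (k : ZMod 8) = m := by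
  rw [← ZMod.natCast_mod k 8, h, ZMod.natCast_zmod_val]

lemma z8_mem3 {x : ℕ} (h : x ∈ [0,1,2]) : (x : ZMod 8) ∈ [(0:ZMod 8),1,2] := by
  fin_cases h <;> decide

lemma z8_mem2 {x : ℕ} (h : x ∈ [0,1]) : (x : ZMod 8) ∈ [(0:ZMod 8),1] := by
  fin_cases h <;> decide

lemma z8_or {x1 x2 x3 : ℕ} (h : (Nat.beq x1 1 || Nat.beq x2 1 || Nat.beq x3 1) = true) :
    (x1 : ZMod 8) = 1 ∨ (x2 : ZMod 8) = 1 ∨ (x3 : ZMod 8) = 1 := by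
  simp only [Bool.or_eq_true, Nat.beq_eq] at h
  rcases h with (h | h) | h <;> simp [h]

lemma dec1 (e1 e2 e3 d m : ZMod 8) (h1 : e1*e1 = 1) (h2 : e2*e2 = 1) (h3 : e3*e3 = 1)
    (hd : d = 2 ∨ d = 6) :
    ∃ x1 ∈ [(0:ZMod 8),1,2], ∃ x2 ∈ [(0:ZMod 8),1,2], ∃ x3 ∈ [(0:ZMod 8),1,2], ∃ t ∈ [(0:ZMod 8),1],
    (x1 = 1 ∨ x2 = 1 ∨ x3 = 1) ∧ x1*x1*e1+x2*x2*e2+x3*x3*e3+t*t*d = m := by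
  have h := List.all_eq_true.1 (List.all_eq_true.1 (List.all_eq_true.1 (List.all_eq_true.1
    (List.all_eq_true.1 chk1_true _ (z8_unit_val e1 h1)) _ (z8_unit_val e2 h2)) _
    (z8_unit_val e3 h3)) _ (z8_two d hd)) _ (z8_val m)
  obtain ⟨x1, m1, h⟩ := List.any_eq_true.1 h
  obtain ⟨x2, m2, h⟩ := List.any_eq_true.1 h
  obtain ⟨x3, m3, h⟩ := List.any_eq_true.1 h
  obtain ⟨t, mt, h⟩ := List.any_eq_true.1 h
  obtain ⟨ho, he⟩ := (Bool.and_eq_true _ _).mp h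
  refine ⟨x1, z8_mem3 m1, x2, z8_mem3 m2, x3, z8_mem3 m3, t, z8_mem2 mt, z8_or ho, ?_⟩
  have := z8_of (Nat.eq_of_beq_eq_true he)
  push_cast [ZMod.natCast_zmod_val] at this
  exact this

lemma dec2 (e1 e2 e3 m : ZMod 8) (h1 : e1*e1 = 1) (h2 : e2*e2 = 1) (h3 : e3*e3 = 1)
    (hm : m ≠ 0) (hm' : m ≠ 4) :
    ∃ x1 ∈ [(0:ZMod 8),1,2], ∃ x2 ∈ [(0:ZMod 8),1,2], ∃ x3 ∈ [(0:ZMod 8),1,2], ∃ t ∈ [(0:ZMod 8),1],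
    (x1 = 1 ∨ x2 = 1 ∨ x3 = 1) ∧ x1*x1*e1+x2*x2*e2+x3*x3*e3+t*t*4 = m := by
  have h := List.all_eq_true.1 (List.all_eq_true.1 (List.all_eq_true.1
    (List.all_eq_true.1 chk2_true _ (z8_unit_val e1 h1)) _ (z8_unit_val e2 h2)) _
    (z8_unit_val e3 h3)) _ (z8_ne m hm hm')
  obtain ⟨x1, m1, h⟩ := List.any_eq_true.1 h
  obtain ⟨x2, m2, h⟩ := List.any_eq_true.1 h
  obtain ⟨x3, m3, h⟩ := List.any_eq_true.1 h
  obtain ⟨t, mt, h⟩ := List.any_eq_true.1 h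
  obtain ⟨ho, he⟩ := (Bool.and_eq_true _ _).mp h
  refine ⟨x1, z8_mem3 m1, x2, z8_mem3 m2, x3, z8_mem3 m3, t, z8_mem2 mt, z8_or ho, ?_⟩
  have := z8_of (Nat.eq_of_beq_eq_true he)
  push_cast [ZMod.natCast_zmod_val] at this
  exact this

lemma dec3 (e1 e2 e3 e4 m : ZMod 8) (h1 : e1*e1 = 1) (h2 : e2*e2 = 1) (h3 : e3*e3 = 1)
    (h4 : e4*e4 = 1) (hm : m = 0 ∨ m = 4) :
    ∃ x1 ∈ [(0:ZMod 8),1], ∃ x2 ∈ [(0:ZMod 8),1], ∃ x3 ∈ [(0:ZMod 8),1], ∃ x4 ∈ [(0:ZMod 8),1],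
    ∃ t ∈ [(0:ZMod 8),1],
    (x1 = 1 ∨ x2 = 1 ∨ x3 = 1) ∧ x1*x1*e1+x2*x2*e2+x3*x3*e3+x4*x4*e4+t*t*4 = m := by
  have h := List.all_eq_true.1 (List.all_eq_true.1 (List.all_eq_true.1 (List.all_eq_true.1
    (List.all_eq_true.1 chk3_true _ (z8_unit_val e1 h1)) _ (z8_unit_val e2 h2)) _
    (z8_unit_val e3 h3)) _ (z8_unit_val e4 h4)) _ (z8_four m hm)
  obtain ⟨x1, m1, h⟩ := List.any_eq_true.1 h
  obtain ⟨x2, m2, h⟩ := List.any_eq_true.1 h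
  obtain ⟨x3, m3, h⟩ := List.any_eq_true.1 h
  obtain ⟨x4, m4, h⟩ := List.any_eq_true.1 h
  obtain ⟨t, mt, h⟩ := List.any_eq_true.1 h
  obtain ⟨ho, he⟩ := (Bool.and_eq_true _ _).mp h
  refine ⟨x1, z8_mem2 m1, x2, z8_mem2 m2, x3, z8_mem2 m3, x4, z8_mem2 m4, t, z8_mem2 mt, z8_or ho, ?_⟩
  have := z8_of (Nat.eq_of_beq_eq_true he)
  push_cast [ZMod.natCast_zmod_val] at this
  exact this

lemma z8_dvd (a : ℤ) : ((a : ZMod 8) = 0) ↔ (8:ℤ) ∣ a := by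
  simpa using ZMod.intCast_zmod_eq_zero_iff_dvd a 8

lemma z8_odd {a : ℤ} (h : ¬ (2:ℤ) ∣ a) : ((a : ZMod 8)) * a = 1 := by
  have : ((a*a - 1 : ℤ) : ZMod 8) = 0 := by
    rw [z8_dvd]
    have h2 : a % 2 = 1 := by omega
    have := Int.sq_mod_four_eq_one_of_odd (Int.odd_iff.2 h2)
    have h8 : (8:ℤ) ∣ a^2 - 1 := Int.eight_dvd_sq_sub_one_of_odd (Int.odd_iff.2 h2)
    rwa [pow_two] at h8
  push_cast at this
  linear_combination this

/-- all the cases in which an odd coordinate can be used -/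
lemma rep_comb (hM : M.IsSymm) (v1 v2 v3 v4 y : Fin n → ℤ) (m : ℤ) (K : ℕ)
    (h1 : ¬ (2:ℤ) ∣ bl M v1 v1) (h2 : ¬ (2:ℤ) ∣ bl M v2 v2) (h3 : ¬ (2:ℤ) ∣ bl M v3 v3)
    (h12 : (8:ℤ) ∣ bl M v1 v2) (h13 : (8:ℤ) ∣ bl M v1 v3) (h14 : (8:ℤ) ∣ bl M v1 v4)
    (h1y : (8:ℤ) ∣ bl M v1 y) (h23 : (8:ℤ) ∣ bl M v2 v3) (h24 : (8:ℤ) ∣ bl M v2 v4)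
    (h2y : (8:ℤ) ∣ bl M v2 y) (h34 : (8:ℤ) ∣ bl M v3 v4) (h3y : (8:ℤ) ∣ bl M v3 y)
    (h4y : (8:ℤ) ∣ bl M v4 y)
    (H : (bl M y y % 4 = 2) ∨ (bl M y y % 8 = 4 ∧ (m % 4 ≠ 0 ∨ ¬ (2:ℤ) ∣ bl M v4 v4))) : Rep 2 M m K := by
  rw [← z8_dvd] at h12 h13 h14 h1y h23 h24 h2y h34 h3y h4y
  have g1 := z8_odd h1
  have g2 := z8_odd h2
  have g3 := z8_odd h3
  have hex : ∃ x1 x2 x3 x4 t : ZMod 8, (x1 = 1 ∨ x2 = 1 ∨ x3 = 1) ∧ x1*x1*((bl M v1 v1 : ℤ) : ZMod 8)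
      +x2*x2*((bl M v2 v2 : ℤ) : ZMod 8)+x3*x3*((bl M v3 v3 : ℤ) : ZMod 8)
      +x4*x4*((bl M v4 v4 : ℤ) : ZMod 8)+t*t*((bl M y y : ℤ) : ZMod 8) = (m : ZMod 8) := by
    rcases H with H | ⟨H, H'⟩
    · have hd : ((bl M y y : ℤ) : ZMod 8) = 2 ∨ ((bl M y y : ℤ) : ZMod 8) = 6 := by
        have : (8:ℤ) ∣ bl M y y - 2 ∨ (8:ℤ) ∣ bl M y y - 6 := by omega
        rw [← z8_dvd, ← z8_dvd] at this
        push_cast at this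
        simpa [sub_eq_zero] using this
      obtain ⟨x1, -, x2, -, x3, -, t, -, ho, hs⟩ := dec1 _ _ _ _ (m : ZMod 8) g1 g2 g3 hd
      exact ⟨x1, x2, x3, 0, t, ho, by linear_combination hs⟩
    · have hd : ((bl M y y : ℤ) : ZMod 8) = 4 := by
        have : (8:ℤ) ∣ bl M y y - 4 := by omega
        rw [← z8_dvd] at this
        push_cast at this
        simpa [sub_eq_zero] using this
      rw [hd]
      by_cases hm : (m : ZMod 8) = 0 ∨ (m : ZMod 8) = 4
      · have hm4 : m % 4 = 0 := by
          have : (8:ℤ) ∣ m ∨ (8:ℤ) ∣ m - 4 := by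
            rw [← z8_dvd, ← z8_dvd]; push_cast; simpa [sub_eq_zero] using hm
          omega
        obtain ⟨x1, -, x2, -, x3, -, x4, -, t, -, ho, hs⟩ := dec3 _ _ _ _ (m : ZMod 8) g1 g2 g3
          (z8_odd (H'.resolve_left (fun h => h hm4))) hm
        exact ⟨x1, x2, x3, x4, t, ho, hs⟩
      · push Not at hm
        obtain ⟨x1, -, x2, -, x3, -, t, -, ho, hs⟩ := dec2 _ _ _ (m : ZMod 8) g1 g2 g3 hm.1 hm.2
        exact ⟨x1, x2, x3, 0, t, ho, by linear_combination hs⟩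
  obtain ⟨x1, x2, x3, x4, t, ho, hs⟩ := hex
  have lift : ∀ x : ZMod 8, ∃ X : ℤ, (X : ZMod 8) = x := fun x => ⟨x.val, by simp⟩
  obtain ⟨X1, rfl⟩ := lift x1
  obtain ⟨X2, rfl⟩ := lift x2
  obtain ⟨X3, rfl⟩ := lift x3
  obtain ⟨X4, rfl⟩ := lift x4
  obtain ⟨T, rfl⟩ := lift t
  set x := X1 • v1 + X2 • v2 + X3 • v3 + X4 • v4 + T • y with hx
  have hf : (8:ℤ) ∣ bl M x x - m := by
    rw [← z8_dvd, hx]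
    simp only [bl_add_left, bl_add_right, bl_smul_left, bl_smul_right, bl_comm hM v2 v1, bl_comm hM v3 v1,
      bl_comm hM v3 v2, bl_comm hM v4 v1, bl_comm hM v4 v2, bl_comm hM v4 v3, bl_comm hM y v1,
      bl_comm hM y v2, bl_comm hM y v3, bl_comm hM y v4]
    push_cast
    simp only [h12, h13, h14, h1y, h23, h24, h2y, h34, h3y, h4y]
    linear_combination hs
  have fin : ∀ (X : ℤ) (v : Fin n → ℤ), (X : ZMod 8) = 1 → ¬ (2:ℤ) ∣ bl M v v →
      ((bl M x v : ℤ) : ZMod 8) = X * ((bl M v v : ℤ) : ZMod 8) → Rep 2 M m K := by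
    intro X v hX hv hxv
    refine rep_two_a hM K hf (v := v) fun hdv => hv ?_
    rw [hX, one_mul, ← sub_eq_zero, ← Int.cast_sub, z8_dvd] at hxv
    omega
  rcases ho with ho | ho | ho
  · refine fin X1 v1 ho h1 ?_
    simp only [hx, bl_add_left, bl_smul_left, bl_comm hM v2 v1, bl_comm hM v3 v1, bl_comm hM v4 v1,
      bl_comm hM y v1]
    push_cast
    rw [h12, h13, h14, h1y]; ring
  · refine fin X2 v2 ho h2 ?_
    simp only [hx, bl_add_left, bl_smul_left, bl_comm hM v3 v2, bl_comm hM v4 v2, bl_comm hM y v2]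
    push_cast
    rw [h12, h23, h24, h2y]; ring
  · refine fin X3 v3 ho h3 ?_
    simp only [hx, bl_add_left, bl_smul_left, bl_comm hM v4 v3, bl_comm hM y v3]
    push_cast
    rw [h13, h23, h34, h3y]; ring

end APU
set_option maxHeartbeats 400000
namespace APU
open Finset
variable {n : ℕ} {M : Matrix (Fin n) (Fin n) ℤ}

lemma St_one {p : ℕ} (hp : p.Prime) : St p M (fun i => Pi.single i 1) ∅ := by
  refine ⟨?_, by simp, by simp⟩
  have : Matrix.of (fun i => (Pi.single i 1 : Fin n → ℤ)) = 1 := by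
    ext i j; simp [Matrix.one_apply, Pi.single_apply, eq_comm]
  rw [this, Matrix.det_one]
  exact fun h => (Nat.prime_iff_prime_int.1 hp).not_unit (isUnit_of_dvd_one h)

lemma init_two (hM : M.IsSymm) (hodd : ∃ x : Fin n → ℤ, Odd (bl M x x)) :
    ∃ b s, St 2 M b s ∧ s.Nonempty := by
  have : ∃ i, ¬ (2:ℤ) ∣ M i i := by
    by_contra hc
    push Not at hc
    obtain ⟨x, hx⟩ := hodd
    have h2 : (2:ℤ) ∣ bl M x x := by
      rw [← Finset.univ_sum_single x]
      apply Finset.sum_induction (p := fun x => (2:ℤ) ∣ bl M x x)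
      · intro a b ha hb
        have := bl_line hM a b 1
        rw [one_smul] at this
        rw [this]
        exact dvd_add (dvd_add ha ⟨bl M a b, by ring⟩) (by simpa using hb)
      · simp [bl]
      · intro i _
        have : (Pi.single i (x i) : Fin n → ℤ) = x i • Pi.single i 1 := by
          rw [← Pi.single_smul]; simp
        rw [this, bl_smul_left, bl_smul_right, bl_single]
        exact ((hc i).mul_left _).mul_left _
    have := Int.odd_iff.1 hx
    omega
  obtain ⟨i, hi⟩ := this
  obtain ⟨b, hb, -⟩ := (St_one (M := M) Nat.prime_two).ext Nat.prime_two hM (i := i) (by simp)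
    (by rw [bl_single]; exact hi)
  exact ⟨b, _, hb, insert_nonempty _ _⟩

lemma init_odd {p : ℕ} (hp : p.Prime) (hp2 : p ≠ 2) (hM : M.IsSymm) (hd : ¬ (p:ℤ)^(n-2) ∣ M.det) :
    ∃ b s, St p M b s ∧ s.Nonempty := by
  have hpi := Nat.prime_iff_prime_int.1 hp
  have h1 := St_one (M := M) hp
  by_cases hi : ∃ i, ¬ (p:ℤ) ∣ M i i
  · obtain ⟨i, hi⟩ := hi
    obtain ⟨b, hb, -⟩ := h1.ext hp hM (i := i) (by simp) (by rw [bl_single]; exact hi)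
    exact ⟨b, _, hb, insert_nonempty _ _⟩
  push Not at hi
  have : ∃ i j, ¬ (p:ℤ) ∣ M i j := by
    by_contra hc
    push Not at hc
    have := h1.det_dvd hp hM 1 (by norm_num) (by intro i _ j _; rw [bl_single, pow_one]; exact hc i j)
    exact hd ((pow_dvd_pow _ (by simp)).trans this)
  obtain ⟨i, j, hij⟩ := this
  have hne : i ≠ j := by rintro rfl; exact hij (hi i)
  have h2 : St p M (Function.update (fun i => Pi.single i 1) i (Pi.single i 1 + Pi.single j 1)) ∅ := by
    refine ⟨?_, by simp, by simp⟩
    have e : Matrix.of (Function.update (fun i => (Pi.single i 1 : Fin n → ℤ)) i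
        (Pi.single i 1 + Pi.single j 1)) = (Matrix.of (fun i => (Pi.single i 1 : Fin n → ℤ))).updateRow i
        ((Matrix.of (fun i => (Pi.single i 1 : Fin n → ℤ))) i +
          (Matrix.of (fun i => (Pi.single i 1 : Fin n → ℤ))) j) := rfl
    rw [e, Matrix.det_updateRow_add_self _ hne]; exact h1.1
  obtain ⟨b, hb, -⟩ := h2.ext hp hM (i := i) (by simp) (by
    simp only [Function.update_self, bl_add_left, bl_add_right, bl_single]
    intro h
    have h3 : (p:ℤ) ∣ 2 * M i j := by
      have h4 := dvd_sub (dvd_sub h (hi i)) (hi j)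
      rw [hM.apply i j] at h4
      ring_nf at h4 ⊢; exact h4
    rcases hpi.dvd_or_dvd h3 with h3 | h3
    · exact hp2 ((Nat.prime_dvd_prime_iff_eq hp Nat.prime_two).1 (by exact_mod_cast h3))
    · exact hij h3)
  exact ⟨b, _, hb, insert_nonempty _ _⟩

lemma quad_rep {p : ℕ} (hp : p.Prime) (hp2 : p ≠ 2) {a b : ℤ} (ha : ¬ (p:ℤ) ∣ a) (hb : ¬ (p:ℤ) ∣ b) (c : ℤ) :
    ∃ x y : ℤ, (p:ℤ) ∣ a*x^2 + b*y^2 - c := by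
  have : Fact p.Prime := ⟨hp⟩
  have ha' : (a : ZMod p) ≠ 0 := fun h => ha ((ZMod.intCast_zmod_eq_zero_iff_dvd a p).1 h)
  have hb' : (b : ZMod p) ≠ 0 := fun h => hb ((ZMod.intCast_zmod_eq_zero_iff_dvd b p).1 h)
  obtain ⟨x, y, hxy⟩ := FiniteField.exists_root_sum_quadratic (R := ZMod p)
    (f := Polynomial.C (a : ZMod p) * Polynomial.X^2 + Polynomial.C 0 * Polynomial.X + Polynomial.C (-(c : ZMod p)))
    (g := Polynomial.C (b : ZMod p) * Polynomial.X^2 + Polynomial.C 0 * Polynomial.X + Polynomial.C 0)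
    (Polynomial.degree_quadratic ha') (Polynomial.degree_quadratic hb')
    (by rw [ZMod.card]; exact hp.mod_two_eq_one_iff_ne_two.2 hp2)
  refine ⟨x.val, y.val, (ZMod.intCast_zmod_eq_zero_iff_dvd _ p).1 ?_⟩
  simp at hxy
  push_cast
  simp only [ZMod.natCast_val, ZMod.cast_id', id]
  linear_combination hxy

lemma rep_of_odd {p : ℕ} (hp : p.Prime) (hp2 : p ≠ 2) (hn : 4 ≤ n) (hM : M.IsSymm)
    (hd : ¬ (p:ℤ)^(n-2) ∣ M.det) (m : ℤ) (K : ℕ) : Rep p M m K := by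
  obtain ⟨b0, s0, hS0, hs0⟩ := init_odd hp hp2 hM hd
  obtain ⟨b, s, hS, hall⟩ := St.complete hp hM _ hS0 hs0 rfl
  have h1 := hS.det_dvd hp hM 1 (by norm_num) (by simpa using hall)
  have hc : 2 < #s := by
    by_contra hc
    exact hd ((pow_dvd_pow _ (by omega)).trans h1)
  obtain ⟨i, hi, j, hj, k, hk, hij, hik, hjk⟩ := two_lt_card.1 hc
  obtain ⟨hdet, hu, ho⟩ := hS
  have hp3 : (p:ℤ) ∣ (p:ℤ)^3 := dvd_pow_self _ (by norm_num)
  obtain ⟨α, β, h⟩ := quad_rep hp hp2 (hu i hi) (hu j hj) (m - bl M (b k) (b k))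
  obtain ⟨w, hw⟩ := h
  obtain ⟨w1, e1⟩ := hp3.trans (ho i hi j hij.symm)
  obtain ⟨w2, e2⟩ := hp3.trans (ho i hi k hik.symm)
  obtain ⟨w3, e3⟩ := hp3.trans (ho j hj k hjk.symm)
  refine rep_odd hp hp2 hM (x := α • b i + β • b j + b k) (v := b k) K ?_ ?_
  · simp only [bl_add_left, bl_add_right, bl_smul_left, bl_smul_right, bl_comm hM (b j) (b i),
      bl_comm hM (b k) (b i), bl_comm hM (b k) (b j), e1, e2, e3]
    exact ⟨w + 2*α*β*w1 + 2*α*w2 + 2*β*w3, by linear_combination hw⟩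
  · simp only [bl_add_left, bl_smul_left, e2, e3]
    intro h
    exact hu k hk ((dvd_add_right (dvd_add (Dvd.dvd.mul_left (dvd_mul_right _ _) _)
      (Dvd.dvd.mul_left (dvd_mul_right _ _) _))).1 h)

/-- three odd orthogonal vectors and a vector of norm 2 mod 4 -/
lemma rep_gamma (hM : M.IsSymm) {b : Fin n → Fin n → ℤ} {s t : Finset (Fin n)} (hS : St 2 M b s) (ht : t ⊆ s)
    (hc : 2 < #t) {y : Fin n → ℤ} (hy : ∀ i ∈ t, (8:ℤ) ∣ bl M (b i) y)
    (m : ℤ) (K : ℕ) (H : bl M y y % 4 = 2 ∨ (bl M y y % 8 = 4 ∧ m % 4 ≠ 0)) : Rep 2 M m K := by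
  obtain ⟨i, hi, j, hj, k, hk, hij, hik, hjk⟩ := two_lt_card.1 hc
  have hu : ∀ i ∈ s, ¬ (2:ℤ) ∣ bl M (b i) (b i) := hS.2.1
  have ho : ∀ i ∈ s, ∀ j, j ≠ i → (8:ℤ) ∣ bl M (b i) (b j) := hS.2.2
  refine rep_comb hM (b i) (b j) (b k) 0 y m K (hu i (ht hi)) (hu j (ht hj)) (hu k (ht hk))
    (ho _ (ht hi) _ hij.symm) (ho _ (ht hi) _ hik.symm) (by simp [bl]) (hy i hi) (ho _ (ht hj) _ hjk.symm)
    (by simp [bl]) (hy j hj) (by simp [bl]) (hy k hk) (by simp [bl]) ?_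
  exact H.imp id (fun h => ⟨h.1, Or.inl h.2⟩)

lemma rep_delta (hM : M.IsSymm) {b : Fin n → Fin n → ℤ} {s : Finset (Fin n)} (hS : St 2 M b s) (hc : 2 < #s)
    (hall : ∀ i ∉ s, ∀ j ∉ s, (2:ℤ) ∣ bl M (b i) (b j)) {k l : Fin n} (hk : k ∉ s) (hl : l ∉ s)
    (hkk : (4:ℤ) ∣ bl M (b k) (b k)) (hll : (4:ℤ) ∣ bl M (b l) (b l)) (hkl : ¬ (4:ℤ) ∣ bl M (b k) (b l))
    (m : ℤ) (K : ℕ) : Rep 2 M m K := by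
  have hu : ∀ i ∈ s, ¬ (2:ℤ) ∣ bl M (b i) (b i) := hS.2.1
  have ho : ∀ i ∈ s, ∀ j, j ≠ i → (8:ℤ) ∣ bl M (b i) (b j) := hS.2.2
  have hne : ∀ i ∈ s, ∀ l ∉ s, l ≠ i := fun i hi l hl e => hl (e ▸ hi)
  by_cases hm : m % 4 = 0
  · obtain ⟨i, hi⟩ : s.Nonempty := card_pos.1 (by omega)
    have hik := ho i hi k (hne i hi k hk)
    have hil := ho i hi l (hne i hi l hl)
    have hz : ∀ z, (2:ℤ) ∣ bl M z (b l) := by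
      have := dvd_bl_of_basis (M := M) Nat.prime_two hS.1 (v := b l) (by
        intro a
        by_cases ha : a ∈ s
        · exact Dvd.dvd.trans (by norm_num) (ho a ha l (hne a ha l hl))
        · exact hall a ha l hl)
      exact this
    have hx : ∃ c : ℤ, (8:ℤ) ∣ bl M (b k + (2*c) • b i) (b k + (2*c) • b i) - m := by
      have hui := hu i hi
      have hki := bl_comm hM (b k) (b i)
      by_cases h8 : (8:ℤ) ∣ bl M (b k) (b k) - m
      · exact ⟨0, by simpa using h8⟩
      · refine ⟨1, ?_⟩
        rw [bl_line hM]
        omega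
    obtain ⟨c, hx⟩ := hx
    refine rep_two_b hM K hx (v := b l) ?_ hll hz
    rw [bl_add_left, bl_smul_left, mul_assoc]
    obtain ⟨w, hw⟩ := hil
    rw [hw]
    rintro ⟨y, hy⟩
    exact hkl ⟨y - 4*c*w, by linear_combination hy⟩
  · have : ∃ y, (∀ i ∈ s, (8:ℤ) ∣ bl M (b i) y) ∧ bl M y y % 8 = 4 := by
      have hev := hall k hk l hl
      by_cases h1 : bl M (b k) (b k) % 8 = 4
      · exact ⟨b k, fun i hi => ho i hi k (hne i hi k hk), h1⟩
      by_cases h2 : bl M (b l) (b l) % 8 = 4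
      · exact ⟨b l, fun i hi => ho i hi l (hne i hi l hl), h2⟩
      refine ⟨b k + (1:ℤ) • b l, fun i hi => ?_, ?_⟩
      · rw [bl_add_right, bl_smul_right, one_mul]
        exact dvd_add (ho i hi k (hne i hi k hk)) (ho i hi l (hne i hi l hl))
      · rw [bl_line hM]; omega
    obtain ⟨y, hy, hy4⟩ := this
    exact rep_gamma hM hS subset_rfl hc hy m K (Or.inr ⟨hy4, hm⟩)

lemma rep_of_two (hM : M.IsSymm) (hodd : ∃ x : Fin n → ℤ, Odd (bl M x x))
    (hd : ¬ (2:ℤ)^(n-2) ∣ M.det) (hcase : 5 ≤ n ∨ (n = 4 ∧ Even M.det)) (m : ℤ) (K : ℕ) : Rep 2 M m K := by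
  obtain ⟨b0, s0, hS0, hs0⟩ := init_two hM hodd
  obtain ⟨b, s, hS, hall⟩ := St.complete Nat.prime_two hM _ hS0 hs0 rfl
  norm_num at hall
  have h1 := hS.det_dvd Nat.prime_two hM 1 (by norm_num) (by simpa using hall)
  norm_num at h1
  have hc : 2 < #s := by
    by_contra hc
    exact hd ((pow_dvd_pow _ (by omega)).trans h1)
  have hu : ∀ i ∈ s, ¬ (2:ℤ) ∣ bl M (b i) (b i) := hS.2.1
  have ho : ∀ i ∈ s, ∀ j, j ≠ i → (8:ℤ) ∣ bl M (b i) (b j) := hS.2.2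
  have hne : ∀ i ∈ s, ∀ l ∉ s, l ≠ i := fun i hi l hl e => hl (e ▸ hi)
  -- a residual Gram entry which is 2 mod 4
  by_cases hg : ∃ k ∉ s, ¬ (4:ℤ) ∣ bl M (b k) (b k)
  · obtain ⟨k, hk, hk4⟩ := hg
    have := hall k hk k hk
    exact rep_gamma hM hS subset_rfl hc (y := b k) (fun i hi => ho i hi k (hne i hi k hk)) m K
      (Or.inl (by omega))
  push Not at hg
  by_cases hδ : ∃ k ∉ s, ∃ l ∉ s, ¬ (4:ℤ) ∣ bl M (b k) (b l)
  · obtain ⟨k, hk, l, hl, hkl⟩ := hδ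
    exact rep_delta hM hS hc hall hk hl (hg k hk) (hg l hl) hkl m K
  push Not at hδ
  have h2 := hS.det_dvd Nat.prime_two hM 2 (by norm_num) (by norm_num; exact hδ)
  have hcn : #s ≤ n := by simpa using card_le_univ s
  -- five odd vectors
  by_cases h5 : 5 ≤ #s
  · obtain ⟨i, hi, j, hj, k, hk, hij, hik, hjk⟩ := two_lt_card.1 hc
    have pair : ∀ i j, i ∈ s → j ∈ s → i ≠ j → bl M (b i) (b i) % 4 = bl M (b j) (b j) % 4 → Rep 2 M m K := by
      intro i j hi hj hij he
      have hcard : 2 < #((s.erase i).erase j) := by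
        rw [card_erase_of_mem (mem_erase.2 ⟨hij.symm, hj⟩), card_erase_of_mem hi]; omega
      refine rep_gamma hM hS ((erase_subset _ _).trans (erase_subset _ _)) hcard (y := b i + (1:ℤ) • b j)
        ?_ m K (Or.inl ?_)
      · intro k hk
        simp only [mem_erase] at hk
        rw [bl_add_right, bl_smul_right, one_mul]
        exact dvd_add (ho k hk.2.2 i (Ne.symm hk.2.1)) (ho k hk.2.2 j (Ne.symm hk.1))
      · have := ho i hi j hij.symm
        have := hu i hi
        have := hu j hj
        rw [bl_line hM]; omega
    have := hu i hi
    have := hu j hj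
    have := hu k hk
    by_cases h12 : bl M (b i) (b i) % 4 = bl M (b j) (b j) % 4
    · exact pair i j hi hj hij h12
    by_cases h13 : bl M (b i) (b i) % 4 = bl M (b k) (b k) % 4
    · exact pair i k hi hk hik h13
    exact pair j k hj hk hjk (by omega)
  have h4 : #s = 4 := by
    by_contra hne4
    exact hd ((pow_dvd_pow _ (by omega)).trans h2)
  have hn6 : n ≤ 5 := by
    by_contra hn
    exact hd ((pow_dvd_pow _ (by omega)).trans h2)
  rcases (show n = 4 ∨ n = 5 by omega) with rfl | rfl
  · exfalso
    have hev := (hcase.resolve_left (by norm_num)).2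
    have hsu : s = univ := (card_eq_iff_eq_univ s).1 (by simpa using h4)
    have hdet : (((Matrix.of b * M * (Matrix.of b).transpose).det : ℤ) : ZMod 2) = 1 := by
      rw [← gram_eq, Int.cast_det]
      have : (Matrix.of fun i j => bl M (b i) (b j)).map (fun x : ℤ => (x : ZMod 2)) = 1 := by
        ext i j
        rcases eq_or_ne j i with rfl | hji
        · have := hu j (by simp [hsu])
          simp only [Matrix.map_apply, Matrix.of_apply, Matrix.one_apply_eq]
          exact ZMod.intCast_eq_one_iff_odd.2 (Int.odd_iff.2 (by omega))
        · have := ho i (by simp [hsu]) j hji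
          simp only [Matrix.map_apply, Matrix.of_apply, Matrix.one_apply_ne hji.symm]
          exact (ZMod.intCast_zmod_eq_zero_iff_dvd _ 2).2 (by push_cast; omega)
      rw [this, Matrix.det_one]
    rw [Matrix.det_mul, Matrix.det_mul] at hdet
    have : ((M.det : ℤ) : ZMod 2) = 0 := (ZMod.intCast_zmod_eq_zero_iff_dvd _ 2).2 hev.two_dvd
    rw [Int.cast_mul, Int.cast_mul, this] at hdet
    simp at hdet
  · obtain ⟨k, hk⟩ : ∃ k, k ∉ s := by
      by_contra hcon
      push Not at hcon
      have : s = univ := eq_univ_iff_forall.2 hcon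
      rw [this] at h4; simp at h4
    have hsc : ∀ i, i ∉ s → i = k := by
      intro i hi
      have h1 : #sᶜ = 1 := by rw [card_compl, h4]; rfl
      exact card_le_one.1 h1.le i (by simpa using hi) k (by simpa using hk)
    have hk8 : bl M (b k) (b k) % 8 = 4 := by
      by_contra h8
      have h4k := hg k hk
      have := hS.det_dvd Nat.prime_two hM 3 (by norm_num) (by
        intro i hi j hj
        rw [hsc i hi, hsc j hj]; norm_num; omega)
      rw [h4] at this
      exact hd (by simpa using this)
    obtain ⟨a, ha⟩ : s.Nonempty := card_pos.1 (by omega)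
    obtain ⟨i, hi, j, hj, l, hl, hij, hil, hjl⟩ := two_lt_card.1
      (show 2 < #(s.erase a) by rw [card_erase_of_mem ha]; omega)
    rw [mem_erase] at hi hj hl
    exact rep_comb hM (b i) (b j) (b l) (b a) (b k) m K (hu _ hi.2) (hu _ hj.2) (hu _ hl.2)
      (ho _ hi.2 _ hij.symm) (ho _ hi.2 _ hil.symm) (ho _ hi.2 _ hi.1.symm) (ho _ hi.2 _ (hne _ hi.2 _ hk))
      (ho _ hj.2 _ hjl.symm) (ho _ hj.2 _ hj.1.symm) (ho _ hj.2 _ (hne _ hj.2 _ hk))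
      (ho _ hl.2 _ hl.1.symm) (ho _ hl.2 _ (hne _ hl.2 _ hk)) (ho _ ha _ (hne _ ha _ hk))
      (Or.inr ⟨hk8, Or.inr (hu _ ha)⟩)

theorem rep_all (hM : M.IsSymm) (hodd : ∃ x : Fin n → ℤ, Odd (bl M x x))
    (hd : ∀ p : ℕ, p.Prime → ¬ (p:ℤ)^(n-2) ∣ M.det) (hcase : 5 ≤ n ∨ (n = 4 ∧ Even M.det))
    {p : ℕ} (hp : p.Prime) (m : ℤ) (K : ℕ) : Rep p M m K := by
  rcases eq_or_ne p 2 with rfl | hp2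
  · exact rep_of_two hM hodd (by exact_mod_cast hd 2 hp) hcase m K
  · exact rep_of_odd hp hp2 (by omega) hM (hd p hp) m K

end APU
set_option maxHeartbeats 400000
namespace APU
open Finset

/-- the partial form `C1 B(x,e1)² + C2 B(x,e2)²` -/
def gq {n : ℕ} {R : Type*} [CommRing R] (M : Matrix (Fin n) (Fin n) R) (C1 C2 : R) (e1 e2 x : Fin n → R) : R :=
  C1 * bl M x e1 ^ 2 + C2 * bl M x e2 ^ 2

lemma ptw {n : ℕ} {R : Type*} [CommRing R] [IsDomain R] [CharZero R] {M : Matrix (Fin n) (Fin n) R}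
    (hM : M.IsSymm) {e1 e2 e3 : Fin n → R} (h12 : bl M e1 e2 = 0) (h13 : bl M e1 e3 = 0) (h23 : bl M e2 e3 = 0)
    (h1 : bl M e1 e1 ≠ 0) (h3 : bl M e3 e3 ≠ 0) {C1 C2 : R} (hC1 : C1 ≠ 0) (hC2 : C2 ≠ 0)
    {q : R} (hq : q ≠ 0) (v x : Fin n → R) (hx : ∃ y, bl M x y ≠ 0) :
    ∃ z : Fin n → R, ∃ y, y = v + q • z ∧ gq M C1 C2 e1 e2 (bl M y y • x - (2 * bl M x y) • y) ≠ 0 := by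
  by_contra hcon
  push Not at hcon
  have H : ∀ z, bl M z z^2 * gq M C1 C2 e1 e2 x - 4 * bl M z z * bl M x z *
      (C1 * bl M x e1 * bl M z e1 + C2 * bl M x e2 * bl M z e2)
      + 4 * bl M x z^2 * gq M C1 C2 e1 e2 z = 0 := by
    intro z
    have k := fun s : R => hcon (s • z) _ rfl
    simp only [gq, bl_add_left, bl_add_right, bl_sub_left, bl_smul_left, bl_smul_right, bl_comm hM z v] at k
    simp only [gq]
    have h24 : (24 * q^4 : R) ≠ 0 := mul_ne_zero (by norm_num) (pow_ne_zero _ hq)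
    apply mul_left_cancel₀ h24
    rw [mul_zero]
    linear_combination k 4 - 4 * k 3 + 6 * k 2 - 4 * k 1 + k 0
  have hg : gq M C1 C2 e1 e2 x = 0 := by
    have k := H e3
    have h31 : bl M e3 e1 = 0 := by rw [bl_comm hM, h13]
    have h32 : bl M e3 e2 = 0 := by rw [bl_comm hM, h23]
    have g3 : gq M C1 C2 e1 e2 e3 = 0 := by rw [gq, h31, h32]; ring
    rw [g3, h31, h32] at k
    apply mul_left_cancel₀ (pow_ne_zero 2 h3)
    linear_combination k
  have h21 : bl M e2 e1 = 0 := by rw [bl_comm hM, h12]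
  by_cases hb1 : bl M x e1 = 0
  · have hb2 : bl M x e2 = 0 := by
      rw [gq, hb1] at hg
      have : C2 * bl M x e2 ^ 2 = 0 := by linear_combination hg
      simpa [hC2] using this
    obtain ⟨y, hy⟩ := hx
    have H2 : ∀ t : R, gq M C1 C2 e1 e2 (y + t • e1) = 0 := by
      intro t
      have k := H (y + t • e1)
      have e : bl M x (y + t • e1) = bl M x y := by rw [bl_add_right, bl_smul_right, hb1]; ring
      rw [hg, hb1, hb2, e] at k
      have h4 : (4 * bl M x y ^ 2 : R) ≠ 0 := mul_ne_zero (by norm_num) (pow_ne_zero _ hy)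
      apply mul_left_cancel₀ h4
      linear_combination k
    have k0 := H2 0
    have k1 := H2 1
    have k2 := H2 (-1)
    simp only [gq, bl_add_left, bl_smul_left, h12] at k0 k1 k2
    have : C1 * bl M e1 e1 ^ 2 = 0 := by
      apply mul_left_cancel₀ (two_ne_zero : (2:R) ≠ 0)
      linear_combination k1 + k2 - 2 * k0
    simp [hC1, h1] at this
  · have H2 : ∀ t : R, t ≠ 0 → (bl M x e1 + t * bl M x e3) * (bl M x e3 * bl M e1 e1 - t * bl M e3 e3 * bl M x e1) = 0 := by
      intro t ht
      have k := H (e1 + t • e3)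
      rw [hg] at k
      simp only [gq, bl_add_left, bl_add_right, bl_smul_left, bl_smul_right, h12, h13, bl_comm hM e3 e1,
        bl_comm hM e3 e2, h23] at k
      have h4 : (4 * t * C1 * bl M e1 e1 : R) ≠ 0 :=
        mul_ne_zero (mul_ne_zero (mul_ne_zero (by norm_num) ht) hC1) h1
      apply mul_left_cancel₀ h4
      linear_combination k
    have k1 := H2 1 one_ne_zero
    have k2 := H2 (-1) (neg_ne_zero.2 one_ne_zero)
    have k3 := H2 2 two_ne_zero
    have h6 : (6 : R) * (bl M e3 e3 * bl M x e1) * bl M x e3 = 0 := by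
      linear_combination 3 * k1 - k2 - 2 * k3
    have hb3 : bl M x e3 = 0 := by
      simpa [h3, hb1] using h6
    rw [hb3] at k1
    have : bl M e3 e3 * bl M x e1 ^ 2 = 0 := by linear_combination -k1
    simp [h3, hb1] at this

lemma bl_map {n : ℕ} {R S : Type*} [CommRing R] [CommRing S] (φ : R →+* S) (M : Matrix (Fin n) (Fin n) R)
    (x y : Fin n → R) : bl (M.map φ) (φ ∘ x) (φ ∘ y) = φ (bl M x y) := by
  simp [bl_eq_sum, map_sum, map_mul]

lemma bl_congr {n : ℕ} {R : Type*} [CommRing R] (M : Matrix (Fin n) (Fin n) R) {d : R}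
    {x x' y y' : Fin n → R} (h : ∀ i, d ∣ x i - x' i) (h' : ∀ i, d ∣ y i - y' i) :
    d ∣ bl M x y - bl M x' y' := by
  choose z hz using h
  choose w hw using h'
  have e : x = x' + d • z := by ext i; simp [← hz i]
  have e' : y = y' + d • w := by ext i; simp [← hw i]
  rw [e, e']
  simp only [bl_add_left, bl_add_right, bl_smul_left, bl_smul_right]
  exact ⟨bl M x' w + bl M z y' + d * bl M z w, by ring⟩

lemma gq_congr {n : ℕ} {R : Type*} [CommRing R] (M : Matrix (Fin n) (Fin n) R) {d : R} (C1 C2 : R)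
    (e1 e2 : Fin n → R) {x x' : Fin n → R} (h : ∀ i, d ∣ x i - x' i) :
    d ∣ gq M C1 C2 e1 e2 x - gq M C1 C2 e1 e2 x' := by
  obtain ⟨u, hu⟩ := bl_congr M (y := e1) (y' := e1) h (by simp)
  obtain ⟨w, hw⟩ := bl_congr M (y := e2) (y' := e2) h (by simp)
  refine ⟨C1 * u * (bl M x e1 + bl M x' e1) + C2 * w * (bl M x e2 + bl M x' e2), ?_⟩
  rw [gq, gq]
  linear_combination C1 * (bl M x e1 + bl M x' e1) * hu + C2 * (bl M x e2 + bl M x' e2) * hw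

lemma compact_padic {n p : ℕ} [hp : Fact p.Prime] {M : Matrix (Fin n) (Fin n) ℤ_[p]}
    (hM : M.IsSymm) (hdet : M.det ≠ 0) {e1 e2 e3 : Fin n → ℤ_[p]} (h12 : bl M e1 e2 = 0) (h13 : bl M e1 e3 = 0)
    (h23 : bl M e2 e3 = 0) (h1 : bl M e1 e1 ≠ 0) (h3 : bl M e3 e3 ≠ 0) {C1 C2 : ℤ_[p]} (hC1 : C1 ≠ 0)
    (hC2 : C2 ≠ 0) {v : Fin n → ℤ_[p]} (hv : IsUnit (bl M v v)) :
    ∃ Γ : ℕ, ∀ x : Fin n → ℤ_[p], (∃ i, IsUnit (x i)) → ∃ y, IsUnit (bl M y y) ∧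
      ¬ (p:ℤ_[p])^Γ ∣ gq M C1 C2 e1 e2 (bl M y y • x - (2 * bl M x y) • y) := by
  have hp0 : (p:ℤ_[p]) ≠ 0 := PadicInt.prime_p.ne_zero
  have hcl : IsClosed {x : Fin n → ℤ_[p] | ∃ i, IsUnit (x i)} := by
    simp only [PadicInt.isUnit_iff, Set.setOf_exists]
    exact isClosed_iUnion_of_finite fun i => isClosed_eq (by fun_prop) continuous_const
  have key := IsCompact.induction_on hcl.isCompact (p := fun S => ∃ Γ : ℕ, ∀ x ∈ S, ∃ y, IsUnit (bl M y y) ∧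
      ¬ (p:ℤ_[p])^Γ ∣ gq M C1 C2 e1 e2 (bl M y y • x - (2 * bl M x y) • y)) ⟨0, by simp⟩
    (fun s t hst ⟨Γ, h⟩ => ⟨Γ, fun x hx => h x (hst hx)⟩) ?_ ?_
  · exact key
  · rintro s t ⟨Γ, h⟩ ⟨Γ', h'⟩
    refine ⟨Γ + Γ', fun x hx => ?_⟩
    rcases hx with hx | hx
    · obtain ⟨y, hy, hn⟩ := h x hx
      exact ⟨y, hy, fun hd => hn ((pow_dvd_pow _ (by omega)).trans hd)⟩
    · obtain ⟨y, hy, hn⟩ := h' x hx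
      exact ⟨y, hy, fun hd => hn ((pow_dvd_pow _ (by omega)).trans hd)⟩
  · rintro x ⟨i, hi⟩
    have hxy : ∃ y, bl M x y ≠ 0 := by
      by_contra hc
      push Not at hc
      have hz : M.mulVec x = 0 := by
        ext j
        have := hc (Pi.single j 1)
        rw [bl_comm hM] at this
        simpa [bl] using this
      have := Matrix.eq_zero_of_mulVec_eq_zero hdet hz
      rw [this] at hi
      simp at hi
    obtain ⟨z, y, hy, hg⟩ := ptw hM h12 h13 h23 h1 h3 hC1 hC2 hp0 v x hxy
    have hyu : IsUnit (bl M y y) := by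
      by_contra hc
      have hd : (p:ℤ_[p]) ∣ bl M y y := by
        rw [← PadicInt.norm_lt_one_iff_dvd]
        exact PadicInt.mem_nonunits.1 hc
      have h2 : (p:ℤ_[p]) ∣ bl M y y - bl M v v := bl_congr M (by intro i; simp [hy]) (by intro i; simp [hy])
      have h4 : (p:ℤ_[p]) ∣ bl M v v := (dvd_sub_right hd).1 h2
      exact PadicInt.prime_p.not_unit (isUnit_of_dvd_unit h4 hv)
    obtain ⟨Γ, hΓ⟩ := PadicInt.exists_pow_neg_lt p (norm_pos_iff.2 hg)
    have hcont : Continuous fun x : Fin n → ℤ_[p] =>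
        gq M C1 C2 e1 e2 (bl M y y • x - (2 * bl M x y) • y) := by
      simp only [gq, bl_sub_left, bl_smul_left]
      unfold bl dotProduct
      fun_prop
    refine ⟨_, mem_nhdsWithin_of_mem_nhds ((isOpen_lt continuous_const hcont.norm).mem_nhds hΓ), Γ, ?_⟩
    intro x' hx'
    refine ⟨y, hyu, fun hd => ?_⟩
    have := (PadicInt.norm_le_pow_iff_mem_span_pow _ Γ).2 (Ideal.mem_span_singleton.2 hd)
    exact absurd this (not_le.2 hx')

theorem good_vec {n : ℕ} {M : Matrix (Fin n) (Fin n) ℤ} (hM : M.IsSymm) (hdet : M.det ≠ 0)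
    {e1 e2 e3 : Fin n → ℤ} (h12 : bl M e1 e2 = 0) (h13 : bl M e1 e3 = 0) (h23 : bl M e2 e3 = 0)
    (h1 : bl M e1 e1 ≠ 0) (h3 : bl M e3 e3 ≠ 0) {C1 C2 : ℤ} (hC1 : C1 ≠ 0) (hC2 : C2 ≠ 0)
    {p : ℕ} (hp : p.Prime) (hrep : ∀ m K, Rep p M m K) :
    ∃ Γ : ℕ, ∀ (m : ℤ) (K : ℕ), ∃ x : Fin n → ℤ, (p:ℤ)^K ∣ bl M x x - m ∧ (∃ i, ¬ (p:ℤ) ∣ x i) ∧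
      ¬ (p:ℤ)^Γ ∣ gq M C1 C2 e1 e2 x := by
  have : Fact p.Prime := ⟨hp⟩
  set φ := Int.castRingHom ℤ_[p] with hφ
  have hinj : Function.Injective φ := Int.cast_injective
  have hne : ∀ a : ℤ, a ≠ 0 → φ a ≠ 0 := fun a ha => (map_ne_zero_iff φ hinj).2 ha
  have hun : ∀ a : ℤ, ¬ (p:ℤ) ∣ a → IsUnit (φ a) := by
    intro a ha
    by_contra hc
    have hlt := PadicInt.mem_nonunits.1 hc
    exact ha ((PadicInt.norm_int_lt_one_iff_dvd a).1 hlt)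
  have hMs : (M.map φ).IsSymm := hM.map φ
  obtain ⟨v, hv, -⟩ := hrep 1 1
  have hvu : IsUnit (bl (M.map φ) (φ ∘ v) (φ ∘ v)) := by
    rw [bl_map]
    refine hun _ fun hd => (Nat.prime_iff_prime_int.1 hp).not_unit (isUnit_of_dvd_one ?_)
    rw [pow_one] at hv
    have := dvd_sub hd hv
    simpa using this
  have hdet' : (M.map φ).det ≠ 0 := by
    have : (M.map φ).det = φ M.det := by rw [RingHom.map_det]; rfl
    rw [this]; exact hne _ hdet
  obtain ⟨Γ, hΓ⟩ := compact_padic (C1 := φ C1) (C2 := φ C2) hMs hdet' (by rw [bl_map, h12, map_zero])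
    (by rw [bl_map, h13, map_zero]) (by rw [bl_map, h23, map_zero])
    (e1 := φ ∘ e1) (e2 := φ ∘ e2) (e3 := φ ∘ e3) (by rw [bl_map]; exact hne _ h1)
    (by rw [bl_map]; exact hne _ h3) (hne _ hC1) (hne _ hC2) hvu
  refine ⟨Γ, fun m K => ?_⟩
  obtain ⟨x, hx, i0, hi0⟩ := hrep m K
  obtain ⟨y, hy, hg⟩ := hΓ (φ ∘ x) ⟨i0, hun _ hi0⟩
  obtain ⟨w, hw⟩ := hy.exists_left_inv
  set N := M.map φ with hN
  set X := φ ∘ x with hX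
  set Y := X - (2 * bl N X y * w) • y with hY
  have hYf : bl N Y Y = bl N X X := by
    simp only [hY, bl_sub_left, bl_sub_right, bl_smul_left, bl_smul_right, bl_comm hMs y X]
    linear_combination (4 * w * bl N X y^2) * hw
  have hYg : bl N y y • X - (2 * bl N X y) • y = bl N y y • Y := by
    ext i
    simp only [hY, Pi.sub_apply, Pi.smul_apply, smul_eq_mul]
    linear_combination (2 * bl N X y * y i) * hw
  have hYy : bl N Y y = - bl N X y := by
    simp only [hY, bl_sub_left, bl_smul_left]
    linear_combination (-2 * bl N X y) * hw
  have hg' : ¬ (p:ℤ_[p])^Γ ∣ gq N (φ C1) (φ C2) (φ ∘ e1) (φ ∘ e2) Y := by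
    intro hd
    apply hg
    rw [hYg]
    have : gq N (φ C1) (φ C2) (φ ∘ e1) (φ ∘ e2) (bl N y y • Y) =
        bl N y y ^ 2 * gq N (φ C1) (φ C2) (φ ∘ e1) (φ ∘ e2) Y := by
      simp only [gq, bl_smul_left]; ring
    rw [this]
    exact hd.mul_left _
  have hYp : ∃ i, ¬ (p:ℤ_[p]) ∣ Y i := by
    by_contra hc
    push Not at hc
    have h2 : (p:ℤ_[p]) ∣ bl N X y := by
      rw [← dvd_neg, ← hYy]
      unfold bl dotProduct
      exact dvd_sum fun i _ => (hc i).mul_right _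
    have h4 : (p:ℤ_[p]) ∣ X i0 := by
      have h5 : X i0 = Y i0 + (2 * bl N X y * w) * y i0 := by simp [hY]
      rw [h5]
      exact dvd_add (hc i0) (((h2.mul_left 2).mul_right w).mul_right _)
    exact PadicInt.prime_p.not_unit (isUnit_of_dvd_unit h4 (hun _ hi0))
  set L := K + Γ + 1 with hL
  set x' : Fin n → ℤ := fun i => ((Y i).appr L : ℤ) with hx'
  have happ : ∀ i, (p:ℤ_[p])^L ∣ Y i - (φ ∘ x') i := by
    intro i
    have := PadicInt.appr_spec L (Y i)
    rw [Ideal.mem_span_singleton] at this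
    simpa [hx', hφ] using this
  have hle : ∀ j ≤ L, ∀ i, (p:ℤ_[p])^j ∣ Y i - (φ ∘ x') i := fun j hj i => (pow_dvd_pow _ hj).trans (happ i)
  have hback : ∀ (j : ℕ) (a : ℤ), (p:ℤ_[p])^j ∣ φ a ↔ (p:ℤ)^j ∣ a := by
    intro j a
    have := PadicInt.pow_p_dvd_int_iff (p := p) j a
    push_cast at this
    exact this
  refine ⟨x', ?_, ?_, ?_⟩
  · have h5 : (p:ℤ_[p])^K ∣ bl N Y Y - bl N (φ ∘ x') (φ ∘ x') :=
      bl_congr N (hle K (by omega)) (hle K (by omega))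
    rw [hYf, hX, hN, bl_map, bl_map, ← map_sub, hback] at h5
    have := dvd_sub hx h5
    simpa using this
  · obtain ⟨i, hi⟩ := hYp
    refine ⟨i, fun hd => hi ?_⟩
    have h5 := (hback 1 _).2 (by simpa using hd : (p:ℤ)^1 ∣ x' i)
    have h6 := dvd_add (hle 1 (by omega) i) h5
    simpa using h6
  · intro hd
    apply hg'
    have h5 := gq_congr N (φ C1) (φ C2) (φ ∘ e1) (φ ∘ e2) (hle Γ (by omega))
    have h6 : gq N (φ C1) (φ C2) (φ ∘ e1) (φ ∘ e2) (φ ∘ x') = φ (gq M C1 C2 e1 e2 x') := by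
      simp only [gq, hN, bl_map, map_add, map_mul, map_pow]
    rw [h6] at h5
    have := dvd_add h5 ((hback Γ _).2 hd)
    simpa using this

end APU
set_option maxHeartbeats 400000
namespace APU
open Finset

lemma orth3 {n : ℕ} (hn : 4 ≤ n) (M : Matrix (Fin n) (Fin n) ℤ) (u v w : Fin n → ℤ) :
    ∃ t : Fin n → ℤ, t ≠ 0 ∧ bl M u t = 0 ∧ bl M v t = 0 ∧ bl M w t = 0 := by
  obtain ⟨t, ht, h, -⟩ := Int.Matrix.exists_ne_zero_int_vec_norm_le
    (Matrix.of ![Matrix.vecMul u M, Matrix.vecMul v M, Matrix.vecMul w M]) (by simp; omega) (by simp)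
  refine ⟨t, ht, ?_, ?_, ?_⟩ <;> rw [bl, Matrix.dotProduct_mulVec]
  · exact congrFun h 0
  · exact congrFun h 1
  · exact congrFun h 2

lemma crt_pow (K : ℕ) (r : ℕ → ℤ) (P : Finset ℕ) : (∀ p ∈ P, p.Prime) →
    ∃ x : ℤ, ∀ p ∈ P, (p:ℤ)^K ∣ x - r p := by
  induction P using Finset.induction_on with
  | empty => intro _; exact ⟨0, by simp⟩
  | insert q P hq ih =>
    intro hP
    obtain ⟨x, hx⟩ := ih fun p hp => hP p (mem_insert_of_mem hp)
    have hco : IsCoprime (∏ p ∈ P, (p:ℤ)^K) ((q:ℤ)^K) := by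
      refine IsCoprime.prod_left fun p hp => IsCoprime.pow ?_
      rw [Nat.isCoprime_iff_coprime]
      exact (Nat.coprime_primes (hP p (mem_insert_of_mem hp)) (hP q (mem_insert_self _ _))).2
        (fun e => hq (e ▸ hp))
    obtain ⟨a, b, hab⟩ := hco
    refine ⟨x + (r q - x) * (a * ∏ p ∈ P, (p:ℤ)^K), fun p hp => ?_⟩
    rcases mem_insert.1 hp with rfl | hp
    · exact ⟨(x - r p) * b, by linear_combination (r p - x) * hab⟩
    · have h1 : (p:ℤ)^K ∣ ∏ p ∈ P, (p:ℤ)^K := dvd_prod_of_mem (fun p : ℕ => (p:ℤ)^K) hp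
      have := dvd_add (hx p hp) ((h1.mul_left a).mul_left (r q - x))
      ring_nf at this ⊢; exact this

lemma dvd_of_primes {Q K : ℕ} (hQ : 0 < Q) (hK : Q ≤ K) {z : ℤ}
    (h : ∀ p : ℕ, p.Prime → p ∣ Q → (p:ℤ)^K ∣ z) : (Q:ℤ) ∣ z := by
  rw [Int.natCast_dvd, Nat.dvd_iff_prime_pow_dvd_dvd]
  intro p k hp hk
  rcases Nat.eq_zero_or_pos k with rfl | hk0
  · simp
  have hkQ : k ≤ K := (Nat.lt_pow_self hp.one_lt).le.trans ((Nat.le_of_dvd hQ hk).trans hK)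
  have h1 := (pow_dvd_pow (p:ℤ) hkQ).trans (h p hp ((dvd_pow_self p (by omega)).trans hk))
  rw [← Int.natCast_dvd]
  exact_mod_cast h1

lemma smooth_dvd {v s G : ℕ} (h : ∀ p : ℕ, p.Prime → p ∣ v → p ∣ s)
    (h' : ∀ p : ℕ, p.Prime → p ∣ s → ¬ p^G ∣ v) : v ∣ s^G := by
  rw [Nat.dvd_iff_prime_pow_dvd_dvd]
  intro p k hp hk
  rcases Nat.eq_zero_or_pos k with rfl | hk0
  · simp
  have hps := h p hp ((dvd_pow_self p (by omega)).trans hk)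
  have hlt : k ≤ G := by
    by_contra hc
    exact h' p hp hps ((pow_dvd_pow p (by omega)).trans hk)
  exact (pow_dvd_pow_of_dvd hps k).trans (pow_dvd_pow s hlt)

theorem main_thm {n : ℕ} (hn : 4 ≤ n) {M : Matrix (Fin n) (Fin n) ℤ} (hM : M.IsSymm) (hdet : M.det ≠ 0)
    (hpos : ∀ x : Fin n → ℤ, x ≠ 0 → 0 < bl M x x) (hrep : ∀ p : ℕ, p.Prime → ∀ m K, Rep p M m K) :
    ∃ T : ℤ, ∀ m : ℤ, T ≤ m → ∃ x : Fin n → ℤ, (∀ p : ℕ, p.Prime → ∃ i, ¬ (p:ℤ) ∣ x i) ∧ bl M x x = m := by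
  obtain ⟨e1, he1, -⟩ := orth3 hn M 0 0 0
  obtain ⟨e2, he2, h12, -⟩ := orth3 hn M e1 0 0
  obtain ⟨e3', he3, h13', h23', -⟩ := orth3 hn M e1 e2 0
  obtain ⟨e4, he4, h14, h24, h34'⟩ := orth3 hn M e1 e2 e3'
  obtain ⟨e3, h13, h23, h34, h33⟩ : ∃ e3, bl M e1 e3 = 0 ∧ bl M e2 e3 = 0 ∧ bl M e3 e4 = 0 ∧
      2 ≤ bl M e3 e3 := by
    have := hpos e3' he3
    refine ⟨(2:ℤ) • e3', ?_, ?_, ?_, ?_⟩ <;> simp only [bl_smul_left, bl_smul_right]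
    · rw [h13']; rfl
    · rw [h23']; rfl
    · rw [h34']; rfl
    · omega
  obtain ⟨a1, ha1⟩ := Int.eq_ofNat_of_zero_le (hpos e1 he1).le
  obtain ⟨a2, ha2⟩ := Int.eq_ofNat_of_zero_le (hpos e2 he2).le
  obtain ⟨a3, ha3⟩ := Int.eq_ofNat_of_zero_le ((by norm_num : (0:ℤ) ≤ 2).trans h33)
  obtain ⟨a4, ha4⟩ := Int.eq_ofNat_of_zero_le (hpos e4 he4).le
  have p1 : 0 < a1 := by have := hpos e1 he1; omega
  have p2 : 0 < a2 := by have := hpos e2 he2; omega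
  have p3 : 2 ≤ a3 := by omega
  have p4 : 0 < a4 := by have := hpos e4 he4; omega
  have p3' : 0 < a3 := by omega
  clear he1 he2 he3 he4 h13' h23' h34'
  obtain ⟨A1, hA1⟩ : ∃ A, A = a2*a3*a4 := ⟨_, rfl⟩
  obtain ⟨A2, hA2⟩ : ∃ A, A = a1*a3*a4 := ⟨_, rfl⟩
  obtain ⟨A3, hA3⟩ : ∃ A, A = a1*a2*a4 := ⟨_, rfl⟩
  obtain ⟨A4, hA4⟩ : ∃ A, A = a1*a2*a3 := ⟨_, rfl⟩
  obtain ⟨A0, hA0⟩ : ∃ A, A = a1*a2*a3*a4 := ⟨_, rfl⟩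
  have q1 : 0 < A1 := by rw [hA1]; positivity
  have q2 : 0 < A2 := by rw [hA2]; positivity
  have q3 : 0 < A3 := by rw [hA3]; positivity
  have q4 : 0 < A4 := by rw [hA4]; positivity
  have q0 : 0 < A0 := by rw [hA0]; positivity
  have hD2 : 2 ≤ A1*A2 := by
    have h1 : a3 ∣ A1*A2 := ⟨a2*a4*A2, by rw [hA1]; ring⟩
    exact p3.trans (Nat.le_of_dvd (Nat.mul_pos q1 q2) h1)
  have z1 : (a1:ℤ)*A1 = A0 := by rw [hA1, hA0]; push_cast; ring
  have z2 : (a2:ℤ)*A2 = A0 := by rw [hA2, hA0]; push_cast; ring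
  have z3 : (a3:ℤ)*A3 = A0 := by rw [hA3, hA0]; push_cast; ring
  have z4 : (a4:ℤ)*A4 = A0 := by rw [hA4, hA0]; push_cast; ring
  clear hA1 hA2 hA3 hA4 hA0
  obtain ⟨s0, hs0⟩ : ∃ s, s = 2*(A1*A2)*(A3*A4*A0) := ⟨_, rfl⟩
  have hspos : 0 < s0 := by rw [hs0]; positivity
  have d12 : 2*(A1*A2) ∣ s0 := ⟨_, hs0⟩
  have d3 : A3 ∣ s0 := ⟨2*(A1*A2)*(A4*A0), by rw [hs0]; ring⟩
  have d4 : A4 ∣ s0 := ⟨2*(A1*A2)*(A3*A0), by rw [hs0]; ring⟩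
  have d0 : A0 ∣ s0 := ⟨2*(A1*A2)*(A3*A4), by rw [hs0]; ring⟩
  have d1 : A1 ∣ s0 := (Dvd.intro_left (2) (by ring : 2 * (A1*A2) = 2*(A1*A2))).trans d12 |> (dvd_mul_right A1 A2).trans
  have d2 : 2 ∣ s0 := (dvd_mul_right _ _).trans d12
  clear hs0
  obtain ⟨N, hN⟩ : ∃ N, N = s0 * A0 := ⟨_, rfl⟩
  have hNpos : 0 < N := by rw [hN]; positivity
  have hNp : ∀ p : ℕ, p.Prime → p ∣ N → p ∣ s0 := by
    intro p hp h
    rw [hN] at h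
    exact (hp.dvd_mul.1 h).elim id (fun h => h.trans d0)
  have hG : ∀ p : ℕ, ∃ Γ : ℕ, p.Prime → ∀ (m : ℤ) (K : ℕ), ∃ x : Fin n → ℤ, (p:ℤ)^K ∣ bl M x x - m ∧
      (∃ i, ¬ (p:ℤ) ∣ x i) ∧ ¬ (p:ℤ)^Γ ∣ gq M (A1*A1) (A1*A2) e1 e2 x := by
    intro p
    by_cases hp : p.Prime
    · obtain ⟨Γ, h⟩ := good_vec hM hdet h12 h13 h23 (by omega) (by omega)
        (C1 := A1*A1) (C2 := A1*A2) (by positivity) (by positivity) hp (hrep p hp)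
      exact ⟨Γ, fun _ => h⟩
    · exact ⟨0, fun h => absurd h hp⟩
  choose G hG using hG
  obtain ⟨Γ, hΓ⟩ : ∃ Γ, ∀ p ∈ s0.primeFactors, G p ≤ Γ := ⟨s0.primeFactors.sup G, fun p hp => le_sup hp⟩
  obtain ⟨Q, hQ⟩ : ∃ Q, Q = s0^Γ * (16*(A1*A2)*(A1*N)) := ⟨_, rfl⟩
  have hQpos : 0 < Q := by rw [hQ]; positivity
  have hQp : ∀ p : ℕ, p.Prime → p ∣ Q → p ∈ s0.primeFactors := by
    intro p hp h
    rw [Nat.mem_primeFactors]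
    refine ⟨hp, ?_, hspos.ne'⟩
    rw [hQ] at h
    rcases hp.dvd_mul.1 h with h | h
    · exact hp.dvd_of_dvd_pow h
    rcases hp.dvd_mul.1 h with h | h
    · rcases hp.dvd_mul.1 h with h | h
      · exact (hp.dvd_of_dvd_pow (show p ∣ 2^4 from h)).trans d2
      · exact h.trans ((dvd_mul_left _ _).trans d12)
    · rcases hp.dvd_mul.1 h with h | h
      · exact h.trans d1
      · exact hNp p hp h
  -- one residue class
  have cls : ∀ r : ℕ, ∃ T : ℤ, ∀ m : ℤ, T ≤ m → (Q:ℤ) ∣ m - r → ∃ x : Fin n → ℤ,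
      (∀ p : ℕ, p.Prime → ∃ i, ¬ (p:ℤ) ∣ x i) ∧ bl M x x = m := by
    intro r
    obtain ⟨K, hK⟩ : ∃ K, K = Q + Γ + 1 := ⟨_, rfl⟩
    have hX : ∀ p : ℕ, ∃ x : Fin n → ℤ, p ∈ s0.primeFactors → (p:ℤ)^K ∣ bl M x x - r ∧
      (∃ i, ¬ (p:ℤ) ∣ x i) ∧ ¬ (p:ℤ)^Γ ∣ gq M (A1*A1) (A1*A2) e1 e2 x := by
      intro p
      by_cases hp : p ∈ s0.primeFactors
      · obtain ⟨x, hx1, hx2, hx3⟩ := hG p (Nat.prime_of_mem_primeFactors hp) r K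
        exact ⟨x, fun _ => ⟨hx1, hx2, fun h => hx3 ((pow_dvd_pow _ (hΓ p hp)).trans h)⟩⟩
      · exact ⟨0, fun h => absurd h hp⟩
    choose X hX using hX
    have hcrt := fun i => crt_pow K (fun p => X p i) s0.primeFactors fun p => Nat.prime_of_mem_primeFactors
    choose xs hxs using hcrt
    have hxk : ∀ k ≤ K, ∀ p ∈ s0.primeFactors, ∀ i, (p:ℤ)^k ∣ xs i - X p i :=
      fun k hk p hp i => (pow_dvd_pow _ hk).trans (hxs i p hp)
    have f1 : (Q:ℤ) ∣ bl M xs xs - r := by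
      refine dvd_of_primes hQpos (show Q ≤ K by omega) fun p hp hpQ => ?_
      have hm := hQp p hp hpQ
      have := dvd_add (bl_congr M (hxk K le_rfl p hm) (hxk K le_rfl p hm)) (hX p hm).1
      simpa using this
    have f2 : ∀ p ∈ s0.primeFactors, ∃ i, ¬ (p:ℤ) ∣ xs i := by
      intro p hp
      obtain ⟨i, hi⟩ := (hX p hp).2.1
      refine ⟨i, fun h => hi ?_⟩
      have := hxk 1 (by omega) p hp i
      rw [pow_one] at this
      exact (dvd_sub_right h).1 this
    have f3 : ∀ p ∈ s0.primeFactors, ¬ (p:ℤ)^Γ ∣ gq M (A1*A1) (A1*A2) e1 e2 xs := by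
      intro p hp h
      exact (hX p hp).2.2 ((dvd_sub_right h).1 (gq_congr M _ _ e1 e2 (hxk Γ (by omega) p hp)))
    obtain ⟨g0, hg0⟩ : ∃ g0 : ℕ, gq M (A1*A1) (A1*A2) e1 e2 xs = g0 :=
      Int.eq_ofNat_of_zero_le (by rw [gq]; positivity)
    have hg0ne : g0 ≠ 0 := by
      rintro rfl
      exact f3 2 (Nat.mem_primeFactors.2 ⟨Nat.prime_two, d2, hspos.ne'⟩) (by rw [hg0]; simp)
    obtain ⟨ν, n', hgn, hco, hsm⟩ := split_smooth s0 g0 hg0ne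
    have hν0 : 0 < ν := Nat.pos_of_ne_zero (by rintro rfl; simp at hgn; exact hg0ne hgn)
    have hn0 : 0 < n' := Nat.pos_of_ne_zero (by rintro rfl; simp at hgn; exact hg0ne hgn)
    have hνd : ν ∣ s0^Γ := smooth_dvd hsm (by
      intro p hp hps hd
      refine f3 p (Nat.mem_primeFactors.2 ⟨hp, hps, hspos.ne'⟩) ?_
      rw [hg0, hgn]
      exact_mod_cast hd.mul_right n')
    obtain ⟨m0, hm0⟩ := diag q1 q3 q4 hD2 hspos d12 d3 d4 (Dvd.intro _ hN.symm) hNpos hNp hν0 hsm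
    obtain ⟨c, hc⟩ : ∃ c : ℤ, c = A1*bl M xs e1^2+A2*bl M xs e2^2+A3*bl M xs e3^2+A4*bl M xs e4^2 := ⟨_, rfl⟩
    have hc0 : 0 ≤ c := by rw [hc]; positivity
    refine ⟨bl M xs xs + m0, fun m hm hmr => ?_⟩
    have hge : (m0:ℤ) ≤ A0 * (m - bl M xs xs) + c := by
      have h1 : (1:ℤ) ≤ A0 := by exact_mod_cast q0
      have h2 : (0:ℤ) ≤ m0 := by positivity
      nlinarith
    obtain ⟨m', hm'⟩ := Int.eq_ofNat_of_zero_le ((by positivity : (0:ℤ) ≤ m0).trans hge)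
    have hle : m0 ≤ m' := by rw [hm'] at hge; exact_mod_cast hge
    obtain ⟨y1, y2, y3, y4, ⟨k1, hy1⟩, ⟨k2, hy2⟩, ⟨k3, hy3⟩, ⟨k4, hy4⟩, hy, hyp⟩ := hm0 m' hle
      (bl M xs e1) (bl M xs e2) (bl M xs e3) (bl M xs e4) n' hn0 hco (by
        rw [gq, hgn] at hg0; push_cast at hg0; linear_combination hg0) (by
        have h1 : ((ν*(16*(A1*A2)*(A1*N)) : ℕ):ℤ) ∣ (Q:ℤ) := by
          rw [hQ]; exact Int.natCast_dvd_natCast.2 (Nat.mul_dvd_mul_right hνd _)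
        have h2 := h1.trans (dvd_sub hmr f1)
        rw [← hc, show (m':ℤ) - c = A0 * (m - r - (bl M xs xs - r)) by linear_combination -hm']
        exact h2.mul_left _)
    have hNz : (N:ℤ) = s0 * A0 := by rw [hN]; push_cast; rfl
    rw [hNz] at hy1 hy2 hy3 hy4
    set w : Fin n → ℤ := (A1*k1 : ℤ) • e1 + (A2*k2 : ℤ) • e2 + (A3*k3 : ℤ) • e3 + (A4*k4 : ℤ) • e4 with hw
    have h21 : bl M e2 e1 = 0 := by rw [bl_comm hM, h12]
    have h31 : bl M e3 e1 = 0 := by rw [bl_comm hM, h13]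
    have h32 : bl M e3 e2 = 0 := by rw [bl_comm hM, h23]
    have h41 : bl M e4 e1 = 0 := by rw [bl_comm hM, h14]
    have h42 : bl M e4 e2 = 0 := by rw [bl_comm hM, h24]
    have h43 : bl M e4 e3 = 0 := by rw [bl_comm hM, h34]
    have b1 : bl M (xs + (s0:ℤ) • w) e1 = y1 := by
      simp only [hw, bl_add_left, bl_smul_left, h21, h31, h41, ha1]
      linear_combination (s0 * k1 : ℤ) * z1 - hy1
    have b2 : bl M (xs + (s0:ℤ) • w) e2 = y2 := by
      simp only [hw, bl_add_left, bl_smul_left, h12, h32, h42, ha2]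
      linear_combination (s0 * k2 : ℤ) * z2 - hy2
    have b3 : bl M (xs + (s0:ℤ) • w) e3 = y3 := by
      simp only [hw, bl_add_left, bl_smul_left, h13, h23, h43, ha3]
      linear_combination (s0 * k3 : ℤ) * z3 - hy3
    have b4 : bl M (xs + (s0:ℤ) • w) e4 = y4 := by
      simp only [hw, bl_add_left, bl_smul_left, h14, h24, h34, ha4]
      linear_combination (s0 * k4 : ℤ) * z4 - hy4
    refine ⟨xs + (s0:ℤ) • w, ?_, ?_⟩
    · intro p hp
      by_contra hcon
      push Not at hcon
      have hall : ∀ e, (p:ℤ) ∣ bl M (xs + (s0:ℤ) • w) e := by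
        intro e
        unfold bl dotProduct
        exact dvd_sum fun i _ => (hcon i).mul_right _
      by_cases hps : p ∣ s0
      · obtain ⟨i, hi⟩ := f2 p (Nat.mem_primeFactors.2 ⟨hp, hps, hspos.ne'⟩)
        apply hi
        have h1 := hcon i
        have h2 : (p:ℤ) ∣ s0 * w i := (Int.natCast_dvd_natCast.2 hps).mul_right _
        exact (dvd_add_left h2).1 h1
      · exact hyp p hp hps ⟨b1 ▸ hall e1, b2 ▸ hall e2, b3 ▸ hall e3, b4 ▸ hall e4⟩
    · have hA0ne : (A0:ℤ) ≠ 0 := by exact_mod_cast q0.ne'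
      apply mul_left_cancel₀ hA0ne
      rw [bl_line hM]
      have e1' : bl M xs w = A1*k1*bl M xs e1 + A2*k2*bl M xs e2 + A3*k3*bl M xs e3 + A4*k4*bl M xs e4 := by
        simp only [hw, bl_add_right, bl_smul_right]
      have e2' : bl M w w = A1^2*k1^2*a1 + A2^2*k2^2*a2 + A3^2*k3^2*a3 + A4^2*k4^2*a4 := by
        simp only [hw, bl_add_right, bl_smul_right, bl_add_left, bl_smul_left, h12, h13, h14, h23, h24, h34,
          h21, h31, h32, h41, h42, h43, ha1, ha2, ha3, ha4]
        ring
      rw [e1', e2']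
      have Y1 : y1 = bl M xs e1 + s0*A0*k1 := by linear_combination hy1
      have Y2 : y2 = bl M xs e2 + s0*A0*k2 := by linear_combination hy2
      have Y3 : y3 = bl M xs e3 + s0*A0*k3 := by linear_combination hy3
      have Y4 : y4 = bl M xs e4 + s0*A0*k4 := by linear_combination hy4
      rw [Y1, Y2, Y3, Y4, ← Int.ofNat_eq_natCast, ← hm', hc] at hy
      linear_combination hy + s0^2*A0*(A1*k1^2*z1 + A2*k2^2*z2 + A3*k3^2*z3 + A4*k4^2*z4)
  choose T hT using cls
  obtain ⟨T0, hT0⟩ : ∃ T0 : ℤ, ∀ r ∈ range Q, T r ≤ T0 :=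
    ⟨∑ r ∈ range Q, |T r|, fun r hr => (le_abs_self _).trans
      (single_le_sum (f := fun r => |T r|) (fun _ _ => abs_nonneg _) hr)⟩
  refine ⟨T0, fun m hm => ?_⟩
  have hQz : (0:ℤ) < Q := by exact_mod_cast hQpos
  obtain ⟨r, hr⟩ := Int.eq_ofNat_of_zero_le (Int.emod_nonneg m hQz.ne')
  have hlt : r < Q := by
    have := Int.emod_lt_of_pos m hQz
    rw [hr] at this; exact_mod_cast this
  refine hT r m ((hT0 r (mem_range.2 hlt)).trans hm) ?_
  have := Int.dvd_self_sub_emod (x := m) (m := (Q:ℤ))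
  rwa [hr] at this

end APU

/-- A positive definite classically integral form `x ↦ xᵀMx` in `n` variables that
represents an odd integer, whose discriminant `det M` is not divisible by `p^(n-2)`
for any prime `p`, with `n ≥ 5`, or `n = 4` and `det M` even, is almost primitively
universal. -/
theorem stmt_2 {n : ℕ} (M : Matrix (Fin n) (Fin n) ℤ) (hsymm : M.IsSymm)
    (hpos : ∀ x : Fin n → ℝ, x ≠ 0 →
      0 < ∑ i : Fin n, ∑ j : Fin n, (M i j : ℝ) * x i * x j)
    (hodd : ∃ x : Fin n → ℤ, Odd (∑ i : Fin n, ∑ j : Fin n, M i j * x i * x j))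
    (hdisc : ∀ p : ℕ, p.Prime → ¬ ((p : ℤ) ^ (n - 2) ∣ M.det))
    (hcase : 5 ≤ n ∨ (n = 4 ∧ Even M.det)) :
    ∃ N : ℤ, ∀ m : ℤ, N ≤ m → ∃ x : Fin n → ℤ,
      Finset.univ.gcd x = 1 ∧
      ∑ i : Fin n, ∑ j : Fin n, M i j * x i * x j = m := by
  have hn : 4 ≤ n := by omega
  have hdet : M.det ≠ 0 := fun h => hdisc 2 Nat.prime_two (by rw [h]; exact dvd_zero _)
  have hpos' : ∀ x : Fin n → ℤ, x ≠ 0 → 0 < APU.bl M x x := by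
    intro x hx
    have h := hpos (fun i => (x i : ℝ)) (fun h => hx (by
      funext i
      have := congrFun h i
      simpa using this))
    rw [APU.bl_eq_sum]
    exact_mod_cast h
  have hodd' : ∃ x, Odd (APU.bl M x x) := by
    obtain ⟨x, hx⟩ := hodd
    exact ⟨x, by rw [APU.bl_eq_sum]; exact hx⟩
  obtain ⟨T, hT⟩ := APU.main_thm hn hsymm hdet hpos'
    (fun p hp m K => APU.rep_all hsymm hodd' hdisc hcase hp m K)
  refine ⟨T, fun m hm => ?_⟩
  obtain ⟨x, hx, hxm⟩ := hT m hm
  refine ⟨x, ?_, by rw [← APU.bl_eq_sum]; exact hxm⟩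
  by_contra hg
  have hg' : (Finset.univ.gcd x).natAbs ≠ 1 := by
    intro h
    apply hg
    have h1 : normalize (Finset.univ.gcd x) = Finset.univ.gcd x := Finset.normalize_gcd
    have h2 := Int.nonneg_of_normalize_eq_self h1
    omega
  obtain ⟨p, hp, hpd⟩ := Nat.exists_prime_and_dvd hg'
  obtain ⟨i, hi⟩ := hx p hp
  exact hi ((Int.natCast_dvd.2 hpd).trans (Finset.gcd_dvd (Finset.mem_univ i)))
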